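/- (Mordell–Lang for tori in characteristic 0; Laurent's theorem.) Let K be an algebraically closed field of characteristic 0, let N ≥ 1, let X be a subvariety of (Kˣ)^N, and let Γ be a finitely generated subgroup of (Kˣ)^N. Then X ∩ Γ is a finite union of cosets of subgroups of Γ. -/

import Mathlib

/-- `X` is a subvariety of the torus `(Kˣ)^N`: the common zero set in `(Kˣ)^N` of a
family of polynomials in `N` variables over `K`. -/
def IsTorusSubvariety (K : Type*) [Field K] {N : ℕ} (X : Set (Fin N → Kˣ)) : Prop :=
  ∃ 𝒮 : Set (MvPolynomial (Fin N) K),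
    X = {x | ∀ f ∈ 𝒮, MvPolynomial.eval (fun i => (x i : K)) f = 0}

section

open Finset

/-- Abstract arithmetic data: a field `k`, a finite set `S` of places, `S`-integers `A`, integers `O`. -/
structure PD (k : Type*) [Field k] (S : Type*) [Fintype S] where
  f : S → k →*₀ ℝ
  nonneg : ∀ v x, 0 ≤ f v x
  A : Subring k
  O : Subring k
  OA : O ≤ A
  sum' : ∀ (v : S) (n : ℕ) (a : Fin n → k) (M : ℝ), (∀ i, f v (a i) ≤ M) →
    f v (∑ i, a i) ≤ (n : ℝ) ^ 2 * M
  prod_ge : ∀ a ∈ A, a ≠ 0 → 1 ≤ ∏ v, f v a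
  den : ∀ a : k, ∃ c ∈ O, c ≠ 0 ∧ c * a ∈ O
  cop : ∀ ξ : k, ∃ a ∈ A, ∃ b ∈ A, b ≠ 0 ∧ ξ = a / b ∧ ∃ x ∈ A, ∃ y ∈ A, x * a + y * b = 1
  mink : ∀ (n : ℕ) (L : S → Matrix (Fin n) (Fin n) k), 0 < n → (∀ v, (L v).det ≠ 0) →
    ∃ C : ℝ, 0 < C ∧ ∀ w : S → Fin n → ℝ, (∀ v i, 0 < w v i) → C ≤ ∏ v, ∏ i, w v i →
      ∃ x : Fin n → k, x ≠ 0 ∧ (∀ i, x i ∈ A) ∧ ∀ v i, f v ((L v).mulVec x i) ≤ w v i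
  siegel : ∃ c : ℕ, 1 ≤ c ∧ ∀ (p q : ℕ) (M : Matrix (Fin p) (Fin q) k) (H : ℝ), 1 ≤ H → 0 < q →
    2 * p ≤ q → (∀ i j, M i j ∈ O) → (∀ v i j, f v (M i j) ≤ H) →
      ∃ ξ : Fin q → k, ξ ≠ 0 ∧ (∀ j, ξ j ∈ O) ∧ M.mulVec ξ = 0 ∧
        ∀ v j, f v (ξ j) ≤ (c * q * H) ^ c

namespace PD

variable {k : Type*} [Field k] {S : Type*} [Fintype S] (D : PD k S)

theorem sum_le {ι : Type*} (v : S) (s : Finset ι) (a : ι → k) (M : ℝ)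
    (h : ∀ i ∈ s, D.f v (a i) ≤ M) : D.f v (∑ i ∈ s, a i) ≤ (#s : ℝ) ^ 2 * M := by
  have e := s.equivFin
  have := D.sum' v (#s) (fun i => a (e.symm i)) M (fun i => h _ (e.symm i).2)
  rw [← Finset.sum_coe_sort s a, ← e.symm.sum_comp]
  exact this

theorem sum_le' {ι : Type*} (v : S) (s : Finset ι) (a : ι → k) (M T : ℝ) (hM : 0 ≤ M)
    (hT : (#s : ℝ) ≤ T)
    (h : ∀ i ∈ s, D.f v (a i) ≤ M) : D.f v (∑ i ∈ s, a i) ≤ T ^ 2 * M := by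
  refine (D.sum_le v s a M h).trans ?_
  gcongr

theorem add_le (v : S) (x y : k) (M : ℝ) (hx : D.f v x ≤ M) (hy : D.f v y ≤ M) :
    D.f v (x + y) ≤ 4 * M := by
  have := D.sum' v 2 ![x, y] M (by intro i; fin_cases i <;> simpa)
  simp [Fin.sum_univ_two] at this
  linarith

theorem f_neg (v : S) (x : k) : D.f v (-x) = D.f v x := by
  have h : D.f v (-1) * D.f v (-1) = 1 := by rw [← map_mul]; simp
  have h1 : D.f v (-1) = 1 := by nlinarith [D.nonneg v (-1)]
  rw [neg_eq_neg_one_mul, map_mul, h1, one_mul]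

theorem f_pos (v : S) {x : k} (hx : x ≠ 0) : 0 < D.f v x :=
  lt_of_le_of_ne (D.nonneg v x) (Ne.symm ((map_ne_zero (D.f v)).2 hx))

theorem f_natCast (v : S) (n : ℕ) : D.f v (n : k) ≤ (n : ℝ) ^ 2 := by
  have := D.sum' v n (fun _ => 1) 1 (by simp)
  simpa using this

/-- The height of a fraction given by a coprime pair. -/
noncomputable def ht (a b : k) : ℝ := ∏ v, max (D.f v a) (D.f v b)

theorem coprime_mem {a b : k} (ha : a ∈ D.A) (hb : b ∈ D.A)
    (hc : ∃ x ∈ D.A, ∃ y ∈ D.A, x * a + y * b = 1) {t : k} {i j : ℕ}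
    (h1 : a ^ i * t ∈ D.A) (h2 : b ^ j * t ∈ D.A) : t ∈ D.A := by
  obtain ⟨x, hx, y, hy, h⟩ := hc
  have : IsCoprime (⟨a, ha⟩ : D.A) ⟨b, hb⟩ := ⟨⟨x, hx⟩, ⟨y, hy⟩, by ext; simpa using h⟩
  obtain ⟨u, w, h⟩ := IsCoprime.pow (m := i) (n := j) this
  have h' : (u : k) * a ^ i + w * b ^ j = 1 := by
    have := congrArg (Subtype.val) h
    simpa using this
  have : t = u * (a ^ i * t) + w * (b ^ j * t) := by
    linear_combination (-t) * h'
  rw [this]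
  exact D.A.add_mem (D.A.mul_mem u.2 h1) (D.A.mul_mem w.2 h2)

open Polynomial in
theorem quot_mem {a b : k} (ha : a ∈ D.A) (hb : b ∈ D.A)
    (hc : ∃ x ∈ D.A, ∃ y ∈ D.A, x * a + y * b = 1) (R : k[X])
    (h : ∀ i, ((C b * X - C a) * R).coeff i ∈ D.A) (i : ℕ) : R.coeff i ∈ D.A := by
  have h0 : ((C b * X - C a) * R).coeff 0 = - (a * R.coeff 0) := by
    simp [sub_mul, mul_assoc]
  have hs : ∀ i, ((C b * X - C a) * R).coeff (i + 1) = b * R.coeff i - a * R.coeff (i + 1) := by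
    intro i; simp [sub_mul, mul_assoc, coeff_X_mul]
  have up : ∀ i, ∃ j, a ^ j * R.coeff i ∈ D.A := by
    intro i
    induction i with
    | zero =>
      refine ⟨1, ?_⟩
      have := D.A.neg_mem (h 0); rw [h0] at this; simpa using this
    | succ i ih =>
      obtain ⟨j, hj⟩ := ih
      refine ⟨j + 1, ?_⟩
      have := D.A.mul_mem (pow_mem ha j) (h (i + 1))
      rw [hs] at this
      have e : a ^ (j + 1) * R.coeff (i + 1) = b * (a ^ j * R.coeff i) -
        a ^ j * (b * R.coeff i - a * R.coeff (i + 1)) := by ring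
      rw [e]
      exact D.A.sub_mem (D.A.mul_mem hb hj) this
  have down : ∀ n i, R.natDegree < i + n → ∃ j, b ^ j * R.coeff i ∈ D.A := by
    intro n
    induction n with
    | zero => intro i hi; exact ⟨0, by rw [coeff_eq_zero_of_natDegree_lt (by simpa using hi)]; simp⟩
    | succ n ih =>
      intro i hi
      obtain ⟨j, hj⟩ := ih (i + 1) (by omega)
      refine ⟨j + 1, ?_⟩
      have := D.A.mul_mem (pow_mem hb j) (h (i + 1))
      rw [hs] at this
      have e : b ^ (j + 1) * R.coeff i = a * (b ^ j * R.coeff (i + 1)) +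
        b ^ j * (b * R.coeff i - a * R.coeff (i + 1)) := by ring
      rw [e]
      exact D.A.add_mem (D.A.mul_mem ha hj) this
  obtain ⟨j, hj⟩ := up i
  obtain ⟨j', hj'⟩ := down (R.natDegree + 1) i (by omega)
  exact D.coprime_mem ha hb hc hj hj'

open Polynomial in
theorem step_b (v : S) (a b : k) (hab : D.f v a ≤ D.f v b) (hb : b ≠ 0) (R : k[X]) (B : ℝ)
    (hB : 0 ≤ B)
    (h : ∀ i, 4 ^ i * D.f v (((C b * X - C a) * R).coeff i) ≤ B) (i : ℕ) :
    4 ^ i * D.f v (R.coeff i) * D.f v b ≤ B := by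
  have hs : ∀ i, ((C b * X - C a) * R).coeff (i + 1) = b * R.coeff i - a * R.coeff (i + 1) := by
    intro i; simp [sub_mul, mul_assoc, coeff_X_mul]
  have down : ∀ n i, R.natDegree < i + n → 4 ^ i * D.f v (R.coeff i) * D.f v b ≤ B := by
    intro n
    induction n with
    | zero =>
      intro i hi
      rw [coeff_eq_zero_of_natDegree_lt (by simpa using hi)]; simpa
    | succ n ih =>
      intro i hi
      have h1 := ih (i + 1) (by omega)
      have h2 := h (i + 1)
      rw [hs] at h2
      have e : b * R.coeff i = (b * R.coeff i - a * R.coeff (i + 1)) + a * R.coeff (i + 1) := by ring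
      have p4 : (0:ℝ) < 4 ^ (i+1) := by positivity
      have := D.add_le v (b * R.coeff i - a * R.coeff (i + 1)) (a * R.coeff (i + 1)) (B / 4 ^ (i+1))
        (by rw [le_div_iff₀ p4]; linarith) (by
          rw [le_div_iff₀ p4, map_mul]
          calc D.f v a * D.f v (R.coeff (i+1)) * 4 ^ (i+1)
              ≤ D.f v b * D.f v (R.coeff (i+1)) * 4 ^ (i+1) := by
                gcongr; exact D.nonneg _ _
            _ ≤ B := by linarith)
      rw [← e, map_mul] at this
      have p5 : (0:ℝ) < 4 ^ i := by positivity
      have : 4 ^ i * (D.f v b * D.f v (R.coeff i)) ≤ 4 ^ i * (4 * (B / 4 ^ (i+1))) := by gcongr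
      have e2 : (4:ℝ) ^ i * (4 * (B / 4 ^ (i+1))) = B := by field_simp; ring
      linarith
  exact down (R.natDegree + 1) i (by omega)

open Polynomial in
theorem step_a (v : S) (a b : k) (hab : D.f v b ≤ D.f v a) (R : k[X]) (B : ℝ)
    (hB : 0 ≤ B)
    (h : ∀ i, D.f v (((C b * X - C a) * R).coeff i) ≤ 4 ^ i * B) (i : ℕ) :
    D.f v (R.coeff i) * D.f v a ≤ 4 ^ i * (4 * B) := by
  have h0 : ((C b * X - C a) * R).coeff 0 = - (a * R.coeff 0) := by
    simp [sub_mul, mul_assoc]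
  have hs : ∀ i, ((C b * X - C a) * R).coeff (i + 1) = b * R.coeff i - a * R.coeff (i + 1) := by
    intro i; simp [sub_mul, mul_assoc, coeff_X_mul]
  induction i with
  | zero =>
    have := h 0
    rw [h0, f_neg, map_mul] at this
    simp at this ⊢
    linarith
  | succ i ih =>
    have h2 := h (i + 1)
    rw [hs] at h2
    have e : a * R.coeff (i+1) = - (b * R.coeff i - a * R.coeff (i + 1)) + b * R.coeff i := by ring
    have := D.add_le v (-(b * R.coeff i - a * R.coeff (i + 1))) (b * R.coeff i) (4 ^ (i+1) * B)
        (by rw [f_neg]; exact h2) (by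
          rw [map_mul]
          calc D.f v b * D.f v (R.coeff i)
              ≤ D.f v a * D.f v (R.coeff i) := by
                gcongr; exact D.nonneg _ _
            _ ≤ _ := by rw [pow_succ]; linarith)
    rw [← e, map_mul] at this
    linarith

open Polynomial in
/-- Univariate case of Roth's lemma. -/
theorem univRoth {a b : k} (ha : a ∈ D.A) (hb : b ∈ D.A) (hb0 : b ≠ 0)
    (hc : ∃ x ∈ D.A, ∃ y ∈ D.A, x * a + y * b = 1) (V : k[X]) (hV : V ≠ 0)
    (hVA : ∀ i, V.coeff i ∈ D.A) (B : S → ℝ) (hVB : ∀ v i, D.f v (V.coeff i) ≤ B v)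
    (d r : ℕ) (hd : V.natDegree ≤ d) (hr : (X - C (a / b)) ^ r ∣ V) :
    (D.ht a b) ^ r ≤ (16 ^ d) ^ (Fintype.card S) * ∏ v, B v := by
  have key : (C b * X - C a) ^ r ∣ V := by
    have e : (C b * X - C a) = C b * (X - C (a / b)) := by
      rw [mul_sub, ← C_mul, mul_div_cancel₀ _ hb0]
    rw [e, mul_pow]
    have hu : IsUnit (C b ^ r : k[X]) := (IsUnit.pow _ (isUnit_C.2 (isUnit_iff_ne_zero.2 hb0)))
    exact hu.mul_left_dvd.2 hr
  obtain ⟨R, hR⟩ := key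
  have hR0 : R ≠ 0 := by rintro rfl; simp at hR; exact hV hR
  have hP0 : (C b * X - C a) ≠ 0 := by
    intro h
    have := congrArg (fun p => p.coeff 1) h
    simp at this; exact hb0 this
  have hB0 : ∀ v, 0 ≤ B v := fun v => (D.nonneg _ _).trans (hVB v 0)
  -- membership
  have mem : ∀ r (R : k[X]), (∀ i, ((C b * X - C a) ^ r * R).coeff i ∈ D.A) → ∀ i, R.coeff i ∈ D.A := by
    intro r
    induction r with
    | zero => intro R h; simpa using h
    | succ r ih =>
      intro R h
      apply D.quot_mem ha hb hc
      apply ih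
      intro i
      rw [← mul_assoc, ← pow_succ]; exact h i
  have hRA := mem r R (by rw [← hR]; exact hVA)
  have bb : ∀ v, D.f v a ≤ D.f v b → ∀ r (R : k[X]) (B : ℝ), 0 ≤ B →
      (∀ i, 4 ^ i * D.f v (((C b * X - C a) ^ r * R).coeff i) ≤ B) →
      ∀ i, 4 ^ i * D.f v (R.coeff i) * D.f v b ^ r ≤ B := by
    intro v hv r
    induction r with
    | zero => intro R B _ h; simpa using h
    | succ r ih =>
      intro R B hB h i
      have h1 := ih ((C b * X - C a) * R) B hB (by
        intro i; rw [← mul_assoc, ← pow_succ]; exact h i)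
      have hp : 0 < D.f v b ^ r := pow_pos (D.f_pos v hb0) r
      have := D.step_b v a b hv hb0 R (B / D.f v b ^ r) (by positivity) (by
        intro i; rw [le_div_iff₀ hp]; exact h1 i) i
      rw [le_div_iff₀ hp] at this
      rw [pow_succ]; linarith
  have ba : ∀ v, D.f v b ≤ D.f v a → ∀ r (R : k[X]) (B : ℝ), 0 ≤ B →
      (∀ i, D.f v (((C b * X - C a) ^ r * R).coeff i) ≤ 4 ^ i * B) →
      ∀ i, D.f v (R.coeff i) * D.f v a ^ r ≤ 4 ^ i * (4 ^ r * B) := by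
    intro v hv r
    induction r with
    | zero => intro R B _ h; simpa using h
    | succ r ih =>
      intro R B hB h i
      have h1 := ih ((C b * X - C a) * R) B hB (by
        intro i; rw [← mul_assoc, ← pow_succ]; exact h i)
      have hp : 0 < D.f v a ^ r := pow_pos ((D.f_pos v hb0).trans_le hv) r
      have := D.step_a v a b hv R (4 ^ r * B / D.f v a ^ r) (by positivity) (by
        intro i; rw [← mul_div_assoc, le_div_iff₀ hp]; exact h1 i) i
      have e : (4:ℝ) ^ i * (4 * (4 ^ r * B / D.f v a ^ r)) = (4 ^ i * (4 ^ (r+1) * B)) / D.f v a ^ r := by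
        field_simp; ring
      rw [e, le_div_iff₀ hp] at this
      rw [pow_succ]; linarith
  have hnd : R.natDegree + r = V.natDegree := by
    have h1 : (C b * X - C a).natDegree = 1 := by
      rw [sub_eq_add_neg, ← C_neg]; exact natDegree_linear hb0
    rw [hR, natDegree_mul (pow_ne_zero _ hP0) hR0, natDegree_pow, h1]; ring
  set t := R.leadingCoeff with ht
  have hrd : r ≤ d := by omega
  have hRd : R.natDegree ≤ d := by omega
  have loc : ∀ v, D.f v t * max (D.f v a) (D.f v b) ^ r ≤ 16 ^ d * B v := by
    intro v
    rcases le_total (D.f v a) (D.f v b) with hv | hv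
    · rw [max_eq_right hv]
      have := bb v hv r R (4 ^ d * B v) (by have := hB0 v; positivity) (by
        intro i
        rw [← hR]
        by_cases hi : i ≤ d
        · have h4 : (4:ℝ) ^ i ≤ 4 ^ d := pow_le_pow_right₀ (by norm_num) hi
          have := D.nonneg v (V.coeff i)
          have := hB0 v
          gcongr; exact hVB v i
        · rw [coeff_eq_zero_of_natDegree_lt (by omega)]
          have := hB0 v; simp; positivity) R.natDegree
      have h4 : (1:ℝ) ≤ 4 ^ R.natDegree := one_le_pow₀ (by norm_num)
      have h5 : (4:ℝ) ^ d ≤ 16 ^ d := by gcongr; norm_num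
      calc D.f v t * D.f v b ^ r = 1 * D.f v t * D.f v b ^ r := by ring
        _ ≤ 4 ^ R.natDegree * D.f v t * D.f v b ^ r := by
          have := D.nonneg v t
          have := D.nonneg v b
          gcongr
        _ ≤ 4 ^ d * B v := this
        _ ≤ _ := by have := hB0 v; gcongr
    · rw [max_eq_left hv]
      have := ba v hv r R (B v) (hB0 v) (by
        intro i
        rw [← hR]
        have h4 : (1:ℝ) ≤ 4 ^ i := one_le_pow₀ (by norm_num)
        have := hVB v i
        have := hB0 v
        nlinarith) R.natDegree
      refine this.trans ?_
      have e : (16:ℝ) ^ d = 4 ^ d * 4 ^ d := by rw [← mul_pow]; norm_num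
      rw [e, mul_assoc]
      have := hB0 v
      gcongr <;> norm_num
  have htA : t ∈ D.A := hRA _
  have ht0 : t ≠ 0 := leadingCoeff_ne_zero.2 hR0
  have h1 := D.prod_ge t htA ht0
  have hpos : 0 ≤ D.ht a b ^ r := by
    unfold PD.ht
    exact pow_nonneg (prod_nonneg fun v _ => le_max_of_le_left (D.nonneg v a)) r
  calc D.ht a b ^ r = 1 * D.ht a b ^ r := by ring
    _ ≤ (∏ v, D.f v t) * D.ht a b ^ r := by gcongr
    _ = ∏ v, (D.f v t * max (D.f v a) (D.f v b) ^ r) := by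
        rw [prod_mul_distrib, prod_pow]; rfl
    _ ≤ ∏ v, (16 ^ d * B v) := prod_le_prod (fun v _ => mul_nonneg (D.nonneg v t)
        (pow_nonneg (le_max_of_le_left (D.nonneg v a)) r)) (fun v _ => loc v)
    _ = _ := by rw [prod_mul_distrib]; simp

end PD

end

section

open Finset MvPolynomial

section Hasse
variable {k : Type*} [Field k] {M : ℕ}

/-- Hasse derivative. -/
noncomputable def hD (e : Fin M →₀ ℕ) : MvPolynomial (Fin M) k →ₗ[k] MvPolynomial (Fin M) k :=
  (MvPolynomial.basisMonomials (Fin M) k).constr k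
    (fun α => monomial (α - e) ((∏ i, (α i).choose (e i) : ℕ) : k))

theorem hD_monomial (e α : Fin M →₀ ℕ) (c : k) :
    hD e (monomial α c) = monomial (α - e) (c * ((∏ i, (α i).choose (e i) : ℕ) : k)) := by
  have : monomial α c = c • (MvPolynomial.basisMonomials (Fin M) k) α := by
    simp [smul_monomial]
  rw [this, map_smul, hD, Module.Basis.constr_basis, smul_monomial]; simp

theorem coeff_hD (e β : Fin M →₀ ℕ) (P : MvPolynomial (Fin M) k) :
    coeff β (hD e P) = ((∏ i, (β i + e i).choose (e i) : ℕ) : k) * coeff (β + e) P := by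
  classical
  induction P using MvPolynomial.induction_on' with
  | add p q hp hq =>
    rw [map_add, coeff_add, coeff_add, hp, hq, mul_add]
  | monomial α b =>
    rw [hD_monomial]
    simp only [coeff_monomial]
    by_cases h : α = β + e
    · subst h; simp [mul_comm]
    · rw [if_neg h, mul_zero]
      split_ifs with h1
      · have : ∃ i, α i < e i := by
          by_contra hcon
          push Not at hcon
          apply h
          rw [← h1]
          ext i; simp [Nat.sub_add_cancel (hcon i)]
        obtain ⟨i, hi⟩ := this
        rw [prod_eq_zero (mem_univ i)]; · simp
        exact Nat.choose_eq_zero_of_lt hi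
      · rfl

theorem hD_zero (P : MvPolynomial (Fin M) k) : hD 0 P = P := by
  ext β; rw [coeff_hD]; simp

theorem pderiv_hD (e : Fin M →₀ ℕ) (j : Fin M) (P : MvPolynomial (Fin M) k) :
    pderiv j (hD e P) = ((e j + 1 : ℕ) : k) • hD (e + Finsupp.single j 1) P := by
  classical
  ext β
  rw [coeff_pderiv, coeff_smul, coeff_hD, coeff_hD, smul_eq_mul, add_right_comm, add_assoc]
  simp only [Finsupp.add_apply]
  set δ : Fin M →₀ ℕ := Finsupp.single j 1 with hδ
  have : (∏ i, (β i + δ i + e i).choose (e i)) * (β j + 1) =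
      (e j + 1) * ∏ i, (β i + (e i + δ i)).choose (e i + δ i) := by
    rw [← mul_prod_erase univ _ (mem_univ j), ← mul_prod_erase univ _ (mem_univ j)]
    have h1 : ∏ x ∈ univ.erase j, (β x + δ x + e x).choose (e x) =
      ∏ x ∈ univ.erase j, (β x + (e x + δ x)).choose (e x + δ x) := by
      apply prod_congr rfl
      intro x hx
      have : j ≠ x := (ne_of_mem_erase hx).symm
      simp [hδ, this.symm]
    rw [h1]
    have hj : δ j = 1 := by simp [hδ]
    rw [hj]
    have := Nat.choose_succ_right_eq (β j + 1 + e j) (e j)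
    have e1 : β j + 1 + e j - e j = β j + 1 := by omega
    rw [e1] at this
    have e2 : β j + (e j + 1) = β j + 1 + e j := by omega
    rw [e2]
    generalize (∏ x ∈ univ.erase j, _ : ℕ) = T
    calc _ = T * ((β j + 1 + e j).choose (e j) * (β j + 1)) := by ring
      _ = _ := by rw [← this]; ring
  have := congrArg (Nat.cast : ℕ → k) this
  push_cast at this ⊢
  linear_combination (coeff (β + (e + δ)) P) * this

/-- translation -/
noncomputable def tr (ξ : Fin M → k) : MvPolynomial (Fin M) k →ₐ[k] MvPolynomial (Fin M) k :=
  aeval (fun j => X j + C (ξ j))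

theorem pderiv_tr (ξ : Fin M → k) (j : Fin M) (P : MvPolynomial (Fin M) k) :
    pderiv j (tr ξ P) = tr ξ (pderiv j P) := by
  classical
  induction P using MvPolynomial.induction_on with
  | C a => simp [tr]
  | add p q hp hq => simp [hp, hq]
  | mul_X p i hp =>
    have : tr ξ (X i) = X i + C (ξ i) := by simp [tr]
    rw [map_mul, pderiv_mul, pderiv_mul, hp, map_add, map_mul, map_mul, this]
    congr 2
    simp [pderiv_X, Pi.single_apply]

theorem expo_ind {p : (Fin M →₀ ℕ) → Prop} (h0 : p 0)
    (hs : ∀ e j, p e → p (e + Finsupp.single j 1)) (e) : p e := by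
  have : ∀ n, ∀ e : Fin M →₀ ℕ, ∑ i, e i = n → p e := by
    intro n
    induction n with
    | zero =>
      intro e he
      have : e = 0 := by ext i; simpa using (sum_eq_zero_iff.1 he) i (mem_univ i)
      rwa [this]
    | succ n ih =>
      intro e he
      obtain ⟨j, _, hj⟩ := exists_ne_zero_of_sum_ne_zero (by rw [he]; omega : ∑ i, e i ≠ 0)
      have h1 : e - Finsupp.single j 1 + Finsupp.single j 1 = e := by
        ext i
        by_cases hij : j = i
        · subst hij; simp; omega
        · simp [Ne.symm hij]
      rw [← h1]
      apply hs
      apply ih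
      have h2 : ∑ i, (e - Finsupp.single j 1 + Finsupp.single j 1 : Fin M →₀ ℕ) i = n + 1 := by rw [h1, he]
      simp only [Finsupp.add_apply, sum_add_distrib] at h2
      have h3 : ∑ i, (Finsupp.single j 1 : Fin M →₀ ℕ) i = 1 := by
        simp [Finsupp.single_apply]
      omega
  exact this _ e rfl

theorem hD_tr [CharZero k] (ξ : Fin M → k) (e : Fin M →₀ ℕ) (P : MvPolynomial (Fin M) k) :
    hD e (tr ξ P) = tr ξ (hD e P) := by
  induction e using expo_ind with
  | h0 => simp [hD_zero]
  | hs e j ih =>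
    have h1 := pderiv_hD e j (tr ξ P)
    rw [ih, pderiv_tr, pderiv_hD, map_smul] at h1
    have h2 : ((e j + 1 : ℕ) : k) ≠ 0 := Nat.cast_ne_zero.2 (Nat.succ_ne_zero _)
    exact (smul_right_injective _ h2 h1).symm

theorem prop_of_pderiv [CharZero k] (P Q : MvPolynomial (Fin M) k) (hP : P ≠ 0)
    (h : ∀ j, P * pderiv j Q = Q * pderiv j P) : ∃ c : k, Q = C c * P := by
  classical
  let m : MonomialOrder (Fin M) := MonomialOrder.lex
  have E : ∀ (j) (R : MvPolynomial (Fin M) k) (α), coeff α (X j * pderiv j R) = (α j : k) * coeff α R := by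
    intro j R α
    induction R using MvPolynomial.induction_on' with
    | add p q hp hq => rw [map_add, mul_add, coeff_add, coeff_add, hp, hq]; ring
    | monomial β b =>
      rw [X_mul_pderiv_monomial]
      rw [coeff_smul]
      simp only [coeff_monomial, nsmul_eq_mul]
      split_ifs with h
      · rw [h]
      · simp
  have Ed : ∀ (j) (R : MvPolynomial (Fin M) k), m.toSyn (m.degree (X j * pderiv j R)) ≤ m.toSyn (m.degree R) := by
    intro j R
    rw [MonomialOrder.degree_le_iff]
    intro α hα
    apply MonomialOrder.le_degree
    rw [mem_support_iff, E] at hα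
    rw [mem_support_iff]
    exact right_ne_zero_of_mul hα
  have key : ∀ Q : MvPolynomial (Fin M) k, Q ≠ 0 → (∀ j, P * pderiv j Q = Q * pderiv j P) →
      m.degree Q = m.degree P := by
    intro Q hQ h
    ext j
    have h1 : P * (X j * pderiv j Q) = Q * (X j * pderiv j P) := by linear_combination X j * h j
    have h2 := congrArg (coeff (m.degree P + m.degree Q)) h1
    rw [MonomialOrder.coeff_mul_of_add_of_degree_le (m := m) le_rfl (Ed j Q), add_comm,
      MonomialOrder.coeff_mul_of_add_of_degree_le (m := m) le_rfl (Ed j P), E, E] at h2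
    have hp : coeff (m.degree P) P ≠ 0 := m.coeff_degree_ne_zero_iff.2 hP
    have hq : coeff (m.degree Q) Q ≠ 0 := m.coeff_degree_ne_zero_iff.2 hQ
    have h3 : ((m.degree Q j : ℕ) : k) = (m.degree P j : ℕ) := by
      apply mul_left_cancel₀ (mul_ne_zero hp hq)
      linear_combination h2
    exact_mod_cast h3
  have hp : coeff (m.degree P) P ≠ 0 := m.coeff_degree_ne_zero_iff.2 hP
  refine ⟨coeff (m.degree P) Q / coeff (m.degree P) P, ?_⟩
  by_contra hne
  have hne' : Q - C (coeff (m.degree P) Q / coeff (m.degree P) P) * P ≠ 0 := sub_ne_zero.2 hne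
  have := key _ hne' (by
    intro j
    rw [map_sub, pderiv_C_mul]
    linear_combination h j)
  have h2 := m.coeff_degree_ne_zero_iff.2 hne'
  rw [this, coeff_sub, coeff_C_mul, div_mul_cancel₀ _ hp, sub_self] at h2
  exact h2 rfl

theorem wronsk [CharZero k] : ∀ (s : ℕ) (φ : Fin s → MvPolynomial (Fin M) k), LinearIndependent k φ →
    ∃ e : Fin s → (Fin M →₀ ℕ), (∀ i, ∑ j, e i j < s) ∧
      (Matrix.of fun i l => hD (e i) (φ l)).det ≠ 0 := by
  intro s
  induction s with
  | zero => intro φ _; exact ⟨Fin.elim0, fun i => i.elim0, by simp⟩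
  | succ s ih =>
    intro φ hφ
    obtain ⟨e, he, hdet⟩ := ih (fun i => φ i.castSucc) (hφ.comp _ (Fin.castSucc_injective s))
    by_contra hcon
    push Not at hcon
    let μ : Fin (s+1) → MvPolynomial (Fin M) k := fun l =>
      (-1) ^ (s + (l : ℕ)) * (Matrix.of fun (i : Fin s) (l' : Fin s) => hD (e i) (φ (l.succAbove l'))).det
    have hμlast : μ (Fin.last s) ≠ 0 := by
      simp only [μ]
      apply mul_ne_zero (pow_ne_zero _ (by simp))
      simpa [Fin.succAbove_last] using hdet
    have hrel : ∀ e' : Fin M →₀ ℕ, ∑ j, e' j < s + 1 → ∑ l, μ l * hD e' (φ l) = 0 := by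
      intro e' he'
      have h1 := hcon (Fin.snoc e e' : Fin (s+1) → (Fin M →₀ ℕ)) (by
        intro i
        refine Fin.lastCases ?_ (fun i => ?_) i
        · simpa using he'
        · simp; exact (he i).le)
      rw [Matrix.det_succ_row _ (Fin.last s)] at h1
      rw [← h1]
      apply sum_congr rfl
      intro l _
      simp only [μ, Matrix.of_apply, Fin.snoc_last, Fin.val_last]
      rw [mul_right_comm]
      congr 2
      ext i l'
      simp [Matrix.submatrix_apply, Fin.succAbove_last]
    have hder : ∀ j, ∀ i : Fin s, ∑ l, pderiv j (μ l) * hD (e i) (φ l) = 0 := by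
      intro j i
      have h1 := congrArg (pderiv j) (hrel (e i) ((he i).trans (Nat.lt_succ_self s)))
      have h2 := hrel (e i + Finsupp.single j 1) (by
        have h3 : ∑ i, (Finsupp.single j 1 : Fin M →₀ ℕ) i = 1 := by
          simp [Finsupp.single_apply]
        simp only [Finsupp.add_apply, sum_add_distrib, h3]
        have := he i; omega)
      rw [map_sum, map_zero] at h1
      simp only [pderiv_mul, pderiv_hD, sum_add_distrib, mul_smul_comm] at h1
      rw [← smul_sum, h2, smul_zero, add_zero] at h1
      exact h1
    have hprop : ∀ l : Fin s, ∀ j, μ (Fin.last s) * pderiv j (μ l.castSucc) = μ l.castSucc * pderiv j (μ (Fin.last s)) := by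
      intro l j
      have := Matrix.eq_zero_of_mulVec_eq_zero (v := fun l : Fin s =>
        μ (Fin.last s) * pderiv j (μ l.castSucc) - μ l.castSucc * pderiv j (μ (Fin.last s))) hdet (by
          ext1 i
          have h1 := hder j i
          have h2 := hrel (e i) ((he i).trans (Nat.lt_succ_self s))
          rw [Fin.sum_univ_castSucc] at h1 h2
          simp only [Matrix.mulVec, dotProduct, Matrix.of_apply, Pi.zero_apply]
          calc _ = μ (Fin.last s) * ∑ l : Fin s, pderiv j (μ l.castSucc) * hD (e i) (φ l.castSucc)
                - pderiv j (μ (Fin.last s)) * ∑ l : Fin s, μ l.castSucc * hD (e i) (φ l.castSucc) := by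
                  rw [mul_sum, mul_sum, ← sum_sub_distrib]
                  apply sum_congr rfl; intros; ring
            _ = 0 := by linear_combination μ (Fin.last s) * h1 - pderiv j (μ (Fin.last s)) * h2)
      exact sub_eq_zero.1 (congrFun this l)
    have hc : ∀ l : Fin (s+1), ∃ c : k, μ l = C c * μ (Fin.last s) := by
      intro l
      refine Fin.lastCases ⟨1, by simp⟩ (fun l => ?_) l
      exact prop_of_pderiv _ _ hμlast (hprop l)
    choose c hc using hc
    have h0 := hrel 0 (by simp)
    simp only [hD_zero] at h0
    have h1 : μ (Fin.last s) * ∑ l, c l • φ l = 0 := by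
      rw [← h0, mul_sum]
      apply sum_congr rfl
      intro l _
      rw [hc l, smul_eq_C_mul]; ring
    have h2 := (mul_eq_zero.1 h1).resolve_left hμlast
    have h3 := Fintype.linearIndependent_iff.1 hφ c h2 (Fin.last s)
    have h4 := hc (Fin.last s)
    rw [h3] at h4
    simp at h4
    exact hμlast h4

end Hasse

end

section

open Finset MvPolynomial

section Idx
variable {k : Type*} [Field k] {M : ℕ}

/-- All exponents have weight at least `t`. -/
def Idx (w : (Fin M →₀ ℕ) →+ ℝ) (t : ℝ) (P : MvPolynomial (Fin M) k) : Prop :=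
  ∀ α, coeff α P ≠ 0 → t ≤ w α

theorem Idx.mono {w : (Fin M →₀ ℕ) →+ ℝ} {t u : ℝ} {P : MvPolynomial (Fin M) k} (h : Idx w t P)
    (hu : u ≤ t) : Idx w u P := fun α hα => hu.trans (h α hα)

theorem Idx.mul {w : (Fin M →₀ ℕ) →+ ℝ} {t u : ℝ} {P Q : MvPolynomial (Fin M) k} (h : Idx w t P)
    (h' : Idx w u Q) : Idx w (t + u) (P * Q) := by
  classical
  intro α hα
  rw [coeff_mul] at hα
  obtain ⟨x, hx, hne⟩ := exists_ne_zero_of_sum_ne_zero hα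
  rw [HasAntidiagonal.mem_antidiagonal] at hx
  rw [← hx, map_add]
  exact add_le_add (h _ (left_ne_zero_of_mul hne)) (h' _ (right_ne_zero_of_mul hne))

theorem Idx.one {w : (Fin M →₀ ℕ) →+ ℝ} : Idx w 0 (1 : MvPolynomial (Fin M) k) := by
  classical
  intro α hα
  rw [coeff_one] at hα
  split_ifs at hα with h
  · rw [← h, map_zero]
  · exact absurd rfl hα

theorem Idx.prod {ι : Type*} (s : Finset ι) {w : (Fin M →₀ ℕ) →+ ℝ} {t : ι → ℝ} {P : ι → MvPolynomial (Fin M) k}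
    (h : ∀ i ∈ s, Idx w (t i) (P i)) : Idx w (∑ i ∈ s, t i) (∏ i ∈ s, P i) := by
  classical
  induction s using Finset.induction_on with
  | empty => simpa using Idx.one
  | insert i s hi ih =>
    rw [sum_insert hi, prod_insert hi]
    exact (h i (mem_insert_self i s)).mul (ih fun j hj => h j (mem_insert_of_mem hj))

theorem Idx.sum {ι : Type*} (s : Finset ι) {w : (Fin M →₀ ℕ) →+ ℝ} {t : ℝ} {P : ι → MvPolynomial (Fin M) k}
    (h : ∀ i ∈ s, Idx w t (P i)) : Idx w t (∑ i ∈ s, P i) := by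
  intro α hα
  rw [coeff_sum] at hα
  obtain ⟨i, hi, hne⟩ := exists_ne_zero_of_sum_ne_zero hα
  exact h i hi α hne

theorem Idx.det {s : ℕ} {w : (Fin M →₀ ℕ) →+ ℝ} {t : Fin s → ℝ}
    {E : Matrix (Fin s) (Fin s) (MvPolynomial (Fin M) k)}
    (h : ∀ i j, Idx w (t j) (E i j)) : Idx w (∑ j, t j) E.det := by
  rw [Matrix.det_apply]
  refine Idx.sum _ fun σ _ => ?_
  intro α hα
  apply (Idx.prod univ (P := fun i => E (σ i) i) (fun i _ => h (σ i) i)) α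
  intro h0
  apply hα
  rcases Int.units_eq_one_or (Equiv.Perm.sign σ) with h | h <;> simp [h, h0]

theorem Idx.hD {w : (Fin M →₀ ℕ) →+ ℝ} {t : ℝ} {P : MvPolynomial (Fin M) k} (h : Idx w t P) (e) :
    Idx w (t - w e) (hD e P) := by
  intro α hα
  rw [coeff_hD] at hα
  have := h _ (right_ne_zero_of_mul hα)
  rw [map_add] at this; linarith

theorem supp_coeff {s : Set (Fin M)} {P : MvPolynomial (Fin M) k} (h : P ∈ supported k s) {α}
    (hα : coeff α P ≠ 0) {j} (hj : j ∉ s) : α j = 0 := by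
  by_contra hne
  apply hj
  apply mem_supported.1 h
  rw [mem_coe, mem_vars_iff_mem_support]
  exact ⟨α, mem_support_iff.2 hα, by simpa using hne⟩

theorem supp_of_coeff {s : Set (Fin M)} {P : MvPolynomial (Fin M) k}
    (h : ∀ α, coeff α P ≠ 0 → ∀ j ∉ s, α j = 0) : P ∈ supported k s := by
  rw [mem_supported]
  intro j hj
  rw [mem_coe, mem_vars_iff_mem_support] at hj
  obtain ⟨α, hα, hj⟩ := hj
  by_contra hne
  have := h α (mem_support_iff.1 hα) j hne
  simp at hj; exact hj this

theorem supp_hD {s : Set (Fin M)} {P : MvPolynomial (Fin M) k} (h : P ∈ supported k s) (e) :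
    hD e P ∈ supported k s := by
  apply supp_of_coeff
  intro α hα j hj
  rw [coeff_hD] at hα
  have := supp_coeff h (right_ne_zero_of_mul hα) hj
  simp at this; exact this.1

theorem supp_hD_zero {s : Set (Fin M)} {P : MvPolynomial (Fin M) k} (h : P ∈ supported k s) {e : Fin M →₀ ℕ}
    {j} (hj : j ∉ s) (he : e j ≠ 0) : hD e P = 0 := by
  ext α
  rw [coeff_hD, coeff_zero]
  by_contra hne
  have := supp_coeff h (right_ne_zero_of_mul hne) hj
  simp at this; exact he this.2

theorem supp_tr {s : Set (Fin M)} {P : MvPolynomial (Fin M) k} (h : P ∈ supported k s) (ξ) :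
    tr ξ P ∈ supported k s := by
  unfold supported at h
  induction h using Algebra.adjoin_induction with
  | mem x hx =>
    obtain ⟨j, hj, rfl⟩ := hx
    have : tr ξ (X j) = X j + C (ξ j) := by simp [tr]
    rw [this]
    exact add_mem (X_mem_supported.2 hj) (Subalgebra.algebraMap_mem _ (ξ j))
  | algebraMap r => rw [AlgHom.commutes]; exact Subalgebra.algebraMap_mem _ r
  | add x y _ _ hx hy => rw [map_add]; exact add_mem hx hy
  | mul x y _ _ hx hy => rw [map_mul]; exact mul_mem hx hy

theorem supp_det {n : ℕ} {s : Set (Fin M)} {E : Matrix (Fin n) (Fin n) (MvPolynomial (Fin M) k)}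
    (h : ∀ i j, E i j ∈ supported k s) : E.det ∈ supported k s := by
  rw [Matrix.det_apply]
  refine sum_mem fun σ _ => ?_
  have : ∏ i, E (σ i) i ∈ supported k s := prod_mem fun i _ => h _ _
  rcases Int.units_eq_one_or (Equiv.Perm.sign σ) with h | h <;> simp only [h, one_smul, Units.neg_smul]
  · exact this
  · exact neg_mem this

theorem coeff_disj {s t : Set (Fin M)} (hst : Disjoint s t) {U V : MvPolynomial (Fin M) k}
    (hU : U ∈ supported k s) (hV : V ∈ supported k t) {α β : Fin M →₀ ℕ}
    (hα : ∀ j ∉ s, α j = 0) (hβ : ∀ j ∉ t, β j = 0) :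
    coeff (α + β) (U * V) = coeff α U * coeff β V := by
  classical
  rw [coeff_mul]
  rw [sum_eq_single (α, β)]
  · rintro ⟨x, y⟩ hx hne
    rw [HasAntidiagonal.mem_antidiagonal] at hx
    by_contra h0
    apply hne
    have h1 : ∀ j ∉ s, x j = 0 := fun j hj => supp_coeff hU (left_ne_zero_of_mul h0) hj
    have h2 : ∀ j ∉ t, y j = 0 := fun j hj => supp_coeff hV (right_ne_zero_of_mul h0) hj
    have : ∀ j, x j = α j ∧ y j = β j := by
      intro j
      have h3 := DFunLike.congr_fun hx j
      simp at h3
      by_cases hj : j ∈ s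
      · have hj' : j ∉ t := fun h => Set.disjoint_left.1 hst hj h
        have := h2 j hj'; have := hβ j hj'; omega
      · have := h1 j hj; have := hα j hj; omega
    rw [Prod.mk.injEq]
    exact ⟨Finsupp.ext fun j => (this j).1, Finsupp.ext fun j => (this j).2⟩
  · intro h; simp at h

theorem hD_disj {s t : Set (Fin M)} (hst : Disjoint s t) {U V : MvPolynomial (Fin M) k}
    (hU : U ∈ supported k s) (hV : V ∈ supported k t) {e e' : Fin M →₀ ℕ}
    (he : ∀ j ∉ s, e j = 0) (he' : ∀ j ∉ t, e' j = 0) :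
    hD (e + e') (U * V) = hD e U * hD e' V := by
  classical
  have hU' := U.as_sum
  have hV' := V.as_sum
  rw [hU', hV', sum_mul_sum, map_sum, map_sum, map_sum, sum_mul_sum]
  refine sum_congr rfl fun α hα => ?_
  rw [map_sum]
  refine sum_congr rfl fun β hβ => ?_
  rw [monomial_mul, hD_monomial, hD_monomial, hD_monomial, monomial_mul]
  have h1 : ∀ j ∉ s, α j = 0 := fun j hj => supp_coeff hU (mem_support_iff.1 hα) hj
  have h2 : ∀ j ∉ t, β j = 0 := fun j hj => supp_coeff hV (mem_support_iff.1 hβ) hj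
  by_cases hle : (∀ j, e j ≤ α j) ∧ (∀ j, e' j ≤ β j)
  · congr 1
    · have : α + β - (e + e') = α - e + (β - e') := by
        ext j; have := hle.1 j; have := hle.2 j; simp; omega
      rw [this]
    · have : ∏ i, ((α + β) i).choose ((e + e') i) = (∏ i, (α i).choose (e i)) * ∏ i, (β i).choose (e' i) := by
        rw [← prod_mul_distrib]
        refine prod_congr rfl fun j _ => ?_
        by_cases hj : j ∈ s
        · have hj' : j ∉ t := fun h => Set.disjoint_left.1 hst hj h
          simp [h2 j hj', he' j hj']
        · simp [h1 j hj, he j hj]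
      rw [this]; push_cast; ring
  · have h3 : (∏ i, (α i).choose (e i)) * ∏ i, (β i).choose (e' i) = 0 := by
      rw [not_and_or] at hle
      push Not at hle
      rcases hle with ⟨j, hj⟩ | ⟨j, hj⟩
      · rw [prod_eq_zero (mem_univ j) (Nat.choose_eq_zero_of_lt hj), zero_mul]
      · rw [prod_eq_zero (f := fun i => (β i).choose (e' i)) (mem_univ j) (Nat.choose_eq_zero_of_lt hj), mul_zero]
    have h4 : ∏ i, ((α + β) i).choose ((e + e') i) = (∏ i, (α i).choose (e i)) * ∏ i, (β i).choose (e' i) := by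
      rw [← prod_mul_distrib]
      refine prod_congr rfl fun j _ => ?_
      by_cases hj : j ∈ s
      · have hj' : j ∉ t := fun h => Set.disjoint_left.1 hst hj h
        simp [h2 j hj', he' j hj']
      · simp [h1 j hj, he j hj]
    rw [h4]
    have h5 := congrArg (Nat.cast : ℕ → k) h3
    push_cast at h5 ⊢
    rw [h5, mul_zero]
    have : coeff α U * (∏ x, ((α x).choose (e x) : k)) * (coeff β V * ∏ x, ((β x).choose (e' x) : k)) = 0 := by
      linear_combination (coeff α U * coeff β V) * h5
    rw [this, monomial_zero, monomial_zero]

/-- decomposition with respect to one variable -/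
theorem decomp (G : MvPolynomial (Fin M) k) (hG : G ≠ 0) (r : Fin M) (s : Set (Fin M)) (hr : r ∉ s)
    (hGs : G ∈ supported k (insert r s)) (d : ℕ) (hd : ∀ α, coeff α G ≠ 0 → α r ≤ d) :
    ∃ (n : ℕ) (φ ψ : Fin n → MvPolynomial (Fin M) k), 1 ≤ n ∧ n ≤ d + 1 ∧ LinearIndependent k φ ∧
      LinearIndependent k ψ ∧ (∀ i, φ i ∈ supported k s) ∧ (∀ i, ψ i ∈ supported k {r}) ∧
      G = ∑ i, φ i * ψ i := by
  classical
  let g : Fin (d+1) → MvPolynomial (Fin M) k := fun n =>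
    ∑ α ∈ G.support with α r = (n:ℕ), monomial (α - Finsupp.single r (n:ℕ)) (coeff α G)
  have hg : ∀ n, g n ∈ supported k s := by
    intro n
    refine sum_mem fun α hα => ?_
    rw [mem_filter] at hα
    apply supp_of_coeff
    intro β hβ j hj
    rw [coeff_monomial] at hβ
    split_ifs at hβ with h
    · rw [← h]
      by_cases hjr : j = r
      · subst hjr; simp [hα.2]
      · have := supp_coeff hGs hβ (j := j) (by simp [hjr, hj])
        simp [this]
    · exact absurd rfl hβ
  have hGg : G = ∑ n, g n * X r ^ (n:ℕ) := by
    conv_lhs => rw [G.as_sum]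
    rw [← sum_fiberwise_of_maps_to (s := G.support) (t := (univ : Finset (Fin (d+1))))
      (g := fun α => (⟨min (α r) d, by omega⟩ : Fin (d+1))) (by simp)]
    refine sum_congr rfl fun n _ => ?_
    simp only [g]
    rw [sum_mul]
    refine sum_congr ?_ ?_
    · ext α
      simp only [mem_filter, and_congr_right_iff]
      intro hα
      have := hd α (mem_support_iff.1 hα)
      rw [Fin.ext_iff]; simp [this]
    · intro α hα
      rw [mem_filter] at hα
      rw [X_pow_eq_monomial, monomial_mul, mul_one]
      congr 1
      have : Finsupp.single r (n:ℕ) ≤ α := by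
        rw [Finsupp.single_le_iff]; exact hα.2.ge
      rw [tsub_add_cancel_of_le this]
  let V := Submodule.span k (Set.range g)
  have : FiniteDimensional k V := FiniteDimensional.span_of_finite k (Set.finite_range g)
  let b := Module.finBasis k V
  let gV : Fin (d+1) → V := fun n => ⟨g n, Submodule.subset_span ⟨n, rfl⟩⟩
  let c : Fin (d+1) → Fin (Module.finrank k V) → k := fun n l => b.repr (gV n) l
  have hgc : ∀ n, g n = ∑ l, c n l • (b l : MvPolynomial (Fin M) k) := by
    intro n
    have := congrArg Subtype.val (b.sum_repr (gV n))
    simp only [AddSubmonoidClass.coe_finsetSum, Submodule.coe_smul] at this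
    exact this.symm
  refine ⟨Module.finrank k V, fun l => b l, fun l => ∑ n, c n l • X r ^ (n:ℕ), ?_, ?_, ?_, ?_, ?_, ?_, ?_⟩
  · by_contra h0
    have h0 : Module.finrank k V = 0 := by omega
    apply hG
    rw [hGg]
    refine sum_eq_zero fun n _ => ?_
    rw [hgc]
    have : IsEmpty (Fin (Module.finrank k V)) := by rw [h0]; infer_instance
    simp
  · have := finrank_range_le_card (R := k) g
    rw [Fintype.card_fin] at this
    exact this
  · exact b.linearIndependent.map' V.subtype (Submodule.ker_subtype V)
  · rw [Fintype.linearIndependent_iff]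
    intro a ha
    have h1 : ∀ n, ∑ l, a l * c n l = 0 := by
      intro n
      have := congrArg (coeff (Finsupp.single r (n:ℕ))) ha
      simp only [coeff_sum, coeff_smul, smul_sum, coeff_zero, smul_eq_mul, X_pow_eq_monomial, coeff_monomial] at this
      rw [← this]
      refine sum_congr rfl fun l _ => ?_
      rw [sum_eq_single n]
      · simp
      · intro n' _ hn
        rw [if_neg]; · simp
        intro h
        have := DFunLike.congr_fun h r
        simp at this; exact hn (Fin.ext this)
      · simp
    let F : V →ₗ[k] k := ∑ l, a l • b.coord l
    have hF : F = 0 := by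
      apply LinearMap.ext_on (s := Set.range gV)
      · apply Submodule.map_injective_of_injective V.subtype_injective
        rw [Submodule.map_span, ← Set.range_comp, Submodule.map_top, Submodule.range_subtype]
        rfl
      · rintro _ ⟨n, rfl⟩
        simpa [F] using h1 n
    intro l
    have := LinearMap.congr_fun hF (b l)
    simpa [F, Finsupp.single_apply] using this
  · intro l
    have : (V : Submodule k _) ≤ (supported k s).toSubmodule := by
      rw [Submodule.span_le]; rintro _ ⟨n, rfl⟩; exact hg n
    exact this (b l).2
  · intro l
    refine sum_mem fun n _ => ?_
    exact (supported k {r}).smul_mem (pow_mem (X_mem_supported.2 (Set.mem_singleton r)) _) _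
  · conv_lhs => rw [hGg]
    simp only [mul_sum]
    rw [sum_comm]
    refine sum_congr rfl fun n _ => ?_
    rw [hgc, sum_mul]
    refine sum_congr rfl fun l _ => ?_
    simp

end Idx

end

section

open Finset MvPolynomial

namespace PD
variable {k : Type*} [Field k] {S : Type*} [Fintype S] (D : PD k S) {M : ℕ}

theorem coef_mul_mem {σ : Type*} {P Q : MvPolynomial σ k} (hP : ∀ α, coeff α P ∈ D.A) (hQ : ∀ α, coeff α Q ∈ D.A) (α) :
    coeff α (P * Q) ∈ D.A := by
  classical
  rw [coeff_mul]; exact sum_mem fun x _ => mul_mem (hP _) (hQ _)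

theorem coef_prod_mem {σ : Type*} {ι : Type*} (s : Finset ι) {P : ι → MvPolynomial σ k} (hP : ∀ i ∈ s, ∀ α, coeff α (P i) ∈ D.A) (α) :
    coeff α (∏ i ∈ s, P i) ∈ D.A := by
  classical
  induction s using Finset.induction_on generalizing α with
  | empty => rw [prod_empty, coeff_one]; split_ifs <;> simp
  | insert i s hi ih =>
    rw [prod_insert hi]
    exact D.coef_mul_mem (hP i (mem_insert_self i s)) (fun α => ih (fun j hj => hP j (mem_insert_of_mem hj)) α) α

theorem coef_det_mem {n : ℕ} {E : Matrix (Fin n) (Fin n) (MvPolynomial (Fin M) k)}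
    (h : ∀ i j α, coeff α (E i j) ∈ D.A) (α) : coeff α E.det ∈ D.A := by
  rw [Matrix.det_apply, coeff_sum]
  refine sum_mem fun σ _ => ?_
  have := D.coef_prod_mem univ (P := fun i => E (σ i) i) (fun i _ => h _ _) α
  rcases Int.units_eq_one_or (Equiv.Perm.sign σ) with h | h <;> simp only [h, one_smul, Units.neg_smul, coeff_neg]
  · exact this
  · exact neg_mem this

theorem coef_mul_le {σ : Type*} (v : S) {P Q : MvPolynomial σ k} {B B' T : ℝ} (hB : 0 ≤ B) (hB' : 0 ≤ B') (hT : (#P.support : ℝ) ≤ T)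
    (hP : ∀ α, D.f v (coeff α P) ≤ B) (hQ : ∀ α, D.f v (coeff α Q) ≤ B') (α) :
    D.f v (coeff α (P * Q)) ≤ T ^ 2 * (B * B') := by
  classical
  have : coeff α (P * Q) = ∑ β ∈ P.support, coeff β P * (if β ≤ α then coeff (α - β) Q else 0) := by
    conv_lhs => rw [P.as_sum, sum_mul, coeff_sum]
    refine sum_congr rfl fun β _ => ?_
    rw [coeff_monomial_mul']
    split_ifs <;> simp
  rw [this]
  refine D.sum_le' v _ _ _ _ (by positivity) hT ?_
  intro β _
  rw [map_mul]
  refine mul_le_mul (hP β) ?_ (D.nonneg _ _) hB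
  split_ifs
  · exact hQ _
  · simpa

theorem coef_prod_le {σ : Type*} (v : S) {ι : Type*} (s : Finset ι) {P : ι → MvPolynomial σ k} {B T : ℝ} (hB : 0 ≤ B)
    (hT : ∀ i ∈ s, (#(P i).support : ℝ) ≤ T)
    (hP : ∀ i ∈ s, ∀ α, D.f v (coeff α (P i)) ≤ B) (α) :
    D.f v (coeff α (∏ i ∈ s, P i)) ≤ (T ^ 2 * B) ^ #s := by
  classical
  induction s using Finset.induction_on generalizing α with
  | empty => rw [prod_empty, coeff_one]; split_ifs <;> simp
  | insert i s hi ih =>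
    rw [prod_insert hi, card_insert_of_notMem hi, pow_succ']
    have := D.coef_mul_le v hB (by positivity) (hT i (mem_insert_self i s)) (hP i (mem_insert_self i s)) (fun α => ih (fun j hj => hT j (mem_insert_of_mem hj)) (fun j hj => hP j (mem_insert_of_mem hj)) α) α
    linarith

theorem coef_det_le (v : S) {n : ℕ} {E : Matrix (Fin n) (Fin n) (MvPolynomial (Fin M) k)} {B T : ℝ} (hB : 0 ≤ B)
    (hT : ∀ i j, (#(E i j).support : ℝ) ≤ T)
    (hP : ∀ i j, ∀ α, D.f v (coeff α (E i j)) ≤ B) (α) :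
    D.f v (coeff α E.det) ≤ (n ^ 2 * T ^ 2 * B) ^ n := by
  rw [Matrix.det_apply, coeff_sum]
  have h1 : ((n.factorial : ℕ) : ℝ) ≤ (n:ℝ) ^ n := by exact_mod_cast Nat.factorial_le_pow n
  refine (D.sum_le' v _ _ ((T ^ 2 * B) ^ n) ((n:ℝ) ^ n) (by positivity)
    (by rw [card_univ, Fintype.card_perm, Fintype.card_fin]; exact h1) ?_).trans ?_
  · intro σ _
    have := D.coef_prod_le v univ (P := fun i => E (σ i) i) hB (fun i _ => hT _ _) (fun i _ => hP _ _) α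
    rw [card_univ, Fintype.card_fin] at this
    rcases Int.units_eq_one_or (Equiv.Perm.sign σ) with h | h <;> simp only [h, one_smul, Units.neg_smul, coeff_neg, f_neg]
    · exact this
    · exact this
  · apply le_of_eq; rw [← pow_mul, mul_comm n 2, pow_mul, ← mul_pow]; ring

open Polynomial in
/-- univariate vanishing in one variable of a multivariate polynomial -/
theorem univ_mv {a b : k} (ha : a ∈ D.A) (hb : b ∈ D.A) (hb0 : b ≠ 0)
    (hc : ∃ x ∈ D.A, ∃ y ∈ D.A, x * a + y * b = 1) (j : Fin M) (V : MvPolynomial (Fin M) k) (hV : V ≠ 0)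
    (hVs : V ∈ supported k {j})
    (hVA : ∀ α, MvPolynomial.coeff α V ∈ D.A) (B : S → ℝ) (hVB : ∀ v α, D.f v (MvPolynomial.coeff α V) ≤ B v)
    (d r : ℕ) (hd : ∀ α, MvPolynomial.coeff α V ≠ 0 → α j ≤ d) (ξ : Fin M → k) (hξ : ξ j = a / b)
    (hr : ∀ α, MvPolynomial.coeff α (tr ξ V) ≠ 0 → r ≤ α j) :
    (D.ht a b) ^ r ≤ (16 ^ d) ^ (Fintype.card S) * ∏ v, B v := by
  classical
  have hco : ∀ (p : k[X]) (n : ℕ), MvPolynomial.coeff (Finsupp.single j n) (Polynomial.aeval (MvPolynomial.X j : MvPolynomial (Fin M) k) p) = p.coeff n := by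
    intro p n
    rw [Polynomial.aeval_eq_sum_range, MvPolynomial.coeff_sum]
    simp only [MvPolynomial.coeff_smul, MvPolynomial.X_pow_eq_monomial, MvPolynomial.coeff_monomial, smul_eq_mul]
    have : ∀ i, (Finsupp.single j i = Finsupp.single j n) ↔ i = n := by
      intro i; constructor
      · intro h; have := DFunLike.congr_fun h j; simpa using this
      · rintro rfl; rfl
    simp only [this]
    by_cases hn : n ≤ p.natDegree
    · simp [hn]
    · rw [sum_eq_zero]
      · rw [Polynomial.coeff_eq_zero_of_natDegree_lt (by omega)]
      · intro i hi
        rw [if_neg]; · simp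
        rintro rfl; simp at hi; omega
  have : ∃ p : k[X], Polynomial.aeval (MvPolynomial.X j : MvPolynomial (Fin M) k) p = V := by
    unfold supported at hVs
    rw [Set.image_singleton, Algebra.adjoin_singleton_eq_range_aeval] at hVs
    exact hVs
  obtain ⟨p, rfl⟩ := this
  have hp0 : p ≠ 0 := by rintro rfl; simp at hV
  have htr : tr ξ (Polynomial.aeval (MvPolynomial.X j : MvPolynomial (Fin M) k) p) =
      Polynomial.aeval (MvPolynomial.X j) (p.comp (Polynomial.X + Polynomial.C (a / b))) := by
    rw [← Polynomial.aeval_algHom_apply, Polynomial.aeval_comp]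
    simp [tr, hξ, MvPolynomial.algebraMap_eq]
  rw [htr] at hr
  apply D.univRoth ha hb hb0 hc p hp0 (fun i => by rw [← hco]; exact hVA _) B (fun v i => by rw [← hco]; exact hVB _ _) d r
  · have := hd (Finsupp.single j p.natDegree) (by rw [hco]; simpa using hp0)
    simpa using this
  · have h1 : Polynomial.X ^ r ∣ p.comp (Polynomial.X + Polynomial.C (a / b)) := by
      rw [Polynomial.X_pow_dvd_iff]
      intro n hn
      by_contra h
      have := hr (Finsupp.single j n) (by rw [hco]; exact h)
      simp at this; omega
    obtain ⟨q, hq⟩ := h1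
    refine ⟨q.comp (Polynomial.X - Polynomial.C (a / b)), ?_⟩
    have := congrArg (fun t => Polynomial.comp t (Polynomial.X - Polynomial.C (a / b))) hq
    simp only [Polynomial.comp_assoc] at this
    simpa using this

end PD

end

section

open Finset MvPolynomial

/-- weight function of Roth's lemma -/
noncomputable def wtR {M : ℕ} (d : Fin M → ℕ) : (Fin M →₀ ℕ) →+ ℝ where
  toFun e := ∑ j, (e j : ℝ) / d j
  map_zero' := by simp
  map_add' x y := by simp [add_div, sum_add_distrib]

theorem wtR_apply {M : ℕ} (d : Fin M → ℕ) (e) : wtR d e = ∑ j, (e j : ℝ) / d j := rfl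

theorem wtR_nonneg {M : ℕ} (d : Fin M → ℕ) (e) : 0 ≤ wtR d e := by
  rw [wtR_apply]; exact sum_nonneg fun j _ => by positivity

theorem sum_inj_bound (s d : ℕ) (hs : 1 ≤ s) (hd : s ≤ d + 1) (hd1 : 1 ≤ d) (l : Fin s → ℕ)
    (hl : Function.Injective l)
    (hls : ∀ i, l i < s) (θ : ℝ) (h0 : 0 < θ) (h1 : θ ≤ 1) :
    s * θ ^ 2 / 32 ≤ ∑ i, max 0 (θ / 2 - l i / d) := by
  have e1 : ∑ i, max 0 (θ / 2 - (l i : ℝ) / d) = ∑ n ∈ range s, max 0 (θ / 2 - (n : ℝ) / d) := by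
    have himg : univ.image l = range s := by
      apply eq_of_subset_of_card_le
      · intro n hn
        simp at hn; obtain ⟨i, rfl⟩ := hn; simpa using hls i
      · rw [card_image_of_injective _ hl]; simp
    rw [← himg, sum_image (fun x _ y _ h => hl h)]
  rw [e1]
  have hs' : (1:ℝ) ≤ s := by exact_mod_cast hs
  have hd1' : (1:ℝ) ≤ d := by exact_mod_cast hd1
  have hd' : (s:ℝ) ≤ d + 1 := by exact_mod_cast hd
  set m := ⌊θ * s / 8⌋₊ + 1 with hm
  have hfl : (⌊θ * s / 8⌋₊ : ℝ) ≤ θ * s / 8 := Nat.floor_le (by positivity)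
  have hms : m ≤ s := by
    have : (⌊θ * s / 8⌋₊ : ℝ) < s := by nlinarith
    have : ⌊θ * s / 8⌋₊ < s := by exact_mod_cast this
    omega
  have hmr : θ * s / 8 ≤ m := by rw [hm]; push_cast; exact (Nat.lt_floor_add_one _).le
  calc (s:ℝ) * θ ^ 2 / 32 = (θ * s / 8) * (θ / 4) := by ring
    _ ≤ m * (θ / 4) := by gcongr
    _ = ∑ n ∈ range m, θ / 4 := by simp
    _ ≤ ∑ n ∈ range m, max 0 (θ / 2 - (n : ℝ) / d) := by
      refine sum_le_sum fun n hn => le_max_of_le_right ?_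
      have hn' : n ≤ ⌊θ * s / 8⌋₊ := by simp at hn; omega
      have hn2 : (n:ℝ) ≤ θ * s / 8 := le_trans (by exact_mod_cast hn') hfl
      have : (n:ℝ) / d ≤ θ / 4 := by
        rw [div_le_iff₀ (by linarith)]; nlinarith
      linarith
    _ ≤ _ := sum_le_sum_of_subset_of_nonneg (by simpa using hms) (fun _ _ _ => le_max_left _ _)

namespace PD
variable {k : Type*} [Field k] [CharZero k] {S : Type*} [Fintype S] (D : PD k S) {M : ℕ}

def RothStmt (M r : ℕ) : Prop := ∀ θ : ℝ, 0 < θ → θ ≤ 1 → ∃ C : ℕ, 1 ≤ C ∧ ∃ ω : ℝ, 0 < ω ∧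
  ∀ (d : Fin M → ℕ) (D0 : ℕ) (G : MvPolynomial (Fin M) k) (B : S → ℝ) (a b : Fin M → k),
    (∀ j, 1 ≤ d j) → (∀ j, d j ≤ D0) → (∀ i j, i < j → (d j : ℝ) ≤ ω * d i) → G ≠ 0 →
    G ∈ supported k {j : Fin M | j.val < r} → (∀ α, coeff α G ∈ D.A) → (∀ v, 1 ≤ B v) →
    (∀ v α, D.f v (coeff α G) ≤ B v) → (∀ α, coeff α G ≠ 0 → ∀ j, α j ≤ d j) →
    (∀ j, a j ∈ D.A ∧ b j ∈ D.A ∧ b j ≠ 0 ∧ ∃ x ∈ D.A, ∃ y ∈ D.A, x * a j + y * b j = 1) →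
    (∀ j, ((C:ℝ) ^ D0 * ∏ v, B v) ^ C ≤ D.ht (a j) (b j) ^ d j) →
    ∃ e, wtR d e < θ ∧ coeff e (tr (fun j => a j / b j) G) ≠ 0

theorem hD_size (v : S) (d : Fin M → ℕ) (D0 : ℕ) (hd : ∀ j, d j ≤ D0) (G : MvPolynomial (Fin M) k)
    (B : ℝ) (hB : ∀ α, D.f v (coeff α G) ≤ B) (hG : ∀ α, coeff α G ≠ 0 → ∀ j, α j ≤ d j) (e α) :
    D.f v (coeff α (hD e G)) ≤ (4:ℝ) ^ (M * D0) * B := by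
  have hB0 : 0 ≤ B := (D.nonneg _ _).trans (hB 0)
  rw [coeff_hD]
  by_cases h : coeff (α + e) G = 0
  · rw [h]; simp; positivity
  · rw [map_mul]
    refine mul_le_mul ?_ (hB _) (D.nonneg _ _) (by positivity)
    refine (D.f_natCast v _).trans ?_
    have : (∏ i, (α i + e i).choose (e i)) ≤ 2 ^ (M * D0) := by
      calc _ ≤ ∏ i : Fin M, 2 ^ D0 := by
            refine prod_le_prod' fun i _ => ?_
            refine (Nat.choose_le_two_pow _ _).trans ?_
            have := hG _ h i
            simp at this
            exact Nat.pow_le_pow_right (by norm_num) (this.trans (hd i))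
        _ = _ := by simp [← pow_mul, mul_comm]
    calc ((∏ i, (α i + e i).choose (e i) : ℕ) : ℝ) ^ 2 ≤ ((2 ^ (M * D0) : ℕ) : ℝ) ^ 2 := by gcongr
      _ = _ := by push_cast; rw [← pow_mul, mul_comm _ 2, pow_mul]; norm_num

theorem card_supp (d : Fin M → ℕ) (D0 : ℕ) (hd : ∀ j, d j ≤ D0) (G : MvPolynomial (Fin M) k)
    (hG : ∀ α, coeff α G ≠ 0 → ∀ j, α j ≤ d j) : (#G.support : ℝ) ≤ 2 ^ (M * D0) := by
  classical
  have h1 : #G.support ≤ #(Fintype.piFinset fun _ : Fin M => range (D0 + 1)) := by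
    apply card_le_card_of_injOn (fun α : Fin M →₀ ℕ => (⇑α : Fin M → ℕ))
    · intro α hα
      simp only [mem_coe, Fintype.mem_piFinset, mem_range]
      intro j
      have := hG α (mem_support_iff.1 hα) j
      have := hd j
      omega
    · intro α _ β _ h; exact DFunLike.coe_injective h
  rw [Fintype.card_piFinset] at h1
  have h2 : ∏ i : Fin M, #(range (D0+1)) ≤ 2 ^ (M * D0) := by
    calc _ ≤ ∏ i : Fin M, 2 ^ D0 := prod_le_prod' fun i _ => by rw [card_range]; exact Nat.lt_two_pow_self
      _ = _ := by simp [← pow_mul, mul_comm]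
  exact_mod_cast h1.trans h2

theorem hD_deg (d : Fin M → ℕ) (G : MvPolynomial (Fin M) k)
    (hG : ∀ α, coeff α G ≠ 0 → ∀ j, α j ≤ d j) (e α) (h : coeff α (hD e G) ≠ 0) (j) : α j ≤ d j := by
  rw [coeff_hD] at h
  have := hG _ (right_ne_zero_of_mul h) j
  simp at this; omega

/-- coordinate as additive map -/
noncomputable def negCoord (j : Fin M) : (Fin M →₀ ℕ) →+ ℝ where
  toFun e := -(e j : ℝ)
  map_zero' := by simp
  map_add' x y := by simp; ring

set_option maxHeartbeats 2000000 in
theorem roth_step (r : ℕ) (ih : D.RothStmt M r) : D.RothStmt M (r + 1) := by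
  classical
  by_cases hrM : r < M
  swap
  · intro θ h0 h1
    obtain ⟨C, hC, ω, hω, h⟩ := ih θ h0 h1
    refine ⟨C, hC, ω, hω, ?_⟩
    intro d D0 G B a b h1 h2 h3 h4 h5 h6 h7 h8 h9 h10 h11
    apply h d D0 G B a b h1 h2 h3 h4 ?_ h6 h7 h8 h9 h10 h11
    apply supported_mono ?_ h5
    intro j _
    have := j.2
    simp; omega
  intro θ h0 h1
  obtain ⟨C', hC', ω', hω', ih⟩ := ih (θ ^ 2 / 64) (by positivity) (by nlinarith)
  set c : ℕ := 64 ^ M with hc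
  set q : ℕ := ⌈64 / θ ^ 2⌉₊ with hq
  set C : ℕ := C' * (16 * c) ^ (Fintype.card S) + q + 1 with hC
  have hc1 : 1 ≤ c := Nat.one_le_pow _ _ (by norm_num)
  have h16 : 1 ≤ (16 * c) ^ (Fintype.card S) := Nat.one_le_pow _ _ (by omega)
  have hcS : c ^ (Fintype.card S) ≤ (16 * c) ^ (Fintype.card S) := Nat.pow_le_pow_left (by omega) _
  have hC'C : C' ≤ C := by nlinarith
  have hqC : q < C := by have : 0 ≤ C' * (16 * c) ^ (Fintype.card S) := Nat.zero_le _; omega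
  have hq1 : 1 ≤ q := Nat.one_le_iff_ne_zero.2 (by rw [hq]; exact (Nat.ceil_pos.2 (by positivity)).ne')
  refine ⟨C, by omega, min ω' (θ / 2), by positivity, ?_⟩
  intro d D0 G B a b hd1 hdD hω hG0 hGs hGA hB1 hGB hGd hab hht
  by_contra hcon
  push Not at hcon
  set jr : Fin M := ⟨r, hrM⟩ with hjr
  set ξ : Fin M → k := fun j => a j / b j with hξ
  set sr : Set (Fin M) := {j | j.val < r} with hsr
  have hjs : jr ∉ sr := by simp [hsr, hjr]
  have hGs' : G ∈ supported k (insert jr sr) := by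
    apply supported_mono ?_ hGs
    intro j hj
    simp [hsr, hjr, Fin.ext_iff] at hj ⊢; omega
  obtain ⟨s, φ, ψ, hs1, hsd, hφ, hψ, hφs, hψs, hGφ⟩ := decomp G hG0 jr sr hjs hGs' (d jr) (fun α hα => hGd α hα jr)
  obtain ⟨e, he, hU⟩ := wronsk s φ hφ
  obtain ⟨e', he', hV⟩ := wronsk s ψ hψ
  set U := (Matrix.of fun i l => hD (e i) (φ l)).det with hUdef
  set V := (Matrix.of fun i l => hD (e' i) (ψ l)).det with hVdef
  have hes : ∀ i, ∀ j ∉ sr, e i j = 0 := by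
    intro i j hj
    by_contra hne
    exact hU (Matrix.det_eq_zero_of_row_eq_zero i fun l => by
      rw [Matrix.of_apply]; exact supp_hD_zero (hφs l) hj hne)
  have hes' : ∀ i, ∀ j ∉ ({jr} : Set (Fin M)), e' i j = 0 := by
    intro i j hj
    by_contra hne
    exact hV (Matrix.det_eq_zero_of_row_eq_zero i fun l => by
      rw [Matrix.of_apply]; exact supp_hD_zero (hψs l) hj hne)
  have hinj : Function.Injective (fun i => e' i jr) := by
    intro i i' hii
    by_contra hne
    apply hV
    apply Matrix.det_zero_of_row_eq hne
    have : e' i = e' i' := by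
      ext j
      by_cases hj : j = jr
      · rw [hj]; exact hii
      · rw [hes' i j hj, hes' i' j hj]
    ext1 l
    simp only [Matrix.of_apply, this]
  have hdisj : Disjoint sr {jr} := by simpa using hjs
  set E : Matrix (Fin s) (Fin s) (MvPolynomial (Fin M) k) := Matrix.of fun i i' => hD (e i + e' i') G with hE
  have hW : E.det = U * V := by
    rw [hUdef, hVdef, ← Matrix.det_transpose (Matrix.of fun i l => hD (e' i) (ψ l)), ← Matrix.det_mul]
    congr 1
    ext1 i i'
    rw [hE, Matrix.mul_apply, Matrix.of_apply]
    conv_lhs => rw [hGφ]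
    rw [map_sum]
    refine sum_congr rfl fun l _ => ?_
    rw [hD_disj hdisj (hφs l) (hψs l) (hes i) (hes' i')]
    rfl
  have hUs : U ∈ supported k sr := supp_det fun i l => supp_hD (hφs l) _
  have hVs : V ∈ supported k {jr} := supp_det fun i l => supp_hD (hψs l) _
  set W := E.det with hWdef
  have hWA : ∀ α, coeff α W ∈ D.A := D.coef_det_mem (fun i j α => by
    rw [hE, Matrix.of_apply, coeff_hD]
    exact mul_mem (natCast_mem _ _) (hGA _))
  have hWd : ∀ α, coeff α W ≠ 0 → ∀ j, α j ≤ s * d j := by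
    intro α hα j
    have := Idx.det (w := negCoord j) (t := fun _ => -(d j : ℝ)) (E := E) (by
      intro i i' β hβ
      have := hD_deg d G hGd _ β hβ j
      change -(d j : ℝ) ≤ -(β j : ℝ)
      have : (β j : ℝ) ≤ d j := by exact_mod_cast this
      linarith) α hα
    change _ ≤ -(α j : ℝ) at this
    simp at this
    exact_mod_cast this
  set B' : S → ℝ := fun v => ((c:ℝ) ^ D0 * B v) ^ s with hB'
  have hM1 : 1 ≤ M := by omega
  have hs2 : s ≤ 2 ^ D0 := by
    have : D0 < 2 ^ D0 := Nat.lt_two_pow_self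
    have := hdD jr
    omega
  have hWB : ∀ v α, D.f v (coeff α W) ≤ B' v := by
    intro v α
    have hBv := hB1 v
    refine (D.coef_det_le v (B := (4:ℝ) ^ (M * D0) * B v) (T := 2 ^ (M * D0)) (by positivity) (fun i j => ?_) (fun i j => ?_) α).trans ?_
    · exact card_supp d D0 hdD _ (hD_deg d G hGd _)
    · exact D.hD_size v d D0 hdD G (B v) (hGB v) hGd _
    · rw [hB']
      simp only
      have h2 : ((s:ℕ):ℝ) ≤ 2 ^ (M * D0) := by
        calc ((s:ℕ):ℝ) ≤ 2 ^ D0 := by exact_mod_cast hs2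
          _ ≤ _ := pow_le_pow_right₀ (by norm_num) (by nlinarith)
      have h3 : (c:ℝ) ^ D0 = (2 ^ (M * D0)) ^ 2 * (2 ^ (M * D0)) ^ 2 * 4 ^ (M * D0) := by
        rw [hc]; push_cast
        rw [← pow_mul, ← pow_mul, mul_comm (M * D0) 2, pow_mul (2:ℝ) 2, ← mul_pow, ← mul_pow]; norm_num
      rw [h3]
      have h4 : (s:ℝ)^2 * (2 ^ (M * D0)) ^ 2 * (4 ^ (M * D0) * B v) ≤ (2 ^ (M * D0)) ^ 2 * (2 ^ (M * D0)) ^ 2 * 4 ^ (M * D0) * B v := by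
        have : (s:ℝ)^2 ≤ (2 ^ (M * D0)) ^ 2 := by gcongr
        calc _ = (s:ℝ)^2 * ((2 ^ (M * D0)) ^ 2 * (4 ^ (M * D0) * B v)) := by ring
          _ ≤ (2 ^ (M * D0)) ^ 2 * ((2 ^ (M * D0)) ^ 2 * (4 ^ (M * D0) * B v)) := by gcongr
          _ = _ := by ring
      gcongr
  -- index
  have hGidx : Idx (wtR d) θ (tr ξ G) := by
    intro α hα
    by_contra hlt
    exact hα (hcon α (not_le.1 hlt))
  have htrW : tr ξ W = (Matrix.of fun i i' => hD (e i + e' i') (tr ξ G)).det := by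
    rw [hWdef, AlgHom.map_det]
    congr 1
    ext1 i i'
    simp [hE, hD_tr]
  have hdr1 : (1:ℝ) ≤ d jr := by exact_mod_cast hd1 jr
  have hwe : ∀ i, wtR d (e i) ≤ θ / 2 := by
    intro i
    have h2 : ∀ j, (e i j : ℝ) / d j ≤ (e i j : ℝ) * (θ / 2 / d jr) := by
      intro j
      by_cases hj : j ∈ sr
      · have h3 := hω j jr (show j.val < r from hj)
        have h4 : (d jr : ℝ) ≤ θ / 2 * d j := h3.trans (by gcongr; exact min_le_right _ _)
        have h5 : (1:ℝ) ≤ d j := by exact_mod_cast hd1 j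
        rw [div_eq_mul_inv]
        gcongr
        rw [inv_eq_one_div, div_le_div_iff₀ (by linarith) (by linarith)]
        linarith
      · rw [hes i j hj]; simp
    rw [wtR_apply]
    calc _ ≤ ∑ j, (e i j : ℝ) * (θ / 2 / d jr) := sum_le_sum fun j _ => h2 j
      _ = ((∑ j, e i j : ℕ) : ℝ) * (θ / 2 / d jr) := by rw [← sum_mul]; push_cast; rfl
      _ ≤ (d jr : ℝ) * (θ / 2 / d jr) := by
        have : ∑ j, e i j ≤ d jr := by have := he i; omega
        gcongr
      _ = θ / 2 := by field_simp
  have hwe' : ∀ i, wtR d (e' i) = (e' i jr : ℝ) / d jr := by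
    intro i
    rw [wtR_apply, sum_eq_single jr]
    · intro j _ hj; rw [hes' i j hj]; simp
    · simp
  have hWidx : Idx (wtR d) (s * θ ^ 2 / 32) (tr ξ W) := by
    rw [htrW]
    refine (Idx.det (t := fun i' => max 0 (θ / 2 - (e' i' jr : ℝ) / d jr)) ?_).mono
      (sum_inj_bound s (d jr) hs1 hsd (hd1 jr) (fun i => e' i jr) hinj ?_ θ h0 h1)
    · intro i i' α hα
      rw [Matrix.of_apply] at hα
      have := hGidx.hD (e i + e' i') α hα
      rw [map_add, hwe'] at this
      have := hwe i
      apply max_le (wtR_nonneg d α)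
      linarith
    · intro i
      refine lt_of_le_of_lt ?_ (he' i)
      exact single_le_sum (f := fun j => e' i j) (fun _ _ => Nat.zero_le _) (mem_univ jr)
  have htrUs := supp_tr hUs ξ
  have htrVs := supp_tr hVs ξ
  have hs1' : (1:ℝ) ≤ s := by exact_mod_cast hs1
  have hprodB : ∏ v, B' v = (((c:ℝ) ^ (Fintype.card S)) ^ D0 * ∏ v, B v) ^ s := by
    rw [hB']; simp only
    rw [prod_pow, prod_mul_distrib]; simp [← pow_mul, mul_comm]
  have hPB1 : 1 ≤ ∏ v, B v := by
    calc (1:ℝ) = ∏ v : S, 1 := by simp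
      _ ≤ _ := prod_le_prod (fun _ _ => zero_le_one) (fun v _ => hB1 v)
  have hB'1 : ∀ v, 1 ≤ B' v := by
    intro v
    rw [hB']
    apply one_le_pow₀
    have h2 : (1:ℝ) ≤ (c:ℝ) ^ D0 := one_le_pow₀ (by exact_mod_cast hc1)
    have := hB1 v
    nlinarith
  obtain ⟨αU, hαU⟩ := ne_zero_iff.1 hU
  obtain ⟨αV, hαV⟩ := ne_zero_iff.1 hV
  have hαUs : ∀ j ∉ sr, αU j = 0 := fun j hj => supp_coeff hUs hαU hj
  have hαVs : ∀ j ∉ ({jr} : Set (Fin M)), αV j = 0 := fun j hj => supp_coeff hVs hαV hj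
  have hUV : Idx (wtR d) (s * θ ^ 2 / 64) (tr ξ U) ∨ Idx (wtR d) (s * θ ^ 2 / 64) (tr ξ V) := by
    by_contra hno
    rw [not_or] at hno
    unfold Idx at hno
    push Not at hno
    obtain ⟨⟨α, hα, hα2⟩, ⟨β, hβ, hβ2⟩⟩ := hno
    have := hWidx (α + β) (by
      rw [hW, map_mul, coeff_disj hdisj htrUs htrVs (fun j hj => supp_coeff htrUs hα hj)
        (fun j hj => supp_coeff htrVs hβ hj)]
      exact mul_ne_zero hα hβ)
    rw [map_add] at this
    linarith
  have hscale : ∀ e : Fin M →₀ ℕ, wtR (fun j => s * d j) e = wtR d e / s := by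
    intro e
    rw [wtR_apply, wtR_apply, sum_div]
    refine sum_congr rfl fun j _ => ?_
    push_cast
    rw [div_div, mul_comm (s:ℝ)]
  have hht1 : ∀ j, 1 ≤ D.ht (a j) (b j) := by
    intro j
    have h2 : 1 ≤ D.ht (a j) (b j) ^ d j := by
      refine le_trans ?_ (hht j)
      apply one_le_pow₀
      have h2 : (1:ℝ) ≤ (C:ℝ) ^ D0 := one_le_pow₀ (by exact_mod_cast (by omega : 1 ≤ C))
      nlinarith
    by_contra hlt
    rw [not_le] at hlt
    have hn : 0 ≤ D.ht (a j) (b j) := prod_nonneg fun v _ => le_max_of_le_left (D.nonneg v _)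
    have := pow_lt_one₀ hn hlt (by have := hd1 j; omega : d j ≠ 0)
    linarith
  rcases hUV with hcase | hcase
  · -- case U
    set U' := MvPolynomial.C (coeff αV V) * U with hU'
    have hcU : ∀ α, coeff α U' ≠ 0 → coeff α U' = coeff (α + αV) W := by
      intro α hα
      rw [hU', coeff_C_mul] at hα ⊢
      rw [hW, coeff_disj hdisj hUs hVs (fun j hj => supp_coeff hUs (right_ne_zero_of_mul hα) hj) hαVs, mul_comm]
    obtain ⟨e0, he0, hne0⟩ := ih (fun j => s * d j) (s * D0) U' B' a b
      (fun j => Nat.mul_pos hs1 (hd1 j)) (fun j => Nat.mul_le_mul_left _ (hdD j))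
      (fun i j hij => by
        have h2 := hω i j hij
        have h3 : (d j : ℝ) ≤ ω' * d i := h2.trans (by gcongr; exact min_le_left _ _)
        push_cast
        nlinarith)
      (mul_ne_zero (by simpa using hαV) hU)
      (mul_mem (Subalgebra.algebraMap_mem _ _) hUs)
      (fun α => by
        by_cases h : coeff α U' = 0
        · rw [h]; exact zero_mem _
        · rw [hcU α h]; exact hWA _)
      hB'1
      (fun v α => by
        by_cases h : coeff α U' = 0
        · rw [h, map_zero]; linarith [hB'1 v]
        · rw [hcU α h]; exact hWB _ _)
      (fun α h j => by
        have := hWd (α + αV) (by rw [← hcU α h]; exact h) j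
        simp at this; omega)
      hab
      (fun j => by
        have e1 : D.ht (a j) (b j) ^ (s * d j) = (D.ht (a j) (b j) ^ d j) ^ s := by
          rw [← pow_mul, mul_comm]
        have e2 : ((C':ℝ) ^ (s * D0) * ∏ v, B' v) ^ C' =
            (((C':ℝ) ^ D0 * (((c:ℝ) ^ Fintype.card S) ^ D0 * ∏ v, B v)) ^ C') ^ s := by
          rw [hprodB, mul_comm s D0, pow_mul (C':ℝ), ← mul_pow]
          exact pow_right_comm _ _ _
        rw [e1, e2]
        gcongr
        refine le_trans ?_ (hht j)
        have h2 : (C':ℝ) ^ D0 * (((c:ℝ) ^ Fintype.card S) ^ D0 * ∏ v, B v) ≤ (C:ℝ) ^ D0 * ∏ v, B v := by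
          rw [← mul_assoc, ← mul_pow]
          gcongr
          have : C' * c ^ Fintype.card S ≤ C := by
            have : C' * c ^ Fintype.card S ≤ C' * (16 * c) ^ (Fintype.card S) := Nat.mul_le_mul_left _ hcS
            omega
          exact_mod_cast this
        have h3 : (1:ℝ) ≤ (C:ℝ) ^ D0 * ∏ v, B v := by
          have h2 : (1:ℝ) ≤ (C:ℝ) ^ D0 := one_le_pow₀ (by exact_mod_cast (by omega : 1 ≤ C))
          nlinarith
        calc _ ≤ ((C:ℝ) ^ D0 * ∏ v, B v) ^ C' := by gcongr
          _ ≤ _ := pow_le_pow_right₀ h3 hC'C)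
    rw [hscale, div_lt_iff₀ (by linarith)] at he0
    have h5 : tr ξ U' = MvPolynomial.C (coeff αV V) * tr ξ U := by
      rw [hU', map_mul]; congr 1; exact AlgHom.commutes _ _
    rw [h5, coeff_C_mul] at hne0
    have := hcase e0 (right_ne_zero_of_mul hne0)
    linarith
  · -- case V
    set V' := MvPolynomial.C (coeff αU U) * V with hV'
    have hcV : ∀ α, coeff α V' ≠ 0 → coeff α V' = coeff (αU + α) W := by
      intro α hα
      rw [hV', coeff_C_mul] at hα ⊢
      rw [hW, coeff_disj hdisj hUs hVs hαUs (fun j hj => supp_coeff hVs (right_ne_zero_of_mul hα) hj)]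
    have h5 : tr ξ V' = MvPolynomial.C (coeff αU U) * tr ξ V := by
      rw [hV', map_mul]; congr 1; exact AlgHom.commutes _ _
    set m := ⌈s * θ ^ 2 / 64 * d jr⌉₊ with hm
    have key := D.univ_mv (hab jr).1 (hab jr).2.1 (hab jr).2.2.1 (hab jr).2.2.2 jr V'
      (mul_ne_zero (by simpa using hαU) hV)
      (mul_mem (Subalgebra.algebraMap_mem _ _) hVs)
      (fun α => by
        by_cases h : coeff α V' = 0
        · rw [h]; exact zero_mem _
        · rw [hcV α h]; exact hWA _)
      B'
      (fun v α => by
        by_cases h : coeff α V' = 0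
        · rw [h, map_zero]; linarith [hB'1 v]
        · rw [hcV α h]; exact hWB _ _)
      (s * d jr) m
      (fun α h => by
        have := hWd (αU + α) (by rw [← hcV α h]; exact h) jr
        simp at this; omega)
      ξ rfl
      (fun α h => by
        rw [h5, coeff_C_mul] at h
        have h6 := hcase α (right_ne_zero_of_mul h)
        rw [wtR_apply, sum_eq_single jr, le_div_iff₀ (by linarith)] at h6
        · exact Nat.ceil_le.2 h6
        · intro j _ hj; rw [supp_coeff htrVs (right_ne_zero_of_mul h) hj]; simp
        · simp)
    rw [hprodB] at key
    set Z := (C:ℝ) ^ D0 * ∏ v, B v with hZ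
    have hD01 : 1 ≤ D0 := (hd1 jr).trans (hdD jr)
    have hC2 : (2:ℝ) ≤ C := by exact_mod_cast (by omega : 2 ≤ C)
    have hZ1 : 1 < Z := by
      have h2 : (2:ℝ) ≤ (C:ℝ) ^ D0 := by
        calc (2:ℝ) ≤ C := hC2
          _ = (C:ℝ) ^ 1 := by ring
          _ ≤ _ := pow_le_pow_right₀ (by linarith) hD01
      nlinarith
    have hqm : s * d jr ≤ m * q := by
      have h2 : (s:ℝ) * θ ^ 2 / 64 * d jr ≤ m := Nat.le_ceil _
      have h3 : 64 / θ ^ 2 ≤ q := Nat.le_ceil _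
      have : (s:ℝ) * d jr ≤ m * q := by
        calc (s:ℝ) * d jr = ((s:ℝ) * θ ^ 2 / 64 * d jr) * (64 / θ ^ 2) := by field_simp
          _ ≤ _ := by gcongr
      exact_mod_cast this
    have h7 : (16 ^ (s * d jr)) ^ Fintype.card S * (((c:ℝ) ^ Fintype.card S) ^ D0 * ∏ v, B v) ^ s ≤ Z ^ s := by
      have e1 : ((16:ℝ) ^ (s * d jr)) ^ Fintype.card S = ((16 ^ Fintype.card S) ^ d jr) ^ s := by
        rw [← pow_mul, ← pow_mul, ← pow_mul]; congr 1; ring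
      rw [e1, ← mul_pow, ← mul_assoc]
      rw [hZ]
      gcongr
      calc ((16:ℝ) ^ Fintype.card S) ^ d jr * ((c:ℝ) ^ Fintype.card S) ^ D0 ≤ ((16:ℝ) ^ Fintype.card S) ^ D0 * ((c:ℝ) ^ Fintype.card S) ^ D0 := by
            gcongr
            · exact one_le_pow₀ (by norm_num)
            · exact hdD jr
        _ = ((16 * c : ℝ) ^ Fintype.card S) ^ D0 := by rw [← mul_pow, ← mul_pow]
        _ ≤ _ := by
          gcongr
          have : (16 * c) ^ Fintype.card S ≤ C := by nlinarith
          exact_mod_cast this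
    have h8 : (Z ^ C) ^ s ≤ (Z ^ s) ^ q := by
      calc (Z ^ C) ^ s ≤ (D.ht (a jr) (b jr) ^ d jr) ^ s := by
            have := hht jr
            gcongr
        _ = D.ht (a jr) (b jr) ^ (s * d jr) := by rw [← pow_mul, mul_comm]
        _ ≤ D.ht (a jr) (b jr) ^ (m * q) := pow_le_pow_right₀ (hht1 jr) hqm
        _ = (D.ht (a jr) (b jr) ^ m) ^ q := by rw [pow_mul]
        _ ≤ _ := by
          have := hht1 jr
          have h9 := key.trans h7
          gcongr
    rw [← pow_mul, ← pow_mul, mul_comm s q] at h8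
    have := pow_lt_pow_right₀ hZ1 (Nat.mul_lt_mul_of_pos_right hqC hs1)
    linarith

theorem roth (r : ℕ) : D.RothStmt M r := by
  induction r with
  | zero =>
    intro θ h0 h1
    refine ⟨1, le_rfl, 1, one_pos, ?_⟩
    intro d D0 G B a b _ _ _ hG0 hGs _ _ _ _ _ _
    have : ({j : Fin M | j.val < 0}) = ∅ := by ext; simp
    rw [this, supported_empty, Algebra.mem_bot] at hGs
    obtain ⟨c, rfl⟩ := hGs
    refine ⟨0, by simpa using h0, ?_⟩
    rw [AlgHom.commutes, algebraMap_eq, coeff_zero_C]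
    rintro rfl; simp at hG0
  | succ r ih => exact D.roth_step r ih

end PD

end

section

open Finset MvPolynomial

section lsub
variable {k : Type*} [Field k] {σ : Type*} [Fintype σ]

theorem expo_ind' {p : (σ →₀ ℕ) → Prop} (h0 : p 0)
    (hs : ∀ e j, p e → p (e + Finsupp.single j 1)) (e) : p e := by
  induction e using Finsupp.induction_linear with
  | zero => exact h0
  | add f g hf hg =>
    clear hf
    induction f using Finsupp.induction with
    | zero => simpa using hg
    | single_add a b f ha hb hf =>
      have : ∀ n : ℕ, p (Finsupp.single a n + f + g) := by
        intro n
        induction n with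
        | zero => simpa using hf
        | succ n ih =>
          have := hs _ a ih
          rwa [show Finsupp.single a n + f + g + Finsupp.single a 1 = Finsupp.single a (n+1) + f + g by
            rw [Finsupp.single_add]; abel] at this
      exact this b
  | single a b =>
    induction b with
    | zero => simpa using h0
    | succ n ih => rw [Finsupp.single_add]; exact hs _ _ ih

/-- Linear substitution. -/
noncomputable def lsub (a : Matrix σ σ k) : MvPolynomial σ k →ₐ[k] MvPolynomial σ k :=
  aeval (fun s => ∑ t, C (a s t) * X t)

theorem lsub_X (a : Matrix σ σ k) (s) : lsub a (X s) = ∑ t, C (a s t) * X t := by simp [lsub]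

theorem lsub_mul (a b : Matrix σ σ k) (P : MvPolynomial σ k) : lsub b (lsub a P) = lsub (a * b) P := by
  have : (lsub b).comp (lsub a) = lsub (a * b) := by
    ext1 s
    rw [AlgHom.comp_apply, lsub_X, lsub_X, map_sum]
    simp_rw [map_mul, lsub_X, Matrix.mul_apply, map_sum, sum_mul]
    rw [sum_comm]
    refine sum_congr rfl fun t _ => ?_
    rw [show (lsub b) (C (a s t)) = C (a s t) from AlgHom.commutes _ _, mul_sum]
    refine sum_congr rfl fun t _ => by rw [C_mul]; ring
  rw [← this]; rfl

theorem lsub_one [DecidableEq σ] (P : MvPolynomial σ k) : lsub (1 : Matrix σ σ k) P = P := by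
  have : lsub (1 : Matrix σ σ k) = AlgHom.id k _ := by
    ext1 s
    rw [lsub_X, sum_eq_single s]
    · simp
    · intro t _ h; rw [Matrix.one_apply_ne h.symm]; simp
    · simp
  rw [this]; rfl

theorem coeff_lsub_succ (a : Matrix σ σ k) (α β : σ →₀ ℕ) (s : σ) (c : k) :
    coeff β (lsub a (monomial (α + Finsupp.single s 1 : σ →₀ ℕ) c)) =
      ∑ t, a s t * (if β t = 0 then 0 else coeff (β - Finsupp.single t 1) (lsub a (monomial α c))) := by
  classical
  have : monomial (α + Finsupp.single s 1 : σ →₀ ℕ) c = monomial α c * X s := by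
    rw [X, monomial_mul, mul_one]
  rw [this, map_mul, lsub_X, mul_sum, coeff_sum]
  refine sum_congr rfl fun t _ => ?_
  rw [mul_left_comm, coeff_C_mul, coeff_mul_X']
  congr 1
  by_cases h : β t = 0 <;> simp [h]

theorem lsub_zero_monomial (a : Matrix σ σ k) (c : k) : lsub a (monomial 0 c) = monomial 0 c :=
  AlgHom.commutes _ _

/-- total weight preserved -/
theorem lsub_wt {M : Type*} [AddCommMonoid M] (a : Matrix σ σ k) (w : σ → M)
    (h : ∀ s t, a s t ≠ 0 → w s = w t) (α : σ →₀ ℕ) (c : k) : ∀ β,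
    coeff β (lsub a (monomial α c)) ≠ 0 → ∑ s, β s • w s = ∑ s, α s • w s := by
  classical
  induction α using expo_ind' with
  | h0 =>
    intro β hβ
    rw [lsub_zero_monomial, coeff_monomial] at hβ
    split_ifs at hβ with h1
    · rw [← h1]
    · exact absurd rfl hβ
  | hs α s ih =>
    intro β hβ
    rw [coeff_lsub_succ] at hβ
    obtain ⟨t, _, ht⟩ := exists_ne_zero_of_sum_ne_zero hβ
    have h1 := h s t (left_ne_zero_of_mul ht)
    have h2 := right_ne_zero_of_mul ht
    split_ifs at h2 with h3
    · exact absurd rfl h2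
    have h4 := ih _ h2
    have h5 : β = (β - Finsupp.single t 1) + Finsupp.single t 1 := by
      ext u
      by_cases hu : u = t
      · subst hu; simp; omega
      · simp [Ne.symm hu]
    have aux : ∀ (γ : σ →₀ ℕ) (u : σ), ∑ s, (γ + Finsupp.single u 1 : σ →₀ ℕ) s • w s = ∑ s, γ s • w s + w u := by
      intro γ u
      simp only [Finsupp.add_apply, add_smul, sum_add_distrib]
      congr 1
      rw [sum_eq_single u]
      · simp
      · intro x _ hx; simp [hx.symm]
      · simp
    rw [h5, aux, aux, h4, h1]

theorem coeff_lsub (a : Matrix σ σ k) (P : MvPolynomial σ k) (β) :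
    coeff β (lsub a P) = ∑ α ∈ P.support, coeff α P * coeff β (lsub a (monomial α 1)) := by
  conv_lhs => rw [P.as_sum, map_sum, coeff_sum]
  refine sum_congr rfl fun α _ => ?_
  rw [← coeff_C_mul]
  congr 1
  rw [show C (coeff α P) = lsub a (C (coeff α P)) from (AlgHom.commutes _ _).symm, ← map_mul, C_mul_monomial, mul_one]

theorem lsub_wt' {M : Type*} [AddCommMonoid M] (a : Matrix σ σ k) (w : σ → M)
    (h : ∀ s t, a s t ≠ 0 → w s = w t) (P : MvPolynomial σ k) (m : M)
    (hP : ∀ α, coeff α P ≠ 0 → ∑ s, α s • w s = m) (β)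
    (hβ : coeff β (lsub a P) ≠ 0) : ∑ s, β s • w s = m := by
  rw [coeff_lsub] at hβ
  obtain ⟨α, hα, h1⟩ := exists_ne_zero_of_sum_ne_zero hβ
  rw [lsub_wt a w h α 1 β (right_ne_zero_of_mul h1)]
  exact hP α (mem_support_iff.1 hα)

theorem coeff_scale (c : k) (P : MvPolynomial σ k) (β) (a : Matrix σ σ k) :
    coeff β (lsub (c • a) P) = c ^ (∑ s, β s) * coeff β (lsub a P) := by
  have key : ∀ α : σ →₀ ℕ, ∀ β, coeff β (lsub (c • a) (monomial α 1)) = c ^ (∑ s, β s) * coeff β (lsub a (monomial α 1)) := by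
    intro α
    induction α using expo_ind' with
    | h0 =>
      classical
      intro β
      rw [lsub_zero_monomial, lsub_zero_monomial, coeff_monomial]
      split_ifs with h
      · subst h; simp
      · simp
    | hs α s ih =>
      intro β
      rw [coeff_lsub_succ, coeff_lsub_succ, mul_sum]
      refine sum_congr rfl fun t _ => ?_
      split_ifs with h
      · simp
      · rw [ih]
        have : ∑ s, β s = ∑ s, (β - Finsupp.single t 1 : σ →₀ ℕ) s + 1 := by
          classical
          simp only [Finsupp.tsub_apply]
          rw [← add_sum_erase _ _ (mem_univ t), ← add_sum_erase (a := t) _ _ (mem_univ t)]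
          have : ∑ x ∈ univ.erase t, (β x - (Finsupp.single t 1 : σ →₀ ℕ) x) = ∑ x ∈ univ.erase t, β x :=
            sum_congr rfl fun x hx => by simp [(ne_of_mem_erase hx).symm]
          rw [this]; simp; omega
        rw [this, pow_succ, Matrix.smul_apply, smul_eq_mul]; ring
  rw [coeff_lsub, coeff_lsub, mul_sum]
  exact sum_congr rfl fun α _ => by rw [key]; ring

theorem lsub_mem (R : Subring k) (a : Matrix σ σ k) (h : ∀ s t, a s t ∈ R) (α : σ →₀ ℕ) : ∀ β,
    coeff β (lsub a (monomial α 1)) ∈ R := by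
  classical
  induction α using expo_ind' with
  | h0 =>
    intro β; rw [lsub_zero_monomial, coeff_monomial]; split_ifs
    · exact one_mem _
    · exact zero_mem _
  | hs α s ih =>
    intro β
    rw [coeff_lsub_succ]
    refine sum_mem fun t _ => mul_mem (h _ _) ?_
    split_ifs
    · exact zero_mem _
    · exact ih _

theorem lsub_mem' (R : Subring k) (a : Matrix σ σ k) (h : ∀ s t, a s t ∈ R) (P : MvPolynomial σ k)
   (hP : ∀ α, coeff α P ∈ R) (β) : coeff β (lsub a P) ∈ R := by
  rw [coeff_lsub]
  exact sum_mem fun α _ => mul_mem (hP _) (lsub_mem R a h α β)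

end lsub

namespace PD
variable {k : Type*} [Field k] {S : Type*} [Fintype S] (D : PD k S) {σ : Type*} [Fintype σ]

theorem plf (v : S) (a : Matrix σ σ k) (ω ρ : σ → ℝ) (hω : ∀ s, 0 ≤ ω s) (hρ : ∀ s, 0 ≤ ρ s)
    (h : ∀ s t, D.f v (a s t) ≤ ω s * ρ t) (α : σ →₀ ℕ) : ∀ β,
    D.f v (coeff β (lsub a (monomial α 1))) ≤
      ((Fintype.card σ : ℝ) ^ 2) ^ (∑ s, α s) * (∏ s, ω s ^ α s) * ∏ s, ρ s ^ β s := by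
  classical
  induction α using expo_ind' with
  | h0 =>
    intro β; rw [lsub_zero_monomial, coeff_monomial]
    split_ifs with h1
    · subst h1; simp
    · rw [map_zero]; have := fun s => hρ s; simp; exact prod_nonneg fun s _ => pow_nonneg (hρ s) _
  | hs α s ih =>
    intro β
    rw [coeff_lsub_succ]
    have e1 : ∑ x, (α + Finsupp.single s 1 : σ →₀ ℕ) x = ∑ x, α x + 1 := by
      simp [sum_add_distrib]
    have e2 : ∏ x, ω x ^ (α + Finsupp.single s 1 : σ →₀ ℕ) x = (∏ x, ω x ^ α x) * ω s := by
      simp only [Finsupp.add_apply, pow_add, prod_mul_distrib]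
      congr 1
      rw [prod_eq_single s]
      · simp
      · intro x _ hx; simp [hx.symm]
      · simp
    have p1 : 0 ≤ ∏ x, ω x ^ α x := prod_nonneg fun s _ => pow_nonneg (hω s) _
    have p2 : 0 ≤ ∏ s, ρ s ^ β s := prod_nonneg fun s _ => pow_nonneg (hρ s) _
    have p3 := hω s
    refine (D.sum_le v univ _ (((Fintype.card σ : ℝ) ^ 2) ^ (∑ s, α s) * (∏ s, ω s ^ α s) * ω s * ∏ s, ρ s ^ β s) ?_).trans ?_
    · intro t _
      split_ifs with h3
      · simp; positivity
      · rw [map_mul]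
        have h5 : β = (β - Finsupp.single t 1) + Finsupp.single t 1 := by
          ext u
          by_cases hu : u = t
          · subst hu; simp; omega
          · simp [Ne.symm hu]
        have e3 : ∏ x, ρ x ^ β x = (∏ x, ρ x ^ (β - Finsupp.single t 1 : σ →₀ ℕ) x) * ρ t := by
          conv_lhs => rw [h5]
          simp only [Finsupp.add_apply, pow_add, prod_mul_distrib]
          congr 1
          rw [prod_eq_single t]
          · simp
          · intro x _ hx; simp [hx.symm]
          · simp
        rw [e3]
        calc _ ≤ (ω s * ρ t) * _ := mul_le_mul (h s t) (ih _) (D.nonneg _ _) (mul_nonneg (hω s) (hρ t))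
          _ = _ := by ring
    · rw [e1, e2, card_univ, pow_succ]
      apply le_of_eq; ring

theorem lsub_le (v : S) (a : Matrix σ σ k) (ω ρ : σ → ℝ) (hω : ∀ s, 0 ≤ ω s) (hρ : ∀ s, 0 ≤ ρ s)
    (h : ∀ s t, D.f v (a s t) ≤ ω s * ρ t) (P : MvPolynomial σ k) (B T W : ℝ) (N : ℕ) (hB : 0 ≤ B)
    (hPB : ∀ α, D.f v (coeff α P) ≤ B) (hT : (#P.support : ℝ) ≤ T) (hN : ∀ α, coeff α P ≠ 0 → ∑ s, α s = N)
    (hW0 : 0 ≤ W)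
    (hW : ∀ α, coeff α P ≠ 0 → ∏ s, ω s ^ α s ≤ W) (β) :
    D.f v (coeff β (lsub a P)) ≤ T ^ 2 * (B * (((Fintype.card σ : ℝ) ^ 2) ^ N * W * ∏ s, ρ s ^ β s)) := by
  rw [coeff_lsub]
  have p2 : 0 ≤ ∏ s, ρ s ^ β s := prod_nonneg fun s _ => pow_nonneg (hρ s) _
  refine D.sum_le' v _ _ _ _ (by positivity) hT ?_
  intro α hα
  rw [map_mul]
  have hα' := mem_support_iff.1 hα
  have h1 := D.plf v a ω ρ hω hρ h α β
  rw [hN α hα'] at h1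
  have h2 := hW α hα'
  refine mul_le_mul (hPB α) (h1.trans ?_) (D.nonneg _ _) hB
  gcongr

end PD

end

section

open Finset MvPolynomial

section cheb

theorem cheb {m : ℕ} {τ : Type*} (T : Fin m → Finset τ) (g : Fin m → τ → ℝ)
    (h0 : ∀ j, ∑ x ∈ T j, g j x = 0) (h1 : ∀ j, ∀ x ∈ T j, g j x ^ 2 ≤ 1) :
    ∑ e ∈ Fintype.piFinset T, (∑ j, g j (e j)) ^ 2 ≤ m * #(Fintype.piFinset T) := by
  classical
  have e1 : ∑ e ∈ Fintype.piFinset T, (∑ j, g j (e j)) ^ 2 =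
      ∑ j, ∑ j', ∑ e ∈ Fintype.piFinset T, g j (e j) * g j' (e j') := by
    simp_rw [sq, sum_mul_sum]
    rw [sum_comm]
    refine sum_congr rfl fun j _ => ?_
    rw [sum_comm]
  have cross : ∀ j j', j ≠ j' → ∑ e ∈ Fintype.piFinset T, g j (e j) * g j' (e j') = 0 := by
    intro j j' hj
    have := prod_univ_sum T (fun l x => (if l = j then g l x else 1) * (if l = j' then g l x else 1))
    simp only [prod_mul_distrib, prod_ite_eq', mem_univ, if_true] at this
    rw [← this]
    apply prod_eq_zero (mem_univ j)
    simp [hj, h0]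
  rw [e1]
  calc _ ≤ ∑ j : Fin m, (#(Fintype.piFinset T) : ℝ) := by
        refine sum_le_sum fun j _ => ?_
        rw [sum_eq_single j (fun j' _ hj' => cross j j' hj'.symm) (by simp)]
        calc _ ≤ ∑ e ∈ Fintype.piFinset T, (1:ℝ) := sum_le_sum fun e he => by
              rw [← sq]; exact h1 j _ (Fintype.mem_piFinset.1 he j)
          _ = _ := by simp
    _ = _ := by simp

theorem simplex_mean (n d : ℕ) (i : Fin n) :
    (n : ℝ) * ∑ a ∈ piAntidiag (univ : Finset (Fin n)) d, (a i : ℝ) = d * #(piAntidiag (univ : Finset (Fin n)) d) := by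
  classical
  have sym : ∀ i', ∑ a ∈ piAntidiag (univ : Finset (Fin n)) d, (a i' : ℝ) = ∑ a ∈ piAntidiag (univ : Finset (Fin n)) d, (a i : ℝ) := by
    intro i'
    refine sum_bij' (fun a _ => a ∘ Equiv.swap i i') (fun a _ => a ∘ Equiv.swap i i') ?_ ?_ ?_ ?_ ?_
    · intro a ha
      simp only [mem_piAntidiag, mem_univ, implies_true, and_true] at ha ⊢
      rw [← ha]; exact Equiv.sum_comp (Equiv.swap i i') a
    · intro a ha
      simp only [mem_piAntidiag, mem_univ, implies_true, and_true] at ha ⊢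
      rw [← ha]; exact Equiv.sum_comp (Equiv.swap i i') a
    · intro a _; ext x; simp
    · intro a _; ext x; simp
    · intro a _; simp
  calc _ = ∑ i' : Fin n, ∑ a ∈ piAntidiag (univ : Finset (Fin n)) d, (a i' : ℝ) := by
        rw [sum_congr rfl fun i' _ => sym i']; simp
    _ = ∑ a ∈ piAntidiag (univ : Finset (Fin n)) d, (d : ℝ) := by
        rw [sum_comm]
        refine sum_congr rfl fun a ha => ?_
        simp only [mem_piAntidiag, mem_univ, implies_true, and_true] at ha
        rw [← ha]; push_cast; rfl
    _ = _ := by simp [mul_comm]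

/-- the product of simplices -/
def splx (m n : ℕ) (d : Fin m → ℕ) : Finset (Fin m → Fin n → ℕ) :=
  Fintype.piFinset (fun j => piAntidiag (univ : Finset (Fin n)) (d j))

theorem mem_splx {m n : ℕ} {d : Fin m → ℕ} {e : Fin m → Fin n → ℕ} : e ∈ splx m n d ↔ ∀ j, ∑ i, e j i = d j := by
  simp [splx]

theorem card_splx {m n : ℕ} {d : Fin m → ℕ} (D0 : ℕ) (hd : ∀ j, d j ≤ D0) :
    #(splx m n d) ≤ (2 ^ (n * m)) ^ D0 := by
  classical
  have : splx m n d ⊆ Fintype.piFinset (fun _ => Fintype.piFinset (fun _ => range (D0 + 1))) := by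
    intro e he
    rw [mem_splx] at he
    simp only [Fintype.mem_piFinset, mem_range]
    intro j i
    have h1 : e j i ≤ ∑ i, e j i := single_le_sum (f := e j) (fun _ _ => Nat.zero_le _) (mem_univ i)
    have := he j; have := hd j
    omega
  refine (card_le_card this).trans ?_
  rw [Fintype.card_piFinset_const, Fintype.card_piFinset_const, card_range, ← pow_mul,
    ← pow_mul, mul_comm (n * m)]
  rw [pow_mul 2 D0]
  exact Nat.pow_le_pow_left (Nat.lt_two_pow_self) _

def Good (m n : ℕ) (d : Fin m → ℕ) (ε : ℝ) (e : Fin m → Fin n → ℕ) : Prop :=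
  ∀ i, |∑ j, (e j i : ℝ) / d j - m / n| ≤ ε * m

open Classical in
theorem card_bad (m n : ℕ) (d : Fin m → ℕ) (hd : ∀ j, 1 ≤ d j) (ε : ℝ) (hε : 0 < ε) (hn : 1 ≤ n) :
    ε ^ 2 * m * #{e ∈ splx m n d | ¬ Good m n d ε e} ≤ n * #(splx m n d) := by
  rcases Nat.eq_zero_or_pos m with hm | hm
  · subst hm; simp; positivity
  have hm' : (0:ℝ) < m := by exact_mod_cast hm
  have hn' : (0:ℝ) < n := by exact_mod_cast hn
  have hi : ∀ i : Fin n, (#{e ∈ splx m n d | ε * m < |∑ j, (e j i : ℝ) / d j - m / n|} : ℝ) * (ε ^ 2 * m) ≤ #(splx m n d) := by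
    intro i
    have h := cheb (fun j => piAntidiag (univ : Finset (Fin n)) (d j)) (fun j a => (a i : ℝ) / d j - 1 / n)
      (fun j => by
        have h2 := simplex_mean n (d j) i
        have h3 : (0:ℝ) < d j := by exact_mod_cast hd j
        rw [sum_sub_distrib, ← sum_div]
        simp only [sum_const, nsmul_eq_mul]
        field_simp
        linarith)
      (fun j a ha => by
        have h3 : (0:ℝ) < d j := by exact_mod_cast hd j
        simp only [mem_piAntidiag, mem_univ, implies_true, and_true] at ha
        have h4 : a i ≤ d j := by rw [← ha]; exact single_le_sum (f := a) (fun _ _ => Nat.zero_le _) (mem_univ i)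
        have h5 : (a i : ℝ) / d j ≤ 1 := by rw [div_le_one h3]; exact_mod_cast h4
        have h6 : 0 ≤ (a i : ℝ) / d j := by positivity
        have h7 : (1:ℝ) / n ≤ 1 := by rw [div_le_one hn']; exact_mod_cast hn
        have h8 : 0 ≤ (1:ℝ) / n := by positivity
        rw [sq_le_one_iff_abs_le_one, abs_le]
        constructor <;> linarith)
    have h2 : (#{e ∈ splx m n d | ε * m < |∑ j, (e j i : ℝ) / d j - m / n|} : ℝ) * (ε * m) ^ 2 ≤
        ∑ e ∈ splx m n d, (∑ j, ((e j i : ℝ) / d j - 1 / n)) ^ 2 := by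
      calc _ = ∑ e ∈ splx m n d with ε * m < |∑ j, (e j i : ℝ) / d j - m / n|, (ε * m) ^ 2 := by simp
        _ ≤ ∑ e ∈ splx m n d with ε * m < |∑ j, (e j i : ℝ) / d j - m / n|, (∑ j, ((e j i : ℝ) / d j - 1 / n)) ^ 2 := by
          refine sum_le_sum fun e he => ?_
          have h3 := (mem_filter.1 he).2
          rw [sum_sub_distrib, ← sq_abs (_ - _)]
          simp only [sum_const, card_univ, Fintype.card_fin, nsmul_eq_mul, mul_one_div]
          gcongr
        _ ≤ _ := sum_le_sum_of_subset_of_nonneg (filter_subset _ _) (fun _ _ _ => by positivity)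
    have h3 := h2.trans h
    have h4 : (#{e ∈ splx m n d | ε * m < |∑ j, (e j i : ℝ) / d j - m / n|} : ℝ) * (ε ^ 2 * m) * m ≤ #(splx m n d) * m := by
      calc _ = (#{e ∈ splx m n d | ε * m < |∑ j, (e j i : ℝ) / d j - m / n|} : ℝ) * (ε * m) ^ 2 := by ring
        _ ≤ _ := h3
        _ = _ := by rw [mul_comm]; rfl
    exact le_of_mul_le_mul_right h4 hm'
  have hsub : {e ∈ splx m n d | ¬ Good m n d ε e} ⊆ univ.biUnion (fun i : Fin n => {e ∈ splx m n d | ε * m < |∑ j, (e j i : ℝ) / d j - m / n|}) := by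
    intro e he
    simp only [mem_filter, Good, not_forall, not_le] at he
    obtain ⟨h1, i, h2⟩ := he
    simp only [mem_biUnion, mem_univ, true_and, mem_filter]
    exact ⟨i, h1, h2⟩
  have h5 : (#{e ∈ splx m n d | ¬ Good m n d ε e} : ℝ) ≤ ∑ i : Fin n, (#{e ∈ splx m n d | ε * m < |∑ j, (e j i : ℝ) / d j - m / n|} : ℝ) := by
    exact_mod_cast (card_le_card hsub).trans card_biUnion_le
  calc _ ≤ ε ^ 2 * m * ∑ i : Fin n, (#{e ∈ splx m n d | ε * m < |∑ j, (e j i : ℝ) / d j - m / n|} : ℝ) := by gcongr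
    _ = ∑ i : Fin n, (#{e ∈ splx m n d | ε * m < |∑ j, (e j i : ℝ) / d j - m / n|} : ℝ) * (ε ^ 2 * m) := by rw [mul_comm, sum_mul]
    _ ≤ ∑ i : Fin n, (#(splx m n d) : ℝ) := sum_le_sum fun i _ => hi i
    _ = _ := by simp

end cheb

section blk
variable {k : Type*} [Field k] {m n : ℕ}

def blk (Y : Fin m → Matrix (Fin n) (Fin n) k) : Matrix (Fin m × Fin n) (Fin m × Fin n) k :=
  fun s t => if s.1 = t.1 then Y s.1 s.2 t.2 else 0

theorem blk_mul (Y Z : Fin m → Matrix (Fin n) (Fin n) k) : blk Y * blk Z = blk (fun j => Y j * Z j) := by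
  ext ⟨j, i⟩ ⟨j', i'⟩
  rw [Matrix.mul_apply, Fintype.sum_prod_type, sum_eq_single j]
  · by_cases h : j = j'
    · subst h; simp [blk, Matrix.mul_apply]
    · simp [blk, h]
  · intro b _ hb; simp [blk, hb.symm]
  · simp

theorem blk_one : blk (fun _ : Fin m => (1 : Matrix (Fin n) (Fin n) k)) = 1 := by
  ext ⟨j, i⟩ ⟨j', i'⟩
  by_cases h : j = j' <;> by_cases h' : i = i' <;> simp [blk, h, h', Matrix.one_apply]

def MHom (d : Fin m → ℕ) (P : MvPolynomial (Fin m × Fin n) k) : Prop :=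
  ∀ α, coeff α P ≠ 0 → ∀ j, ∑ i, α (j, i) = d j

theorem MHom.lsub {d : Fin m → ℕ} {P : MvPolynomial (Fin m × Fin n) k} (h : MHom d P)
    (Y : Fin m → Matrix (Fin n) (Fin n) k) : MHom d (lsub (blk Y) P) := by
  intro β hβ j
  have key : ∀ α : Fin m × Fin n →₀ ℕ, ∑ s, α s • (if s.1 = j then 1 else 0) = ∑ i, α (j, i) := by
    intro α
    rw [Fintype.sum_prod_type, sum_eq_single j] <;> simp
    intro b hb; simp [hb]
  rw [← key]
  refine lsub_wt' (blk Y) (fun s => if s.1 = j then 1 else 0) ?_ P _ ?_ β hβ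
  · intro s t hst
    have : s.1 = t.1 := by
      by_contra hne; exact hst (by simp [blk, hne])
    simp [this]
  · intro α hα; rw [key]; exact h α hα j

/-- currying of exponents -/
def cur (α : Fin m × Fin n →₀ ℕ) : Fin m → Fin n → ℕ := fun j i => α (j, i)

noncomputable def unc (e : Fin m → Fin n → ℕ) : Fin m × Fin n →₀ ℕ := Finsupp.equivFunOnFinite.symm (fun s => e s.1 s.2)

theorem cur_unc (e : Fin m → Fin n → ℕ) : cur (unc e) = e := by ext; simp [cur, unc]
theorem unc_cur (e : Fin m × Fin n →₀ ℕ) : unc (cur e) = e := by ext; simp [cur, unc]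

theorem MHom.card {d : Fin m → ℕ} {P : MvPolynomial (Fin m × Fin n) k} (h : MHom d P) (D0 : ℕ) (hd : ∀ j, d j ≤ D0) :
    #P.support ≤ (2 ^ (n * m)) ^ D0 := by
  refine le_trans ?_ (card_splx (n := n) D0 hd)
  apply card_le_card_of_injOn cur
  · intro α hα; exact mem_coe.2 (mem_splx.2 (h α (mem_support_iff.1 hα)))
  · intro α _ β _ h; rw [← unc_cur α, h, unc_cur]

end blk

namespace PD
variable {k : Type*} [Field k] {S : Type*} [Fintype S] (D : PD k S)

theorem siegel' : ∃ c : ℕ, 1 ≤ c ∧ ∀ (ι : Type*) (κ : Type) [Fintype ι] [Fintype κ] (M : Matrix ι κ k) (H : ℝ), 1 ≤ H → 0 < Fintype.card κ →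
    2 * Fintype.card ι ≤ Fintype.card κ → (∀ i j, M i j ∈ D.O) → (∀ v i j, D.f v (M i j) ≤ H) →
      ∃ ξ : κ → k, ξ ≠ 0 ∧ (∀ j, ξ j ∈ D.O) ∧ M.mulVec ξ = 0 ∧
        ∀ v j, D.f v (ξ j) ≤ (c * Fintype.card κ * H) ^ c := by
  obtain ⟨c, hc, h⟩ := D.siegel
  refine ⟨c, hc, ?_⟩
  intro ι κ _ _ M H hH h0 h2 hO hB
  obtain ⟨ξ, h3, h4, h5, h6⟩ := h _ _ (M.submatrix (Fintype.equivFin ι).symm (Fintype.equivFin κ).symm) H hH h0 h2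
    (fun i j => hO _ _) (fun v i j => hB _ _ _)
  refine ⟨ξ ∘ Fintype.equivFin κ, ?_, fun j => h4 _, ?_, fun v j => h6 _ _⟩
  · intro h; apply h3; ext i
    have := congrFun h ((Fintype.equivFin κ).symm i)
    simpa using this
  · ext i
    have := congrFun h5 (Fintype.equivFin ι i)
    rw [Matrix.submatrix_mulVec_equiv] at this
    simpa using this

theorem den_all {ι : Type*} (s : Finset ι) (a : ι → k) : ∃ c ∈ D.O, c ≠ 0 ∧ ∀ i ∈ s, c * a i ∈ D.O := by
  classical
  induction s using Finset.induction_on with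
  | empty => exact ⟨1, one_mem _, one_ne_zero, by simp⟩
  | insert i s hi ih =>
    obtain ⟨c, hc, hc0, h⟩ := ih
    obtain ⟨b, hb, hb0, h'⟩ := D.den (a i)
    refine ⟨b * c, mul_mem hb hc, mul_ne_zero hb0 hc0, ?_⟩
    intro j hj
    rcases mem_insert.1 hj with rfl | hj
    · rw [mul_right_comm]; exact mul_mem h' hc
    · rw [mul_assoc]; exact mul_mem hb (h j hj)

theorem bdd_all {ι : Type*} [Fintype ι] (a : ι → k) : ∃ H : ℕ, 1 ≤ H ∧ ∀ v i, D.f v (a i) ≤ H := by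
  obtain ⟨H, hH⟩ := exists_nat_ge (∑ v, ∑ i, D.f v (a i))
  refine ⟨H + 1, by omega, fun v i => ?_⟩
  have h1 : D.f v (a i) ≤ ∑ i, D.f v (a i) := single_le_sum (f := fun i => D.f v (a i)) (fun _ _ => D.nonneg _ _) (mem_univ i)
  have h2 : ∑ i, D.f v (a i) ≤ ∑ v, ∑ i, D.f v (a i) :=
    single_le_sum (f := fun v => ∑ i, D.f v (a i)) (fun _ _ => sum_nonneg fun _ _ => D.nonneg _ _) (mem_univ v)
  push_cast; linarith

/-- The auxiliary polynomial. -/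
theorem auxPoly (m n : ℕ) (hn : 1 ≤ n) (L : S → Matrix (Fin n) (Fin n) k) (ε : ℝ) (hε : 0 < ε)
    (hm : 2 * (Fintype.card S : ℝ) * n ≤ ε ^ 2 * m) : ∃ C : ℕ, 1 ≤ C ∧ ∀ (d : Fin m → ℕ) (D0 : ℕ),
      (∀ j, 1 ≤ d j) → (∀ j, d j ≤ D0) → 1 ≤ D0 →
      ∃ P : MvPolynomial (Fin m × Fin n) k, P ≠ 0 ∧ MHom d P ∧ (∀ α, coeff α P ∈ D.O) ∧
        (∀ v α, D.f v (coeff α P) ≤ (C:ℝ) ^ D0) ∧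
        ∀ v α, coeff α (lsub (blk fun _ => L v) P) ≠ 0 → Good m n d ε (cur α) := by
  classical
  obtain ⟨c, hc, hc0, hcO⟩ := D.den_all (univ : Finset (S × Fin n × Fin n)) (fun x => L x.1 x.2.1 x.2.2)
  obtain ⟨H, hH, hHb⟩ := D.bdd_all (fun x : S × Fin n × Fin n => c * L x.1 x.2.1 x.2.2)
  obtain ⟨c1, hc1, sg⟩ := D.siegel'
  set G : ℕ := ((m * n) ^ 2 + 1) ^ m * H ^ m with hG
  have hG1 : 1 ≤ G := Nat.one_le_iff_ne_zero.2 (by positivity)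
  refine ⟨(c1 * 2 ^ (n * m) * G) ^ c1, Nat.one_le_iff_ne_zero.2 (by positivity), ?_⟩
  intro d D0 hd1 hdD hD0
  set T := splx m n d with hT
  set Bad := {e ∈ T | ¬ Good m n d ε e} with hBad
  have hTpos : 0 < Fintype.card T := by
    rw [Fintype.card_coe, card_pos]
    refine ⟨fun j i => if i = ⟨0, hn⟩ then d j else 0, mem_splx.2 fun j => by simp⟩
  -- matrix
  set Mx : Matrix (S × Bad) T k := fun x e => coeff (unc x.2.1) (lsub (blk fun _ => c • L x.1) (monomial (unc e.1) 1)) with hMx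
  have hentryO : ∀ v (s t : Fin m × Fin n), (blk fun _ => c • L v) s t ∈ D.O := by
    intro v s t
    unfold blk
    split_ifs
    · exact hcO (v, s.2, t.2) (mem_univ _)
    · exact zero_mem _
  have hdeg : ∀ e ∈ T, ∑ s, (unc e : Fin m × Fin n →₀ ℕ) s = ∑ j, d j := by
    intro e he
    rw [Fintype.sum_prod_type]
    exact sum_congr rfl fun j _ => mem_splx.1 he j
  have hsumd : ∑ j, d j ≤ m * D0 := by
    calc _ ≤ ∑ j : Fin m, D0 := sum_le_sum fun j _ => hdD j
      _ = _ := by simp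
  have hH' : (1:ℝ) ≤ H := by exact_mod_cast hH
  have hMB : ∀ v x e, D.f v (Mx x e) ≤ (G:ℝ) ^ D0 := by
    intro v x e
    have h1 := D.plf v (blk fun _ : Fin m => c • L x.1) (fun _ => H) (fun _ => 1) (fun _ => by linarith) (fun _ => zero_le_one)
      (fun s t => by
        unfold blk
        split_ifs
        · simpa using hHb v (x.1, s.2, t.2)
        · simp) (unc e.1) (unc x.2.1)
    refine h1.trans ?_
    rw [prod_pow_eq_pow_sum, hdeg _ e.2]
    simp only [one_pow, prod_const_one, mul_one, Fintype.card_prod, Fintype.card_fin]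
    have h2 : (((m * n : ℕ) : ℝ) ^ 2) ≤ ((m * n) ^ 2 + 1 : ℕ) := by push_cast; linarith
    have h3 : (1:ℝ) ≤ ((m * n) ^ 2 + 1 : ℕ) := by exact_mod_cast Nat.le_add_left 1 _
    calc _ ≤ (((m * n) ^ 2 + 1 : ℕ) : ℝ) ^ (m * D0) * (H:ℝ) ^ (m * D0) := by
          gcongr
          refine (pow_le_pow_left₀ (by positivity) h2 _).trans (pow_le_pow_right₀ h3 hsumd)
      _ = _ := by rw [hG]; push_cast; rw [mul_pow _ ((H:ℝ) ^ m), ← pow_mul, ← pow_mul]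
  have hG1' : (1:ℝ) ≤ G := by exact_mod_cast hG1
  have hcard : 2 * Fintype.card (S × Bad) ≤ Fintype.card T := by
    have h1 := card_bad m n d hd1 ε hε hn
    rw [Fintype.card_prod, Fintype.card_coe, Fintype.card_coe]
    rcases Nat.eq_zero_or_pos (Fintype.card S) with h0 | h0
    · rw [h0]; simp
    have hS : (1:ℝ) ≤ Fintype.card S := by exact_mod_cast h0
    have hn' : (1:ℝ) ≤ n := by exact_mod_cast hn
    have hpos : 0 < ε ^ 2 * m := by nlinarith
    have h2 : (2 * (Fintype.card S * #Bad) : ℝ) * (ε ^ 2 * m) ≤ #T * (ε ^ 2 * m) := by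
      calc _ = 2 * Fintype.card S * (ε ^ 2 * m * #Bad) := by ring
        _ ≤ 2 * Fintype.card S * (n * #T) := by gcongr
        _ = #T * (2 * Fintype.card S * n) := by ring
        _ ≤ _ := by gcongr
    exact_mod_cast le_of_mul_le_mul_right h2 hpos
  obtain ⟨ξ, hξ0, hξO, hξM, hξB⟩ := sg (S × Bad) T Mx ((G:ℝ) ^ D0) (one_le_pow₀ hG1') hTpos hcard
    (fun x e => lsub_mem D.O _ (hentryO x.1) _ _) hMB
  set P : MvPolynomial (Fin m × Fin n) k := ∑ e : T, monomial (unc e.1) (ξ e) with hP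
  have hcoef : ∀ e : T, coeff (unc e.1) P = ξ e := by
    intro e
    rw [hP, coeff_sum, sum_eq_single e]
    · simp
    · intro b _ hb
      rw [coeff_monomial, if_neg]
      intro h; apply hb; ext1; rw [← cur_unc b.1, h, cur_unc]
    · simp
  have hcoef0 : ∀ α, cur α ∉ T → coeff α P = 0 := by
    intro α hα
    rw [hP, coeff_sum]
    refine sum_eq_zero fun b _ => ?_
    rw [coeff_monomial, if_neg]
    rintro rfl; apply hα; rw [cur_unc]; exact b.2
  have hcoef' : ∀ α, coeff α P = 0 ∨ ∃ e, coeff α P = ξ e := by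
    intro α
    by_cases h : cur α ∈ T
    · right; refine ⟨⟨cur α, h⟩, ?_⟩
      rw [← hcoef]; simp [unc_cur]
    · exact Or.inl (hcoef0 α h)
  have hMH : MHom d P := by
    intro α hα
    have : cur α ∈ T := by by_contra h; exact hα (hcoef0 α h)
    exact mem_splx.1 this
  refine ⟨P, ?_, hMH, ?_, ?_, ?_⟩
  · intro h; apply hξ0; ext e
    rw [← hcoef, h]; simp
  · intro α; rcases hcoef' α with h | ⟨e, h⟩ <;> rw [h]
    · exact zero_mem _
    · exact hξO e
  · intro v α; rcases hcoef' α with h | ⟨e, h⟩ <;> rw [h]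
    · rw [map_zero]; positivity
    · refine (hξB v e).trans ?_
      have h1 : (Fintype.card T : ℝ) ≤ (2 ^ (n * m)) ^ D0 := by
        rw [Fintype.card_coe]; exact_mod_cast card_splx D0 hdD
      have h2 : (c1:ℝ) ≤ (c1:ℝ) ^ D0 := le_self_pow₀ (by exact_mod_cast hc1) (by omega)
      calc ((c1:ℝ) * Fintype.card T * (G:ℝ) ^ D0) ^ c1 ≤ ((c1:ℝ) ^ D0 * (2 ^ (n * m)) ^ D0 * (G:ℝ) ^ D0) ^ c1 := by gcongr
        _ = _ := by push_cast; rw [← mul_pow, ← mul_pow]; exact pow_right_comm _ _ _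
  · intro v α hα
    by_contra hbad
    have hcur : cur α ∈ T := mem_splx.2 (hMH.lsub _ α hα)
    have hmem : cur α ∈ Bad := mem_filter.2 ⟨hcur, hbad⟩
    have h1 := congrFun hξM (v, ⟨cur α, hmem⟩)
    have h2 : coeff α (lsub (blk fun _ => c • L v) P) = 0 := by
      rw [hP, map_sum, coeff_sum]
      rw [Matrix.mulVec, dotProduct] at h1
      rw [Pi.zero_apply] at h1
      rw [← h1]
      refine sum_congr rfl fun e _ => ?_
      rw [hMx]; simp only
      rw [unc_cur, mul_comm, ← coeff_C_mul]
      congr 1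
      rw [show C (ξ e) = lsub (blk fun _ => c • L v) (C (ξ e)) from (AlgHom.commutes _ _).symm, ← map_mul, C_mul_monomial, mul_one]
    have h3 : (blk fun _ : Fin m => c • L v) = c • (blk fun _ : Fin m => L v) := by
      ext s t; by_cases h : s.1 = t.1 <;> simp [blk, h]
    rw [h3, coeff_scale] at h2
    exact (mul_ne_zero (pow_ne_zero _ hc0) hα) h2

end PD

end

section

open Finset MvPolynomial

section strip
variable {k : Type*} [Field k] {σ : Type*} [Fintype σ]

theorem lsub_low (a a0 : Matrix σ σ k) (w : σ → ℕ)
    (h : ∀ s t, a s t ≠ 0 → w s ≤ w t) (h0 : ∀ s t, a0 s t = if w s = w t then a s t else 0) (α : σ →₀ ℕ) : ∀ β,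
    (∑ s, β s * w s < ∑ s, α s * w s → coeff β (lsub a (monomial α 1)) = 0) ∧
    (∑ s, β s * w s ≤ ∑ s, α s * w s → coeff β (lsub a (monomial α 1)) = coeff β (lsub a0 (monomial α 1))) := by
  classical
  induction α using expo_ind' with
  | h0 =>
    intro β
    rw [lsub_zero_monomial, lsub_zero_monomial]
    simp
  | hs α s ih =>
    intro β
    rw [coeff_lsub_succ, coeff_lsub_succ]
    have aux : ∀ (γ : σ →₀ ℕ) (u : σ), ∑ s, (γ + Finsupp.single u 1 : σ →₀ ℕ) s * w s = ∑ s, γ s * w s + w u := by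
      intro γ u
      simp only [Finsupp.add_apply, add_mul, sum_add_distrib]
      congr 1
      rw [sum_eq_single u]
      · simp
      · intro x _ hx; simp [hx.symm]
      · simp
    rw [aux]
    have aux2 : ∀ t, β t ≠ 0 → ∑ s, β s * w s = ∑ s, (β - Finsupp.single t 1 : σ →₀ ℕ) s * w s + w t := by
      intro t ht
      rw [← aux]
      congr 1
      ext u
      congr 1
      by_cases hu : u = t
      · subst hu; simp; omega
      · simp [Ne.symm hu]
    constructor
    · intro hlt
      refine sum_eq_zero fun t _ => ?_
      by_cases ha : a s t = 0
      · simp [ha]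
      have := h s t ha
      split_ifs with h3
      · simp
      · rw [aux2 t h3] at hlt
        rw [(ih _).1 (by omega), mul_zero]
    · intro hle
      refine sum_congr rfl fun t _ => ?_
      by_cases ha : a s t = 0
      · have : a0 s t = 0 := by rw [h0]; simp [ha]
        simp [ha, this]
      have hst := h s t ha
      split_ifs with h3
      · simp
      rw [aux2 t h3] at hle
      by_cases hw : w s = w t
      · rw [h0, if_pos hw, (ih _).2 (by omega)]
      · rw [(ih _).1 (by omega), h0, if_neg hw]; simp

theorem lsub_ge (a : Matrix σ σ k) (s0 : σ) (h : ∀ t, t ≠ s0 → a s0 t = 0) (α : σ →₀ ℕ) : ∀ β,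
    coeff β (lsub a (monomial α 1)) ≠ 0 → α s0 ≤ β s0 := by
  classical
  induction α using expo_ind' with
  | h0 => intro β _; simp
  | hs α s ih =>
    intro β hβ
    rw [coeff_lsub_succ] at hβ
    obtain ⟨t, _, ht⟩ := exists_ne_zero_of_sum_ne_zero hβ
    have h1 := left_ne_zero_of_mul ht
    have h2 := right_ne_zero_of_mul ht
    split_ifs at h2 with h3
    · exact absurd rfl h2
    have := ih _ h2
    by_cases hs : s = s0
    · subst hs
      have : t = s := by by_contra hne; exact h1 (h t hne)
      subst this
      simp at this ⊢
      omega
    · simp [hs] at this ⊢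
      omega

variable {m n : ℕ}

/-- substitution matrix replacing the coordinate `a` -/
def thM (a : Fin n) (r : Fin n → k) : Matrix (Fin n) (Fin n) k :=
  fun i l => if i = a then (if l = a then 1 else r l) else (if i = l then 1 else 0)

noncomputable def phA (a : Fin n) : MvPolynomial (Fin m × Fin n) k →ₐ[k] MvPolynomial (Fin m) k :=
  aeval (fun s => if s.2 = a then X s.1 else 1)

noncomputable def eA (a : Fin n) (α : Fin m × Fin n →₀ ℕ) : Fin m →₀ ℕ := Finsupp.equivFunOnFinite.symm (fun j => α (j, a))

theorem phA_monomial (a : Fin n) (α : Fin m × Fin n →₀ ℕ) (c : k) :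
    phA a (monomial α c) = monomial (eA a α) c := by
  rw [phA, aeval_monomial, Finsupp.prod_fintype _ _ (by simp), Fintype.prod_prod_type, monomial_eq,
    Finsupp.prod_fintype _ _ (by simp)]
  congr 1
  refine prod_congr rfl fun j _ => ?_
  rw [prod_eq_single a]
  · simp [eA]
  · intro i _ hi; simp [hi]
  · simp

theorem phA_tr (a b : Fin n) (hab : a ≠ b) (ξ : Fin m → k) (P : MvPolynomial (Fin m × Fin n) k) :
    phA a (lsub (blk fun j => thM a (fun l => if l = b then ξ j else 0)) P) = tr ξ (phA a P) := by
  have : (phA a).comp (lsub (blk fun j => thM a (fun l => if l = b then ξ j else 0))) = (tr ξ).comp (phA a) := by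
    ext1 ⟨j, i⟩
    rw [AlgHom.comp_apply, AlgHom.comp_apply, lsub_X, map_sum, Fintype.sum_prod_type, sum_eq_single j]
    · by_cases hi : i = a
      · subst hi
        have : ∀ l, phA i (C (blk (fun j => thM i (fun l => if l = b then ξ j else 0)) (j, i) (j, l)) * X (j, l))
            = if l = i then (X j : MvPolynomial (Fin m) k) else (if l = b then C (ξ j) else 0) := by
          intro l
          by_cases h1 : l = i
          · subst h1; simp [blk, thM, phA]
          · by_cases h2 : l = b
            · subst h2; simp [blk, thM, phA, h1, algebraMap_eq]
            · simp [blk, thM, phA, h1, h2]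
        simp_rw [this]
        rw [← add_sum_erase _ _ (mem_univ i)]
        have e2 : ∑ x ∈ univ.erase i, (if x = i then (X j : MvPolynomial (Fin m) k) else (if x = b then C (ξ j) else 0))
            = ∑ x ∈ univ.erase i, (if x = b then C (ξ j) else 0) :=
          sum_congr rfl fun x hx => by rw [if_neg (ne_of_mem_erase hx)]
        rw [e2]
        simp [phA, tr, Ne.symm hab]
      · rw [sum_eq_single i]
        · simp [blk, thM, phA, hi]
        · intro l _ hl; simp [blk, thM, hi, hl.symm]
        · simp
    · intro j' _ hj
      refine sum_eq_zero fun l _ => ?_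
      simp [blk, hj.symm]
    · simp
  exact congrFun (congrArg DFunLike.coe this) P

set_option maxHeartbeats 1000000 in
theorem strip (P : MvPolynomial (Fin m × Fin n) k) (hP : P ≠ 0) (d : Fin m → ℕ) (hd : MHom d P) (a b : Fin n) (hab : a ≠ b)
    (r : Fin m → Fin n → k) : ∃ G : MvPolynomial (Fin m) k, G ≠ 0 ∧ (∀ e, coeff e G = 0 ∨ ∃ α, coeff e G = coeff α P) ∧
      (∀ e, coeff e G ≠ 0 → ∀ j, e j ≤ d j) ∧
      ∀ e, coeff e (tr (fun j => r j b) G) ≠ 0 → ∃ γ, coeff γ (lsub (blk fun j => thM a (r j)) P) ≠ 0 ∧ ∀ j, γ (j, a) = e j := by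
  classical
  set w : Fin m × Fin n → ℕ := fun s => if s.2 = a ∨ s.2 = b then 0 else 1 with hw
  obtain ⟨α0, hα0, hmin⟩ := exists_min_image P.support (fun α => ∑ s, α s * w s) (support_nonempty.2 hP)
  set W : Fin m × Fin n → (Fin m × Fin n →₀ ℕ) := fun s => if s.2 = a ∨ s.2 = b then 0 else Finsupp.single s 1 with hW
  have hWs : ∀ (α : Fin m × Fin n →₀ ℕ) t, (∑ s, α s • W s) t = α t * w t := by
    intro α t
    rw [Finsupp.finset_sum_apply, sum_eq_single t]
    · simp only [hW, hw]; split_ifs <;> simp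
    · intro s _ hs; simp only [hW]; split_ifs <;> simp [hs]
    · simp
  set F := {α ∈ P.support | ∑ s, α s • W s = ∑ s, α0 s • W s} with hF
  set P0 : MvPolynomial (Fin m × Fin n) k := ∑ α ∈ F, monomial α (coeff α P) with hP0
  have hcP0 : ∀ α, coeff α P0 = if α ∈ F then coeff α P else 0 := by
    intro α
    rw [hP0, coeff_sum]
    simp [coeff_monomial]
  have hinj : ∀ α ∈ F, ∀ β ∈ F, eA a α = eA a β → α = β := by
    intro α hα β hβ he
    have h1 : ∀ s, α s * w s = β s * w s := by
      intro s
      rw [← hWs, ← hWs, (mem_filter.1 hα).2, (mem_filter.1 hβ).2]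
    have ha : ∀ j, α (j, a) = β (j, a) := fun j => by
      have := DFunLike.congr_fun he j
      simpa [eA] using this
    have hr : ∀ j i, i ≠ b → α (j, i) = β (j, i) := by
      intro j i hi
      by_cases hia : i = a
      · subst hia; exact ha j
      · have := h1 (j, i); simpa [hw, hi, hia] using this
    ext ⟨j, i⟩
    by_cases hi : i = b
    · subst hi
      have e1 := hd α (mem_support_iff.1 (mem_filter.1 hα).1) j
      have e2 := hd β (mem_support_iff.1 (mem_filter.1 hβ).1) j
      rw [← add_sum_erase _ _ (mem_univ i)] at e1 e2
      rw [sum_congr rfl fun x hx => hr j x (ne_of_mem_erase hx)] at e1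
      omega
    · exact hr j i hi
  have hG : phA a P0 = ∑ α ∈ F, monomial (eA a α) (coeff α P) := by
    rw [hP0, map_sum]; exact sum_congr rfl fun α _ => phA_monomial a α _
  have hGc : ∀ α ∈ F, coeff (eA a α) (phA a P0) = coeff α P := by
    intro α hα
    rw [hG, coeff_sum, sum_eq_single α]
    · simp
    · intro β hβ hne
      rw [coeff_monomial, if_neg]
      intro h; exact hne (hinj β hβ α hα h)
    · intro h; exact absurd hα h
  have hGc' : ∀ e, coeff e (phA a P0) ≠ 0 → ∃ α ∈ F, eA a α = e := by
    intro e he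
    rw [hG, coeff_sum] at he
    obtain ⟨α, hα, h⟩ := exists_ne_zero_of_sum_ne_zero he
    refine ⟨α, hα, ?_⟩
    rw [coeff_monomial] at h
    by_contra hne; rw [if_neg hne] at h; exact h rfl
  have hα0F : α0 ∈ F := mem_filter.2 ⟨hα0, rfl⟩
  refine ⟨phA a P0, ?_, ?_, ?_, ?_⟩
  · intro h
    have := hGc α0 hα0F
    rw [h] at this
    exact mem_support_iff.1 hα0 (by simpa using this.symm)
  · intro e
    by_cases he : coeff e (phA a P0) = 0
    · exact Or.inl he
    · obtain ⟨α, hα, rfl⟩ := hGc' e he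
      exact Or.inr ⟨α, hGc α hα⟩
  · intro e he j
    obtain ⟨α, hα, rfl⟩ := hGc' e he
    have := hd α (mem_support_iff.1 (mem_filter.1 hα).1) j
    rw [← this]
    exact single_le_sum (f := fun i => α (j, i)) (fun _ _ => Nat.zero_le _) (mem_univ a)
  · intro e he
    rw [← phA_tr a b hab] at he
    set T0 := (blk fun j => thM a (fun l => if l = b then r j b else 0)) with hT0
    have : ∃ γ, coeff γ (lsub T0 P0) ≠ 0 ∧ eA a γ = e := by
      rw [(lsub T0 P0).as_sum, map_sum, coeff_sum] at he
      obtain ⟨γ, hγ, h⟩ := exists_ne_zero_of_sum_ne_zero he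
      rw [phA_monomial, coeff_monomial] at h
      refine ⟨γ, mem_support_iff.1 hγ, ?_⟩
      by_contra hne; rw [if_neg hne] at h; exact h rfl
    obtain ⟨γ, hγ, hγe⟩ := this
    refine ⟨γ, ?_, fun j => by rw [← hγe]; simp [eA]⟩
    have hT0W : ∀ s t, T0 s t ≠ 0 → W s = W t := by
      rintro ⟨j, i⟩ ⟨j', i'⟩ hst
      rw [hT0] at hst
      simp only [blk, thM] at hst
      have hjj : j = j' := by by_contra h; simp [h] at hst
      subst hjj
      simp only [if_true] at hst
      simp only [hW]
      by_cases h1 : i = a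
      · by_cases h2 : i' = a
        · simp [h1, h2]
        · by_cases h3 : i' = b
          · simp [h1, h3]
          · simp [h1, h2, h3] at hst
      · by_cases h2 : i = i'
        · rw [h2]
        · simp [h1, h2] at hst
    have hγW : ∑ s, γ s • W s = ∑ s, α0 s • W s := by
      refine lsub_wt' T0 W hT0W P0 _ ?_ γ hγ
      intro α hα
      rw [hcP0] at hα
      split_ifs at hα with h
      · exact (mem_filter.1 h).2
      · exact absurd rfl hα
    have hγw : ∑ s, γ s * w s = ∑ s, α0 s * w s := by
      refine sum_congr rfl fun s _ => ?_
      rw [← hWs, ← hWs, hγW]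
    have e1 : coeff γ (lsub T0 P0) = coeff γ (lsub T0 P) := by
      rw [hP0, map_sum, coeff_sum, coeff_lsub T0 P, hF, sum_filter]
      refine sum_congr rfl fun α hα => ?_
      have e3 : coeff γ (lsub T0 (monomial α (coeff α P))) = coeff α P * coeff γ (lsub T0 (monomial α 1)) := by
        rw [← coeff_C_mul]
        congr 1
        rw [show C (coeff α P) = lsub T0 (C (coeff α P)) from (AlgHom.commutes _ _).symm, ← map_mul, C_mul_monomial, mul_one]
      rw [e3]
      split_ifs with h
      · rfl
      · by_contra hne
        have := lsub_wt T0 W hT0W α 1 γ (right_ne_zero_of_mul (Ne.symm hne))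
        exact h (this.symm.trans hγW)
    have e2 : coeff γ (lsub (blk fun j => thM a (r j)) P) = coeff γ (lsub T0 P) := by
      rw [coeff_lsub, coeff_lsub]
      refine sum_congr rfl fun α hα => ?_
      have hfin : ∑ s, γ s * w s ≤ ∑ s, α s * w s := by rw [hγw]; exact hmin α hα
      have hlow := fun h1 h2 => (lsub_low (blk fun j => thM a (r j)) T0 w h1 h2 α γ).2 hfin
      rw [hlow]
      · rintro ⟨j, i⟩ ⟨j', i'⟩ hst
        simp only [blk, thM] at hst
        have hjj : j = j' := by by_contra h; simp [h] at hst
        subst hjj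
        simp only [if_true] at hst
        simp only [hw]
        by_cases h1 : i = a
        · simp [h1]
        · by_cases h2 : i = i'
          · rw [h2]
          · simp [h1, h2] at hst
      · rintro ⟨j, i⟩ ⟨j', i'⟩
        rw [hT0]
        simp only [blk, thM, hw]
        by_cases hjj : j = j'
        · subst hjj
          by_cases h1 : i = a
          · by_cases h2 : i' = a
            · simp [h1, h2]
            · by_cases h3 : i' = b
              · simp [h1, h3]
              · simp [h1, h2, h3]
          · by_cases h2 : i = i'
            · subst h2; simp [h1]
            · simp [h1, h2]
        · simp [hjj]
    rw [e2, ← e1]; exact hγ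

end strip

end

section

open Finset MvPolynomial

section
variable {k : Type*} [Field k] {n : ℕ}

theorem rowA (Y : Matrix (Fin n) (Fin n) k) (hY : Y.det ≠ 0) (a : Fin n) (hYa : ∀ i, Y i a = if i = a then 1 else 0)
    (p : Fin n → k) (hp : p a ≠ 0) (hpY : ∀ l, l ≠ a → ∑ i, p i * Y i l = 0) (l : Fin n) (hl : l ≠ a) :
    (Y⁻¹ * thM a (fun i => - p i / p a)) a l = 0 := by
  have hz : ∀ i, Y⁻¹ a i = p i / p a := by
    have h1 : Matrix.vecMul (fun i => p i / p a) Y = Pi.single a 1 := by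
      ext l
      rw [Matrix.vecMul, dotProduct]
      by_cases h : l = a
      · subst h
        rw [sum_eq_single l]
        · simp [hYa, hp]
        · intro i _ hi; simp [hYa, hi]
        · simp
      · rw [Pi.single_eq_of_ne h]
        have := hpY l h
        simp_rw [div_mul_eq_mul_div]
        rw [← sum_div, this, zero_div]
    have h2 : Matrix.vecMul (Matrix.vecMul (fun i => p i / p a) Y) Y⁻¹ = Matrix.vecMul (Pi.single a 1) Y⁻¹ := by rw [h1]
    rw [Matrix.vecMul_vecMul, Matrix.mul_nonsing_inv _ (isUnit_iff_ne_zero.2 hY), Matrix.vecMul_one] at h2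
    intro i
    have := congrFun h2 i
    rw [this]; simp
  rw [Matrix.mul_apply]
  simp_rw [hz]
  have : ∀ i, p i / p a * thM a (fun i => - p i / p a) i l = (if i = a then - p l / p a else 0) + (if i = l then p l / p a else 0) := by
    intro i
    by_cases h : i = a
    · subst h; simp [thM, hl, Ne.symm hl, hp]
    · by_cases h' : i = l
      · subst h'; simp [thM, h]
      · simp [thM, h, h']
  simp_rw [this, sum_add_distrib]
  simp; ring

theorem Wbound (m n : ℕ) (hn : 1 ≤ n) (c : Fin n → ℝ) (ε Δ : ℝ) (hε : 0 < ε) (hε1 : ε ≤ 1) (hΔ : 0 < Δ) (ℓ : Fin m → ℝ)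
    (d : Fin m → ℕ) (hd : ∀ j, 1 ≤ d j)
    (hu1 : ∀ j, Δ ≤ d j * ℓ j) (hu2 : ∀ j, d j * ℓ j ≤ (1 + ε) * Δ) (w : Fin m → Fin n → ℝ)
    (hw : ∀ j i, 0 ≤ w j i ∧ w j i ≤ Real.exp ((c i + ε) * ℓ j)) (e : Fin m → Fin n → ℕ) (hed : ∀ j, ∑ i, e j i = d j)
    (hg : Good m n d ε e) :
    ∏ j, ∏ i, w j i ^ e j i ≤ Real.exp (Δ * m * ((∑ i, c i) / n + 2 * ε * (∑ i, |c i| + 1))) := by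
  calc ∏ j, ∏ i, w j i ^ e j i ≤ ∏ j, ∏ i, Real.exp ((c i + ε) * ℓ j) ^ e j i := by
        refine prod_le_prod (fun j _ => prod_nonneg fun i _ => pow_nonneg (hw j i).1 _) fun j _ => ?_
        refine prod_le_prod (fun i _ => pow_nonneg (hw j i).1 _) fun i _ => ?_
        exact pow_le_pow_left₀ (hw j i).1 (hw j i).2 _
    _ = Real.exp (∑ j, ∑ i, (e j i : ℝ) * ((c i + ε) * ℓ j)) := by
        rw [Real.exp_sum]
        refine prod_congr rfl fun j _ => ?_
        rw [Real.exp_sum]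
        refine prod_congr rfl fun i _ => ?_
        rw [Real.exp_nat_mul]
    _ ≤ _ := by
        apply Real.exp_le_exp.2
        have hd' : ∀ j, (0:ℝ) < d j := fun j => by exact_mod_cast hd j
        set t : Fin m → Fin n → ℝ := fun j i => (e j i : ℝ) / d j with ht
        have ht0 : ∀ j i, 0 ≤ t j i := fun j i => by rw [ht]; positivity
        have ht1 : ∀ j, ∑ i, t j i = 1 := by
          intro j
          rw [ht]; simp only
          rw [← sum_div, div_eq_one_iff_eq (hd' j).ne']
          rw [← hed j]; push_cast; rfl
        have hte : ∀ j i, (e j i : ℝ) = t j i * d j := fun j i => by rw [ht]; field_simp [(hd' j).ne']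
        have ht1' : ∀ j i, t j i ≤ 1 := fun j i => by
          rw [← ht1 j]; exact single_le_sum (f := t j) (fun i _ => ht0 j i) (mem_univ i)
        have step1 : ∀ j i, (e j i : ℝ) * ((c i + ε) * ℓ j) ≤ c i * Δ * t j i + |c i| * ε * Δ + t j i * (2 * ε * Δ) := by
          intro j i
          rw [hte j i]
          have h1 := hu1 j
          have h2 := hu2 j
          have h3 : t j i * d j * ((c i + ε) * ℓ j) = c i * t j i * Δ + (c i * t j i) * (d j * ℓ j - Δ) + t j i * ε * (d j * ℓ j) := by ring
          rw [h3]
          have h4 : (c i * t j i) * (d j * ℓ j - Δ) ≤ |c i| * ε * Δ := by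
            calc (c i * t j i) * (d j * ℓ j - Δ) ≤ |c i| * 1 * (d j * ℓ j - Δ) := by
                  apply mul_le_mul_of_nonneg_right _ (by linarith)
                  exact mul_le_mul (le_abs_self _) (ht1' j i) (ht0 j i) (abs_nonneg _)
              _ ≤ |c i| * 1 * (ε * Δ) := by
                  apply mul_le_mul_of_nonneg_left (by linarith) (by positivity)
              _ = _ := by ring
          have h5 : t j i * ε * (d j * ℓ j) ≤ t j i * (2 * ε * Δ) := by
            have := ht0 j i
            calc t j i * ε * (d j * ℓ j) ≤ t j i * ε * (2 * Δ) :=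
                  mul_le_mul_of_nonneg_left (by nlinarith) (by positivity)
              _ = _ := by ring
          linarith
        calc _ ≤ ∑ j, ∑ i, (c i * Δ * t j i + |c i| * ε * Δ + t j i * (2 * ε * Δ)) :=
              sum_le_sum fun j _ => sum_le_sum fun i _ => step1 j i
          _ = ∑ i, c i * Δ * (∑ j, t j i) + m * (∑ i, |c i|) * ε * Δ + m * (2 * ε * Δ) := by
              simp_rw [sum_add_distrib]
              congr 1
              · congr 1
                · rw [sum_comm]; simp_rw [mul_sum]
                · simp [← sum_mul, mul_assoc]
              · simp_rw [← sum_mul, ht1]; simp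
          _ ≤ ∑ i, (c i * Δ * (m / n) + |c i| * Δ * (ε * m)) + m * (∑ i, |c i|) * ε * Δ + m * (2 * ε * Δ) := by
              gcongr with i
              have := hg i
              have h6 : c i * Δ * (∑ j, t j i) = c i * Δ * (m / n) + c i * Δ * (∑ j, t j i - m / n) := by ring
              rw [h6]
              have h7 : c i * Δ * (∑ j, t j i - m / n) ≤ |c i| * Δ * (ε * m) := by
               calc c i * Δ * (∑ j, t j i - m / n) ≤ |c i * Δ * (∑ j, t j i - m / n)| := le_abs_self _
                _ = |c i| * Δ * |∑ j, t j i - m / n| := by rw [abs_mul, abs_mul, abs_of_pos hΔ]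
                _ ≤ _ := mul_le_mul_of_nonneg_left this (by positivity)
              linarith
          _ = _ := by
              rw [sum_add_distrib]
              simp_rw [← sum_mul]
              ring
end

end

section

open Finset MvPolynomial

section
variable {k : Type*} [Field k] {S : Type*} [Fintype S] (D : PD k S)

theorem PD.coefQ {m n : ℕ} (hm : 1 ≤ m) (hn : 1 ≤ n) (v : S) (Mv : Matrix (Fin n) (Fin n) k) (hdet : Mv.det ≠ 0)
    (H : ℝ) (hH1 : 1 ≤ H) (hH : ∀ i j, D.f v (Mv⁻¹ i j) ≤ H) (Cst : ℝ) (hCst : 1 ≤ Cst)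
    (d : Fin m → ℕ) (D0 : ℕ) (hd : ∀ j, d j ≤ D0) (P : MvPolynomial (Fin m × Fin n) k) (hP : MHom d P)
    (hPC : ∀ α, D.f v (coeff α P) ≤ Cst ^ D0) (w ρ : Fin m → Fin n → ℝ) (hw : ∀ j i, 0 ≤ w j i)
    (hρ : ∀ j i, 0 ≤ ρ j i) (Y : Fin m → Matrix (Fin n) (Fin n) k)
    (h : ∀ j i l, D.f v ((Mv * Y j) i l) ≤ w j i * ρ j l) (W : ℝ) (hW0 : 0 ≤ W)
    (hW : ∀ α, coeff α (lsub (blk fun _ => Mv⁻¹) P) ≠ 0 → ∏ j, ∏ i, w j i ^ α (j, i) ≤ W) (β) :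
    D.f v (coeff β (lsub (blk Y) P)) ≤
      ((2 ^ (n * m)) ^ 4 * Cst * (((m * n : ℝ)) ^ 4 * H) ^ m) ^ D0 * W * ∏ j, ∏ l, ρ j l ^ β (j, l) := by
  have hmn : (1:ℝ) ≤ m * n := by
    have h1 : (1:ℝ) ≤ m := by exact_mod_cast hm
    have h2 : (1:ℝ) ≤ n := by exact_mod_cast hn
    nlinarith
  have hcard : ((Fintype.card (Fin m × Fin n) : ℕ) : ℝ) = m * n := by simp
  set N := ∑ j, d j with hN
  have hND : N ≤ m * D0 := by
    calc N ≤ ∑ _j : Fin m, D0 := sum_le_sum fun j _ => hd j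
      _ = m * D0 := by simp
  have hdeg : ∀ R : MvPolynomial (Fin m × Fin n) k, MHom d R → ∀ α, coeff α R ≠ 0 → ∑ s, α s = N := by
    intro R hR α hα
    rw [Fintype.sum_prod_type]
    exact sum_congr rfl fun j _ => hR α hα j
  have hcd : ∀ R : MvPolynomial (Fin m × Fin n) k, MHom d R → (#R.support : ℝ) ≤ (2 ^ (n * m)) ^ D0 := by
    intro R hR
    exact_mod_cast hR.card D0 hd
  have hpow : ∀ x : ℝ, 1 ≤ x → x ^ N ≤ (x ^ m) ^ D0 := by
    intro x hx
    rw [← pow_mul]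
    exact pow_le_pow_right₀ hx hND
  set Pv := lsub (blk fun _ : Fin m => Mv⁻¹) P with hPv
  have hPvM : MHom d Pv := hP.lsub _
  have h1 : ∀ α, D.f v (coeff α Pv) ≤ ((2 ^ (n * m)) ^ D0) ^ 2 * (Cst ^ D0 * ((((m * n : ℝ)) ^ 2) ^ N * H ^ N)) := by
    intro α
    have := D.lsub_le v (blk fun _ : Fin m => Mv⁻¹) (fun _ => H) (fun _ => 1) (fun _ => by linarith) (fun _ => by norm_num)
      (by
        intro s t
        unfold blk
        split_ifs
        · simpa using hH s.2 t.2
        · simp; linarith) P (Cst ^ D0) ((2 ^ (n * m)) ^ D0) (H ^ N) N (by positivity) hPC (hcd P hP) (hdeg P hP) (by positivity)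
        (by
          intro α hα
          rw [prod_pow_eq_pow_sum, hdeg P hP α hα]) α
    rw [hcard] at this
    simpa using this
  have hQ : lsub (blk Y) P = lsub (blk fun j => Mv * Y j) Pv := by
    rw [hPv, lsub_mul, blk_mul]
    congr 3
    funext j
    rw [← Matrix.mul_assoc, Matrix.nonsing_inv_mul _ (isUnit_iff_ne_zero.2 hdet), Matrix.one_mul]
  have h2 := D.lsub_le v (blk fun j : Fin m => Mv * Y j) (fun s => w s.1 s.2) (fun s => ρ s.1 s.2) (fun _ => hw _ _) (fun _ => hρ _ _)
      (by
        intro s t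
        unfold blk
        split_ifs with hst
        · simpa [hst] using h s.1 s.2 t.2
        · simp; exact mul_nonneg (hw _ _) (hρ _ _)) Pv _ ((2 ^ (n * m)) ^ D0) W N (by positivity) h1 (hcd Pv hPvM) (hdeg Pv hPvM) hW0
        (by
          intro α hα
          rw [Fintype.prod_prod_type]; exact hW α hα) β
  rw [hQ]
  refine h2.trans ?_
  rw [hcard, Fintype.prod_prod_type]
  have hR : 0 ≤ ∏ j, ∏ l, ρ j l ^ β (j, l) := prod_nonneg fun j _ => prod_nonneg fun l _ => pow_nonneg (hρ _ _) _
  have e1 := hpow (((m * n : ℝ)) ^ 4 * H) (by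
    have := one_le_pow₀ hmn (n := 4)
    nlinarith)
  calc _ = (((2 ^ (n * m) : ℝ) ^ 4 * Cst) ^ D0 * (((m * n : ℝ)) ^ 4 * H) ^ N) * (W * ∏ j, ∏ l, ρ j l ^ β (j, l)) := by
        simp only [mul_pow, ← pow_mul]; ring
    _ ≤ (((2 ^ (n * m) : ℝ) ^ 4 * Cst) ^ D0 * ((((m * n : ℝ)) ^ 4 * H) ^ m) ^ D0) * (W * ∏ j, ∏ l, ρ j l ^ β (j, l)) := by
        apply mul_le_mul_of_nonneg_right _ (by positivity)
        apply mul_le_mul_of_nonneg_left e1 (by positivity)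
    _ = _ := by rw [← mul_pow]; ring

end

end

section

open Finset MvPolynomial

section
variable {k : Type*} [Field k] {S : Type*} [Fintype S] (D : PD k S)

theorem rhoBound {m n : ℕ} (a : Fin n) (ε Bc Δ : ℝ) (hε : 0 < ε) (hε1 : ε ≤ 1) (hBc : 0 ≤ Bc) (hΔ : 0 < Δ) (hm : 1 ≤ m)
    (ℓ : Fin m → ℝ) (hℓ : ∀ j, 0 < ℓ j) (d : Fin m → ℕ) (hd : ∀ j, 1 ≤ d j)
    (hu2 : ∀ j, d j * ℓ j ≤ (1 + ε) * Δ) (r : Fin m → Fin n → ℝ) (hr0 : ∀ j l, 0 ≤ r j l)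
    (hr : ∀ j l, l ≠ a → r j l ≤ Real.exp (ε * ℓ j)) (hra : ∀ j, r j a ≤ Real.exp (Bc * ℓ j))
    (e : Fin m → Fin n → ℕ) (hed : ∀ j, ∑ i, e j i = d j) (hea : ∑ j, (e j a : ℝ) / d j < ε) :
    ∏ j, ∏ l, r j l ^ e j l ≤ Real.exp (Δ * m * (2 * ε * (1 + Bc))) := by
  have hd' : ∀ j, (0:ℝ) < d j := fun j => by exact_mod_cast hd j
  have h1 : ∀ j l, r j l ≤ Real.exp ((ε + if l = a then Bc else 0) * ℓ j) := by
    intro j l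
    by_cases h : l = a
    · subst h
      refine (hra j).trans (Real.exp_le_exp.2 ?_)
      simp only [if_true]
      nlinarith [mul_pos hε (hℓ j)]
    · simpa [h] using hr j l h
  calc ∏ j, ∏ l, r j l ^ e j l ≤ ∏ j, ∏ l, Real.exp ((ε + if l = a then Bc else 0) * ℓ j) ^ e j l := by
        refine prod_le_prod (fun j _ => prod_nonneg fun i _ => pow_nonneg (hr0 j i) _) fun j _ => ?_
        refine prod_le_prod (fun i _ => pow_nonneg (hr0 j i) _) fun i _ => ?_
        exact pow_le_pow_left₀ (hr0 j i) (h1 j i) _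
    _ = Real.exp (∑ j, ∑ l, (e j l : ℝ) * ((ε + if l = a then Bc else 0) * ℓ j)) := by
        rw [Real.exp_sum]
        refine prod_congr rfl fun j _ => ?_
        rw [Real.exp_sum]
        refine prod_congr rfl fun i _ => ?_
        rw [Real.exp_nat_mul]
    _ ≤ _ := by
        apply Real.exp_le_exp.2
        have h2 : ∀ j, ∑ l, (e j l : ℝ) * ((ε + if l = a then Bc else 0) * ℓ j) =
            ε * (d j * ℓ j) + Bc * ((e j a : ℝ) / d j) * (d j * ℓ j) := by
          intro j
          have : ∀ l, (e j l : ℝ) * ((ε + if l = a then Bc else 0) * ℓ j) =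
            (e j l : ℝ) * (ε * ℓ j) + (if l = a then (e j l : ℝ) * Bc * ℓ j else 0) := by
            intro l; split_ifs <;> ring
          simp_rw [this, sum_add_distrib, ← sum_mul]
          have h3 : ∑ l, (e j l : ℝ) = d j := by rw [← hed j]; push_cast; rfl
          rw [h3]
          simp only [sum_ite_eq', mem_univ, if_true]
          field_simp [(hd' j).ne']
        simp_rw [h2]
        have hu3 : ∀ j, d j * ℓ j ≤ 2 * Δ := fun j => (hu2 j).trans (by nlinarith)
        calc _ ≤ ∑ j, (ε * (2 * Δ) + Bc * ((e j a : ℝ) / d j) * (2 * Δ)) := by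
              refine sum_le_sum fun j _ => ?_
              have := hd' j
              refine add_le_add (mul_le_mul_of_nonneg_left (hu3 j) hε.le) (mul_le_mul_of_nonneg_left (hu3 j) (by positivity))
          _ = m * (ε * (2 * Δ)) + Bc * (∑ j, (e j a : ℝ) / d j) * (2 * Δ) := by
              rw [sum_add_distrib, mul_sum, sum_mul]; simp
          _ ≤ m * (ε * (2 * Δ)) + Bc * (m * ε) * (2 * Δ) := by
              have h1 : (1:ℝ) ≤ m := by exact_mod_cast hm
              have : ∑ j, (e j a : ℝ) / d j ≤ m * ε := by nlinarith
              have := mul_le_mul_of_nonneg_right (mul_le_mul_of_nonneg_left this hBc) (by positivity : 0 ≤ 2 * Δ)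
              linarith
          _ = _ := by ring

set_option maxHeartbeats 1000000 in
/-- The Thue-Siegel-Roth-Schmidt machine. -/
theorem PD.machine [CharZero k] (n : ℕ) (hn : 2 ≤ n) (Mf : S → Matrix (Fin n) (Fin n) k) (hM : ∀ v, (Mf v).det ≠ 0)
    (a b : Fin n) (hab : a ≠ b) (c : S → Fin n → ℝ) (g : ℝ) (hg : 0 < g) (hc : ∑ v, ∑ i, c v i ≤ -g)
    (Bc : ℝ) (hBc : 0 ≤ Bc) (η : ℝ) (hη : 0 < η) :
    ∃ ε : ℝ, 0 < ε ∧ ∃ m : ℕ, ∃ K : ℝ, 0 < K ∧ ∃ κ : ℝ, 1 ≤ κ ∧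
      ∀ (ℓ : Fin m → ℝ) (w : Fin m → S → Fin n → ℝ) (Y : Fin m → Matrix (Fin n) (Fin n) k)
        (ρ : Fin m → S → Fin n → ℝ) (p : Fin m → Fin n → k) (x y : Fin m → k),
        (∀ j, K ≤ ℓ j) → (∀ i j, i < j → κ * ℓ i ≤ ℓ j) →
        (∀ j v i, 0 ≤ w j v i ∧ w j v i ≤ Real.exp ((c v i + ε) * ℓ j)) →
        (∀ j, (Y j).det ≠ 0) → (∀ j i l, Y j i l ∈ D.A) → (∀ j v l, 0 ≤ ρ j v l) →
        (∀ j v i l, D.f v ((Mf v * Y j) i l) ≤ w j v i * ρ j v l) →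
        (∀ j l, l ≠ a → ∏ v, ρ j v l ≤ Real.exp (ε * ℓ j)) →
        (∀ j, ∏ v, ρ j v a ≤ Real.exp (Bc * ℓ j)) →
        (∀ j i, Y j i a = if i = a then 1 else 0) →
        (∀ j l, l ≠ a → ∑ i, p j i * Y j i l = 0) → (∀ j, p j a ≠ 0) →
        (∀ j, x j ∈ D.A ∧ y j ∈ D.A ∧ y j ≠ 0 ∧ ∃ s ∈ D.A, ∃ t ∈ D.A, s * x j + t * y j = 1) →
        (∀ j, - p j b / p j a = x j / y j) →
        (∀ j, Real.exp (η * ℓ j) ≤ D.ht (x j) (y j)) → False := by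
  have hn0 : (0:ℝ) < n := by exact_mod_cast (by omega : 0 < n)
  set Cs := ∑ v, ∑ i, |c v i| with hCs
  have hCs0 : 0 ≤ Cs := sum_nonneg fun _ _ => sum_nonneg fun _ _ => abs_nonneg _
  set s : ℝ := (Fintype.card S : ℝ) with hs
  have hs0 : 0 ≤ s := by positivity
  set ε : ℝ := min 1 (g / (8 * n * (Cs + s + 2 + Bc))) with hεdef
  have hε : 0 < ε := lt_min one_pos (by positivity)
  have hε1 : ε ≤ 1 := min_le_left _ _
  have hεg : 2 * ε * (Cs + s + 1 + Bc) ≤ g / (4 * n) := by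
    have h1 : ε ≤ g / (8 * n * (Cs + s + 2 + Bc)) := min_le_right _ _
    rw [le_div_iff₀ (by positivity)] at h1 ⊢
    nlinarith [mul_pos hε hn0]
  clear_value ε
  set m : ℕ := ⌈2 * s * n / ε ^ 2⌉₊ + 1 with hmdef
  have hm1 : 1 ≤ m := by omega
  have hm1' : (1:ℝ) ≤ m := by exact_mod_cast hm1
  have hm : 2 * s * n ≤ ε ^ 2 * m := by
    have h1 : 2 * s * n / ε ^ 2 ≤ m := (Nat.le_ceil _).trans (by exact_mod_cast (by omega))
    rw [div_le_iff₀ (by positivity)] at h1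
    linarith
  clear_value m
  obtain ⟨Cx, hCx, haux⟩ := D.auxPoly m n (by omega) (fun v => (Mf v)⁻¹) ε hε hm
  obtain ⟨H, hH1, hH⟩ := D.bdd_all (fun t : S × Fin n × Fin n => (Mf t.1)⁻¹ t.2.1 t.2.2)
  obtain ⟨CR, hCR, ω, hω, hroth⟩ := D.roth (M := m) m ε hε hε1
  set K3 : ℝ := (2 ^ (n * m)) ^ 4 * Cx * (((m * n : ℝ)) ^ 4 * H) ^ m with hK3
  have hK30 : 0 < K3 := by positivity
  set B2 : ℝ := CR * (Cx:ℝ) ^ (Fintype.card S) with hB2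
  have hB20 : 0 < B2 := by positivity
  set K : ℝ := 1 + 8 * s * |Real.log K3| * n / g + 2 * CR * |Real.log B2| / η with hKdef
  have hK0 : 0 < K := by positivity
  have hKa : 8 * s * |Real.log K3| * n ≤ g * K := by
    have h1 : 8 * s * |Real.log K3| * n / g ≤ K := by
      have : 0 ≤ 2 * CR * |Real.log B2| / η := by positivity
      linarith
    rw [div_le_iff₀ hg] at h1; linarith
  have hKb : 2 * CR * |Real.log B2| ≤ η * K := by
    have h1 : 2 * CR * |Real.log B2| / η ≤ K := by
      have : 0 ≤ 8 * s * |Real.log K3| * n / g := by positivity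
      linarith
    rw [div_le_iff₀ hη] at h1; linarith
  clear_value K3 B2 K Cs s
  refine ⟨ε, hε, m, K, hK0, max 1 (2 / ω), le_max_left _ _, ?_⟩
  intro ℓ w Y ρ p x y hℓK hℓ hw hYdet hYA hρ0 hYρ hρl hρa hYa hpY hpa hxy hxy' hht
  have hℓ0 : ∀ j, 0 < ℓ j := fun j => hK0.trans_le (hℓK j)
  set Δ : ℝ := (∑ j, ℓ j) / ε + K with hΔdef
  have hsum0 : 0 ≤ ∑ j, ℓ j := sum_nonneg fun j _ => (hℓ0 j).le
  have hΔK : K ≤ Δ := by have : 0 ≤ (∑ j, ℓ j) / ε := by positivity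
                         linarith
  have hΔ : 0 < Δ := hK0.trans_le hΔK
  have hℓΔ : ∀ j, ℓ j ≤ ε * Δ := by
    intro j
    have h1 : ℓ j ≤ ∑ j, ℓ j := single_le_sum (f := ℓ) (fun j _ => (hℓ0 j).le) (mem_univ j)
    have : ε * Δ = ∑ j, ℓ j + ε * K := by rw [hΔdef]; field_simp
    rw [this]; nlinarith [mul_pos hε hK0]
  clear_value Δ
  set d : Fin m → ℕ := fun j => ⌈Δ / ℓ j⌉₊ with hd
  have hd1 : ∀ j, 1 ≤ d j := fun j => Nat.one_le_ceil_iff.2 (div_pos hΔ (hℓ0 j))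
  set D0 : ℕ := ⌈Δ / K⌉₊ with hD0
  have hdD : ∀ j, d j ≤ D0 := fun j => Nat.ceil_le_ceil (div_le_div_of_nonneg_left hΔ.le hK0 (hℓK j))
  have hD01 : 1 ≤ D0 := Nat.one_le_ceil_iff.2 (div_pos hΔ hK0)
  have hD02 : D0 * K ≤ 2 * Δ := by
    have h1 : (D0:ℝ) < Δ / K + 1 := Nat.ceil_lt_add_one (by positivity)
    have h2 : (Δ / K + 1) * K = Δ + K := by field_simp
    nlinarith
  have hu1 : ∀ j, Δ ≤ d j * ℓ j := by
    intro j
    have := Nat.le_ceil (Δ / ℓ j)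
    rwa [div_le_iff₀ (hℓ0 j)] at this
  have hu2 : ∀ j, d j * ℓ j ≤ (1 + ε) * Δ := by
    intro j
    have h1 : (d j:ℝ) < Δ / ℓ j + 1 := Nat.ceil_lt_add_one (div_pos hΔ (hℓ0 j)).le
    have h2 : (Δ / ℓ j + 1) * ℓ j = Δ + ℓ j := by field_simp [(hℓ0 j).ne']
    nlinarith [hℓ0 j, hℓΔ j]
  clear_value d D0
  obtain ⟨P, hP0, hPM, hPO, hPC, hPG⟩ := haux d D0 hd1 hdD hD01
  set Q := lsub (blk Y) P with hQ
  have hQM : MHom d Q := hPM.lsub _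
  have hQA : ∀ β, coeff β Q ∈ D.A := by
    refine lsub_mem' D.A _ ?_ P (fun α => D.OA (hPO α))
    intro s t; unfold blk; split_ifs
    · exact hYA _ _ _
    · exact zero_mem _
  -- key vanishing
  have key : ∀ β, coeff β Q ≠ 0 → ε ≤ ∑ j, (β (j, a) : ℝ) / d j := by
    intro β hβ
    by_contra! hlt
    have h1 := D.prod_ge _ (hQA β) hβ
    have hbd : ∀ v, D.f v (coeff β Q) ≤ K3 ^ D0 *
        Real.exp (Δ * m * ((∑ i, c v i) / n + 2 * ε * (∑ i, |c v i| + 1))) * ∏ j, ∏ l, ρ j v l ^ β (j, l) := by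
      intro v
      rw [hK3]
      refine D.coefQ hm1 (by omega) v (Mf v) (hM v) H (by exact_mod_cast hH1) (fun i j => hH v (v, i, j)) Cx (by exact_mod_cast hCx) d D0 hdD P hPM
        (hPC v) (fun j i => w j v i) (fun j i => ρ j v i) (fun j i => (hw j v i).1) (fun j i => hρ0 j v i) Y (fun j i l => hYρ j v i l)
        _ (Real.exp_pos _).le ?_ β
      intro α hα
      exact Wbound m n (by omega) (c v) ε Δ hε hε1 hΔ ℓ d hd1 hu1 hu2 (fun j i => w j v i) (fun j i => hw j v i) (cur α)
        (fun j => (hPM.lsub _) α hα j) (hPG v α hα)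
    have h2 : ∏ v, D.f v (coeff β Q) ≤ (K3 ^ D0) ^ (Fintype.card S) *
        Real.exp (Δ * m * ((∑ v, ∑ i, c v i) / n + 2 * ε * (Cs + s))) * ∏ j, ∏ l, (∏ v, ρ j v l) ^ β (j, l) := by
      refine (prod_le_prod (fun v _ => D.nonneg v _) fun v _ => hbd v).trans (le_of_eq ?_)
      rw [prod_mul_distrib, prod_mul_distrib, prod_const, ← Real.exp_sum]
      congr 1
      · congr 2
        rw [← mul_sum, sum_add_distrib, ← sum_div, ← mul_sum, sum_add_distrib]
        simp [hCs, hs]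
      · rw [prod_comm]
        refine prod_congr rfl fun j _ => ?_
        rw [prod_comm]
        refine prod_congr rfl fun l _ => ?_
        rw [prod_pow]
    have h3 := rhoBound a ε Bc Δ hε hε1 hBc hΔ hm1 ℓ hℓ0 d hd1 hu2 (fun j l => ∏ v, ρ j v l)
      (fun j l => prod_nonneg fun v _ => hρ0 j v l) hρl hρa (cur β) (fun j => hQM β hβ j) hlt
    have h4 : (K3 ^ D0) ^ (Fintype.card S) ≤ Real.exp (Δ * m * (g / (4 * n))) := by
      clear hbd h2 h3 hPC hPG hQA hYρ hw
      rw [← pow_mul]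
      calc K3 ^ (D0 * Fintype.card S) = Real.exp ((D0 * Fintype.card S : ℕ) * Real.log K3) := by
            rw [Real.exp_nat_mul, Real.exp_log hK30]
        _ ≤ _ := by
            apply Real.exp_le_exp.2
            push_cast
            rw [← hs]
            have h5 : D0 * s * Real.log K3 ≤ D0 * s * |Real.log K3| := mul_le_mul_of_nonneg_left (le_abs_self _) (by positivity)
            refine h5.trans ?_
            have h6 : Δ * (g / (4 * n)) ≤ Δ * m * (g / (4 * n)) := by
              rw [mul_assoc Δ (m:ℝ)]
              refine mul_le_mul_of_nonneg_left ?_ hΔ.le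
              have : 0 ≤ g / (4 * n) := by positivity
              nlinarith
            refine le_trans ?_ h6
            rw [mul_div_assoc', le_div_iff₀ (by positivity)]
            have h7 := mul_le_mul_of_nonneg_left hKa (by positivity : (0:ℝ) ≤ D0)
            nlinarith
    have h5 : (K3 ^ D0) ^ (Fintype.card S) *
        Real.exp (Δ * m * ((∑ v, ∑ i, c v i) / n + 2 * ε * (Cs + s))) * ∏ j, ∏ l, (∏ v, ρ j v l) ^ β (j, l)
        ≤ Real.exp (Δ * m * (g / (4 * n))) * Real.exp (Δ * m * ((∑ v, ∑ i, c v i) / n + 2 * ε * (Cs + s))) *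
          Real.exp (Δ * m * (2 * ε * (1 + Bc))) := by
      refine mul_le_mul (mul_le_mul_of_nonneg_right h4 (Real.exp_pos _).le) h3 ?_ (by positivity)
      exact prod_nonneg fun j _ => prod_nonneg fun l _ => pow_nonneg (prod_nonneg fun v _ => hρ0 j v l) _
    have h6 : (1:ℝ) < 1 := by
      refine (h1.trans (h2.trans h5)).trans_lt ?_
      rw [← Real.exp_add, ← Real.exp_add, Real.exp_lt_one_iff, ← mul_add, ← mul_add]
      refine mul_neg_of_pos_of_neg (by positivity) ?_
      have h7 : (∑ v, ∑ i, c v i) / n ≤ - g / n := div_le_div_of_nonneg_right hc hn0.le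
      have h8 : g / (4 * n) = g / n / 4 := by field_simp
      have h9 : -g / n = -(g / n) := by ring
      have h10 : 0 < g / n := by positivity
      rw [h8] at hεg ⊢
      rw [h9] at h7
      nlinarith
    exact lt_irrefl _ h6
  -- strip and Roth
  set r : Fin m → Fin n → k := fun j i => - p j i / p j a with hr
  obtain ⟨G, hG0, hGc, hGd, hGt⟩ := strip P hP0 d hPM a b hab r
  have hGfA : ∀ e, coeff e G ∈ D.A := by
    intro e
    rcases hGc e with h | ⟨α, h⟩
    · rw [h]; exact zero_mem _
    · rw [h]; exact D.OA (hPO α)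
  have hGfB : ∀ v e, D.f v (coeff e G) ≤ (Cx:ℝ) ^ D0 := by
    intro v e
    rcases hGc e with h | ⟨α, h⟩
    · rw [h, map_zero]; positivity
    · rw [h]; exact hPC v α
  have hex : ∃ e, wtR d e < ε ∧ coeff e (tr (fun j => x j / y j) G) ≠ 0 := by
    refine hroth d D0 G (fun _ => (Cx:ℝ) ^ D0) x y hd1 hdD ?_ hG0 ?_ hGfA ?_ hGfB hGd hxy ?_
    · intro i j hij
      have h1 := hℓ i j hij
      have h2 : 2 / ω * ℓ i ≤ ℓ j := le_trans (mul_le_mul_of_nonneg_right (le_max_right _ _) (hℓ0 i).le) h1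
      have h3 := hu1 i
      have h4 := hu2 j
      have h5 : d j * ℓ j ≤ 2 * (d i * ℓ i) := h4.trans (by nlinarith)
      have h6 : 2 * ℓ i ≤ ω * ℓ j := by
        have := mul_le_mul_of_nonneg_left h2 hω.le
        have e1 : ω * (2 / ω * ℓ i) = 2 * ℓ i := by field_simp
        linarith
      have h7 : d j * ℓ j ≤ (ω * d i) * ℓ j := by
        have : (0:ℝ) ≤ d i := by positivity
        nlinarith
      exact le_of_mul_le_mul_right h7 (hℓ0 j)
    · have : {j : Fin m | (j:ℕ) < m} = Set.univ := by ext j; simp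
      rw [this, supported_univ]; trivial
    · intro v
      exact one_le_pow₀ (by exact_mod_cast hCx)
    · intro j
      rw [prod_const, card_univ]
      have e1 : ((CR:ℝ) ^ D0 * ((Cx:ℝ) ^ D0) ^ Fintype.card S) ^ CR = Real.exp ((D0 * CR : ℕ) * Real.log B2) := by
        rw [Real.exp_nat_mul, Real.exp_log hB20, hB2, pow_mul, pow_right_comm (Cx:ℝ), ← mul_pow]
      rw [e1]
      calc Real.exp ((D0 * CR : ℕ) * Real.log B2) ≤ Real.exp (η * (d j * ℓ j)) := by
            apply Real.exp_le_exp.2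
            push_cast
            have h5 : D0 * CR * Real.log B2 ≤ D0 * CR * |Real.log B2| := mul_le_mul_of_nonneg_left (le_abs_self _) (by positivity)
            have h7 := mul_le_mul_of_nonneg_left hKb (by positivity : (0:ℝ) ≤ D0)
            have h8 := mul_le_mul_of_nonneg_left hD02 hη.le
            have h9 := mul_le_mul_of_nonneg_left (hu1 j) hη.le
            nlinarith
        _ = Real.exp (η * ℓ j) ^ d j := by rw [← Real.exp_nat_mul]; ring_nf
        _ ≤ _ := pow_le_pow_left₀ (Real.exp_pos _).le (hht j) _

  obtain ⟨e, he1, he2⟩ := hex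
  have hfun : (fun j => x j / y j) = fun j => r j b := by
    funext j; rw [hr, ← hxy' j]
  rw [hfun] at he2
  obtain ⟨γ, hγ, hγe⟩ := hGt e he2
  have hR : lsub (blk fun j => thM a (r j)) P = lsub (blk fun j => (Y j)⁻¹ * thM a (r j)) Q := by
    rw [hQ, lsub_mul, blk_mul]
    congr 3
    funext j
    rw [← Matrix.mul_assoc, Matrix.mul_nonsing_inv _ (isUnit_iff_ne_zero.2 (hYdet j)), Matrix.one_mul]
  rw [hR, coeff_lsub] at hγ
  obtain ⟨β, hβ, hβ'⟩ := exists_ne_zero_of_sum_ne_zero hγ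
  have hle : ∀ j, β (j, a) ≤ γ (j, a) := by
    intro j
    refine lsub_ge _ (j, a) ?_ β γ (right_ne_zero_of_mul hβ')
    rintro ⟨j', l⟩ hne
    unfold blk
    simp only
    split_ifs with h
    · subst h
      apply rowA (Y j) (hYdet j) a (hYa j) (p j) (hpa j) (hpY j) l
      rintro rfl; exact hne rfl
    · rfl
  have h1 := key β (mem_support_iff.1 hβ)
  rw [wtR_apply] at he1
  have h2 : ∑ j, (β (j, a) : ℝ) / d j ≤ ∑ j, (e j : ℝ) / d j := by
    refine sum_le_sum fun j _ => ?_
    have := hle j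
    rw [hγe j] at this
    have h3 : (β (j, a) : ℝ) ≤ e j := by exact_mod_cast this
    gcongr
  linarith

end

end

section

open Finset

section
variable {k : Type*} [Field k] {S : Type*} [Fintype S] (D : PD k S) {N : ℕ}

namespace PD

theorem det_le (v : S) (M : Matrix (Fin N) (Fin N) k) (α β : Fin N → ℝ) (h : ∀ i j, D.f v (M i j) ≤ α i * β j) :
    D.f v M.det ≤ ((N.factorial : ℝ)) ^ 2 * ((∏ i, α i) * ∏ i, β i) := by
  rw [Matrix.det_apply]
  have h0 : ∀ σ : Equiv.Perm (Fin N), D.f v (Equiv.Perm.sign σ • ∏ i, M (σ i) i) ≤ (∏ i, α i) * ∏ i, β i := by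
    intro σ
    have h1 : D.f v (Equiv.Perm.sign σ • ∏ i, M (σ i) i) = D.f v (∏ i, M (σ i) i) := by
      rcases Int.units_eq_one_or (Equiv.Perm.sign σ) with h | h <;> rw [h]
      · simp
      · rw [Units.neg_smul, one_smul, D.f_neg]
    rw [h1, map_prod]
    calc ∏ i, D.f v (M (σ i) i) ≤ ∏ i, α (σ i) * β i := prod_le_prod (fun i _ => D.nonneg _ _) fun i _ => h _ _
      _ = _ := by rw [prod_mul_distrib, Equiv.prod_comp σ α]
  have := D.sum_le v univ _ _ (fun σ _ => h0 σ)
  rwa [card_univ, Fintype.card_perm, Fintype.card_fin] at this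

variable (L : S → Matrix (Fin N) (Fin N) k)

noncomputable def sv (w : S → Fin N → ℝ) (v : S) (x : Fin N → k) : ℝ :=
  ⨆ i, D.f v ((L v).mulVec x i) / w v i

noncomputable def sz (w : S → Fin N → ℝ) (x : Fin N → k) : ℝ := ∏ v, D.sv L w v x

def Int (x : Fin N → k) : Prop := ∀ i, x i ∈ D.A

variable {L} {w : S → Fin N → ℝ}

theorem sv_nonneg (hw : ∀ v i, 0 < w v i) (v x) : 0 ≤ D.sv L w v x :=
  Real.iSup_nonneg fun i => div_nonneg (D.nonneg _ _) (hw v i).le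

theorem sz_nonneg (hw : ∀ v i, 0 < w v i) (x) : 0 ≤ D.sz L w x :=
  prod_nonneg fun _ _ => D.sv_nonneg hw _ _

theorem le_sv (hw : ∀ v i, 0 < w v i) (v x i) : D.f v ((L v).mulVec x i) ≤ w v i * D.sv L w v x := by
  have := le_ciSup (f := fun i => D.f v ((L v).mulVec x i) / w v i) (Set.finite_range _).bddAbove i
  rw [← div_le_iff₀' (hw v i)]
  exact this

theorem sv_le (hw : ∀ v i, 0 < w v i) (v x) (M : ℝ) (hM : 0 ≤ M) (h : ∀ i, D.f v ((L v).mulVec x i) ≤ w v i * M) :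
    D.sv L w v x ≤ M :=
  Real.iSup_le (fun i => by rw [div_le_iff₀' (hw v i)]; exact h i) hM

theorem sv_smul (hw : ∀ v i, 0 < w v i) (v) (c : k) (x) : D.sv L w v (c • x) = D.f v c * D.sv L w v x := by
  unfold sv
  rw [Real.mul_iSup_of_nonneg (D.nonneg _ _)]
  congr 1; ext i
  rw [Matrix.mulVec_smul, Pi.smul_apply, smul_eq_mul, map_mul, mul_div_assoc]

theorem sz_smul (hw : ∀ v i, 0 < w v i) (c : k) (x) : D.sz L w (c • x) = (∏ v, D.f v c) * D.sz L w x := by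
  unfold sz
  rw [← prod_mul_distrib]
  exact prod_congr rfl fun v _ => D.sv_smul hw v c x

theorem sv_pos (hw : ∀ v i, 0 < w v i) (hL : ∀ v, (L v).det ≠ 0) (v) {x : Fin N → k} (hx : x ≠ 0) : 0 < D.sv L w v x := by
  refine lt_of_le_of_ne (D.sv_nonneg hw v x) fun h => hx ?_
  have : (L v).mulVec x = 0 := by
    ext i
    have := D.le_sv (L := L) hw v x i
    rw [← h, mul_zero] at this
    by_contra hne
    exact absurd (D.f_pos v hne) (not_lt.2 this)
  exact Matrix.eq_zero_of_mulVec_eq_zero (hL v) this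

theorem sz_pos (hw : ∀ v i, 0 < w v i) (hL : ∀ v, (L v).det ≠ 0) {x : Fin N → k} (hx : x ≠ 0) : 0 < D.sz L w x :=
  prod_pos fun v _ => D.sv_pos hw hL v hx

/-- determinant lower bound -/
theorem det_lower (L : S → Matrix (Fin N) (Fin N) k) (hL : ∀ v, (L v).det ≠ 0) : ∃ c : ℝ, 0 < c ∧ ∀ w : S → Fin N → ℝ, (∀ v i, 0 < w v i) →
    ∀ y : Fin N → Fin N → k, (∀ l, D.Int (y l)) → (Matrix.of y).det ≠ 0 →
      c ≤ (∏ l, D.sz L w (y l)) * ∏ v, ∏ i, w v i := by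
  set F : ℝ := (((N.factorial : ℝ)) ^ 2) ^ Fintype.card S with hF
  have hF0 : 0 < F := by positivity
  refine ⟨(∏ v, D.f v (L v).det) / F, div_pos (prod_pos fun v _ => D.f_pos v (hL v)) hF0, ?_⟩
  intro w hw y hy hdet
  have h1 : ∀ v, D.f v ((L v).det) * D.f v ((Matrix.of y).det) ≤ ((N.factorial : ℝ)) ^ 2 * ((∏ i, w v i) * ∏ l, D.sv L w v (y l)) := by
    intro v
    rw [← Matrix.det_transpose (Matrix.of y), ← map_mul, ← Matrix.det_mul]
    apply D.det_le v
    intro i j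
    exact D.le_sv hw v (y j) i
  have h2 := prod_le_prod (s := univ) (fun v _ => mul_nonneg (D.nonneg _ _) (D.nonneg _ _)) fun v _ => h1 v
  rw [prod_mul_distrib, prod_mul_distrib, prod_mul_distrib, prod_const, card_univ, ← hF, prod_comm (f := fun v l => D.sv L w v (y l))] at h2
  have h3 : 1 ≤ ∏ v, D.f v ((Matrix.of y).det) := by
    refine D.prod_ge _ ?_ hdet
    rw [Matrix.det_apply]
    refine sum_mem fun σ _ => ?_
    rcases Int.units_eq_one_or (Equiv.Perm.sign σ) with h | h <;> rw [h]
    · rw [one_smul]; exact prod_mem fun i _ => hy _ _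
    · rw [Units.neg_smul, one_smul]; exact neg_mem (prod_mem fun i _ => hy _ _)
  rw [div_le_iff₀ hF0]
  have h4 : 0 ≤ ∏ v, D.f v (L v).det := prod_nonneg fun v _ => D.nonneg _ _
  calc _ ≤ (∏ v, D.f v (L v).det) * ∏ v, D.f v ((Matrix.of y).det) := le_mul_of_one_le_right h4 h3
    _ ≤ _ := h2
    _ = _ := by unfold sz; ring

/-- Minkowski's first theorem -/
theorem mink1 (v0 : S) (hN : 0 < N) (L : S → Matrix (Fin N) (Fin N) k) (hL : ∀ v, (L v).det ≠ 0) : ∃ C : ℝ, 0 < C ∧ ∀ w : S → Fin N → ℝ, (∀ v i, 0 < w v i) →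
    ∀ c : ℝ, 0 ≤ c → (∀ x, D.Int x → x ≠ 0 → c ≤ D.sz L w x) → c ^ N * (∏ v, ∏ i, w v i) ≤ C := by
  classical
  obtain ⟨C, hC, h⟩ := D.mink N L hN hL
  refine ⟨C, hC, fun w hw c hc hx => ?_⟩
  set W := ∏ v, ∏ i, w v i with hW
  have hW0 : 0 < W := prod_pos fun v _ => prod_pos fun i _ => hw v i
  set t : ℝ := (C / W) ^ ((1:ℝ) / N) with ht
  have htN : t ^ N = C / W := by
    rw [ht, one_div, Real.rpow_inv_natCast_pow (by positivity) (by omega)]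
  have ht0 : 0 < t := Real.rpow_pos_of_pos (by positivity) _
  obtain ⟨x, hx0, hxA, hxb⟩ := h (fun v i => w v i * if v = v0 then t else 1) (fun v i => by split_ifs <;> simp [hw, ht0]) (by
    have : ∏ v, ∏ i, (w v i * if v = v0 then t else 1) = W * t ^ N := by
      simp_rw [prod_mul_distrib]
      congr 1
      rw [prod_eq_single v0]
      · simp
      · intro v _ hv; simp [hv]
      · simp
    rw [this, htN]; field_simp; exact le_rfl)
  have h1 : D.sz L w x ≤ t := by
    unfold sz
    calc ∏ v, D.sv L w v x ≤ ∏ v, (if v = v0 then t else 1) := by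
          refine prod_le_prod (fun v _ => D.sv_nonneg hw _ _) fun v _ => ?_
          exact D.sv_le hw v x _ (by split_ifs <;> linarith) fun i => hxb v i
      _ = t := by simp
  have h2 : c ≤ t := (hx x hxA hx0).trans h1
  have h3 : c ^ N ≤ C / W := htN ▸ pow_le_pow_left₀ hc h2 N
  rwa [le_div_iff₀ hW0] at h3

/-- Liouville-type lower bound, polynomial in the weights -/
theorem liou (L : S → Matrix (Fin N) (Fin N) k) (hL : ∀ v, (L v).det ≠ 0) : ∃ c : ℝ, 0 < c ∧ ∀ w : S → Fin N → ℝ, (∀ v i, 0 < w v i) →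
    ∀ R : ℝ, 0 < R → (∀ v i, w v i ≤ R) → ∀ x, D.Int x → x ≠ 0 → c ≤ D.sz L w x * R ^ Fintype.card S := by
  obtain ⟨H, hH1, hH⟩ := D.bdd_all (fun t : S × Fin N × Fin N => (L t.1)⁻¹ t.2.1 t.2.2)
  have hH0 : (0:ℝ) < H := by exact_mod_cast hH1
  refine ⟨1 / (((N:ℝ) ^ 2 + 1) * H) ^ Fintype.card S, by positivity, ?_⟩
  intro w hw R hR hwR x hx hx0
  obtain ⟨i, hi⟩ := Function.ne_iff.1 hx0
  have h1 := D.prod_ge _ (hx i) hi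
  have h2 : ∀ v, D.f v (x i) ≤ ((N:ℝ) ^ 2 + 1) * H * R * D.sv L w v x := by
    intro v
    have e : x = (L v)⁻¹.mulVec ((L v).mulVec x) := by
      rw [Matrix.mulVec_mulVec, Matrix.nonsing_inv_mul _ (isUnit_iff_ne_zero.2 (hL v)), Matrix.one_mulVec]
    have hs := D.sv_nonneg (L := L) hw v x
    have e2 : x i = ∑ j, (L v)⁻¹ i j * (L v).mulVec x j := by
      conv_lhs => rw [e]
      rfl
    rw [e2]
    have := D.sum_le v univ (fun j => (L v)⁻¹ i j * (L v).mulVec x j) (H * (R * D.sv L w v x)) (fun j _ => by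
      rw [map_mul]
      refine mul_le_mul (hH v (v, i, j)) ((D.le_sv hw v x j).trans ?_) (D.nonneg _ _) hH0.le
      exact mul_le_mul_of_nonneg_right (hwR v j) hs)
    refine this.trans ?_
    simp only [card_univ, Fintype.card_fin]
    have : 0 ≤ H * (R * D.sv L w v x) := by positivity
    nlinarith
  have h3 := h1.trans (prod_le_prod (fun v _ => D.nonneg _ _) fun v _ => h2 v)
  rw [prod_mul_distrib, prod_const, card_univ, mul_pow] at h3
  rw [div_le_iff₀ (by positivity)]
  unfold sz; linarith

theorem upper (L : S → Matrix (Fin N) (Fin N) k) : ∃ C : ℝ, 0 < C ∧ ∀ w : S → Fin N → ℝ, (∀ v i, 0 < w v i) →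
    ∀ r : ℝ, 0 < r → (∀ v i, r ≤ w v i) → ∀ i, ∀ v, D.sv L w v (Pi.single i 1) ≤ C / r := by
  obtain ⟨H, hH1, hH⟩ := D.bdd_all (fun t : S × Fin N × Fin N => (L t.1) t.2.1 t.2.2)
  have hH0 : (0:ℝ) < H := by exact_mod_cast hH1
  refine ⟨H, hH0, fun w hw r hr hrw i v => D.sv_le hw v _ _ (by positivity) fun j => ?_⟩
  have : (L v).mulVec (Pi.single i 1) j = L v j i := by simp
  rw [this]
  refine (hH v (v, j, i)).trans ?_
  rw [mul_div_assoc', le_div_iff₀ hr, mul_comm]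
  exact mul_le_mul_of_nonneg_right (hrw v j) hH0.le

end PD
end

end

section

open Finset

section flag
variable {k : Type*} [Field k] {N : ℕ} {E : Type*} [AddCommGroup E] [Module k E]

def Vs (k : Type*) [Field k] {E : Type*} [AddCommGroup E] [Module k E] (y : Fin N → E) (l : ℕ) : Submodule k E := Submodule.span k (Set.image y {r | r.val < l})

theorem Vs_zero (y : Fin N → E) : Vs k y 0 = ⊥ := by simp [Vs]

theorem Vs_succ (y : Fin N → E) (l : Fin N) : Vs k y (l + 1) = Vs k y l ⊔ Submodule.span k {y l} := by
  unfold Vs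
  rw [← Submodule.span_union, ← Set.image_singleton, ← Set.image_union]
  congr 2
  ext r
  simp only [Set.mem_ofPred_eq, Set.mem_union, Set.mem_singleton_iff, Fin.ext_iff]
  omega

theorem Vs_mono (y : Fin N → E) {l l' : ℕ} (h : l ≤ l') : Vs k y l ≤ Vs k y l' :=
  Submodule.span_mono (Set.image_mono fun r hr => lt_of_lt_of_le hr h)

theorem mem_Vs (y : Fin N → E) {l : Fin N} {l' : ℕ} (h : l.val < l') : y l ∈ Vs k y l' :=
  Submodule.subset_span ⟨l, h, rfl⟩

theorem flag_li (y : Fin N → E) (h : ∀ l : Fin N, y l ∉ Vs k y l) : LinearIndependent k y := by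
  classical
  rw [Fintype.linearIndependent_iff]
  intro c hc
  by_contra! hne
  obtain ⟨i, hi⟩ := hne
  obtain ⟨l, hl, hmax⟩ := exists_max_image (univ.filter fun i => c i ≠ 0) (fun i => i.val) ⟨i, by simp [hi]⟩
  simp only [mem_filter, mem_univ, true_and] at hl hmax
  apply h l
  have e : y l = - (c l)⁻¹ • ∑ r ∈ univ.erase l, c r • y r := by
    have := add_sum_erase univ (fun r => c r • y r) (mem_univ l)
    rw [hc] at this
    have h2 : ∑ r ∈ univ.erase l, c r • y r = - (c l • y l) := by
      rw [eq_neg_iff_add_eq_zero, add_comm]; exact this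
    rw [h2, smul_neg, neg_smul, neg_neg, smul_smul, inv_mul_cancel₀ hl, one_smul]
  rw [e]
  refine Submodule.smul_mem _ _ (Submodule.sum_mem _ fun r hr => ?_)
  by_cases hcr : c r = 0
  · rw [hcr, zero_smul]; exact Submodule.zero_mem _
  · refine Submodule.smul_mem _ _ (mem_Vs y ?_)
    have := hmax r hcr
    have h3 : r ≠ l := (mem_erase.1 hr).1
    exact lt_of_le_of_ne this fun h => h3 (Fin.ext h)

theorem li_det (y : Fin N → Fin N → k) (h : LinearIndependent k y) : (Matrix.of y).det ≠ 0 := by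
  have := Matrix.linearIndependent_rows_iff_isUnit.1 (show LinearIndependent k (Matrix.of y).row from h)
  exact ((Matrix.isUnit_iff_isUnit_det _).1 this).ne_zero

theorem Vs_top (y : Fin N → Fin N → k) (h : LinearIndependent k y) : Vs k y N = ⊤ := by
  have h1 : Set.image y {r | r.val < N} = Set.range y := by
    rw [show {r : Fin N | r.val < N} = Set.univ from by ext r; simp, Set.image_univ]
  unfold Vs
  rw [h1]
  exact h.span_eq_top_of_card_eq_finrank' (by simp)

theorem exists_level (y : Fin N → Fin N → k) (h : LinearIndependent k y) {x : Fin N → k} (hx : x ≠ 0) :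
    ∃ l : Fin N, x ∈ Vs k y (l + 1) ∧ x ∉ Vs k y l := by
  classical
  have hex : ∃ l, x ∈ Vs k y l := ⟨N, by rw [Vs_top y h]; trivial⟩
  have h0 : Nat.find hex ≠ 0 := by
    intro h0
    have := Nat.find_spec hex
    rw [h0, Vs_zero] at this
    exact hx (by simpa using this)
  obtain ⟨l, hl⟩ := Nat.exists_eq_succ_of_ne_zero h0
  have hlN : l < N := by
    have := Nat.find_min' hex (show x ∈ Vs k y N by rw [Vs_top y h]; trivial)
    omega
  refine ⟨⟨l, hlN⟩, ?_, ?_⟩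
  · have := Nat.find_spec hex; rwa [hl] at this
  · exact Nat.find_min hex (show l < Nat.find hex by omega)

end flag

section
variable {k : Type*} [Field k] {S : Type*} [Fintype S] (D : PD k S) {N : ℕ}
namespace PD
variable {L : S → Matrix (Fin N) (Fin N) k} {w : S → Fin N → ℝ}

theorem minima (hL : ∀ v, (L v).det ≠ 0) (hw : ∀ v i, 0 < w v i) : ∃ y : Fin N → Fin N → k, (∀ l, D.Int (y l)) ∧
    (∀ l : Fin N, y l ∉ Vs k y l) ∧ ∀ (l : Fin N) x, D.Int x → x ∉ Vs k y l → D.sz L w (y l) ≤ 2 * D.sz L w x := by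
  classical
  have hRex : ∃ R : ℝ, 0 < R ∧ ∀ v i, w v i ≤ R := by
    refine ⟨1 + ∑ v, ∑ i, w v i, ?_, fun v i => ?_⟩
    · have : 0 ≤ ∑ v, ∑ i, w v i := sum_nonneg fun v _ => sum_nonneg fun i _ => (hw v i).le
      linarith
    · have h1 : w v i ≤ ∑ i, w v i := single_le_sum (f := w v) (fun i _ => (hw v i).le) (mem_univ i)
      have h2 : ∑ i, w v i ≤ ∑ v, ∑ i, w v i := single_le_sum (f := fun v => ∑ i, w v i) (fun v _ => sum_nonneg fun i _ => (hw v i).le) (mem_univ v)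
      linarith
  obtain ⟨R, hR, hwR⟩ := hRex
  obtain ⟨c, hc, hliou⟩ := D.liou L hL
  have pick : ∀ V : Submodule k (Fin N → k), ∃ z, V ≠ ⊤ → D.Int z ∧ z ∉ V ∧ ∀ x, D.Int x → x ∉ V → D.sz L w z ≤ 2 * D.sz L w x := by
    intro V
    by_cases hV : V = ⊤
    · exact ⟨0, fun h => absurd hV h⟩
    have hne : ∃ x, D.Int x ∧ x ∉ V := by
      by_contra! hcon
      apply hV
      rw [eq_top_iff, ← (Pi.basisFun k (Fin N)).span_eq, Submodule.span_le]
      rintro _ ⟨i, rfl⟩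
      refine hcon _ fun j => ?_
      rw [Pi.basisFun_apply, Pi.single_apply]
      split_ifs
      · exact one_mem _
      · exact zero_mem _
    set T : Set ℝ := {t | ∃ x, D.Int x ∧ x ∉ V ∧ D.sz L w x = t} with hT
    have hTne : T.Nonempty := by obtain ⟨x, h1, h2⟩ := hne; exact ⟨_, x, h1, h2, rfl⟩
    have hTlow : ∀ t ∈ T, c / R ^ Fintype.card S ≤ t := by
      rintro t ⟨x, h1, h2, rfl⟩
      rw [div_le_iff₀ (by positivity)]
      exact hliou w hw R hR hwR x h1 (by rintro rfl; exact h2 (zero_mem _))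
    have hinf : 0 < sInf T := lt_of_lt_of_le (by positivity) (le_csInf hTne hTlow)
    obtain ⟨t, ⟨z, h1, h2, h3⟩, ht⟩ := exists_lt_of_csInf_lt hTne (show sInf T < 2 * sInf T by linarith)
    refine ⟨z, fun _ => ⟨h1, h2, fun x hx hxV => ?_⟩⟩
    have h4 : sInf T ≤ D.sz L w x := csInf_le ⟨_, hTlow⟩ ⟨x, hx, hxV, rfl⟩
    rw [h3]; linarith
  choose pk hpk using pick
  obtain ⟨V, V0, Vsucc⟩ : ∃ V : ℕ → Submodule k (Fin N → k), V 0 = ⊥ ∧ ∀ l, V (l + 1) = V l ⊔ Submodule.span k {pk (V l)} :=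
    ⟨fun l => Nat.rec ⊥ (fun _ V => V ⊔ Submodule.span k {pk V}) l, rfl, fun _ => rfl⟩
  have hVs : ∀ l, l ≤ N → Vs k (fun i : Fin N => pk (V i)) l = V l := by
    intro l
    induction l with
    | zero => intro _; rw [Vs_zero, V0]
    | succ l ih =>
      intro hl
      have := Vs_succ (k := k) (fun i : Fin N => pk (V i)) ⟨l, hl⟩
      simp only at this
      rw [this, ih (by omega), Vsucc]
  have hdim : ∀ l : ℕ, Module.finrank k (↥(V l)) ≤ l := by
    intro l
    induction l with
    | zero => rw [V0]; simp
    | succ l ih =>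
      rw [Vsucc]
      refine (Submodule.finrank_add_le_finrank_add_finrank _ _).trans ?_
      have := finrank_span_le_card (R := k) ({pk (V l)} : Set (Fin N → k))
      simp at this
      omega
  have htop : ∀ l : Fin N, V l ≠ ⊤ := by
    intro l h
    have := hdim l
    rw [h, finrank_top, Module.finrank_fin_fun] at this
    omega
  refine ⟨fun i => pk (V i), fun l => (hpk _ (htop l)).1, fun l => ?_, fun l => ?_⟩
  · rw [hVs l l.2.le]; exact (hpk _ (htop l)).2.1
  · rw [hVs l l.2.le]; exact (hpk _ (htop l)).2.2

theorem dav (hN : 0 < N) (v : S) (φ : Fin N → (Fin N → k) →ₗ[k] k) (ω : Fin N → ℝ) (hω : ∀ i, 0 < ω i) (y : Fin N → Fin N → k) (l : ℕ)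
   (hl : l ≤ N) :
   ∃ π : Equiv.Perm (Fin N), ∀ l', l ≤ l' → ∀ x ∈ Vs k y l', ∀ M, 0 ≤ M → (∀ r : Fin N, r.val < l' → D.f v (φ (π r) x) ≤ ω (π r) * M) →
     ∀ i, D.f v (φ i x) ≤ ω i * (((N:ℝ) ^ 2) ^ (N - l') * M) := by
  classical
  have hN1 : (1:ℝ) ≤ (N:ℝ) ^ 2 := one_le_pow₀ (by exact_mod_cast hN)
  induction hl using Nat.decreasingInduction with
  | self =>
    refine ⟨1, fun l' hl' x _ M _ h i => ?_⟩
    have : N - l' = 0 := by omega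
    rw [this, pow_zero, one_mul]
    exact h i (by omega)
  | of_succ l hl ih =>
    obtain ⟨π, hπ⟩ := ih
    set l0 : Fin N := ⟨l, hl⟩ with hl0
    let A : Matrix (Fin N) (Fin N) k := fun s r => if s.val < l then φ (π r) (y s) else if s = l0 then 0 else if r = s then 1 else 0
    have hA : A.det = 0 := Matrix.det_eq_zero_of_row_eq_zero l0 fun j => by simp [A, hl0]
    obtain ⟨c, hc0, hc⟩ := Matrix.exists_mulVec_eq_zero_iff.2 hA
    have hc1 : ∀ r : Fin N, l < r.val → c r = 0 := by
      intro r hr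
      have := congrFun hc r
      simp only [Matrix.mulVec, dotProduct, A, Pi.zero_apply] at this
      have h1 : ¬ r.val < l := by omega
      have h2 : r ≠ l0 := by rintro rfl; simp [hl0] at hr
      simpa [h1, h2] using this
    have hc2 : ∀ x ∈ Vs k y l, ∑ r, c r * φ (π r) x = 0 := by
      intro x hx
      have hle : Vs k y l ≤ LinearMap.ker (∑ r, c r • φ (π r)) := by
        unfold Vs
        rw [Submodule.span_le]
        rintro _ ⟨s, hs, rfl⟩
        have := congrFun hc s
        simp only [Matrix.mulVec, dotProduct, A, Pi.zero_apply] at this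
        simp only [Set.mem_ofPred_eq] at hs
        simp only [hs, if_true] at this
        simp only [SetLike.mem_coe, LinearMap.mem_ker, LinearMap.coe_sum, Finset.sum_apply, LinearMap.smul_apply, smul_eq_mul]
        rw [← this]
        exact sum_congr rfl fun r _ => mul_comm _ _
      simpa using hle hx
    obtain ⟨rs, -, hrs⟩ := exists_max_image univ (fun r => D.f v (c r) * ω (π r)) ⟨l0, mem_univ _⟩
    have hcrs : c rs ≠ 0 := by
      obtain ⟨i, hi⟩ := Function.ne_iff.1 hc0
      intro h
      have h1 := hrs i (mem_univ i)
      rw [h, map_zero, zero_mul] at h1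
      exact absurd (mul_pos (D.f_pos v hi) (hω (π i))) (not_lt.2 h1)
    have hrsl : rs.val ≤ l := by
      by_contra! h
      exact hcrs (hc1 rs h)
    refine ⟨π * Equiv.swap rs l0, ?_⟩
    have hsw : ∀ r, π r = (π * Equiv.swap rs l0) (Equiv.swap rs l0 r) := by intro r; simp
    have hsl : ∀ l' , l < l' → ∀ r : Fin N, r.val < l' → (Equiv.swap rs l0 r).val < l' := by
      intro l' hl' r hr
      rcases eq_or_ne r rs with h | h
      · rw [h, Equiv.swap_apply_left]; exact hl'
      · rcases eq_or_ne r l0 with h' | h'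
        · rw [h', Equiv.swap_apply_right]; omega
        · rw [Equiv.swap_apply_of_ne_of_ne h h']; exact hr
    intro l' hl' x hx M hM h
    rcases hl'.eq_or_lt with rfl | hlt
    · have h1 : ∀ r : Fin N, r.val < l + 1 → r ≠ rs → D.f v (φ (π r) x) ≤ ω (π r) * M := by
        intro r hr hne
        rw [hsw r]
        apply h
        rcases eq_or_ne r l0 with h' | h'
        · rw [h', Equiv.swap_apply_right]
          refine lt_of_le_of_ne hrsl fun h3 => hne ?_
          rw [h']; exact Fin.ext h3.symm
        · rw [Equiv.swap_apply_of_ne_of_ne hne h']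
          refine lt_of_le_of_ne (by omega) fun h3 => h' (Fin.ext h3)
      have hrsb : D.f v (φ (π rs) x) ≤ ω (π rs) * ((N:ℝ) ^ 2 * M) := by
        have e := hc2 x hx
        rw [← add_sum_erase univ _ (mem_univ rs)] at e
        have e2 : c rs * φ (π rs) x = - ∑ r ∈ univ.erase rs, c r * φ (π r) x := eq_neg_of_add_eq_zero_left e
        have e3 := congrArg (D.f v) e2
        rw [D.f_neg, map_mul] at e3
        have b1 := D.sum_le' v (univ.erase rs) (fun r => c r * φ (π r) x) (D.f v (c rs) * ω (π rs) * M) N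
          (mul_nonneg (mul_nonneg (D.nonneg _ _) (hω _).le) hM) (by
            have : #(univ.erase rs) ≤ N := (card_erase_le).trans (by simp)
            exact_mod_cast this) (by
          intro r hr
          rw [map_mul]
          by_cases hrl : r.val < l + 1
          · calc D.f v (c r) * D.f v (φ (π r) x) ≤ D.f v (c r) * (ω (π r) * M) :=
                  mul_le_mul_of_nonneg_left (h1 r hrl (mem_erase.1 hr).1) (D.nonneg _ _)
              _ = (D.f v (c r) * ω (π r)) * M := by ring
              _ ≤ _ := mul_le_mul_of_nonneg_right (hrs r (mem_univ r)) hM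
          · rw [hc1 r (by omega), map_zero, zero_mul]
            exact mul_nonneg (mul_nonneg (D.nonneg _ _) (hω _).le) hM)
        rw [← e3] at b1
        have hpos := D.f_pos v hcrs
        refine le_of_mul_le_mul_left (a := D.f v (c rs)) ?_ hpos
        linarith
      intro i
      have hfin := hπ (l + 1) le_rfl x (Vs_mono y (by omega) hx) ((N:ℝ) ^ 2 * M) (by positivity) (by
        intro r hr
        rcases eq_or_ne r rs with h' | h'
        · rw [h']; exact hrsb
        · refine (h1 r hr h').trans (mul_le_mul_of_nonneg_left ?_ (hω _).le)
          nlinarith) i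
      have : N - l = N - (l + 1) + 1 := by omega
      rw [this, pow_succ, mul_assoc (((N:ℝ) ^ 2) ^ (N - (l + 1)))]
      exact hfin
    · refine hπ l' hlt x hx M hM fun r hr => ?_
      rw [hsw r]
      exact h _ (hsl l' hlt r hr)

/-- Davenport reweighting -/
theorem reweight (hN : 0 < N) (v0 : S) (L : S → Matrix (Fin N) (Fin N) k) (w : S → Fin N → ℝ) (hw : ∀ v i, 0 < w v i) (y : Fin N → Fin N → k) (θ : Fin N → ℝ) (hθ : ∀ r, 0 < θ r)
    (hmon : ∀ r r', r ≤ r' → θ r ≤ 2 * θ r') :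
    ∃ w' : S → Fin N → ℝ, (∀ v i, 0 < w' v i) ∧ (∀ v i, w' v i = w v i ∨ ∃ r, w' v i = w v i * θ r) ∧
      (∏ v, ∏ i, w' v i = (∏ v, ∏ i, w v i) * ∏ r, θ r) ∧
      ∀ (l : Fin N) x, x ∈ Vs k y (l + 1) → D.sz L w x ≤ (2 * ((N:ℝ) ^ 2) ^ N) * θ l * D.sz L w' x := by
  classical
  obtain ⟨π, hπ⟩ := D.dav hN v0 (fun i => (LinearMap.proj i).comp (L v0).mulVecLin) (w v0) (hw v0) y 0 (Nat.zero_le _)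
  have hN1 : (1:ℝ) ≤ (N:ℝ) ^ 2 := one_le_pow₀ (by exact_mod_cast hN)
  let w' : S → Fin N → ℝ := fun v i => w v i * if v = v0 then θ (π.symm i) else 1
  have hw' : ∀ v i, 0 < w' v i := fun v i => mul_pos (hw v i) (by split_ifs <;> [exact hθ _; exact one_pos])
  refine ⟨w', hw', ?_, ?_, ?_⟩
  · intro v i
    by_cases h : v = v0
    · right; exact ⟨π.symm i, by simp [w', h]⟩
    · left; simp [w', h]
  · simp only [w', prod_mul_distrib]
    congr 1
    rw [prod_eq_single v0]
    · simp [Equiv.prod_comp]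
    · intro v _ hv; simp [hv]
    · simp
  · intro l x hx
    have hsv : ∀ v, D.sv L w v x ≤ (if v = v0 then (2 * ((N:ℝ) ^ 2) ^ N) * θ l else 1) * D.sv L w' v x := by
      intro v
      have hs := D.sv_nonneg (L := L) hw' v x
      have hl := hθ l
      by_cases h : v = v0
      · subst h
        rw [if_pos rfl]
        refine D.sv_le hw v x _ (by positivity) fun i => ?_
        have := hπ (l + 1) (Nat.zero_le _) x hx (2 * θ l * D.sv L w' v x) (by positivity) (by
          intro r hr
          have h1 := D.le_sv (L := L) hw' v x (π r)
          simp only [w', if_true, Equiv.symm_apply_apply] at h1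
          refine h1.trans ?_
          rw [mul_assoc]
          refine mul_le_mul_of_nonneg_left ?_ (hw _ _).le
          exact mul_le_mul_of_nonneg_right (hmon r l (Fin.le_def.2 (by omega))) hs) i
        refine this.trans (mul_le_mul_of_nonneg_left ?_ (hw _ _).le)
        have h2 : ((N:ℝ) ^ 2) ^ (N - (l + 1)) ≤ ((N:ℝ) ^ 2) ^ N := pow_le_pow_right₀ hN1 (by omega)
        calc _ ≤ ((N:ℝ) ^ 2) ^ N * (2 * θ l * D.sv L w' v x) := mul_le_mul_of_nonneg_right h2 (by positivity)
          _ = _ := by ring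
      · rw [if_neg h, one_mul]
        refine D.sv_le hw v x _ hs fun i => ?_
        have h1 := D.le_sv (L := L) hw' v x i
        have h2 : w' v i = w v i := by simp [w', h]
        rwa [h2] at h1
    unfold sz
    refine (prod_le_prod (fun v _ => D.sv_nonneg hw _ _) fun v _ => hsv v).trans (le_of_eq ?_)
    rw [prod_mul_distrib]
    congr 1
    simp

theorem lam_mon {y : Fin N → Fin N → k} (hy : ∀ l, D.Int (y l)) (hyV : ∀ l : Fin N, y l ∉ Vs k y l)
    (hmin : ∀ (l : Fin N) x, D.Int x → x ∉ Vs k y l → D.sz L w (y l) ≤ 2 * D.sz L w x) (r r' : Fin N) (h : r ≤ r') :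
    D.sz L w (y r) ≤ 2 * D.sz L w (y r') :=
  hmin r _ (hy r') fun hc => hyV r' (Vs_mono y (by exact_mod_cast h) hc)

/-- Minkowski's second theorem -/
theorem mink2 (v0 : S) (hN : 0 < N) (L : S → Matrix (Fin N) (Fin N) k) (hL : ∀ v, (L v).det ≠ 0) : ∃ C : ℝ, 0 < C ∧ ∀ w : S → Fin N → ℝ, (∀ v i, 0 < w v i) →
    ∀ y : Fin N → Fin N → k, (∀ l, D.Int (y l)) → (∀ l : Fin N, y l ∉ Vs k y l) →
     (∀ (l : Fin N) x, D.Int x → x ∉ Vs k y l → D.sz L w (y l) ≤ 2 * D.sz L w x) →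
      (∏ l, D.sz L w (y l)) * ∏ v, ∏ i, w v i ≤ C := by
  obtain ⟨C, hC, h1⟩ := D.mink1 v0 hN L hL
  set B : ℝ := 2 * ((N:ℝ) ^ 2) ^ N with hB
  have hB0 : 0 < B := by positivity
  refine ⟨C * (2 * B) ^ N, by positivity, fun w hw y hy hyV hmin => ?_⟩
  have hyli := flag_li y hyV
  have hpos : ∀ l, 0 < D.sz L w (y l) := fun l => D.sz_pos hw hL (hyli.ne_zero l)
  obtain ⟨w', hw', -, hprod, hsz⟩ := D.reweight hN v0 L w hw y (fun l => D.sz L w (y l)) hpos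
    (fun r r' h => D.lam_mon hy hyV hmin r r' h)
  have h2 := h1 w' hw' (1 / (2 * B)) (by positivity) (by
    intro x hx hx0
    obtain ⟨l, hl1, hl2⟩ := exists_level y hyli hx0
    have h3 := hsz l x hl1
    have h4 := hmin l x hx hl2
    have h5 := hpos l
    rw [div_le_iff₀ (by positivity)]
    have h6 : D.sz L w (y l) * 1 ≤ D.sz L w (y l) * (D.sz L w' x * (2 * B)) := by
      rw [← hB] at h3; linarith
    exact le_of_mul_le_mul_left h6 h5)
  rw [hprod, div_pow, one_pow, div_mul_eq_mul_div, one_mul, div_le_iff₀ (by positivity)] at h2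
  linarith

end PD
end

end

section

open Finset

section
variable {k : Type*} [Field k] {S : Type*} [Fintype S] (D : PD k S) {N : ℕ}
namespace PD

theorem lam_bd (L : S → Matrix (Fin N) (Fin N) k) (hL : ∀ v, (L v).det ≠ 0) : ∃ C : ℝ, 1 ≤ C ∧ ∀ w : S → Fin N → ℝ, (∀ v i, 0 < w v i) →
    ∀ R : ℝ, 1 ≤ R → (∀ v i, w v i ≤ R ∧ R⁻¹ ≤ w v i) →
    ∀ y : Fin N → Fin N → k, (∀ l, D.Int (y l)) → (∀ l : Fin N, y l ∉ Vs k y l) →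
     (∀ (l : Fin N) x, D.Int x → x ∉ Vs k y l → D.sz L w (y l) ≤ 2 * D.sz L w x) →
     ∀ l, D.sz L w (y l) ≤ C * R ^ Fintype.card S ∧ 1 ≤ C * R ^ Fintype.card S * D.sz L w (y l) := by
  obtain ⟨cl, hcl, hl⟩ := D.liou L hL
  obtain ⟨Cu, hCu, hu⟩ := D.upper L
  refine ⟨1 + 2 * Cu ^ Fintype.card S + 1 / cl, ?_, ?_⟩
  · have : 0 < 2 * Cu ^ Fintype.card S + 1 / cl := by positivity
    linarith
  intro w hw R hR hwR y hy hyV hmin l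
  have hR0 : 0 < R := by linarith
  have hz := D.sz_pos (L := L) hw hL ((flag_li y hyV).ne_zero l)
  constructor
  · have hne : ∃ i, (Pi.single i 1 : Fin N → k) ∉ Vs k y l := by
      by_contra! hcon
      apply hyV l
      have : Vs k y l = ⊤ := by
        rw [eq_top_iff, ← (Pi.basisFun k (Fin N)).span_eq, Submodule.span_le]
        rintro _ ⟨i, rfl⟩
        rw [Pi.basisFun_apply]
        exact hcon i
      rw [this]; trivial
    obtain ⟨i, hi⟩ := hne
    have h1 := hmin l _ (fun j => by
      rw [Pi.single_apply]
      split_ifs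
      · exact one_mem _
      · exact zero_mem _) hi
    have h2 : D.sz L w (Pi.single i 1) ≤ (Cu * R) ^ Fintype.card S := by
      unfold sz
      calc _ ≤ ∏ _v : S, Cu * R := prod_le_prod (fun v _ => D.sv_nonneg hw _ _) fun v _ => by
            have := hu w hw R⁻¹ (by positivity) (fun v i => (hwR v i).2) i v
            rwa [div_inv_eq_mul] at this
        _ = _ := by rw [prod_const, card_univ]
    rw [mul_pow] at h2
    have h3 : 0 ≤ (1 + 1 / cl) * R ^ Fintype.card S := by positivity
    nlinarith
  · have h1 := hl w hw R hR0 (fun v i => (hwR v i).1) _ (hy l) ((flag_li y hyV).ne_zero l)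
    have h2 : 1 ≤ 1 / cl * (D.sz L w (y l) * R ^ Fintype.card S) := by
      rw [div_mul_eq_mul_div, one_mul, le_div_iff₀ hcl]; linarith
    have h3 : 0 ≤ (1 + 2 * Cu ^ Fintype.card S) * (D.sz L w (y l) * R ^ Fintype.card S) := by positivity
    nlinarith

theorem flat (v0 : S) (hN : 2 ≤ N) (L : S → Matrix (Fin N) (Fin N) k) (hL : ∀ v, (L v).det ≠ 0) : ∃ C : ℝ, 1 ≤ C ∧ ∀ w : S → Fin N → ℝ,
    (∀ v i, 0 < w v i) → ∀ p, D.Int p → p ≠ 0 → ∀ G, C ≤ G →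
    (∀ x, D.Int x → x ∉ Submodule.span k {p} → G * D.sz L w p ≤ D.sz L w x) →
    ∀ (a : Fin N) (R : ℝ), 1 ≤ R → (∀ v i, w v i ≤ R ∧ R⁻¹ ≤ w v i) →
    ∃ w' : S → Fin N → ℝ, (∀ v i, 0 < w' v i) ∧
      (∀ v i, w' v i ≤ C * R ^ (Fintype.card S + 1) ∧ 1 ≤ C * R ^ (Fintype.card S + 1) * w' v i) ∧
      G ≤ C * ∏ v, ∏ i, w' v i ∧
      ∃ y : Fin N → Fin N → k, (∀ l, D.Int (y l)) ∧ (Matrix.of y).det ≠ 0 ∧ (∃ c : k, c ≠ 0 ∧ y a = c • p) ∧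
        ∀ l, l ≠ a → (∏ r ∈ univ.erase l, D.sz L w' (y r)) * (∏ v, ∏ i, w' v i) ≤ C := by
  classical
  obtain ⟨c0, hc0, hdet⟩ := D.det_lower L hL
  obtain ⟨C2, hC2, hm2⟩ := D.mink2 v0 (by omega) L hL
  obtain ⟨Cl, hCl, hlam⟩ := D.lam_bd L hL
  set B : ℝ := 2 * ((N:ℝ) ^ 2) ^ N with hB
  have hN0 : (0:ℝ) < N := by exact_mod_cast (by omega : 0 < N)
  have hB0 : 0 < B := by positivity
  set C : ℝ := 3 + Cl + 2 / c0 + 2 * B * C2 + 2 * C2 * (2 * B) ^ N / c0 with hC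
  have p1 : 0 < 2 / c0 := by positivity
  have p2 : 0 < 2 * B * C2 := by positivity
  have p3 : 0 < 2 * C2 * (2 * B) ^ N / c0 := by positivity
  refine ⟨C, by linarith, ?_⟩
  intro w hw p hp hp0 G hG hgap a R hR hwR
  have hG0 : 0 < G := by linarith
  obtain ⟨y, hy, hyV, hmin⟩ := D.minima hL hw
  have hyli := flag_li y hyV
  have hpos : ∀ l, 0 < D.sz L w (y l) := fun l => D.sz_pos hw hL (hyli.ne_zero l)
  have hszp := D.sz_pos (L := L) hw hL hp0
  set i0 : Fin N := ⟨0, by omega⟩ with hi0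
  set i1 : Fin N := ⟨1, by omega⟩ with hi1
  have hl0 : D.sz L w (y i0) ≤ 2 * D.sz L w p := hmin i0 p hp (by
    rw [show ((i0 : Fin N) : ℕ) = 0 from rfl, Vs_zero]; simpa using hp0)
  have hy0 : y i0 ∈ Submodule.span k {p} := by
    by_contra hcon
    have := hgap _ (hy i0) hcon
    nlinarith
  have hV1 : Vs k y 1 = Submodule.span k {p} := by
    have h1 := Vs_succ (k := k) y i0
    rw [show ((i0 : Fin N) : ℕ) = 0 from rfl, Vs_zero, zero_add, bot_sup_eq] at h1
    rw [h1]
    obtain ⟨c, hc⟩ := Submodule.mem_span_singleton.1 hy0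
    have hc0 : c ≠ 0 := by rintro rfl; rw [zero_smul] at hc; exact hyli.ne_zero i0 hc.symm
    rw [← hc, Submodule.span_singleton_smul_eq (isUnit_iff_ne_zero.2 hc0)]
  have hl1 : G * D.sz L w p ≤ D.sz L w (y i1) := hgap _ (hy i1) (by
    rw [← hV1]; exact hyV i1)
  set θ : Fin N → ℝ := fun r => if r = i0 then D.sz L w (y i1) else D.sz L w (y r) with hθ
  have hmon0 := D.lam_mon hy hyV hmin
  have hge1 : ∀ r : Fin N, r ≠ i0 → i1 ≤ r := by
    intro r hr
    rw [Fin.le_def]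
    show 1 ≤ r.val
    by_contra h
    exact hr (Fin.ext (by simp [hi0]; omega))
  obtain ⟨w', hw', hwor, hprod, hsz⟩ := D.reweight (by omega) v0 L w hw y θ (fun r => by
      simp only [hθ]; split_ifs <;> exact hpos _) (by
      intro r r' h
      simp only [hθ]
      split_ifs with h1 h2 h2
      · have := hpos i1; linarith
      · exact hmon0 _ _ (hge1 r' h2)
      · exfalso
        have := hge1 r h1
        rw [h2] at h
        have := this.trans h
        rw [Fin.le_def] at this
        simp [hi0, hi1] at this
      · exact hmon0 _ _ h)
  have hW' : (∏ v, ∏ i, w' v i) * D.sz L w (y i0) = (∏ l, D.sz L w (y l)) * (∏ v, ∏ i, w v i) * D.sz L w (y i1) := by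
    rw [hprod, ← mul_prod_erase univ θ (mem_univ i0), ← mul_prod_erase univ (fun l => D.sz L w (y l)) (mem_univ i0)]
    have : ∏ x ∈ univ.erase i0, θ x = ∏ x ∈ univ.erase i0, D.sz L w (y x) :=
      prod_congr rfl fun r hr => by simp only [hθ]; rw [if_neg (mem_erase.1 hr).1]
    rw [this]
    simp only [hθ, if_true]
    ring
  have hW'0 : 0 < ∏ v, ∏ i, w' v i := prod_pos fun v _ => prod_pos fun i _ => hw' v i
  have hWG : c0 * G ≤ 2 * ∏ v, ∏ i, w' v i := by
    have h1 := hdet w hw y hy (li_det y hyli)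
    have h2 : c0 * D.sz L w (y i1) ≤ (∏ v, ∏ i, w' v i) * D.sz L w (y i0) := by
      rw [hW']; exact mul_le_mul_of_nonneg_right h1 (hpos _).le
    have h3 : c0 * (G * D.sz L w p) ≤ (∏ v, ∏ i, w' v i) * (2 * D.sz L w p) :=
      (mul_le_mul_of_nonneg_left hl1 hc0.le).trans (h2.trans (mul_le_mul_of_nonneg_left hl0 hW'0.le))
    exact le_of_mul_le_mul_right (by linarith) hszp
  have hoff : ∀ x, D.Int x → x ∉ Submodule.span k {p} → 1 ≤ 2 * B * D.sz L w' x := by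
    intro x hx hxp
    have hx0 : x ≠ 0 := by rintro rfl; exact hxp (zero_mem _)
    obtain ⟨l, hla, hlb⟩ := exists_level y hyli hx0
    have hl : l ≠ i0 := by
      rintro rfl
      apply hxp
      rw [← hV1]; exact hla
    have h3 := hsz l x hla
    have h4 := hmin l x hx hlb
    simp only [hθ, if_neg hl] at h3
    rw [← hB] at h3
    have h6 : D.sz L w (y l) * 1 ≤ D.sz L w (y l) * (2 * B * D.sz L w' x) := by linarith
    exact le_of_mul_le_mul_left h6 (hpos l)
  obtain ⟨y', hy', hyV', hmin'⟩ := D.minima hL hw'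
  have hyli' := flag_li y' hyV'
  have hpos' : ∀ l, 0 < D.sz L w' (y' l) := fun l => D.sz_pos hw' hL (hyli'.ne_zero l)
  have hM2 := hm2 w' hw' y' hy' hyV' hmin'
  have hex : ∃ l0, y' l0 ∈ Submodule.span k {p} := by
    by_contra! hcon
    have h1 : (1 / (2 * B)) ^ N ≤ ∏ l, D.sz L w' (y' l) := by
      calc (1 / (2 * B)) ^ N = ∏ _l : Fin N, (1 / (2 * B)) := by simp
        _ ≤ _ := prod_le_prod (fun _ _ => by positivity) fun l _ => by
            have := hoff _ (hy' l) (hcon l)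
            rw [div_le_iff₀ (by positivity)]; linarith
    rw [div_pow, one_pow] at h1
    have h2 : 1 / (2 * B) ^ N * (c0 * G) ≤ 2 * C2 := by
      calc _ ≤ (∏ l, D.sz L w' (y' l)) * (2 * ∏ v, ∏ i, w' v i) :=
            mul_le_mul h1 hWG (by positivity) (prod_nonneg fun l _ => (hpos' l).le)
        _ ≤ _ := by linarith
    rw [div_mul_eq_mul_div, one_mul, div_le_iff₀ (by positivity)] at h2
    have h3 : G ≤ 2 * C2 * (2 * B) ^ N / c0 := by
      rw [le_div_iff₀ hc0]; linarith
    linarith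
  obtain ⟨l0, hl0'⟩ := hex
  obtain ⟨c, hc⟩ := Submodule.mem_span_singleton.1 hl0'
  have hcne : c ≠ 0 := by rintro rfl; rw [zero_smul] at hc; exact hyli'.ne_zero l0 hc.symm
  refine ⟨w', hw', ?_, ?_, fun l => y' (Equiv.swap a l0 l), fun l => hy' _, ?_, ⟨c, hcne, by simp [hc]⟩, ?_⟩
  · -- bounds
    have hb := hlam w hw R hR hwR y hy hyV hmin
    have hR0 : 0 < R := by linarith
    have hθb : ∀ r, θ r ≤ Cl * R ^ Fintype.card S ∧ 1 ≤ Cl * R ^ Fintype.card S * θ r := by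
      intro r
      simp only [hθ]
      split_ifs
      · exact hb i1
      · exact hb r
    have hClR : 1 ≤ Cl * R ^ Fintype.card S := one_le_mul_of_one_le_of_one_le hCl (one_le_pow₀ hR)
    have hCC : Cl ≤ C := by linarith
    have hgo : ∀ v i t, 0 < t → t ≤ Cl * R ^ Fintype.card S → 1 ≤ Cl * R ^ Fintype.card S * t →
        w v i * t ≤ C * R ^ (Fintype.card S + 1) ∧ 1 ≤ C * R ^ (Fintype.card S + 1) * (w v i * t) := by
      intro v i t ht0 ht1 ht2
      have hRi : 1 ≤ R * w v i := by
        have := (hwR v i).2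
        rwa [inv_le_iff_one_le_mul₀' hR0] at this
      have hX : Cl * R ^ (Fintype.card S + 1) ≤ C * R ^ (Fintype.card S + 1) := mul_le_mul_of_nonneg_right hCC (by positivity)
      have e : Cl * R ^ (Fintype.card S + 1) = R * (Cl * R ^ Fintype.card S) := by ring
      constructor
      · refine le_trans ?_ hX
        rw [e]
        exact mul_le_mul (hwR v i).1 ht1 ht0.le hR0.le
      · refine le_trans ?_ (mul_le_mul_of_nonneg_right hX (mul_pos (hw v i) ht0).le)
        calc (1:ℝ) ≤ (R * w v i) * (Cl * R ^ Fintype.card S * t) := one_le_mul_of_one_le_of_one_le hRi ht2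
          _ = _ := by rw [e]; ring
    intro v i
    rcases hwor v i with h | ⟨r, h⟩
    · have := hgo v i 1 one_pos hClR (by linarith)
      rw [h]; simpa using this
    · rw [h]
      refine hgo v i (θ r) ?_ (hθb r).1 (hθb r).2
      simp only [hθ]; split_ifs <;> exact hpos _
  · have h1 : G ≤ 2 / c0 * ∏ v, ∏ i, w' v i := by
      rw [div_mul_eq_mul_div, le_div_iff₀ hc0]; linarith
    refine h1.trans (mul_le_mul_of_nonneg_right (by linarith) hW'0.le)
  · exact li_det _ (hyli'.comp _ (Equiv.injective _))
  · intro l hl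
    set y'' : Fin N → Fin N → k := fun l => y' (Equiv.swap a l0 l) with hy''
    have hli'' : LinearIndependent k y'' := hyli'.comp _ (Equiv.injective _)
    have hnot : y'' l ∉ Submodule.span k {p} := by
      intro hmem
      have ha : y'' a = c • p := by simp [hy'', hc]
      obtain ⟨c', hc'⟩ := Submodule.mem_span_singleton.1 hmem
      have h0 : c • y'' l - c' • y'' a = 0 := by
        rw [ha, ← hc', smul_smul, smul_smul, mul_comm, sub_self]
      have hpr := hli''.comp ![l, a] (by
        intro i j hij
        fin_cases i <;> fin_cases j <;> simp_all)
      have hpr2 := Fintype.linearIndependent_iff.1 hpr ![c, -c'] (by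
        simp only [Fin.sum_univ_two, Function.comp, Matrix.cons_val_zero, Matrix.cons_val_one]
        rw [neg_smul, ← sub_eq_add_neg]; exact h0) 0
      exact hcne hpr2
    have h1 := hoff _ (hy' _) hnot
    have h2 : ∏ r, D.sz L w' (y'' r) = ∏ r, D.sz L w' (y' r) :=
      Equiv.prod_comp (Equiv.swap a l0) (fun r => D.sz L w' (y' r))
    rw [← mul_prod_erase univ _ (mem_univ l)] at h2
    have hX : 0 ≤ (∏ r ∈ univ.erase l, D.sz L w' (y'' r)) * ∏ v, ∏ i, w' v i :=
      mul_nonneg (prod_nonneg fun r _ => D.sz_nonneg hw' _) hW'0.le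
    have h3 : D.sz L w' (y'' l) * ((∏ r ∈ univ.erase l, D.sz L w' (y'' r)) * ∏ v, ∏ i, w' v i) ≤ C2 := by
      rw [← mul_assoc, h2]; exact hM2
    have h4 : (∏ r ∈ univ.erase l, D.sz L w' (y'' r)) * ∏ v, ∏ i, w' v i ≤ 2 * B * C2 := by
      calc _ ≤ (2 * B * D.sz L w' (y'' l)) * ((∏ r ∈ univ.erase l, D.sz L w' (y'' r)) * ∏ v, ∏ i, w' v i) :=
            le_mul_of_one_le_left hX h1
        _ = 2 * B * (D.sz L w' (y'' l) * ((∏ r ∈ univ.erase l, D.sz L w' (y'' r)) * ∏ v, ∏ i, w' v i)) := by ring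
        _ ≤ _ := mul_le_mul_of_nonneg_left h3 (by positivity)
    linarith

end PD
end

end

section

open Finset

section
variable {k : Type*} [Field k] {S : Type*} [Fintype S] (D : PD k S) {N : ℕ}
namespace PD

theorem det_mem_A (M : Matrix (Fin N) (Fin N) k) (h : ∀ i j, M i j ∈ D.A) : M.det ∈ D.A := by
  rw [Matrix.det_apply]
  refine sum_mem fun σ _ => ?_
  rw [Units.smul_def]
  exact zsmul_mem (prod_mem fun i _ => h _ _) _

/-- bound for adjugate entries -/
theorem adj_le (L : S → Matrix (Fin N) (Fin N) k) (hL : ∀ v, (L v).det ≠ 0) (w : S → Fin N → ℝ) (hw : ∀ v i, 0 < w v i)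
    (y : Fin N → Fin N → k) (hy : ∀ l, y l ≠ 0) (v : S) (l i : Fin N) :
    D.f v ((L v * (Matrix.of y).transpose).adjugate l i) ≤
      (w v i)⁻¹ * (((N.factorial : ℝ)) ^ 2 * ((∏ i, w v i) * ∏ r ∈ univ.erase l, D.sv L w v (y r))) := by
  have hs : ∀ r, 0 < D.sv L w v (y r) := fun r => D.sv_pos hw hL v (hy r)
  rw [Matrix.adjugate_apply]
  have h1 := D.det_le v ((L v * (Matrix.of y).transpose).updateRow i (Pi.single l 1))
    (Function.update (w v) i (D.sv L w v (y l))⁻¹) (fun r => D.sv L w v (y r)) (by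
      intro i' r
      by_cases hi : i' = i
      · subst hi
        rw [Matrix.updateRow_self, Function.update_self, Pi.single_apply]
        split_ifs with h
        · subst h
          rw [map_one, inv_mul_cancel₀ (hs _).ne']
        · rw [map_zero]
          exact mul_nonneg (inv_nonneg.2 (hs _).le) (hs _).le
      · rw [Matrix.updateRow_ne hi, Function.update_of_ne hi]
        exact D.le_sv (L := L) hw v (y r) i')
  refine h1.trans (le_of_eq ?_)
  rw [prod_update_of_mem (mem_univ i), ← mul_prod_erase univ (fun r => D.sv L w v (y r)) (mem_univ l),
    ← mul_prod_erase univ (w v) (mem_univ i), sdiff_singleton_eq_erase]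
  have := (hs l).ne'
  have := (hw v i).ne'
  field_simp

theorem flatDual (v0 : S) (hN : 2 ≤ N) (L : S → Matrix (Fin N) (Fin N) k) (hL : ∀ v, (L v).det ≠ 0) : ∃ C : ℝ, 1 ≤ C ∧ ∀ w : S → Fin N → ℝ,
    (∀ v i, 0 < w v i) → ∀ p, D.Int p → ∀ a : Fin N, p a ≠ 0 → ∀ G, C ≤ G →
    (∀ x, D.Int x → x ∉ Submodule.span k {p} → G * D.sz L w p ≤ D.sz L w x) →
    ∀ R : ℝ, 1 ≤ R → (∀ v i, w v i ≤ R ∧ R⁻¹ ≤ w v i) →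
    ∃ w' : S → Fin N → ℝ, (∀ v i, 0 < w' v i) ∧
      (∀ v i, w' v i ≤ C * R ^ (Fintype.card S + 1) ∧ 1 ≤ C * R ^ (Fintype.card S + 1) * w' v i) ∧
      G ≤ C * ∏ v, ∏ i, w' v i ∧
      ∃ (Z : Matrix (Fin N) (Fin N) k) (ρ : S → Fin N → ℝ), Z.det ≠ 0 ∧ (∀ i l, Z i l ∈ D.A) ∧ (∀ v l, 0 ≤ ρ v l) ∧
        (∀ v i l, D.f v ((((L v)⁻¹).transpose * Z) i l) ≤ (w' v i)⁻¹ * ρ v l) ∧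
        (∀ l, l ≠ a → ∏ v, ρ v l ≤ C) ∧ (∀ v, ρ v a ≤ C * R ^ (Fintype.card S + 1)) ∧
        (∀ i, Z i a = if i = a then 1 else 0) ∧ (∀ l, l ≠ a → ∑ i, p i * Z i l = 0) := by
  classical
  obtain ⟨C0, hC0, hflat⟩ := D.flat v0 hN L hL
  obtain ⟨H, hH, hLH⟩ := D.bdd_all (fun x : S × Fin N × Fin N => (L x.1)⁻¹ x.2.1 x.2.2)
  have hH' : (1:ℝ) ≤ H := by exact_mod_cast hH
  set K : ℝ := ∏ v : S, ((N.factorial : ℝ)) ^ 2 / D.f v (L v).det with hK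
  have hdp : ∀ v, 0 < D.f v (L v).det := fun v => D.f_pos v (hL v)
  have hNf : (0:ℝ) < N.factorial := by exact_mod_cast N.factorial_pos
  have hK0 : 0 < K := prod_pos fun v _ => div_pos (by positivity) (hdp v)
  set C : ℝ := C0 + H * C0 + K * C0 with hC
  have hp1 : 0 < K * C0 := by positivity
  have hp2 : 0 < (H:ℝ) * C0 := by positivity
  have hCC : C0 ≤ C := by linarith
  refine ⟨C, by linarith, ?_⟩
  intro w hw p hp a hpa G hG hgap R hR hwR
  have hp0 : p ≠ 0 := by rintro rfl; exact hpa rfl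
  obtain ⟨w', hw', hb, hGw, y, hy, hdet, ⟨c, hc, hyc⟩, hprod⟩ := hflat w hw p hp hp0 G (hCC.trans hG) hgap a R hR hwR
  have hRp : 0 < R ^ (Fintype.card S + 1) := by positivity
  have hX : C0 * R ^ (Fintype.card S + 1) ≤ C * R ^ (Fintype.card S + 1) := mul_le_mul_of_nonneg_right hCC hRp.le
  have hy0 : ∀ l, y l ≠ 0 := fun l h => hdet (Matrix.det_eq_zero_of_row_eq_zero l fun j => by
    rw [Matrix.of_apply, h]; rfl)
  set Y : Matrix (Fin N) (Fin N) k := (Matrix.of y).transpose with hY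
  have hYdet : Y.det ≠ 0 := by rw [hY, Matrix.det_transpose]; exact hdet
  set Zt : Matrix (Fin N) (Fin N) k := Y.adjugate.updateRow a (Pi.single a 1) with hZt
  have hZa : ∀ i, Zt a i = if i = a then 1 else 0 := fun i => by
    rw [hZt, Matrix.updateRow_self, Pi.single_apply]
  have hZl : ∀ l, l ≠ a → ∀ i, Zt l i = Y.adjugate l i := fun l hl i => by
    rw [hZt, Matrix.updateRow_ne hl]
  refine ⟨w', hw', fun v i => ⟨(hb v i).1.trans hX, (hb v i).2.trans (mul_le_mul_of_nonneg_right hX (hw' v i).le)⟩,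
    hGw.trans (mul_le_mul_of_nonneg_right hCC (prod_nonneg fun v _ => prod_nonneg fun i _ => (hw' v i).le)),
    Zt.transpose, fun v l => if l = a then H * (C0 * R ^ (Fintype.card S + 1)) else
      ((N.factorial : ℝ)) ^ 2 / D.f v (L v).det * ((∏ i, w' v i) * ∏ r ∈ univ.erase l, D.sv L w' v (y r)), ?_, ?_, ?_, ?_, ?_, ?_, ?_, ?_⟩
  · rw [Matrix.det_transpose, hZt, ← Matrix.adjugate_apply, Matrix.adjugate_adjugate _ (by rw [Fintype.card_fin]; omega),
      Matrix.smul_apply, smul_eq_mul]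
    refine mul_ne_zero (pow_ne_zero _ hYdet) ?_
    rw [hY, Matrix.transpose_apply, Matrix.of_apply, hyc, Pi.smul_apply, smul_eq_mul]
    exact mul_ne_zero hc hpa
  · intro i l
    rw [Matrix.transpose_apply]
    by_cases hl : l = a
    · rw [hl, hZa]; split_ifs
      · exact one_mem _
      · exact zero_mem _
    · rw [hZl l hl, Matrix.adjugate_apply]
      refine D.det_mem_A _ fun i' j' => ?_
      rw [Matrix.updateRow_apply]
      split_ifs
      · rw [Pi.single_apply]; split_ifs
        · exact one_mem _
        · exact zero_mem _
      · exact hy j' i'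
  · intro v l
    dsimp only
    split_ifs
    · positivity
    · exact mul_nonneg (div_nonneg (by positivity) (D.nonneg _ _)) (mul_nonneg (prod_nonneg fun i _ => (hw' v i).le)
        (prod_nonneg fun r _ => D.sv_nonneg hw' _ _))
  · intro v i l
    dsimp only
    rw [← Matrix.transpose_mul, Matrix.transpose_apply]
    split_ifs with hl
    · rw [hl, Matrix.mul_apply, sum_eq_single a (fun b _ hb => by rw [hZa, if_neg hb, zero_mul]) (by simp), hZa, if_pos rfl, one_mul]
      have h1 : D.f v ((L v)⁻¹ a i) ≤ H := hLH v (v, a, i)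
      refine h1.trans ?_
      rw [inv_mul_eq_div, le_div_iff₀ (hw' v i)]
      exact mul_le_mul_of_nonneg_left (hb v i).1 (by positivity)
    · have e : (Zt * (L v)⁻¹) l i = ((L v).det)⁻¹ * (L v * Y).adjugate l i := by
        rw [Matrix.adjugate_mul_distrib, Matrix.mul_apply, Matrix.mul_apply, mul_sum]
        refine sum_congr rfl fun j _ => ?_
        rw [hZl l hl, Matrix.inv_def, Matrix.smul_apply, Ring.inverse_eq_inv', smul_eq_mul]
        ring
      rw [e, map_mul, map_inv₀]
      have := D.adj_le L hL w' hw' y hy0 v l i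
      refine (mul_le_mul_of_nonneg_left this (inv_nonneg.2 (D.nonneg _ _))).trans (le_of_eq ?_)
      ring
  · intro l hl
    simp only [if_neg hl]
    rw [prod_mul_distrib, ← hK, prod_mul_distrib, prod_comm]
    have h1 := hprod l hl
    have e : (∏ y_1, ∏ x, w' x y_1) = ∏ v, ∏ i, w' v i := prod_comm
    have e2 : (∏ x, ∏ r ∈ univ.erase l, D.sv L w' x (y r)) = ∏ r ∈ univ.erase l, D.sz L w' (y r) := prod_comm
    rw [e, e2, mul_comm (∏ v, ∏ i, w' v i)]
    calc _ ≤ K * C0 := mul_le_mul_of_nonneg_left h1 hK0.le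
      _ ≤ C := by linarith
  · intro v
    simp only [if_true]
    rw [← mul_assoc]
    exact mul_le_mul_of_nonneg_right (by linarith) hRp.le
  · intro i; rw [Matrix.transpose_apply, hZa]
  · intro l hl
    have h1 : (Y.adjugate * Y) l a = 0 := by
      rw [Matrix.adjugate_mul, Matrix.smul_apply, Matrix.one_apply_ne hl, smul_zero]
    rw [Matrix.mul_apply] at h1
    have h2 : c * ∑ i, p i * Zt.transpose i l = 0 := by
      rw [← h1, mul_sum]
      refine sum_congr rfl fun i _ => ?_
      rw [Matrix.transpose_apply, hZl l hl, hY, Matrix.transpose_apply, Matrix.of_apply, hyc, Pi.smul_apply, smul_eq_mul]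
      ring
    exact (mul_eq_zero.1 h2).resolve_left hc

end PD
end

end

section

open Finset Filter Topology

section
variable {k : Type*} [Field k] {S : Type*} [Fintype S] (D : PD k S) {N : ℕ}
namespace PD

theorem ev_const {Ω : Type*} (U : Filter Ω) {ℓ : Ω → ℝ} (hℓ : Tendsto ℓ U atTop) (C : ℝ) {ε : ℝ} (hε : 0 < ε) :
    ∀ᶠ ω in U, C ≤ ε * ℓ ω := by
  filter_upwards [hℓ.eventually_ge_atTop (C / ε)] with ω h
  rw [div_le_iff₀ hε] at h; linarith

theorem ev_exp {Ω : Type*} (U : Filter Ω) {ℓ : Ω → ℝ} (hℓ : Tendsto ℓ U atTop) (C : ℝ) {ε : ℝ} (hε : 0 < ε) :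
    ∀ᶠ ω in U, C ≤ Real.exp (ε * ℓ ω) := by
  filter_upwards [ev_const U hℓ C hε] with ω h
  linarith [Real.add_one_le_exp (ε * ℓ ω)]

theorem ev_seq {Ω : Type*} (U : Ultrafilter Ω) {ℓ : Ω → ℝ} (hℓ : Tendsto ℓ U atTop) (κ : ℝ) {P : Ω → Prop}
    (h : ∀ᶠ ω in (U : Filter Ω), P ω) : ∃ q : ℕ → Ω, (∀ n, P (q n)) ∧ ∀ m n, m < n → κ * ℓ (q m) ≤ ℓ (q n) := by
  refine exists_seq_of_forall_finset_exists P (fun ω ω' => κ * ℓ ω ≤ ℓ ω') fun T _ => ?_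
  have h1 : ∀ᶠ ω in (U : Filter Ω), ∀ x ∈ T, κ * ℓ x ≤ ℓ ω := by
    rw [Finset.eventually_all]
    intro x _
    exact hℓ.eventually_ge_atTop _
  exact (h.and h1).exists

theorem core_b [CharZero k] (v0 : S) (hN : 2 ≤ N) (L : S → Matrix (Fin N) (Fin N) k) (hL : ∀ v, (L v).det ≠ 0)
    {Ω : Type*} (U : Ultrafilter Ω) (ℓ : Ω → ℝ) (hℓ : Tendsto ℓ U atTop) (B : ℝ) (hB : 0 ≤ B) (w : Ω → S → Fin N → ℝ)
    (hw : ∀ᶠ ω in (U : Filter Ω), ∀ v i, 0 < w ω v i ∧ w ω v i ≤ Real.exp (B * ℓ ω) ∧ (Real.exp (B * ℓ ω))⁻¹ ≤ w ω v i)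
    (p : Ω → Fin N → k) (hp : ∀ᶠ ω in (U : Filter Ω), D.Int (p ω)) (g : ℝ) (hg : 0 < g)
    (hgap : ∀ᶠ ω in (U : Filter Ω), ∀ x, D.Int x → x ∉ Submodule.span k {p ω} →
      Real.exp (g * ℓ ω) * D.sz L (w ω) (p ω) ≤ D.sz L (w ω) x)
    (a b : Fin N) (hab : a ≠ b) (hpa : ∀ᶠ ω in (U : Filter Ω), p ω a ≠ 0) (x y : Ω → k)
    (hxy : ∀ ω, x ω ∈ D.A ∧ y ω ∈ D.A ∧ y ω ≠ 0 ∧ ∃ s ∈ D.A, ∃ t ∈ D.A, s * x ω + t * y ω = 1)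
    (hξ : ∀ ω, - p ω b / p ω a = x ω / y ω) (η : ℝ) (hη : 0 < η)
    (hht : ∀ᶠ ω in (U : Filter Ω), Real.exp (η * ℓ ω) ≤ D.ht (x ω) (y ω)) : False := by
  classical
  obtain ⟨C, hC, hfd⟩ := D.flatDual v0 hN L hL
  set s : ℕ := Fintype.card S with hs
  set B1 : ℝ := B * (s + 1) + 1 with hB1
  have hB10 : 0 < B1 := by positivity
  have hE : ∀ᶠ ω in (U : Filter Ω), ∃ d : (S → Fin N → ℝ) × Matrix (Fin N) (Fin N) k × (S → Fin N → ℝ),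
      (∀ v i, 0 < d.1 v i) ∧ (∀ v i, Real.exp (- (B1 * ℓ ω)) ≤ d.1 v i ∧ d.1 v i ≤ Real.exp (B1 * ℓ ω)) ∧
      Real.exp (g / 2 * ℓ ω) ≤ ∏ v, ∏ i, d.1 v i ∧
      d.2.1.det ≠ 0 ∧ (∀ i l, d.2.1 i l ∈ D.A) ∧ (∀ v l, 0 ≤ d.2.2 v l) ∧
        (∀ v i l, D.f v ((((L v)⁻¹).transpose * d.2.1) i l) ≤ (d.1 v i)⁻¹ * d.2.2 v l) ∧
        (∀ l, l ≠ a → ∏ v, d.2.2 v l ≤ C) ∧ (∀ v, d.2.2 v a ≤ Real.exp (B1 * ℓ ω)) ∧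
        (∀ i, d.2.1 i a = if i = a then 1 else 0) ∧ (∀ l, l ≠ a → ∑ i, p ω i * d.2.1 i l = 0) := by
    filter_upwards [hw, hp, hgap, hpa, ev_exp _ hℓ C hg, ev_exp _ hℓ C one_pos, ev_exp _ hℓ C (half_pos hg), hℓ.eventually_ge_atTop 0] with ω h1 h2 h3 h4 h5 h6 h7 h8
    obtain ⟨w', q1, q2, q3, Z, ρ, q4, q5, q6, q7, q8, q9, q10, q11⟩ := hfd (w ω) (fun v i => (h1 v i).1) (p ω) h2 a h4
      (Real.exp (g * ℓ ω)) h5 h3 (Real.exp (B * ℓ ω)) (Real.one_le_exp (by positivity)) (fun v i => (h1 v i).2)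
    have hR : C * Real.exp (B * ℓ ω) ^ (s + 1) ≤ Real.exp (B1 * ℓ ω) := by
      have : Real.exp (B1 * ℓ ω) = Real.exp (1 * ℓ ω) * Real.exp (B * ℓ ω) ^ (s + 1) := by
        rw [← Real.exp_nat_mul, ← Real.exp_add]
        congr 1; push_cast; rw [hB1]; ring
      rw [this]
      exact mul_le_mul_of_nonneg_right h6 (by positivity)
    refine ⟨(w', Z, ρ), q1, ?_, ?_, q4, q5, q6, q7, q8, fun v => (q9 v).trans hR, q10, q11⟩
    · intro v i
      refine ⟨?_, (q2 v i).1.trans hR⟩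
      rw [Real.exp_neg, inv_le_iff_one_le_mul₀' (Real.exp_pos _)]
      exact (q2 v i).2.trans (mul_le_mul_of_nonneg_right hR (q1 v i).le)
    · have : Real.exp (g * ℓ ω) = Real.exp (g / 2 * ℓ ω) * Real.exp (g / 2 * ℓ ω) := by
        rw [← Real.exp_add]; congr 1; ring
      rw [this] at q3
      have h9 : Real.exp (g / 2 * ℓ ω) * Real.exp (g / 2 * ℓ ω) ≤ Real.exp (g / 2 * ℓ ω) * ∏ v, ∏ i, w' v i :=
        q3.trans (mul_le_mul_of_nonneg_right h7 (prod_nonneg fun v _ => prod_nonneg fun i _ => (q1 v i).le))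
      exact le_of_mul_le_mul_left h9 (Real.exp_pos _)
  obtain ⟨d, hd⟩ := Filter.skolem.1 hE
  -- limits
  have hlim : ∀ v i, ∃ c : ℝ, Tendsto (fun ω => - Real.log ((d ω).1 v i) / ℓ ω) U (𝓝 c) := by
    intro v i
    have hmem : ∀ᶠ ω in (U : Filter Ω), - Real.log ((d ω).1 v i) / ℓ ω ∈ Set.Icc (-B1) B1 := by
      filter_upwards [hd, hℓ.eventually_gt_atTop 0] with ω h1 h2
      obtain ⟨q1, q2, -⟩ := h1
      have h3 := Real.log_le_log (Real.exp_pos _) (q2 v i).1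
      have h4 := Real.log_le_log (q1 v i) (q2 v i).2
      rw [Real.log_exp] at h3 h4
      rw [Set.mem_Icc, le_div_iff₀ h2, div_le_iff₀ h2]
      constructor <;> linarith
    obtain ⟨c, -, hc⟩ := isCompact_Icc.ultrafilter_le_nhds (U.map (fun ω => - Real.log ((d ω).1 v i) / ℓ ω)) (by
      rw [Filter.le_principal_iff]; exact hmem)
    exact ⟨c, hc⟩
  choose c hc using hlim
  have hcsum : ∑ v, ∑ i, c v i ≤ - (g / 2) := by
    have h1 : Tendsto (fun ω => ∑ v, ∑ i, - Real.log ((d ω).1 v i) / ℓ ω) U (𝓝 (∑ v, ∑ i, c v i)) :=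
      tendsto_finsetSum _ fun v _ => tendsto_finsetSum _ fun i _ => hc v i
    refine le_of_tendsto h1 ?_
    filter_upwards [hd, hℓ.eventually_gt_atTop 0] with ω h1 h2
    obtain ⟨q1, q2, q3, -⟩ := h1
    have h3 := Real.log_le_log (Real.exp_pos _) q3
    rw [Real.log_exp, Real.log_prod (fun v _ => (prod_pos fun i _ => q1 v i).ne'),
      sum_congr rfl (fun v _ => Real.log_prod (fun i _ => (q1 v i).ne'))] at h3
    have e : ∑ v, ∑ i, - Real.log ((d ω).1 v i) / ℓ ω = - (∑ v, ∑ i, Real.log ((d ω).1 v i)) / ℓ ω := by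
      rw [← sum_neg_distrib, sum_div]
      refine sum_congr rfl fun v _ => ?_
      rw [← sum_neg_distrib, sum_div]
    rw [e, div_le_iff₀ h2]
    linarith
  have hMd : ∀ v, (((L v)⁻¹).transpose).det ≠ 0 := fun v => by
    rw [Matrix.det_transpose, Matrix.det_nonsing_inv, Ring.inverse_eq_inv']
    exact inv_ne_zero (hL v)
  obtain ⟨ε, hε, m, K, hK, κ, hκ, hmach⟩ := D.machine N hN (fun v => ((L v)⁻¹).transpose) hMd a b hab c (g / 2) (half_pos hg) hcsum
    (B1 * s) (by positivity) η hη
  have hgood : ∀ᶠ ω in (U : Filter Ω), (K ≤ ℓ ω ∧ (∀ v i, ((d ω).1 v i)⁻¹ ≤ Real.exp ((c v i + ε) * ℓ ω)) ∧ C ≤ Real.exp (ε * ℓ ω) ∧ p ω a ≠ 0 ∧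
      Real.exp (η * ℓ ω) ≤ D.ht (x ω) (y ω)) := by
    have h1 : ∀ᶠ ω in (U : Filter Ω), ∀ v i, - Real.log ((d ω).1 v i) / ℓ ω < c v i + ε := by
      rw [eventually_all]; intro v
      rw [eventually_all]; intro i
      exact (hc v i).eventually_lt_const (by linarith)
    filter_upwards [h1, hd, hpa, hht, ev_exp _ hℓ C hε, hℓ.eventually_ge_atTop K] with ω h1 h2 h3 h4 h5 h6
    refine ⟨h6, ?_, h5, h3, h4⟩
    intro v i
    have h7 := h1 v i
    have h8 := h2.1 v i
    rw [div_lt_iff₀ (by linarith)] at h7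
    rw [← Real.exp_log (inv_pos.2 h8), Real.log_inv]
    exact Real.exp_le_exp.2 h7.le
  obtain ⟨seq, hP, hr⟩ := ev_seq U hℓ κ (hgood.and hd)
  refine hmach (fun j => ℓ (seq j)) (fun j v i => ((d (seq j)).1 v i)⁻¹) (fun j => (d (seq j)).2.1) (fun j => (d (seq j)).2.2)
    (fun j => p (seq j)) (fun j => x (seq j)) (fun j => y (seq j)) (fun j => (hP j).1.1) (fun i j hij => hr i j hij)
    (fun j v i => ⟨inv_nonneg.2 ((hP j).2.1 v i).le, (hP j).1.2.1 v i⟩) (fun j => (hP j).2.2.2.2.1) (fun j => (hP j).2.2.2.2.2.1)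
    (fun j => (hP j).2.2.2.2.2.2.1) (fun j => (hP j).2.2.2.2.2.2.2.1)
    (fun j l hl => ((hP j).2.2.2.2.2.2.2.2.1 l hl).trans (hP j).1.2.2.1) (fun j => ?_) (fun j => (hP j).2.2.2.2.2.2.2.2.2.2.1)
    (fun j => (hP j).2.2.2.2.2.2.2.2.2.2.2) (fun j => (hP j).1.2.2.2.1) (fun j => hxy _) (fun j => hξ _) (fun j => (hP j).1.2.2.2.2)
  calc ∏ v, (d (seq j)).2.2 v a ≤ ∏ _v : S, Real.exp (B1 * ℓ (seq j)) :=
        prod_le_prod (fun v _ => (hP j).2.2.2.2.2.2.1 v a) fun v _ => (hP j).2.2.2.2.2.2.2.2.2.1 v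
    _ = _ := by
        rw [prod_const, card_univ, ← hs, ← Real.exp_nat_mul]; congr 1; ring

end PD
end

end

section

open Finset Filter Topology

section
variable {k : Type*} [Field k] {S : Type*} [Fintype S] (D : PD k S) {N : ℕ}
namespace PD

theorem ev_fin {Ω α : Type*} [Finite α] (U : Ultrafilter Ω) (f : Ω → α) : ∃ c, ∀ᶠ ω in (U : Filter Ω), f ω = c := by
  classical
  by_contra! h
  have h1 : ∀ᶠ ω in (U : Filter Ω), ∀ c, ¬ f ω = c := by
    rw [eventually_all]
    intro c
    exact h c
  obtain ⟨ω, hω⟩ := h1.exists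
  exact hω _ rfl

/-- lower bound for nonzero values of linear forms -/
theorem form_lower (L : S → Matrix (Fin N) (Fin N) k) : ∃ K : ℝ, 1 ≤ K ∧ ∀ (x : Fin N → k) (M : S → ℝ), D.Int x →
    (∀ v i, D.f v (x i) ≤ M v) → ∀ v i, (L v).mulVec x i ≠ 0 → M v ≤ K * (∏ v, M v) * D.f v ((L v).mulVec x i) := by
  classical
  obtain ⟨δ, hδ, hδ0, hδL⟩ := D.den_all univ (fun x : S × Fin N × Fin N => L x.1 x.2.1 x.2.2)
  obtain ⟨H, hH, hLH⟩ := D.bdd_all (fun x : S × Fin N × Fin N => δ * L x.1 x.2.1 x.2.2)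
  obtain ⟨H2, hH2, hH2'⟩ := D.bdd_all (fun _ : Unit => δ)
  have hH' : (1:ℝ) ≤ H := by exact_mod_cast hH
  have hH2'' : (1:ℝ) ≤ H2 := by exact_mod_cast hH2
  set T : ℝ := max 1 ((N:ℝ) ^ 2 * H) with hT
  have hT1 : 1 ≤ T := le_max_left _ _
  refine ⟨H2 * T ^ Fintype.card S, one_le_mul_of_one_le_of_one_le hH2'' (one_le_pow₀ hT1), ?_⟩
  intro x M hx hM v i hne
  have hM0 : ∀ v, 0 ≤ M v := fun v => (D.nonneg v (x i)).trans (hM v i)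
  have e : δ * (L v).mulVec x i = ∑ j, (δ * L v i j) * x j := by
    rw [Matrix.mulVec, dotProduct, mul_sum]
    exact sum_congr rfl fun j _ => by ring
  have h1 : δ * (L v).mulVec x i ∈ D.A := by
    rw [e]
    exact sum_mem fun j _ => mul_mem (D.OA (hδL (v, i, j) (mem_univ _))) (hx j)
  have h2 : ∀ v', D.f v' (δ * (L v).mulVec x i) ≤ T * M v' := by
    intro v'
    rw [e]
    have := D.sum_le v' univ (fun j => (δ * L v i j) * x j) (H * M v') (fun j _ => by
      rw [map_mul]
      exact mul_le_mul (hLH v' (v, i, j)) (hM v' j) (D.nonneg _ _) (by positivity))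
    rw [card_univ, Fintype.card_fin, ← mul_assoc] at this
    exact this.trans (mul_le_mul_of_nonneg_right (le_max_right _ _) (hM0 v'))
  have h3 := D.prod_ge _ h1 (mul_ne_zero hδ0 hne)
  rw [← mul_prod_erase univ _ (mem_univ v)] at h3
  have h4 : ∏ v' ∈ univ.erase v, D.f v' (δ * (L v).mulVec x i) ≤ T ^ Fintype.card S * ∏ v' ∈ univ.erase v, M v' := by
    calc _ ≤ ∏ v' ∈ univ.erase v, T * M v' := prod_le_prod (fun _ _ => D.nonneg _ _) fun v' _ => h2 v'
      _ = T ^ (#(univ.erase v)) * ∏ v' ∈ univ.erase v, M v' := by rw [prod_mul_distrib, prod_const]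
      _ ≤ _ := mul_le_mul_of_nonneg_right (pow_le_pow_right₀ hT1 (by
          rw [← card_univ]; exact card_le_card (erase_subset _ _))) (prod_nonneg fun _ _ => hM0 _)
  rw [map_mul] at h3
  have h5 : 1 ≤ (H2 * D.f v ((L v).mulVec x i)) * (T ^ Fintype.card S * ∏ v' ∈ univ.erase v, M v') := by
    refine h3.trans (mul_le_mul (mul_le_mul_of_nonneg_right (hH2' v ()) (D.nonneg _ _)) h4 (prod_nonneg fun _ _ => D.nonneg _ _) ?_)
    exact mul_nonneg (by positivity) (D.nonneg _ _)
  rw [← mul_prod_erase univ M (mem_univ v)]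
  calc M v = M v * 1 := (mul_one _).symm
    _ ≤ M v * _ := mul_le_mul_of_nonneg_left h5 (hM0 v)
    _ = _ := by ring

/-- the primitive-ish vector attached to ratios -/
theorem core_a (v0 : S) (L : S → Matrix (Fin N) (Fin N) k) (hL : ∀ v, (L v).det ≠ 0)
    {Ω : Type*} (U : Ultrafilter Ω) (ℓ : Ω → ℝ) (hℓ : Tendsto ℓ U atTop) (w : Ω → S → Fin N → ℝ)
    (hw : ∀ᶠ ω in (U : Filter Ω), ∀ v i, 0 < w ω v i)
    (p : Ω → Fin N → k) (hp : ∀ᶠ ω in (U : Filter Ω), D.Int (p ω)) (g : ℝ) (hg : 0 < g)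
    (hgap : ∀ᶠ ω in (U : Filter Ω), ∀ x, D.Int x → x ∉ Submodule.span k {p ω} →
      Real.exp (g * ℓ ω) * D.sz L (w ω) (p ω) ≤ D.sz L (w ω) x)
    (a : Fin N) (hpa : ∀ᶠ ω in (U : Filter Ω), p ω a ≠ 0) (x y : Ω → Fin N → k)
    (hxy : ∀ ω b, x ω b ∈ D.A ∧ y ω b ∈ D.A ∧ y ω b ≠ 0)
    (hξ : ∀ᶠ ω in (U : Filter Ω), ∀ b, p ω b / p ω a = x ω b / y ω b) (η : ℝ) (hη : η * (N * (Fintype.card S + 1)) ≤ g / 2)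
    (hht : ∀ᶠ ω in (U : Filter Ω), ∀ b, D.ht (x ω b) (y ω b) ≤ Real.exp (η * ℓ ω)) :
    ∃ p0, p0 ≠ 0 ∧ ∀ᶠ ω in (U : Filter Ω), p ω ∈ Submodule.span k {p0} := by
  classical
  obtain ⟨K, hK, hlow⟩ := D.form_lower L
  set s : ℕ := Fintype.card S with hs
  set p' : Ω → Fin N → k := fun ω i => x ω i * ∏ b ∈ univ.erase i, y ω b with hp'
  set M : Ω → S → ℝ := fun ω v => ∏ b, max (D.f v (x ω b)) (D.f v (y ω b)) with hM
  set t : Ω → k := fun ω => (∏ b, y ω b) / p ω a with ht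
  have hYne : ∀ ω, ∏ b, y ω b ≠ 0 := fun ω => prod_ne_zero_iff.2 fun b _ => (hxy ω b).2.2
  have hp'A : ∀ ω, D.Int (p' ω) := fun ω i => mul_mem (hxy ω i).1 (prod_mem fun b _ => (hxy ω b).2.1)
  have hp'M : ∀ ω v i, D.f v (p' ω i) ≤ M ω v := by
    intro ω v i
    simp only [hp', hM]
    rw [map_mul, map_prod, ← mul_prod_erase univ _ (mem_univ i)]
    exact mul_le_mul (le_max_left _ _) (prod_le_prod (fun _ _ => D.nonneg _ _) fun _ _ => le_max_right _ _)
      (prod_nonneg fun _ _ => D.nonneg _ _) ((D.nonneg _ _).trans (le_max_left _ _))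
  have hMpos : ∀ ω v, 0 < M ω v := fun ω v => prod_pos fun b _ => lt_max_of_lt_right (D.f_pos v (hxy ω b).2.2)
  have hMprod : ∀ ω, ∏ v, M ω v = ∏ b, D.ht (x ω b) (y ω b) := fun ω => prod_comm
  have hMge : ∀ ω, 1 ≤ ∏ v, M ω v := by
    intro ω
    refine (D.prod_ge _ (prod_mem fun b (_ : b ∈ univ) => (hxy ω b).2.1) (hYne ω)).trans ?_
    refine prod_le_prod (fun _ _ => D.nonneg _ _) fun v _ => ?_
    rw [map_prod]
    exact prod_le_prod (fun _ _ => D.nonneg _ _) fun _ _ => le_max_right _ _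
  have hMle : ∀ᶠ ω in (U : Filter Ω), ∏ v, M ω v ≤ Real.exp (N * η * ℓ ω) := by
    filter_upwards [hht] with ω h
    rw [hMprod]
    calc _ ≤ ∏ _b : Fin N, Real.exp (η * ℓ ω) := prod_le_prod (fun b _ => prod_nonneg fun v _ => (D.nonneg _ _).trans (le_max_left _ _)) fun b _ => h b
      _ = _ := by rw [prod_const, card_univ, Fintype.card_fin, ← Real.exp_nat_mul]; congr 1; ring
  have hp't : ∀ᶠ ω in (U : Filter Ω), p' ω = t ω • p ω := by
    filter_upwards [hξ, hpa] with ω h1 h2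
    ext i
    have h3 := h1 i
    simp only [hp', ht]
    rw [Pi.smul_apply, smul_eq_mul, div_mul_eq_mul_div, mul_div_assoc, h3, ← mul_prod_erase univ _ (mem_univ i)]
    have := (hxy ω i).2.2
    field_simp
  obtain ⟨pat, hpat⟩ := ev_fin U (fun ω => fun (z : S × Fin N) => decide ((L z.1).mulVec (p' ω) z.2 = 0))
  have hp'ne : ∀ᶠ ω in (U : Filter Ω), p' ω ≠ 0 := by
    filter_upwards [hp't, hpa] with ω h1 h2
    rw [h1]
    refine smul_ne_zero (div_ne_zero (hYne ω) h2) ?_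
    intro h; rw [h] at h2; exact h2 rfl
  obtain ⟨ω0, hω0, hq0⟩ := (hpat.and hp'ne).exists
  set q := p' ω0 with hq
  obtain ⟨Cq, hCq, hCq'⟩ := D.bdd_all (fun z : S × Fin N => (L z.1).mulVec q z.2)
  refine ⟨q, hq0, ?_⟩
  have hCqr : (1:ℝ) ≤ Cq := by exact_mod_cast hCq
  have hCK : 1 ≤ (Cq * K) ^ s := one_le_pow₀ (one_le_mul_of_one_le_of_one_le hCqr hK)
  filter_upwards [hw, hp, hgap, hpa, hMle, hp't, hpat, hp'ne, ev_exp _ hℓ ((Cq * K) ^ s + 1) (half_pos hg), hℓ.eventually_ge_atTop 0]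
    with ω h1 h2 h3 h4 h5 h6 h7 h8 h9 h10
  have hqp : q ∈ Submodule.span k {p ω} := by
    by_contra hcon
    have h11 := h3 q (hp'A ω0) hcon
    have hpne : p ω ≠ 0 := by intro h; rw [h] at h4; exact h4 rfl
    have hszp := D.sz_pos (L := L) h1 hL hpne
    -- sv bound
    have h12 : ∀ v, D.sv L (w ω) v q ≤ Cq * K * (∏ v, M ω v) / M ω v * D.sv L (w ω) v (p' ω) := by
      intro v
      have hprod0 : 0 ≤ ∏ v, M ω v := zero_le_one.trans (hMge ω)
      refine D.sv_le h1 v q _ (mul_nonneg (div_nonneg (by positivity) (hMpos ω v).le) (D.sv_nonneg h1 _ _)) ?_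
      intro i
      by_cases hz : (L v).mulVec (p' ω) i = 0
      · have h13 := congrFun (h7.trans hω0.symm) (v, i)
        simp only [hz, decide_true] at h13
        have h14 : (L v).mulVec q i = 0 := of_decide_eq_true h13.symm
        rw [h14, map_zero]
        exact mul_nonneg (h1 v i).le (mul_nonneg (div_nonneg (by positivity) (hMpos ω v).le) (D.sv_nonneg h1 _ _))
      · have h13 := hlow (p' ω) (M ω) (hp'A ω) (hp'M ω) v i hz
        have h14 := D.le_sv (L := L) h1 v (p' ω) i
        have h15 : D.f v ((L v).mulVec q i) ≤ Cq := hCq' v (v, i)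
        have h16 : 1 ≤ K * (∏ v, M ω v) / M ω v * D.f v ((L v).mulVec (p' ω) i) := by
          rw [div_mul_eq_mul_div, le_div_iff₀ (hMpos ω v)]; linarith
        calc _ ≤ (Cq:ℝ) := h15
          _ ≤ Cq * (K * (∏ v, M ω v) / M ω v * D.f v ((L v).mulVec (p' ω) i)) := le_mul_of_one_le_right (by positivity) h16
          _ ≤ Cq * (K * (∏ v, M ω v) / M ω v * (w ω v i * D.sv L (w ω) v (p' ω))) := by
              refine mul_le_mul_of_nonneg_left (mul_le_mul_of_nonneg_left h14 (div_nonneg (by positivity) (hMpos ω v).le)) (by positivity)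
          _ = _ := by ring
    have h13 : D.sz L (w ω) q ≤ (Cq * K) ^ s * (∏ v, M ω v) ^ s * D.sz L (w ω) (p' ω) := by
      calc D.sz L (w ω) q ≤ ∏ v, (Cq * K * (∏ v, M ω v) / M ω v * D.sv L (w ω) v (p' ω)) :=
            prod_le_prod (fun v _ => D.sv_nonneg h1 _ _) fun v _ => h12 v
        _ = (Cq * K * ∏ v, M ω v) ^ s / (∏ v, M ω v) * D.sz L (w ω) (p' ω) := by
            rw [prod_mul_distrib, prod_div_distrib, prod_const, card_univ]; rfl
        _ ≤ (Cq * K * ∏ v, M ω v) ^ s * D.sz L (w ω) (p' ω) := by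
            refine mul_le_mul_of_nonneg_right (div_le_self ?_ (hMge ω)) (D.sz_nonneg h1 _)
            exact pow_nonneg (mul_nonneg (by positivity) (zero_le_one.trans (hMge ω))) _
        _ = _ := by rw [mul_pow]
    have h14 : D.sz L (w ω) (p' ω) ≤ (∏ v, M ω v) * D.sz L (w ω) (p ω) := by
      rw [h6, D.sz_smul h1]
      refine mul_le_mul_of_nonneg_right ?_ hszp.le
      calc ∏ v, D.f v (t ω) ≤ ∏ v, M ω v / D.f v (p ω a) := by
            refine prod_le_prod (fun _ _ => D.nonneg _ _) fun v _ => ?_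
            simp only [ht]
            rw [map_div₀, map_prod]
            exact div_le_div_of_nonneg_right (prod_le_prod (fun _ _ => D.nonneg _ _) fun _ _ => le_max_right _ _) (D.nonneg _ _)
        _ ≤ _ := by
            rw [prod_div_distrib]
            exact div_le_self (zero_le_one.trans (hMge ω)) (D.prod_ge _ (h2 a) h4)
    have h15 : D.sz L (w ω) q ≤ (Cq * K) ^ s * Real.exp (g / 2 * ℓ ω) * D.sz L (w ω) (p ω) := by
      have h16 : (∏ v, M ω v) ^ (s + 1) ≤ Real.exp (g / 2 * ℓ ω) := by
        calc _ ≤ Real.exp (N * η * ℓ ω) ^ (s + 1) := pow_le_pow_left₀ (zero_le_one.trans (hMge ω)) h5 _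
          _ = Real.exp (η * (N * (s + 1)) * ℓ ω) := by rw [← Real.exp_nat_mul]; congr 1; push_cast; ring
          _ ≤ _ := Real.exp_le_exp.2 (mul_le_mul_of_nonneg_right hη h10)
      calc _ ≤ (Cq * K) ^ s * (∏ v, M ω v) ^ s * ((∏ v, M ω v) * D.sz L (w ω) (p ω)) :=
            h13.trans (mul_le_mul_of_nonneg_left h14 (mul_nonneg (by positivity) (pow_nonneg (zero_le_one.trans (hMge ω)) _)))
        _ = (Cq * K) ^ s * (∏ v, M ω v) ^ (s + 1) * D.sz L (w ω) (p ω) := by rw [pow_succ]; ring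
        _ ≤ _ := mul_le_mul_of_nonneg_right (mul_le_mul_of_nonneg_left h16 (by positivity)) hszp.le
    have h16 : Real.exp (g * ℓ ω) ≤ (Cq * K) ^ s * Real.exp (g / 2 * ℓ ω) := le_of_mul_le_mul_right (h11.trans h15) hszp
    have e : Real.exp (g * ℓ ω) = Real.exp (g / 2 * ℓ ω) * Real.exp (g / 2 * ℓ ω) := by
      rw [← Real.exp_add]; congr 1; ring
    rw [e] at h16
    have := le_of_mul_le_mul_right h16 (Real.exp_pos _)
    linarith
  obtain ⟨c, hc⟩ := Submodule.mem_span_singleton.1 hqp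
  have hc0 : c ≠ 0 := by rintro rfl; rw [zero_smul] at hc; exact hq0 hc.symm
  refine Submodule.mem_span_singleton.2 ⟨c⁻¹, ?_⟩
  rw [← hc, smul_smul, inv_mul_cancel₀ hc0, one_smul]

theorem core [CharZero k] (v0 : S) (hN : 2 ≤ N) (L : S → Matrix (Fin N) (Fin N) k) (hL : ∀ v, (L v).det ≠ 0)
    {Ω : Type*} (U : Ultrafilter Ω) (ℓ : Ω → ℝ) (hℓ : Tendsto ℓ U atTop) (B : ℝ) (hB : 0 ≤ B) (w : Ω → S → Fin N → ℝ)
    (hw : ∀ᶠ ω in (U : Filter Ω), ∀ v i, 0 < w ω v i ∧ w ω v i ≤ Real.exp (B * ℓ ω) ∧ (Real.exp (B * ℓ ω))⁻¹ ≤ w ω v i)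
    (p : Ω → Fin N → k) (hp : ∀ᶠ ω in (U : Filter Ω), D.Int (p ω)) (hp0 : ∀ᶠ ω in (U : Filter Ω), p ω ≠ 0) (g : ℝ) (hg : 0 < g)
    (hgap : ∀ᶠ ω in (U : Filter Ω), ∀ x, D.Int x → x ∉ Submodule.span k {p ω} →
      Real.exp (g * ℓ ω) * D.sz L (w ω) (p ω) ≤ D.sz L (w ω) x) :
    ∃ p0, p0 ≠ 0 ∧ ∀ᶠ ω in (U : Filter Ω), p ω ∈ Submodule.span k {p0} := by
  classical
  obtain ⟨pat, hpat⟩ := ev_fin U (fun ω i => decide (p ω i = 0))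
  obtain ⟨a, hpa⟩ : ∃ a, ∀ᶠ ω in (U : Filter Ω), p ω a ≠ 0 := by
    obtain ⟨ω, h1, h2⟩ := (hpat.and hp0).exists
    obtain ⟨a, ha⟩ := Function.ne_iff.1 h2
    refine ⟨a, ?_⟩
    filter_upwards [hpat] with ω' h3 h4
    have := congrFun (h3.trans h1.symm) a
    simp only [h4, decide_true] at this
    exact ha (of_decide_eq_true this.symm)
  have hco : ∀ ω b, ∃ z : k × k, z.1 ∈ D.A ∧ z.2 ∈ D.A ∧ z.2 ≠ 0 ∧ (∃ s ∈ D.A, ∃ t ∈ D.A, s * z.1 + t * z.2 = 1) ∧ - p ω b / p ω a = z.1 / z.2 := by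
    intro ω b
    obtain ⟨x, hx, y, hy, h0, h1, h2⟩ := D.cop (- p ω b / p ω a)
    exact ⟨(x, y), hx, hy, h0, h2, h1⟩
  choose z z1 z2 z3 z4 z5 using hco
  have hN0 : (0:ℝ) < N := by exact_mod_cast (by omega : 0 < N)
  set η : ℝ := g / 2 / (N * (Fintype.card S + 1)) with hη
  have hη0 : 0 < η := by positivity
  by_cases hcase : ∃ b, a ≠ b ∧ ∀ᶠ ω in (U : Filter Ω), Real.exp (η * ℓ ω) ≤ D.ht (z ω b).1 (z ω b).2
  · obtain ⟨b, hab, hb⟩ := hcase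
    exact (D.core_b v0 hN L hL U ℓ hℓ B hB w hw p hp g hg hgap a b hab hpa (fun ω => (z ω b).1) (fun ω => (z ω b).2)
      (fun ω => ⟨z1 ω b, z2 ω b, z3 ω b, z4 ω b⟩) (fun ω => z5 ω b) η hη0 hb).elim
  · push Not at hcase
    refine D.core_a v0 L hL U ℓ hℓ w (hw.mono fun ω h v i => (h v i).1) p hp g hg hgap a hpa
      (fun ω b => if b = a then 1 else - (z ω b).1) (fun ω b => if b = a then 1 else (z ω b).2) ?_ ?_ η ?_ ?_
    · intro ω b
      split_ifs
      · exact ⟨one_mem _, one_mem _, one_ne_zero⟩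
      · exact ⟨neg_mem (z1 ω b), z2 ω b, z3 ω b⟩
    · filter_upwards [hpa] with ω h b
      split_ifs with hb
      · rw [hb, div_self h, div_one]
      · rw [neg_div, ← z5 ω b, neg_div, neg_neg]
    · rw [hη, div_mul_cancel₀ _ (by positivity)]
    · rw [eventually_all]
      intro b
      by_cases hb : b = a
      · filter_upwards [hℓ.eventually_ge_atTop 0] with ω h
        simp only [if_pos hb, ht, map_one, max_self, prod_const_one]
        exact Real.one_le_exp (by positivity)
      · have := hcase b (Ne.symm hb)
        filter_upwards [this] with ω h
        simp only [if_neg hb, ht, D.f_neg] at h ⊢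
        exact h.le

end PD
end

end

section

open Finset

section
variable {k : Type*} [Field k]

theorem wedge_exists (k : Type*) [Field k] (n h : ℕ) : ∃ (W : ℕ) (τ : Fin W → (Fin h ↪o Fin n))
    (P : (Fin h → Fin n → k) → Fin W → k) (cL : Matrix (Fin n) (Fin n) k → Matrix (Fin W) (Fin W) k),
    Function.Bijective τ ∧
    (∀ y J, P y J = (Matrix.of fun a b => y a (τ J b)).det) ∧
    (∀ M y, (cL M).mulVec (P y) = P fun a => M.mulVec (y a)) ∧
    (∀ M, M.det ≠ 0 → (cL M).det ≠ 0) ∧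
    (∀ y : Fin n → Fin n → k, LinearIndependent k y → LinearIndependent k fun J => P fun a => y (τ J a)) ∧
    (∀ y y' : Fin h → Fin n → k, ∀ c : k, c ≠ 0 → LinearIndependent k y' → P y = c • P y' → ∀ x,
      x ∈ Submodule.span k (Set.range y) → x ∈ Submodule.span k (Set.range y')) := by
  classical
  set e := (Pi.basisFun k (Fin n)).exteriorPower h with he
  set σ := (Fintype.equivFin (Set.powersetCard (Fin n) h)).symm with hσ
  set ψ : ⋀[k]^h (Fin n → k) ≃ₗ[k] (Fin (Fintype.card (Set.powersetCard (Fin n) h)) → k) :=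
    (e.reindex σ.symm).equivFun with hψ
  have hψP : ∀ y J, ψ (exteriorPower.ιMulti k h y) J =
      (Matrix.of fun a b => y a (Set.powersetCard.ofFinEmbEquiv.symm (σ J) b)).det := by
    intro y J
    rw [hψ, Module.Basis.equivFun_apply, Module.Basis.repr_reindex_apply, he, exteriorPower.basis_repr_apply,
      exteriorPower.ιMultiDual_apply_ιMulti]
    rfl
  refine ⟨_, fun J => Set.powersetCard.ofFinEmbEquiv.symm (σ J), fun y => ψ (exteriorPower.ιMulti k h y),
    fun M => LinearMap.toMatrix' (ψ.toLinearMap ∘ₗ exteriorPower.map h (Matrix.toLin' M) ∘ₗ ψ.symm.toLinearMap), ?_, hψP, ?_, ?_, ?_, ?_⟩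
  · exact (σ.trans Set.powersetCard.ofFinEmbEquiv.symm).bijective
  · intro M y
    rw [← Matrix.toLin'_apply, Matrix.toLin'_toMatrix']
    simp only [LinearMap.coe_comp, LinearEquiv.coe_coe, Function.comp_apply, LinearEquiv.symm_apply_apply]
    rw [exteriorPower.map_apply_ιMulti]
    rfl
  · intro M hM
    rw [← LinearMap.det_toLin', Matrix.toLin'_toMatrix']
    have hinj : Function.Injective (Matrix.toLin' M) := by
      rw [← LinearMap.ker_eq_bot, LinearMap.ker_eq_bot']
      intro x hx
      exact Matrix.eq_zero_of_mulVec_eq_zero hM (by simpa using hx)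
    have hi : Function.Injective (ψ.toLinearMap ∘ₗ exteriorPower.map h (Matrix.toLin' M) ∘ₗ ψ.symm.toLinearMap) := by
      simp only [LinearMap.coe_comp, LinearEquiv.coe_coe]
      exact ψ.injective.comp ((exteriorPower.map_injective_field hinj).comp ψ.symm.injective)
    have := LinearEquiv.isUnit_det' (LinearEquiv.ofInjectiveEndo _ hi)
    exact this.ne_zero
  · intro y hy
    have h1 := exteriorPower.ιMulti_family_linearIndependent_field h hy
    have h2 := (h1.comp σ σ.injective).map' ψ.toLinearMap (LinearEquiv.ker ψ)
    exact h2
  · intro y y' c hc hy' hP x hx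
    by_contra hcon
    have h1 : exteriorPower.ιMulti k h y = c • exteriorPower.ιMulti k h y' := by
      apply ψ.injective
      rw [map_smul]; exact hP
    have h2 : LinearIndependent k (Fin.cons x y' : Fin (h + 1) → Fin n → k) := hy'.finCons hcon
    have h3 := (exteriorPower.ιMulti_family_linearIndependent_field (h + 1) h2).ne_zero
      (Set.powersetCard.ofFinEmbEquiv (RelEmbedding.refl _))
    rw [exteriorPower.ιMulti_family, Equiv.symm_apply_apply] at h3
    apply h3
    apply Subtype.ext
    rw [exteriorPower.ιMulti_apply_coe]
    have h4 : ExteriorAlgebra.ιMulti k (h + 1) (Fin.cons x y : Fin (h + 1) → Fin n → k) = 0 := by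
      apply AlternatingMap.map_linearDependent
      intro hli
      exact (linearIndependent_finCons.1 hli).2 hx
    have h5 : ExteriorAlgebra.ιMulti k h y = c • ExteriorAlgebra.ιMulti k h y' := by
      have := congrArg Subtype.val h1
      rwa [Submodule.coe_smul, exteriorPower.ιMulti_apply_coe, exteriorPower.ιMulti_apply_coe] at this
    rw [ExteriorAlgebra.ιMulti_succ_apply] at h4
    simp only [Fin.cons_zero] at h4
    have e1 : Matrix.vecTail (Fin.cons x y : Fin (h + 1) → Fin n → k) = y := by
      ext i; rfl
    rw [e1, h5, mul_smul_comm, smul_eq_zero_iff_right hc] at h4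
    show ExteriorAlgebra.ιMulti k (h + 1) (Fin.cons x y' : Fin (h + 1) → Fin n → k) = 0
    rw [ExteriorAlgebra.ιMulti_succ_apply]
    exact h4

end

end

section

open Finset

section wedgecount

theorem wedge_count {n h W : ℕ} (τ : Fin W → (Fin h ↪o Fin n)) (hτ : Function.Bijective τ) :
    ∃ m : ℕ, ∀ g : Fin n → ℝ, ∏ J, ∏ a, g (τ J a) = (∏ j, g j) ^ m := by
  classical
  by_cases hh : 1 ≤ h
  swap
  · refine ⟨0, fun g => ?_⟩
    obtain rfl : h = 0 := by omega
    simp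
  refine ⟨(n - 1).choose (h - 1), fun g => ?_⟩
  have h1 : ∏ J, ∏ a, g (τ J a) = ∏ s ∈ powersetCard h (univ : Finset (Fin n)), ∏ j ∈ s, g j := by
    refine prod_bij' (fun J _ => univ.map (τ J).toEmbedding)
      (fun s hs => (Equiv.ofBijective τ hτ).symm (s.orderEmbOfFin (mem_powersetCard_univ.1 hs))) ?_ ?_ ?_ ?_ ?_
    · intro J _; simp [mem_powersetCard_univ]
    · intro s hs; simp
    · intro J _
      rw [Equiv.symm_apply_eq]
      simp only [Equiv.ofBijective_apply]
      symm
      refine DFunLike.coe_injective (Finset.orderEmbOfFin_unique' _ ?_ |> fun h => congrArg _ h)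
      intro x; simp
    · intro s hs
      have : τ ((Equiv.ofBijective τ hτ).symm (s.orderEmbOfFin (mem_powersetCard_univ.1 hs))) = s.orderEmbOfFin (mem_powersetCard_univ.1 hs) :=
        (Equiv.ofBijective τ hτ).apply_symm_apply _
      simp only [this]
      exact map_orderEmbOfFin_univ _ _
    · intro J _; simp
  rw [h1]
  have h2 : ∀ s : Finset (Fin n), ∏ j ∈ s, g j = ∏ j, if {j} ⊆ s then g j else 1 := by
    intro s
    rw [← prod_filter]
    congr 1; ext j; simp
  simp_rw [h2]
  rw [prod_comm, ← prod_pow]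
  refine prod_congr rfl fun j _ => ?_
  rw [← prod_filter, prod_const, card_filter_powersetCard_subset]
  · simp
  · simp
  · simpa using hh

theorem gap_index {n : ℕ} (lam : Fin n → ℝ) (hpos : ∀ i, 0 < lam i) (hmon : ∀ r r', r ≤ r' → lam r ≤ 2 * lam r')
    (u : Fin n) (hu : lam u ≤ 2) (E : ℝ) (hE : 1 ≤ E) (hbig : 4 ^ n * E ^ (n * n) < ∏ i, lam i) :
    ∃ h : ℕ, ∃ hh : h + 1 < n, u.val ≤ h ∧ E * lam ⟨h, by omega⟩ ≤ lam ⟨h + 1, hh⟩ := by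
  by_contra! hcon
  have h1 : ∀ j : ℕ, ∀ hj : j < n, u.val ≤ j → lam ⟨j, hj⟩ ≤ 2 * E ^ j := by
    intro j
    induction j with
    | zero =>
      intro hj hu0
      have : (⟨0, hj⟩ : Fin n) = u := by ext; simp; omega
      rw [this]; simpa using hu
    | succ j ih =>
      intro hj huj
      by_cases h : u.val ≤ j
      · have a1 := hcon j hj h
        have a2 := ih (by omega) h
        have : E * lam ⟨j, by omega⟩ ≤ E * (2 * E ^ j) := by gcongr
        rw [pow_succ]; linarith
      · have : (⟨j + 1, hj⟩ : Fin n) = u := by ext; simp; omega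
        rw [this]
        have := one_le_pow₀ hE (n := j + 1)
        linarith
  have h2 : ∀ j, lam j ≤ 4 * E ^ n := by
    intro j
    by_cases h : u ≤ j
    · have := h1 j j.2 h
      have h3 : E ^ (j:ℕ) ≤ E ^ n := pow_le_pow_right₀ hE j.2.le
      have : 0 < E ^ n := by positivity
      linarith [show lam j ≤ 2 * E ^ (j:ℕ) by assumption]
    · have := hmon j u (le_of_not_ge h)
      have := one_le_pow₀ hE (n := n)
      linarith
  have h3 : ∏ i, lam i ≤ ∏ _i : Fin n, 4 * E ^ n := prod_le_prod (fun i _ => (hpos i).le) fun i _ => h2 i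
  rw [prod_const, card_univ, Fintype.card_fin, mul_pow, ← pow_mul] at h3
  linarith

theorem wedge_gap {n h W : ℕ} (hh : 1 ≤ h) (hn : h < n) (τ : Fin W → (Fin h ↪o Fin n)) (hτ : Function.Bijective τ)
    (J0 : Fin W) (hJ0 : ∀ a, (τ J0 a).val = a.val) (lam : Fin n → ℝ) (hpos : ∀ i, 0 < lam i) (hmon : ∀ r r', r ≤ r' → lam r ≤ 2 * lam r')
    (E : ℝ) (hE : 0 < E) (hgap : E * lam ⟨h - 1, by omega⟩ ≤ lam ⟨h, hn⟩) (J : Fin W) (hJ : J ≠ J0) :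
    E * ∏ a, lam (τ J0 a) ≤ 4 ^ h * ∏ a, lam (τ J a) := by
  classical
  have hle : ∀ a : ℕ, ∀ ha : a < h, a ≤ (τ J ⟨a, ha⟩).val := by
    intro a
    induction a with
    | zero => intro _; omega
    | succ a ih =>
      intro ha
      have h1 := ih (by omega)
      have h2 : τ J ⟨a, by omega⟩ < τ J ⟨a + 1, ha⟩ := (τ J).strictMono (by simp)
      have h3 : (τ J ⟨a, by omega⟩).val < (τ J ⟨a + 1, ha⟩).val := h2
      omega
  have hex : ∃ a, h ≤ (τ J a).val := by
    by_contra! hc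
    apply hJ
    apply hτ.1
    ext a
    rw [hJ0]
    have h1 : (fun a => (⟨(τ J a).val, hc a⟩ : Fin h)) = id := by
      have sm : StrictMono (fun a => (⟨(τ J a).val, hc a⟩ : Fin h)) := fun a b hab => (τ J).strictMono hab
      exact sm.eq_id
    have := congrFun h1 a
    simpa using congrArg Fin.val this
  obtain ⟨a0, ha0⟩ := hex
  have e1 : E * ∏ a, lam (τ J0 a) = ∏ a, (if a = a0 then E else 1) * lam (τ J0 a) := by
    rw [prod_mul_distrib]; simp
  have e2 : 4 ^ h * ∏ a, lam (τ J a) = ∏ a, 4 * lam (τ J a) := by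
    rw [prod_mul_distrib]; simp
  rw [e1, e2]
  refine prod_le_prod (fun a _ => ?_) fun a _ => ?_
  · have := hpos (τ J0 a)
    split_ifs <;> positivity
  · have h1 : τ J0 a ≤ τ J a := by
      rw [Fin.le_def, hJ0]; exact hle a a.2
    split_ifs with h
    · subst h
      have b1 := hmon (τ J0 a) ⟨h - 1, by omega⟩ (by rw [Fin.le_def, hJ0]; simp; omega)
      have b2 := hmon ⟨h, hn⟩ (τ J a) (by rw [Fin.le_def]; exact ha0)
      have : E * lam (τ J0 a) ≤ E * (2 * lam ⟨h - 1, by omega⟩) := by gcongr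
      linarith
    · have := hmon _ _ h1
      have := hpos (τ J a)
      linarith

end wedgecount

namespace PD
variable {k : Type*} [Field k] {S : Type*} [Fintype S] (D : PD k S)

theorem wedge_sz {n h W : ℕ} (τ : Fin W → (Fin h ↪o Fin n)) (P : (Fin h → Fin n → k) → Fin W → k)
    (cL : Matrix (Fin n) (Fin n) k → Matrix (Fin W) (Fin W) k)
    (hP : ∀ y J, P y J = (Matrix.of fun a b => y a (τ J b)).det)
    (hcL : ∀ M y, (cL M).mulVec (P y) = P fun a => M.mulVec (y a))
    (L : S → Matrix (Fin n) (Fin n) k) (w : S → Fin n → ℝ) (hw : ∀ v i, 0 < w v i) (y : Fin h → Fin n → k) :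
    D.sz (fun v => cL (L v)) (fun v J => ∏ a, w v (τ J a)) (P y) ≤
      (((h.factorial : ℝ)) ^ 2) ^ Fintype.card S * ∏ a, D.sz L w (y a) := by
  have hw' : ∀ v J, 0 < ∏ a, w v (τ J a) := fun v J => prod_pos fun a _ => hw _ _
  have h1 : ∀ v, D.sv (fun v => cL (L v)) (fun v J => ∏ a, w v (τ J a)) v (P y) ≤ ((h.factorial : ℝ)) ^ 2 * ∏ a, D.sv L w v (y a) := by
    intro v
    have h0 : 0 ≤ ∏ a, D.sv L w v (y a) := prod_nonneg fun a _ => D.sv_nonneg hw _ _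
    refine D.sv_le hw' v _ _ (by positivity) fun J => ?_
    simp only [hcL, hP]
    have := D.det_le v (Matrix.of fun a b => (L v).mulVec (y a) (τ J b)) (fun a => D.sv L w v (y a)) (fun b => w v (τ J b)) (fun a b => by
      rw [mul_comm]; exact D.le_sv hw v (y a) (τ J b))
    linarith
  unfold sz
  calc _ ≤ ∏ v, (((h.factorial : ℝ)) ^ 2 * ∏ a, D.sv L w v (y a)) := prod_le_prod (fun v _ => D.sv_nonneg hw' _ _) fun v _ => h1 v
    _ = _ := by rw [prod_mul_distrib, prod_const, card_univ, prod_comm]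

theorem wedge_lower (v0 : S) {n h W : ℕ} (hn : 0 < n) (τ : Fin W → (Fin h ↪o Fin n)) (hτ : Function.Bijective τ)
    (P : (Fin h → Fin n → k) → Fin W → k)
    (cL : Matrix (Fin n) (Fin n) k → Matrix (Fin W) (Fin W) k)
    (hP : ∀ y J, P y J = (Matrix.of fun a b => y a (τ J b)).det)
    (hcL : ∀ M y, (cL M).mulVec (P y) = P fun a => M.mulVec (y a))
    (hcd : ∀ M, M.det ≠ 0 → (cL M).det ≠ 0)
    (hPli : ∀ y : Fin n → Fin n → k, LinearIndependent k y → LinearIndependent k fun J => P fun a => y (τ J a))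
    (J0 : Fin W) (L : S → Matrix (Fin n) (Fin n) k) (hL : ∀ v, (L v).det ≠ 0) :
    ∃ K : ℝ, 0 < K ∧ ∀ w : S → Fin n → ℝ, (∀ v i, 0 < w v i) → ∀ y : Fin n → Fin n → k, (∀ l, D.Int (y l)) →
     (∀ l : Fin n, y l ∉ Vs k y l) →
     (∀ (l : Fin n) x, D.Int x → x ∉ Vs k y l → D.sz L w (y l) ≤ 2 * D.sz L w x) →
     ∀ z, D.Int z → z ∉ Submodule.span k {P fun a => y (τ J0 a)} → ∃ J1, J1 ≠ J0 ∧
      K * ∏ a, D.sz L w (y (τ J1 a)) ≤ D.sz (fun v => cL (L v)) (fun v J => ∏ a, w v (τ J a)) z := by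
  classical
  obtain ⟨m, hm⟩ := wedge_count τ hτ
  obtain ⟨C, hC, hmink⟩ := D.mink2 v0 hn L hL
  obtain ⟨c, hc, hdet⟩ := D.det_lower (fun v => cL (L v)) (fun v => hcd _ (hL v))
  set F : ℝ := (((h.factorial : ℝ)) ^ 2) ^ Fintype.card S with hF
  have hF0 : 0 < F := by positivity
  refine ⟨c * F / (F ^ W * C ^ m), by positivity, ?_⟩
  intro w hw y hy hyV hmin z hz hzp
  have hli := flag_li y hyV
  have hYli := hPli y hli
  set Y : Fin W → Fin W → k := fun J => P fun a => y (τ J a) with hY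
  have hw' : ∀ v J, 0 < ∏ a, w v (τ J a) := fun v J => prod_pos fun a _ => hw _ _
  have hlp : ∀ l, 0 < D.sz L w (y l) := fun l => D.sz_pos hw hL (hli.ne_zero l)
  have hYsz : ∀ J, D.sz (fun v => cL (L v)) (fun v J => ∏ a, w v (τ J a)) (Y J) ≤ F * ∏ a, D.sz L w (y (τ J a)) := fun J =>
    D.wedge_sz τ P cL hP hcL L w hw _
  have hYint : ∀ J, D.Int (Y J) := by
    intro J I
    rw [hY]; simp only [hP]
    exact D.det_mem_A _ fun a b => hy _ _
  have hYdet := li_det Y hYli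
  have hspan : z ∈ Submodule.span k (Set.range Y) := by
    have := hYli.span_eq_top_of_card_eq_finrank' (by simp)
    rw [this]; trivial
  obtain ⟨cc, hcc⟩ := (Submodule.mem_span_range_iff_exists_fun k).1 hspan
  have hex : ∃ J1, J1 ≠ J0 ∧ cc J1 ≠ 0 := by
    by_contra! hcon
    apply hzp
    rw [← hcc, Finset.sum_eq_single J0]
    · exact Submodule.smul_mem _ _ (Submodule.mem_span_singleton_self _)
    · intro J _ hJ; rw [hcon J hJ, zero_smul]
    · simp
  obtain ⟨J1, hJ1, hcJ1⟩ := hex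
  refine ⟨J1, hJ1, ?_⟩
  have hd := hdet _ hw' (Function.update Y J1 z) (by
    intro l
    by_cases h : l = J1
    · subst h; simpa using hz
    · rw [Function.update_of_ne h]; exact hYint l) (by
    have : Matrix.of (Function.update Y J1 z) = (Matrix.of Y).updateRow J1 (∑ i, cc i • (Matrix.of Y) i) := by
      rw [show (∑ i, cc i • (Matrix.of Y) i) = z from hcc]; rfl
    rw [this, Matrix.det_updateRow_sum]
    exact mul_ne_zero hcJ1 hYdet)
  rw [← mul_prod_erase univ _ (mem_univ J1), Function.update_self] at hd
  have e1 : ∏ v, ∏ J, ∏ a, w v (τ J a) = (∏ v, ∏ i, w v i) ^ m := by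
    simp_rw [hm, prod_pow]
  rw [e1] at hd
  set sz' := D.sz (fun v => cL (L v)) (fun v J => ∏ a, w v (τ J a)) with hsz'
  have hz0 : 0 ≤ sz' z := D.sz_nonneg hw' _
  have e2 : ∏ x ∈ univ.erase J1, sz' (Function.update Y J1 z x) ≤ ∏ J ∈ univ.erase J1, (F * ∏ a, D.sz L w (y (τ J a))) := by
    refine prod_le_prod (fun J _ => D.sz_nonneg hw' _) fun J hJ => ?_
    rw [Function.update_of_ne (mem_erase.1 hJ).1]
    exact hYsz J
  have hL1 : 0 < F * ∏ a, D.sz L w (y (τ J1 a)) := mul_pos hF0 (prod_pos fun a _ => hlp _)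
  have e3 : (F * ∏ a, D.sz L w (y (τ J1 a))) * ∏ J ∈ univ.erase J1, (F * ∏ a, D.sz L w (y (τ J a))) = F ^ W * (∏ l, D.sz L w (y l)) ^ m := by
    rw [mul_prod_erase univ (fun J => F * ∏ a, D.sz L w (y (τ J a))) (mem_univ J1), prod_mul_distrib, prod_const, card_univ, Fintype.card_fin,
      hm (fun j => D.sz L w (y j))]
  have hwp : 0 < ∏ v, ∏ i, w v i := prod_pos fun v _ => prod_pos fun i _ => hw v i
  have e4 : ((∏ l, D.sz L w (y l)) * ∏ v, ∏ i, w v i) ^ m ≤ C ^ m :=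
    pow_le_pow_left₀ (mul_nonneg (prod_nonneg fun l _ => (hlp l).le) hwp.le) (hmink w hw y hy hyV hmin) m
  rw [mul_pow] at e4
  rw [div_mul_eq_mul_div, div_le_iff₀ (by positivity)]
  calc c * F * ∏ a, D.sz L w (y (τ J1 a)) = c * (F * ∏ a, D.sz L w (y (τ J1 a))) := by ring
    _ ≤ (sz' z * (∏ J ∈ univ.erase J1, (F * ∏ a, D.sz L w (y (τ J a)))) * (∏ v, ∏ i, w v i) ^ m) * (F * ∏ a, D.sz L w (y (τ J1 a))) := by
        apply mul_le_mul_of_nonneg_right _ hL1.le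
        refine hd.trans ?_
        apply mul_le_mul_of_nonneg_right _ (by positivity)
        exact mul_le_mul_of_nonneg_left e2 hz0
    _ = sz' z * (F ^ W * ((∏ l, D.sz L w (y l)) ^ m * (∏ v, ∏ i, w v i) ^ m)) := by
        rw [← mul_assoc (F ^ W), ← e3]; ring
    _ ≤ sz' z * (F ^ W * C ^ m) := by
        apply mul_le_mul_of_nonneg_left _ hz0
        apply mul_le_mul_of_nonneg_left e4 (by positivity)

end PD

end


section
open Finset Filter Topology
namespace PD
variable {k : Type*} [Field k] {S : Type*} [Fintype S] (D : PD k S)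

theorem subspace [CharZero k] (v0 : S) {n : ℕ} (L : S → Matrix (Fin n) (Fin n) k) (hL : ∀ v, (L v).det ≠ 0)
    {Ω : Type*} (U : Ultrafilter Ω) (ℓ : Ω → ℝ) (hℓ : Tendsto ℓ U atTop) (B : ℝ) (hB : 0 ≤ B) (w : Ω → S → Fin n → ℝ)
    (hw : ∀ᶠ ω in (U : Filter Ω), ∀ v i, 0 < w ω v i ∧ w ω v i ≤ Real.exp (B * ℓ ω) ∧ (Real.exp (B * ℓ ω))⁻¹ ≤ w ω v i)
    (x : Ω → Fin n → k) (hx : ∀ᶠ ω in (U : Filter Ω), D.Int (x ω)) (hx0 : ∀ᶠ ω in (U : Filter Ω), x ω ≠ 0)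
    (hsz : ∀ᶠ ω in (U : Filter Ω), D.sz L (w ω) (x ω) ≤ 1) (κ : ℝ) (hκ : 0 < κ)
    (hprod : ∀ᶠ ω in (U : Filter Ω), ∏ v, ∏ i, w ω v i ≤ Real.exp (-(κ * ℓ ω))) :
    ∃ V : Submodule k (Fin n → k), V ≠ ⊤ ∧ ∀ᶠ ω in (U : Filter Ω), x ω ∈ V := by
  classical
  have hn : 0 < n := by
    obtain ⟨ω, h⟩ := hx0.exists
    rcases Nat.eq_zero_or_pos n with rfl | h'
    · exact absurd (Subsingleton.elim _ _) h
    · exact h'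
  have hmin : ∀ ω, ∃ y : Fin n → Fin n → k, (∀ v i, 0 < w ω v i) → (∀ l, D.Int (y l)) ∧
    (∀ l : Fin n, y l ∉ Vs k y l) ∧ ∀ (l : Fin n) x, D.Int x → x ∉ Vs k y l → D.sz L (w ω) (y l) ≤ 2 * D.sz L (w ω) x := by
    intro ω
    by_cases h : ∀ v i, 0 < w ω v i
    · obtain ⟨y, hy⟩ := D.minima hL h
      exact ⟨y, fun _ => hy⟩
    · exact ⟨fun _ _ => 0, fun h' => absurd h' h⟩
  choose y hy using hmin
  obtain ⟨c, hc, hdet⟩ := D.det_lower L hL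
  have hnR : (0:ℝ) < n := by exact_mod_cast hn
  set κ' : ℝ := κ / (2 * (n * n)) with hκ'
  have hκ'0 : 0 < κ' := by positivity
  have hℓ0 : ∀ᶠ ω in (U : Filter Ω), 0 ≤ ℓ ω := hℓ.eventually_ge_atTop 0
  have hgapex : ∀ᶠ ω in (U : Filter Ω), ∃ h : Fin n, ∃ h1 : 1 ≤ h.val, x ω ∈ Vs k (y ω) h ∧
      Real.exp (κ' * ℓ ω) * D.sz L (w ω) (y ω ⟨h - 1, by omega⟩) ≤ D.sz L (w ω) (y ω h) := by
    filter_upwards [hw, hx, hx0, hsz, hprod, hℓ0, ev_exp _ hℓ (4 ^ n / c + 1) (half_pos hκ)] with ω hw hx hx0 hsz hprod hℓ0 hbig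
    have hw0 : ∀ v i, 0 < w ω v i := fun v i => (hw v i).1
    obtain ⟨hy1, hy2, hy3⟩ := hy ω hw0
    have hli := flag_li _ hy2
    have hlp : ∀ l, 0 < D.sz L (w ω) (y ω l) := fun l => D.sz_pos hw0 hL (hli.ne_zero l)
    obtain ⟨u, hu1, hu2⟩ := exists_level (y ω) hli hx0
    have hu3 := hy3 u _ hx hu2
    have hd := hdet (w ω) hw0 (y ω) hy1 (li_det _ hli)
    have hb : 4 ^ n * Real.exp (κ' * ℓ ω) ^ (n * n) < ∏ i, D.sz L (w ω) (y ω i) := by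
      have e1 : Real.exp (κ' * ℓ ω) ^ (n * n) = Real.exp (κ / 2 * ℓ ω) := by
        rw [← Real.exp_nat_mul]
        congr 1
        rw [hκ']; push_cast; field_simp
      have e2 : Real.exp (-(κ * ℓ ω)) * (Real.exp (κ / 2 * ℓ ω) * Real.exp (κ / 2 * ℓ ω)) = 1 := by
        rw [← Real.exp_add, ← Real.exp_add, ← Real.exp_zero]; congr 1; ring
      rw [e1]
      set E := Real.exp (κ / 2 * ℓ ω) with hE
      have hE0 : 0 < E := Real.exp_pos _
      have hp : 0 < ∏ i, D.sz L (w ω) (y ω i) := prod_pos fun i _ => hlp i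
      set Pi := ∏ i, D.sz L (w ω) (y ω i) with hPi
      have a1 : c ≤ Pi * Real.exp (-(κ * ℓ ω)) := hd.trans (mul_le_mul_of_nonneg_left hprod hp.le)
      have a2 : c * (E * E) ≤ Pi := by
        calc c * (E * E) ≤ Pi * Real.exp (-(κ * ℓ ω)) * (E * E) := mul_le_mul_of_nonneg_right a1 (by positivity)
          _ = Pi := by rw [mul_assoc, e2, mul_one]
      have a3 : 4 ^ n / c < E := by linarith
      rw [div_lt_iff₀ hc] at a3
      nlinarith
    obtain ⟨h, hh, huh, hg⟩ := gap_index (fun l => D.sz L (w ω) (y ω l)) hlp (fun r r' => D.lam_mon hy1 hy2 hy3 r r') u (by linarith)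
      (Real.exp (κ' * ℓ ω)) (Real.one_le_exp (by positivity)) hb
    refine ⟨⟨h + 1, hh⟩, by simp, Vs_mono _ (by simpa using huh) hu1, ?_⟩
    simpa using hg
  have hch : ∀ ω, ∃ h : Fin n, (∃ h : Fin n, ∃ h1 : 1 ≤ h.val, x ω ∈ Vs k (y ω) h ∧
      Real.exp (κ' * ℓ ω) * D.sz L (w ω) (y ω ⟨h - 1, by omega⟩) ≤ D.sz L (w ω) (y ω h)) → ∃ h1 : 1 ≤ h.val, x ω ∈ Vs k (y ω) h ∧
      Real.exp (κ' * ℓ ω) * D.sz L (w ω) (y ω ⟨h - 1, by omega⟩) ≤ D.sz L (w ω) (y ω h) := by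
    intro ω
    by_cases h : (∃ h : Fin n, ∃ h1 : 1 ≤ h.val, x ω ∈ Vs k (y ω) h ∧
      Real.exp (κ' * ℓ ω) * D.sz L (w ω) (y ω ⟨h - 1, by omega⟩) ≤ D.sz L (w ω) (y ω h))
    · obtain ⟨a, b⟩ := h
      exact ⟨a, fun _ => b⟩
    · exact ⟨⟨0, hn⟩, fun h' => absurd h' h⟩
  choose hf hhf using hch
  obtain ⟨h, hhc⟩ := ev_fin U hf
  have hgap : ∀ᶠ ω in (U : Filter Ω), ∃ h1 : 1 ≤ h.val, x ω ∈ Vs k (y ω) h ∧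
      Real.exp (κ' * ℓ ω) * D.sz L (w ω) (y ω ⟨h - 1, by omega⟩) ≤ D.sz L (w ω) (y ω h) := by
    filter_upwards [hgapex, hhc] with ω h1 h2
    have := hhf ω h1
    rw [h2] at this
    exact this
  have h1 : 1 ≤ h.val := by
    obtain ⟨ω, h1, -⟩ := hgap.exists
    exact h1
  clear hgapex hhc
  obtain ⟨h, hhn⟩ := h
  simp only at hgap h1
  obtain ⟨W, τ, P, cL, hτ, hP, hcL, hcd, hPli, hPspan⟩ := wedge_exists k n h
  obtain ⟨J0, hJ0'⟩ := hτ.2 (Fin.castLEOrderEmb hhn.le)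
  have hJ0 : ∀ a, (τ J0 a).val = a.val := by intro a; rw [hJ0']; simp
  have hW : 2 ≤ W := by
    obtain ⟨J1, hJ1⟩ := hτ.2 (OrderEmbedding.ofStrictMono (fun a : Fin h => (⟨a + 1, by omega⟩ : Fin n)) (fun a b hab => by
      simpa using hab))
    have : J0 ≠ J1 := by
      rintro rfl
      have h2 := hJ0 ⟨0, h1⟩
      rw [hJ1] at h2
      change 0 + 1 = 0 at h2
      omega
    exact Fin.nontrivial_iff_two_le.1 ⟨_, _, this⟩
  obtain ⟨K, hK, hKz⟩ := D.wedge_lower v0 hn τ hτ P cL hP hcL hcd hPli J0 L hL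
  set F : ℝ := (((h.factorial : ℝ)) ^ 2) ^ Fintype.card S with hF
  have hF0 : 0 < F := by positivity
  have hpne : ∀ᶠ ω in (U : Filter Ω), (P fun a => y ω (τ J0 a)) ≠ 0 := by
    filter_upwards [hw] with ω hw
    obtain ⟨hy1, hy2, hy3⟩ := hy ω fun v i => (hw v i).1
    exact (hPli _ (flag_li _ hy2)).ne_zero J0
  obtain ⟨p0, hp0, hpp⟩ := D.core v0 hW (fun v => cL (L v)) (fun v => hcd _ (hL v)) U ℓ hℓ (B * h) (by positivity)
    (fun ω v J => ∏ a, w ω v (τ J a)) (by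
      filter_upwards [hw] with ω hw v J
      have hw0 : ∀ v i, 0 < w ω v i := fun v i => (hw v i).1
      have e1 : Real.exp (B * h * ℓ ω) = ∏ _a : Fin h, Real.exp (B * ℓ ω) := by
        rw [prod_const, card_univ, Fintype.card_fin, ← Real.exp_nat_mul]; congr 1; ring
      refine ⟨prod_pos fun a _ => hw0 _ _, ?_, ?_⟩
      · rw [e1]
        exact prod_le_prod (fun a _ => (hw0 _ _).le) fun a _ => (hw _ _).2.1
      · rw [e1, ← prod_inv_distrib]
        exact prod_le_prod (fun a _ => by positivity) fun a _ => (hw _ _).2.2)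
    (fun ω => P fun a => y ω (τ J0 a)) (by
      filter_upwards [hw] with ω hw I
      obtain ⟨hy1, hy2, hy3⟩ := hy ω fun v i => (hw v i).1
      rw [hP]
      exact D.det_mem_A _ fun a b => hy1 _ _) hpne (κ' / 2) (half_pos hκ'0) (by
    filter_upwards [hw, hgap, ev_exp _ hℓ (F * 4 ^ h / K) (half_pos hκ'0)] with ω hw hg hbig z hz hzp
    obtain ⟨_, hg1, hg2⟩ := hg
    have hw0 : ∀ v i, 0 < w ω v i := fun v i => (hw v i).1
    obtain ⟨hy1, hy2, hy3⟩ := hy ω hw0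
    have hli := flag_li _ hy2
    have hlp : ∀ l, 0 < D.sz L (w ω) (y ω l) := fun l => D.sz_pos hw0 hL (hli.ne_zero l)
    obtain ⟨J1, hJ1, hJz⟩ := hKz (w ω) hw0 (y ω) hy1 hy2 hy3 z hz hzp
    have g1 := wedge_gap h1 hhn τ hτ J0 hJ0 (fun l => D.sz L (w ω) (y ω l)) hlp (fun r r' => D.lam_mon hy1 hy2 hy3 r r')
      (Real.exp (κ' * ℓ ω)) (Real.exp_pos _) hg2 J1 hJ1
    have g2 := D.wedge_sz τ P cL hP hcL L (w ω) hw0 (fun a => y ω (τ J0 a))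
    refine le_trans (mul_le_mul_of_nonneg_left g2 (Real.exp_pos _).le) (le_trans ?_ hJz)
    have e1 : Real.exp (κ' * ℓ ω) = Real.exp (κ' / 2 * ℓ ω) * Real.exp (κ' / 2 * ℓ ω) := by
      rw [← Real.exp_add]; congr 1; ring
    rw [e1] at g1
    set E := Real.exp (κ' / 2 * ℓ ω) with hE
    have hE0 : 0 < E := Real.exp_pos _
    rw [div_le_iff₀ hK] at hbig
    have hP0 : 0 < ∏ a, D.sz L (w ω) (y ω (τ J0 a)) := prod_pos fun a _ => hlp _
    clear_value E
    generalize (∏ a, D.sz L (w ω) (y ω (τ J0 a))) = Q0 at *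
    generalize (∏ a, D.sz L (w ω) (y ω (τ J1 a))) = Q1 at *
    have h4 : (0:ℝ) < 4 ^ h := by positivity
    rw [← mul_le_mul_iff_right₀ h4]
    calc 4 ^ h * (E * (F * Q0)) = (F * 4 ^ h) * (E * Q0) := by ring
      _ ≤ (E * K) * (E * Q0) := mul_le_mul_of_nonneg_right hbig (by positivity)
      _ = K * (E * E * Q0) := by ring
      _ ≤ K * (4 ^ h * Q1) := mul_le_mul_of_nonneg_left g1 hK.le
      _ = _ := by ring)
  obtain ⟨ω0, hw1, hp1, hp2⟩ := (hw.and (hpp.and hpne)).exists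
  obtain ⟨hy1, hy2, hy3⟩ := hy ω0 fun v i => (hw1 v i).1
  refine ⟨Submodule.span k (Set.range fun a => y ω0 (τ J0 a)), ?_, ?_⟩
  · intro htop
    have := finrank_range_le_card (R := k) (fun a => y ω0 (τ J0 a))
    unfold Set.finrank at this
    rw [htop, finrank_top] at this
    simp at this
    omega
  · filter_upwards [hpp, hpne, hgap] with ω a1 a2 a3
    obtain ⟨_, a3, -⟩ := a3
    obtain ⟨c0, hc0⟩ := Submodule.mem_span_singleton.1 hp1
    obtain ⟨c1, hc1⟩ := Submodule.mem_span_singleton.1 a1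
    have hc00 : c0 ≠ 0 := by
      rintro rfl
      rw [zero_smul] at hc0
      exact hp2 hc0.symm
    have hc10 : c1 ≠ 0 := by
      rintro rfl
      rw [zero_smul] at hc1
      exact a2 hc1.symm
    refine hPspan (fun a => y ω (τ J0 a)) (fun a => y ω0 (τ J0 a)) (c1 / c0) (div_ne_zero hc10 hc00) ?_ ?_ _ ?_
    · exact (flag_li _ hy2).comp _ (τ J0).injective
    · rw [← hc0, ← hc1, smul_smul, div_mul_cancel₀ _ hc00]
    · refine Submodule.span_mono ?_ a3
      rintro _ ⟨r, hr, rfl⟩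
      refine ⟨⟨r, hr⟩, ?_⟩
      exact congrArg (y ω) (Fin.ext (hJ0 _))

end PD
end


section
open Finset Filter Topology

theorem ev_ex {Ω α : Type*} [Finite α] (U : Ultrafilter Ω) (p : Ω → α → Prop) (h : ∀ᶠ ω in (U : Filter Ω), ∃ a, p ω a) :
    ∃ a, ∀ᶠ ω in (U : Filter Ω), p ω a := by
  classical
  obtain ⟨ω, a0, -⟩ := h.exists
  obtain ⟨c, hc⟩ := PD.ev_fin U (fun ω => if h : ∃ a, p ω a then h.choose else a0)
  refine ⟨c, ?_⟩
  filter_upwards [h, hc] with ω h1 h2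
  rw [dif_pos h1] at h2
  rw [← h2]; exact h1.choose_spec

theorem uf_exists {Ω P k : Type*} (r : P → Ω → k) (h : ∀ Φ : Finset k, ∃ ω, ∀ p, r p ω ∉ Φ) :
    ∃ U : Ultrafilter Ω, ∀ p φ, ∀ᶠ ω in (U : Filter Ω), r p ω ≠ φ := by
  classical
  choose ω hω using h
  refine ⟨(Ultrafilter.of (atTop : Filter (Finset k))).map ω, fun p φ => ?_⟩
  have h1 : ∀ᶠ Φ in (atTop : Filter (Finset k)), r p (ω Φ) ≠ φ := by
    filter_upwards [eventually_ge_atTop {φ}] with Φ hΦ heq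
    exact hω Φ p (by rw [heq]; exact hΦ (mem_singleton_self _))
  exact Ultrafilter.of_le _ h1

theorem level_gap {ι : Type*} [Fintype ι] [DecidableEq ι] (r : ι → ι → Prop)
    (hr : ∀ J : Finset ι, J.Nonempty → J ≠ univ → ∃ i i', r i i' ∧ ¬ (i ∈ J ↔ i' ∈ J)) (g : ι → ℝ) (a b : ι) (δ : ℝ) (hδ : 0 < δ)
    (hab : Fintype.card ι * δ ≤ g a - g b) : ∃ i i', r i i' ∧ δ ≤ |g i - g i'| := by
  classical
  by_contra! hcon
  set J : ℕ → Finset ι := fun m => univ.filter fun i => g i ≤ g b + m * δ with hJ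
  have hb : ∀ m, b ∈ J m := fun m => by simp [hJ]; positivity
  have hmono : ∀ m, J m ⊆ J (m + 1) := by
    intro m i hi
    simp [hJ] at hi ⊢
    linarith
  have hstep : ∀ m, J m ≠ univ → (J m).card < (J (m+1)).card := by
    intro m hm
    obtain ⟨i, i', h1, h2⟩ := hr (J m) ⟨b, hb m⟩ hm
    have h3 := hcon i i' h1
    rw [abs_lt] at h3
    apply card_lt_card
    rw [Finset.ssubset_iff_of_subset (hmono m)]
    by_cases hi : i ∈ J m
    · have hi' : i' ∉ J m := by tauto
      refine ⟨i', ?_, hi'⟩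
      simp [hJ] at hi ⊢
      linarith
    · have hi' : i' ∈ J m := by tauto
      refine ⟨i, ?_, hi⟩
      simp [hJ] at hi' ⊢
      linarith
  have hcard : ∀ m, J m = univ ∨ m + 1 ≤ (J m).card := by
    intro m
    induction m with
    | zero => right; exact card_pos.2 ⟨b, hb 0⟩
    | succ m ih =>
      by_cases hm : J m = univ
      · left; exact eq_univ_of_forall fun i => hmono m (hm ▸ mem_univ i)
      · right
        have := hstep m hm
        rcases ih with h | h
        · exact absurd h hm
        · omega
  have hpos : 0 < Fintype.card ι := Fintype.card_pos_iff.2 ⟨a⟩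
  have huniv : J (Fintype.card ι - 1) = univ := by
    rcases hcard (Fintype.card ι - 1) with h | h
    · exact h
    · apply eq_univ_of_card
      have := card_le_univ (J (Fintype.card ι - 1))
      omega
  have ha : a ∈ J (Fintype.card ι - 1) := huniv ▸ mem_univ a
  simp [hJ] at ha
  rw [Nat.cast_sub (by omega)] at ha
  push_cast at ha
  linarith

namespace PD
variable {k : Type*} [Field k] {S : Type*} [Fintype S] (D : PD k S)

theorem heart_rel {Ω ι : Type*} [Fintype ι] (U : Ultrafilter Ω) (x : Ω → ι → k) 
    (hsum : ∀ᶠ ω in (U : Filter Ω), ∑ i, x ω i = 0)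
    (hsub : ∀ J : Finset ι, J.Nonempty → J ≠ univ → ∀ᶠ ω in (U : Filter Ω), ∑ i ∈ J, x ω i ≠ 0) :
    ∃ (n : ℕ) (b : Fin n → ι) (A : ι → Fin n → k), Function.Injective b ∧
      (∀ c : Fin n → k, (∀ᶠ ω in (U : Filter Ω), ∑ j, c j * x ω (b j) = 0) → c = 0) ∧
      (∀ i, ∀ᶠ ω in (U : Filter Ω), x ω i = ∑ j, A i j * x ω (b j)) ∧
      (∀ J : Finset ι, J.Nonempty → J ≠ univ → ∃ i j, A i j ≠ 0 ∧ ¬ (i ∈ J ↔ b j ∈ J)) := by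
  classical
  let Z : Submodule k (Ω → k) :=
    { carrier := {g | ∀ᶠ ω in (U : Filter Ω), g ω = 0}
      zero_mem' := by simp
      add_mem' := by
        intro g g' h h'
        filter_upwards [show ∀ᶠ ω in (U : Filter Ω), g ω = 0 from h, show ∀ᶠ ω in (U : Filter Ω), g' ω = 0 from h'] with ω h1 h2
        simp [h1, h2]
      smul_mem' := by
        intro c g h
        filter_upwards [show ∀ᶠ ω in (U : Filter Ω), g ω = 0 from h] with ω h1
        simp [h1] }
  have hZ : ∀ g, g ∈ Z ↔ ∀ᶠ ω in (U : Filter Ω), g ω = 0 := fun g => Iff.rfl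
  obtain ⟨κ, a, ha, hspan, hli⟩ := exists_linearIndependent' k (fun i => Z.mkQ fun ω => x ω i)
  have : Finite κ := Finite.of_injective a ha
  obtain ⟨n, ⟨e⟩⟩ := Finite.exists_equiv_fin κ
  set b : Fin n → ι := fun j => a (e.symm j) with hb
  have hli' : LinearIndependent k fun j => Z.mkQ fun ω => x ω (b j) := hli.comp _ e.symm.injective
  have hsp : ∀ i, ∃ A : Fin n → k, ∀ᶠ ω in (U : Filter Ω), x ω i = ∑ j, A j * x ω (b j) := by
    intro i
    have h1 : (Z.mkQ fun ω => x ω i) ∈ Submodule.span k (Set.range fun j => Z.mkQ fun ω => x ω (b j)) := by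
      have : Set.range (fun j => Z.mkQ fun ω => x ω (b j)) = Set.range ((fun i => Z.mkQ fun ω => x ω i) ∘ a) := by
        ext z
        constructor
        · rintro ⟨j, rfl⟩; exact ⟨e.symm j, rfl⟩
        · rintro ⟨j, rfl⟩; exact ⟨e j, by simp [hb]⟩
      rw [this, hspan]
      exact Submodule.subset_span ⟨i, rfl⟩
    obtain ⟨A, hA⟩ := (Submodule.mem_span_range_iff_exists_fun k).1 h1
    refine ⟨A, ?_⟩
    simp only [← map_smul, ← map_sum] at hA
    rw [← sub_eq_zero, ← map_sub, Submodule.mkQ_apply, Submodule.Quotient.mk_eq_zero, hZ] at hA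
    filter_upwards [hA] with ω h
    simp [sub_eq_zero] at h
    exact h.symm
  choose A hA using hsp
  have hLI : ∀ c : Fin n → k, (∀ᶠ ω in (U : Filter Ω), ∑ j, c j * x ω (b j) = 0) → c = 0 := by
    intro c hc
    ext j
    refine Fintype.linearIndependent_iff.1 hli' c ?_ j
    simp only [← map_smul, ← map_sum]
    rw [Submodule.mkQ_apply, Submodule.Quotient.mk_eq_zero, hZ]
    filter_upwards [hc] with ω h
    simpa using h
  refine ⟨n, b, A, fun j j' h => e.symm.injective (ha h), hLI, hA, ?_⟩
  intro J hJ hJu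
  by_contra! hcon
  have hA' : ∀ᶠ ω in (U : Filter Ω), ∀ i, x ω i = ∑ j, A i j * x ω (b j) := eventually_all.2 hA
  have hcol : (fun j => ∑ i, A i j) = 0 := by
    apply hLI
    filter_upwards [hA', hsum] with ω h1 h2
    simp_rw [sum_mul]
    rw [sum_comm, ← h2]
    exact sum_congr rfl fun i _ => (h1 i).symm
  obtain ⟨ω, h1, h2⟩ := (hA'.and (hsub J hJ hJu)).exists
  apply h2
  calc ∑ i ∈ J, x ω i = ∑ i ∈ J, ∑ j, A i j * x ω (b j) := sum_congr rfl fun i _ => h1 i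
    _ = ∑ j, (∑ i ∈ J, A i j) * x ω (b j) := by rw [sum_comm]; simp_rw [sum_mul]
    _ = 0 := sum_eq_zero fun j _ => by
      have : ∑ i ∈ J, A i j = 0 := by
        by_cases hj : b j ∈ J
        · refine Eq.trans ?_ (congrFun hcol j)
          refine sum_subset (subset_univ _) fun i _ hi => ?_
          by_contra hne
          have := hcon i j hne
          tauto
        · refine sum_eq_zero fun i hi => ?_
          by_contra hne
          have := hcon i j hne
          tauto
      rw [this, zero_mul]

end PD
end


section
open Finset Filter Topology
namespace PD
variable {k : Type*} [Field k] {S : Type*} [Fintype S] (D : PD k S)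

theorem prod_unit {a : k} (ha : a ∈ D.A) (ha0 : a ≠ 0) (hai : a⁻¹ ∈ D.A) : ∏ v, D.f v a = 1 := by
  have h1 := D.prod_ge a ha ha0
  have h2 := D.prod_ge a⁻¹ hai (inv_ne_zero ha0)
  have h3 : (∏ v, D.f v a) * ∏ v, D.f v a⁻¹ = 1 := by
    rw [← prod_mul_distrib]
    refine prod_eq_one fun v _ => ?_
    rw [← map_mul, mul_inv_cancel₀ ha0, map_one]
  nlinarith

theorem heart_swap [CharZero k] [DecidableEq S] {Ω ι : Type*} (U : Ultrafilter Ω) (x : Ω → ι → k)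
    (hx : ∀ᶠ ω in (U : Filter Ω), ∀ i, x ω i ∈ D.A ∧ x ω i ≠ 0 ∧ (x ω i)⁻¹ ∈ D.A)
    (ℓ : Ω → ℝ) (hℓ : Tendsto ℓ U atTop)
    (hbd : ∀ᶠ ω in (U : Filter Ω), ∀ v i, D.f v (x ω i) ≤ Real.exp (1 * ℓ ω) ∧ (Real.exp (1 * ℓ ω))⁻¹ ≤ D.f v (x ω i))
    {n : ℕ} (b : Fin n → ι) (A : ι → Fin n → k) 
    (hLI : ∀ c : Fin n → k, (∀ᶠ ω in (U : Filter Ω), ∑ j, c j * x ω (b j) = 0) → c = 0)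
    (hA : ∀ i, ∀ᶠ ω in (U : Filter Ω), x ω i = ∑ j, A i j * x ω (b j)) (i : ι) (j : Fin n) (hij : A i j ≠ 0)
    (T : Finset S) (v0 : S) (κ : ℝ) (hκ : 0 < κ)
    (hprod : ∀ᶠ ω in (U : Filter Ω), ∏ v, D.f v (if v ∈ T then x ω i else x ω (b j)) ≤ Real.exp (-(κ * ℓ ω))) : False := by
  classical
  set L : S → Matrix (Fin n) (Fin n) k := fun v => if v ∈ T then (1 : Matrix (Fin n) (Fin n) k).updateRow j (A i) else 1 with hLdef
  have hL : ∀ v, (L v).det ≠ 0 := by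
    intro v
    rw [hLdef]
    simp only
    split_ifs
    · have : A i = ∑ j', A i j' • (1 : Matrix (Fin n) (Fin n) k) j' := by
        ext j'; simp [Finset.sum_apply, Matrix.one_apply]
      rw [this, Matrix.det_updateRow_sum, Matrix.det_one]
      simpa using hij
    · simp
  set idx : S → Fin n → ι := fun v j' => if v ∈ T ∧ j' = j then i else b j' with hidx
  have hform : ∀ᶠ ω in (U : Filter Ω), ∀ v j', (L v).mulVec (fun j => x ω (b j)) j' = x ω (idx v j') := by
    filter_upwards [hA i] with ω h v j'
    rw [hLdef, hidx]
    by_cases hv : v ∈ T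
    · by_cases hj : j' = j
      · subst hj
        simp only [hv, and_self, if_true]
        rw [h]
        simp [Matrix.mulVec, dotProduct]
      · simp only [hv, true_and, hj, if_true, if_false]
        simp [Matrix.mulVec, Matrix.updateRow_ne hj, dotProduct, Matrix.one_apply]
    · simp [hv]
  obtain ⟨V, hV, hVx⟩ := D.subspace v0 L hL U ℓ hℓ 1 zero_le_one (fun ω v j' => D.f v (x ω (idx v j'))) (by
      filter_upwards [hbd, hx] with ω h1 h2 v j'
      exact ⟨D.f_pos v (h2 _).2.1, h1 v _⟩) (fun ω j => x ω (b j)) (by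
      filter_upwards [hx] with ω h j
      exact (h _).1) (by
      filter_upwards [hx] with ω h h0
      exact (h (b j)).2.1 (congrFun h0 j)) (by
      filter_upwards [hx, hform] with ω h1 h2
      unfold sz
      have hw0 : ∀ v j', 0 < D.f v (x ω (idx v j')) := fun v j' => D.f_pos v (h1 _).2.1
      refine prod_le_one (fun v _ => D.sv_nonneg hw0 _ _) fun v _ => ?_
      refine D.sv_le hw0 v _ 1 zero_le_one fun j' => ?_
      rw [h2, mul_one]) κ hκ (by
      filter_upwards [hprod, hx] with ω h hx
      refine le_trans (le_of_eq ?_) h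
      rw [Finset.prod_comm, ← mul_prod_erase univ _ (mem_univ j)]
      rw [prod_eq_one (s := univ.erase j), mul_one]
      · refine prod_congr rfl fun v _ => ?_
        rw [hidx]
        simp only [and_true]
        split_ifs <;> rfl
      · intro j' hj'
        rw [← D.prod_unit (hx (b j')).1 (hx (b j')).2.1 (hx (b j')).2.2]
        refine prod_congr rfl fun v _ => ?_
        rw [hidx]
        simp only [(mem_erase.1 hj').1, and_false, if_false])
  obtain ⟨φ, hφ, hφV⟩ := Submodule.exists_le_ker_of_lt_top V (lt_top_iff_ne_top.2 hV)
  apply hφ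
  have hc := hLI (fun j => φ (Pi.single j 1)) (by
    filter_upwards [hVx] with ω h
    have : φ (fun j => x ω (b j)) = 0 := hφV h
    rw [← this, LinearMap.pi_apply_eq_sum_univ φ]
    refine sum_congr rfl fun j _ => ?_
    rw [smul_eq_mul, mul_comm]
    congr 2
    ext j'; simp [Pi.single_apply, eq_comm])
  refine LinearMap.pi_ext' fun j => LinearMap.ext_ring ?_
  simpa using congrFun hc j

theorem heart [CharZero k] {Ω ι : Type*} [Fintype ι] (v0 : S) (hNor : ∀ R : ℝ, {a | a ∈ D.A ∧ ∀ v, D.f v a ≤ R}.Finite)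
    (U : Ultrafilter Ω) (x : Ω → ι → k)
    (hx : ∀ᶠ ω in (U : Filter Ω), ∀ i, x ω i ∈ D.A ∧ x ω i ≠ 0 ∧ (x ω i)⁻¹ ∈ D.A)
    (hsum : ∀ᶠ ω in (U : Filter Ω), ∑ i, x ω i = 0)
    (hsub : ∀ J : Finset ι, J.Nonempty → J ≠ univ → ∀ᶠ ω in (U : Filter Ω), ∑ i ∈ J, x ω i ≠ 0)
    (i0 i1 : ι) (hi0 : ∀ᶠ ω in (U : Filter Ω), x ω i0 = 1) (hi1 : ∀ φ, ∀ᶠ ω in (U : Filter Ω), x ω i1 ≠ φ) : False := by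
  classical
  have : Nonempty (S × ι × ι) := ⟨(v0, i0, i0)⟩
  have hmax : ∀ ω, ∃ t : S × ι × ι, ∀ t' : S × ι × ι, Real.log (D.f t'.1 (x ω t'.2.1)) - Real.log (D.f t'.1 (x ω t'.2.2)) ≤
    Real.log (D.f t.1 (x ω t.2.1)) - Real.log (D.f t.1 (x ω t.2.2)) := fun ω => 
      Finite.exists_max (fun t : S × ι × ι => Real.log (D.f t.1 (x ω t.2.1)) - Real.log (D.f t.1 (x ω t.2.2)))
  choose t ht using hmax
  set ℓ : Ω → ℝ := fun ω => Real.log (D.f (t ω).1 (x ω (t ω).2.1)) - Real.log (D.f (t ω).1 (x ω (t ω).2.2)) with hℓdef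
  have hle : ∀ ω v i i', Real.log (D.f v (x ω i)) - Real.log (D.f v (x ω i')) ≤ ℓ ω := fun ω v i i' => ht ω (v, i, i')
  have hbd : ∀ᶠ ω in (U : Filter Ω), ∀ v i, D.f v (x ω i) ≤ Real.exp (1 * ℓ ω) ∧ (Real.exp (1 * ℓ ω))⁻¹ ≤ D.f v (x ω i) := by
    filter_upwards [hx, hi0] with ω h1 h2 v i
    have hp := D.f_pos v (h1 i).2.1
    have a1 := hle ω v i i0
    have a2 := hle ω v i0 i
    rw [h2, map_one, Real.log_one] at a1 a2
    rw [one_mul, ← Real.exp_neg, ← Real.log_le_iff_le_exp hp, ← Real.le_log_iff_exp_le hp]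
    constructor <;> linarith
  have hℓ : Tendsto ℓ U atTop := by
    rw [tendsto_atTop]
    intro R
    by_contra! hcon
    have hfin := hNor (Real.exp R)
    have : Finite {a | a ∈ D.A ∧ ∀ v, D.f v a ≤ Real.exp R} := hfin
    obtain ⟨a, ha⟩ := ev_ex U (fun ω (a : {a | a ∈ D.A ∧ ∀ v, D.f v a ≤ Real.exp R}) => x ω i1 = a) (by
      filter_upwards [hcon, hx, hbd] with ω h1 h2 h3
      refine ⟨⟨x ω i1, (h2 i1).1, fun v => (h3 v i1).1.trans ?_⟩, rfl⟩
      rw [one_mul]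
      exact Real.exp_le_exp.2 h1.le)
    obtain ⟨ω, h1, h2⟩ := (ha.and (hi1 a)).exists
    exact h2 h1
  obtain ⟨n, b, A, hb, hLI, hA, hcut⟩ := heart_rel U x hsum hsub
  have hc0 : (0:ℝ) < Fintype.card ι := by exact_mod_cast Fintype.card_pos_iff.2 ⟨i0⟩
  set κ : ℝ := 1 / Fintype.card ι with hκ
  have hκ0 : 0 < κ := by positivity
  have hev : ∀ᶠ ω in (U : Filter Ω), ∃ q : S × ι × Fin n, A q.2.1 q.2.2 ≠ 0 ∧
      κ * ℓ ω ≤ |Real.log (D.f q.1 (x ω q.2.1)) - Real.log (D.f q.1 (x ω (b q.2.2)))| := by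
    filter_upwards [hℓ.eventually_gt_atTop 0] with ω h0
    obtain ⟨i, i', ⟨j, rfl, hij⟩, hd⟩ := level_gap (fun i i' => ∃ j, i' = b j ∧ A i j ≠ 0) (by
      intro J hJ hJu
      obtain ⟨i, j, h1, h2⟩ := hcut J hJ hJu
      exact ⟨i, b j, ⟨j, rfl, h1⟩, h2⟩) (fun i => Real.log (D.f (t ω).1 (x ω i))) (t ω).2.1 (t ω).2.2 (κ * ℓ ω) (by positivity) (by
      have : Fintype.card ι * (κ * ℓ ω) = ℓ ω := by rw [hκ]; field_simp
      rw [this])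
    exact ⟨((t ω).1, i, j), hij, hd⟩
  obtain ⟨⟨v, i, j⟩, hq⟩ := ev_ex U _ hev
  simp only at hq
  have hij : A i j ≠ 0 := by
    obtain ⟨ω, h, -⟩ := hq.exists
    exact h
  by_cases hcase : ∀ᶠ ω in (U : Filter Ω), Real.log (D.f v (x ω i)) ≤ Real.log (D.f v (x ω (b j)))
  · refine D.heart_swap U x hx ℓ hℓ hbd b A hLI hA i j hij {v} v0 κ hκ0 ?_
    filter_upwards [hcase, hq, hx] with ω h1 h2 h3
    have h2 := h2.2
    rw [abs_sub_comm, abs_of_nonneg (by linarith)] at h2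
    have hpi := D.f_pos v (h3 i).2.1
    have hpb := D.f_pos v (h3 (b j)).2.1
    have e1 : (∏ u, D.f u (if u ∈ ({v} : Finset S) then x ω i else x ω (b j))) * D.f v (x ω (b j)) = D.f v (x ω i) := by
      have := D.prod_unit (h3 (b j)).1 (h3 (b j)).2.1 (h3 (b j)).2.2
      rw [← mul_prod_erase univ _ (mem_univ v)] at this ⊢
      rw [prod_congr rfl (g := fun u => D.f u (x ω (b j)))]
      · simp only [mem_singleton, if_true]
        rw [mul_assoc, mul_comm _ (D.f v (x ω (b j))), this, mul_one]
      · intro u hu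
        simp [(mem_erase.1 hu).1]
    rw [← mul_le_mul_iff_left₀ hpb, e1]
    rw [← Real.exp_log hpi, ← Real.exp_log hpb, ← Real.exp_add]
    apply Real.exp_le_exp.2
    linarith
  · have hcase : ∀ᶠ ω in (U : Filter Ω), Real.log (D.f v (x ω (b j))) < Real.log (D.f v (x ω i)) := by
      push Not at hcase; exact hcase
    refine D.heart_swap U x hx ℓ hℓ hbd b A hLI hA i j hij (univ.erase v) v0 κ hκ0 ?_
    filter_upwards [hcase, hq, hx] with ω h1 h2 h3
    have h2 := h2.2
    rw [abs_of_nonneg (by linarith)] at h2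
    have hpi := D.f_pos v (h3 i).2.1
    have hpb := D.f_pos v (h3 (b j)).2.1
    have e1 : (∏ u, D.f u (if u ∈ univ.erase v then x ω i else x ω (b j))) * D.f v (x ω i) = D.f v (x ω (b j)) := by
      have := D.prod_unit (h3 i).1 (h3 i).2.1 (h3 i).2.2
      rw [← mul_prod_erase univ _ (mem_univ v)] at this ⊢
      rw [prod_congr rfl (g := fun u => D.f u (x ω i))]
      · simp only [mem_erase, ne_eq, not_true, false_and, if_false]
        rw [mul_assoc, mul_comm _ (D.f v (x ω i)), this, mul_one]
      · intro u hu
        simp [(mem_erase.1 hu).1]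
    rw [← mul_le_mul_iff_left₀ hpi, e1]
    rw [← Real.exp_log hpi, ← Real.exp_log hpb, ← Real.exp_add]
    apply Real.exp_le_exp.2
    linarith

theorem unit [CharZero k] (v0 : S) (hNor : ∀ R : ℝ, {a | a ∈ D.A ∧ ∀ v, D.f v a ≤ R}.Finite)
    (Γ : Subgroup kˣ) (hΓ : ∀ γ ∈ Γ, (γ : k) ∈ D.A) (m : ℕ) (hm : 1 ≤ m) :
    ∃ Φ : Finset k, ∀ x : Fin m → kˣ, (∀ i, x i ∈ Γ) → ∑ i, (x i : k) = 0 → ∃ i i', i ≠ i' ∧ (x i : k) / x i' ∈ Φ := by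
  classical
  by_contra! hcon
  obtain ⟨U, hU⟩ := uf_exists (Ω := {x : Fin m → kˣ // (∀ i, x i ∈ Γ) ∧ ∑ i, (x i : k) = 0}) (P := {p : Fin m × Fin m // p.1 ≠ p.2})
    (fun p x => (x.1 p.1.1 : k) / x.1 p.1.2) (by
      intro Φ
      obtain ⟨x, h1, h2, h3⟩ := hcon Φ
      exact ⟨⟨x, h1, h2⟩, fun p => h3 _ _ p.2⟩)
  obtain ⟨I, hI, hmin⟩ := exists_min_image (univ.filter fun I : Finset (Fin m) => I.Nonempty ∧ ∀ᶠ x in (U : Filter {x : Fin m → kˣ // (∀ i, x i ∈ Γ) ∧ ∑ i, (x i : k) = 0}),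
    ∑ i ∈ I, (x.1 i : k) = 0) card ⟨univ, by
      rw [mem_filter]
      refine ⟨mem_univ _, ⟨⟨0, hm⟩, mem_univ _⟩, Eventually.of_forall fun x => x.2.2⟩⟩
  rw [mem_filter] at hI
  obtain ⟨-, ⟨i0, hi0⟩, hsum⟩ := hI
  have hex : ∃ i1 ∈ I, i1 ≠ i0 := by
    by_contra! h
    have : I = {i0} := by
      ext i; rw [mem_singleton]; exact ⟨h i, fun h => h ▸ hi0⟩
    rw [this] at hsum
    obtain ⟨x, hx⟩ := hsum.exists
    simp at hx
  obtain ⟨i1, hi1, hne⟩ := hex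
  refine D.heart v0 hNor U (fun x (i : I) => (x.1 i : k) / x.1 i0) ?_ ?_ ?_ ⟨i0, hi0⟩ ⟨i1, hi1⟩ ?_ ?_
  · refine Eventually.of_forall fun x i => ⟨?_, ?_, ?_⟩
    · have := hΓ _ (Γ.div_mem (x.2.1 i) (x.2.1 i0))
      rwa [Units.val_div_eq_div_val] at this
    · exact div_ne_zero (Units.ne_zero _) (Units.ne_zero _)
    · have := hΓ _ (Γ.div_mem (x.2.1 i0) (x.2.1 i))
      rwa [Units.val_div_eq_div_val, ← inv_div] at this
  · filter_upwards [hsum] with x hx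
    rw [← sum_div, sum_coe_sort I (fun i => (x.1 i : k)), hx, zero_div]
  · intro J hJ hJu
    by_contra! h
    have h1 : (J.map (Function.Embedding.subtype _)) ∈ (univ.filter fun I : Finset (Fin m) => I.Nonempty ∧ ∀ᶠ x in (U : Filter {x : Fin m → kˣ // (∀ i, x i ∈ Γ) ∧ ∑ i, (x i : k) = 0}),
        ∑ i ∈ I, (x.1 i : k) = 0) := by
      rw [mem_filter]
      refine ⟨mem_univ _, by simpa using hJ, ?_⟩
      filter_upwards [h] with x hx
      rw [← sum_div, div_eq_zero_iff] at hx
      simpa using hx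
    have h2 := hmin _ h1
    rw [card_map] at h2
    apply hJu
    apply eq_univ_of_card
    rw [Fintype.card_coe]
    have := card_le_univ J
    rw [Fintype.card_coe] at this
    omega
  · exact Eventually.of_forall fun x => div_self (Units.ne_zero _)
  · intro φ
    exact hU ⟨(i1, i0), hne⟩ φ

end PD
end

section
open Finset

theorem pigeon_card_icc {b : ℝ} (hb : 1 ≤ b) :
    ((Finset.Icc ⌊-b⌋ ⌊b⌋).card : ℝ) ≤ 4 * b := by
  have h1 : ⌊-b⌋ ≤ ⌊b⌋ + 1 := by
    have : ⌊-b⌋ ≤ ⌊b⌋ := Int.floor_mono (by linarith)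
    omega
  rw [Int.card_Icc]
  have h2 : ((⌊b⌋ + 1 - ⌊-b⌋).toNat : ℝ) = ((⌊b⌋ + 1 - ⌊-b⌋ : ℤ) : ℝ) := by
    have : ((⌊b⌋ + 1 - ⌊-b⌋).toNat : ℤ) = ⌊b⌋ + 1 - ⌊-b⌋ := Int.toNat_of_nonneg (by omega)
    exact_mod_cast this
  rw [h2]
  push_cast
  have := Int.floor_le b
  have := Int.lt_floor_add_one (-b)
  linarith

universe uG

theorem pigeon_box {ι J : Type*} [Fintype ι] [Fintype J] [Nonempty ι]
    (hc : Fintype.card ι = Fintype.card J) (ℓ : J → ι → ℝ) :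
    ∃ C : ℝ, 0 < C ∧ ∀ (G : Type uG) [AddCommGroup G] [Finite G] (g : (ι → ℤ) →+ G) (s : J → ℝ),
      (∀ j, 0 < s j) → C * Nat.card G ≤ ∏ j, s j →
      ∃ z : ι → ℤ, z ≠ 0 ∧ g z = 0 ∧ ∀ j, |∑ i, ℓ j i * z i| ≤ s j := by
  classical
  set B : ℝ := 1 + ∑ j, ∑ i, |ℓ j i| with hB
  have hB1 : 1 ≤ B := by
    have : 0 ≤ ∑ j, ∑ i, |ℓ j i| := by positivity
    linarith
  have hBj : ∀ j, ∑ i, |ℓ j i| ≤ B := by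
    intro j
    have := Finset.single_le_sum (f := fun j => ∑ i, |ℓ j i|) (fun _ _ => by positivity)
      (Finset.mem_univ j)
    linarith
  clear_value B
  refine ⟨(4 * B) ^ Fintype.card J, by positivity, ?_⟩
  intro G _ _ g s hs hC
  have := Fintype.ofFinite G
  obtain ⟨R, hR⟩ : ∃ R : ℕ, 1 ≤ R ∧ ∀ j, s j ≤ B * R := by
    obtain ⟨R, hR⟩ := exists_nat_ge (1 + ∑ j, s j)
    have h0 : 0 ≤ ∑ j, s j := Finset.sum_nonneg fun j _ => (hs j).le
    refine ⟨R, ?_, fun j => ?_⟩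
    · have : (1 : ℝ) ≤ R := by linarith
      exact_mod_cast this
    · have := Finset.single_le_sum (f := s) (fun j _ => (hs j).le) (Finset.mem_univ j)
      have h1 : s j ≤ R := by linarith
      have h2 : (0 : ℝ) ≤ R := by positivity
      nlinarith
  obtain ⟨hR1, hRs⟩ := hR
  have hRpos : (0 : ℝ) < R := by exact_mod_cast hR1
  set P : Finset (ι → ℤ) := Fintype.piFinset fun _ => Finset.Icc (0 : ℤ) R with hP
  set Q : Finset (G × (J → ℤ)) := Finset.univ ×ˢ
    Fintype.piFinset fun j => Finset.Icc ⌊-(B * R / s j)⌋ ⌊B * R / s j⌋ with hQ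
  set F : (ι → ℤ) → G × (J → ℤ) := fun z => (g z, fun j => ⌊(∑ i, ℓ j i * z i) / s j⌋) with hF
  have hlt : Q.card < P.card := by
    have h1 : (Q.card : ℝ) ≤ (R : ℝ) ^ Fintype.card J := by
      rw [hQ, Finset.card_product, Fintype.card_piFinset]
      push_cast
      have h3 : ∏ j, ((Finset.Icc ⌊-(B * R / s j)⌋ ⌊B * R / s j⌋).card : ℝ)
          ≤ ∏ j, (4 * (B * R / s j)) := by
        apply Finset.prod_le_prod
        · intro j _; positivity
        · intro j _
          exact pigeon_card_icc (by rw [le_div_iff₀ (hs j), one_mul]; exact hRs j)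
      have h4 : ∏ j, (4 * (B * R / s j)) = (4 * B) ^ Fintype.card J * R ^ Fintype.card J /
          ∏ j, s j := by
        rw [← mul_pow, ← Finset.card_univ, ← Finset.prod_const, ← Finset.prod_div_distrib]
        apply Finset.prod_congr rfl
        intro j _; ring
      have hps : 0 < ∏ j, s j := Finset.prod_pos fun j _ => hs j
      have h5 : ((Finset.univ : Finset G).card : ℝ) = Nat.card G := by
        rw [Finset.card_univ, Nat.card_eq_fintype_card]
      rw [h5]
      calc (Nat.card G : ℝ) * ∏ j, ((Finset.Icc ⌊-(B * R / s j)⌋ ⌊B * R / s j⌋).card : ℝ)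
          ≤ Nat.card G * ((4 * B) ^ Fintype.card J * R ^ Fintype.card J / ∏ j, s j) := by
            rw [← h4]
            exact mul_le_mul_of_nonneg_left h3 (by positivity)
        _ = ((4 * B) ^ Fintype.card J * Nat.card G) * R ^ Fintype.card J / ∏ j, s j := by ring
        _ ≤ R ^ Fintype.card J := by
            rw [div_le_iff₀ hps, mul_comm]
            exact mul_le_mul_of_nonneg_left hC (by positivity)
    have h2 : P.card = (R + 1) ^ Fintype.card J := by
      rw [hP, Fintype.card_piFinset]
      simp [hc]
    have h3 : Q.card ≤ R ^ Fintype.card J := by exact_mod_cast h1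
    rw [h2]
    refine h3.trans_lt ?_
    apply Nat.pow_lt_pow_left (by omega)
    rw [← hc]; exact Fintype.card_ne_zero
  have hmaps : ∀ z ∈ P, F z ∈ Q := by
    intro z hz
    rw [hP, Fintype.mem_piFinset] at hz
    rw [hQ, Finset.mem_product]
    refine ⟨Finset.mem_univ _, ?_⟩
    rw [Fintype.mem_piFinset]
    intro j
    have hb : |∑ i, ℓ j i * z i| ≤ B * R := by
      calc |∑ i, ℓ j i * z i| ≤ ∑ i, |ℓ j i * z i| := Finset.abs_sum_le_sum_abs _ _
        _ ≤ ∑ i, |ℓ j i| * R := by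
          apply Finset.sum_le_sum
          intro i _
          rw [abs_mul]
          apply mul_le_mul_of_nonneg_left _ (abs_nonneg _)
          have := Finset.mem_Icc.1 (hz i)
          rw [abs_le]
          constructor
          · have : (0 : ℝ) ≤ z i := by exact_mod_cast this.1
            linarith
          · exact_mod_cast this.2
        _ = (∑ i, |ℓ j i|) * R := by rw [Finset.sum_mul]
        _ ≤ B * R := mul_le_mul_of_nonneg_right (hBj j) hRpos.le
    rw [abs_le] at hb
    rw [Finset.mem_Icc]
    constructor
    · apply Int.floor_mono
      rw [← neg_div]
      exact div_le_div_of_nonneg_right hb.1 (hs j).le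
    · apply Int.floor_mono
      exact div_le_div_of_nonneg_right hb.2 (hs j).le
  obtain ⟨x, hx, y, hy, hne, heq⟩ := Finset.exists_ne_map_eq_of_card_lt_of_maps_to hlt hmaps
  refine ⟨x - y, sub_ne_zero.2 hne, ?_, ?_⟩
  · rw [map_sub, sub_eq_zero]; exact congrArg Prod.fst heq
  · intro j
    have h1 : ⌊(∑ i, ℓ j i * x i) / s j⌋ = ⌊(∑ i, ℓ j i * y i) / s j⌋ :=
      congrFun (congrArg Prod.snd heq) j
    have h2 := Int.abs_sub_lt_one_of_floor_eq_floor h1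
    rw [← sub_div, abs_div, abs_of_pos (hs j), div_lt_one (hs j)] at h2
    have h3 : ∑ i, ℓ j i * ((x - y) i : ℤ) = ∑ i, ℓ j i * x i - ∑ i, ℓ j i * y i := by
      rw [← Finset.sum_sub_distrib]
      apply Finset.sum_congr rfl
      intro i _
      simp only [Pi.sub_apply]; push_cast; ring
    rw [h3]; exact h2.le

open NumberField in
theorem siegel_house (K : Type*) [Field K] [NumberField K] : ∃ c : ℝ, ∀ (p q : ℕ) (a : Matrix (Fin p) (Fin q) (𝓞 K)) (A : ℝ),
    a ≠ 0 → p < q → 0 < p → (∀ i j, house ((a i j : 𝓞 K) : K) ≤ A) →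
    ∃ ξ : Fin q → 𝓞 K, ξ ≠ 0 ∧ a.mulVec ξ = 0 ∧
      ∀ l, house (ξ l).1 ≤ c * ((c * q * A) ^ ((p : ℝ) / (q - p))) := by
  classical
  exact ⟨_, fun p q a A ha hpq h0p habs => 
    house.exists_ne_zero_int_vec_house_le K a ha h0p hpq (Fintype.card_fin q) habs (Fintype.card_fin p)⟩
end

section
open Finset NumberField IsDedekindDomain

set_option linter.unusedSectionVars false
namespace NF
variable (k : Type*) [Field k] [NumberField k]

theorem fin_le_one (v : HeightOneSpectrum (𝓞 k)) {x : k} (hx : IsIntegral ℤ x) :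
    FinitePlace.mk v x ≤ 1 := by
  have := FinitePlace.norm_le_one k v (⟨x, hx⟩ : 𝓞 k)
  exact this

theorem integral_of_fin {x : k} (h : ∀ v : HeightOneSpectrum (𝓞 k), FinitePlace.mk v x ≤ 1) :
    IsIntegral ℤ x := by
  have h2 : x ∈ (algebraMap (𝓞 k) k).range := by
    apply HeightOneSpectrum.mem_integers_of_valuation_le_one
    intro v
    have h1 := h v
    rw [FinitePlace.mk_apply, FinitePlace.norm_embedding] at h1
    rw [HeightOneSpectrum.adicAbv_def] at h1
    exact (WithZeroMulInt.toNNReal_le_one_iff (HeightOneSpectrum.one_lt_absNorm_nnreal v)).1 (by exact_mod_cast h1)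
  obtain ⟨y, rfl⟩ := h2
  exact RingOfIntegers.isIntegral_coe y

/-- finite places dividing `n` -/
abbrev FP (n : ℕ) := {v : HeightOneSpectrum (𝓞 k) // (n : 𝓞 k) ∈ v.asIdeal}

theorem FP_finite {n : ℕ} (hn : n ≠ 0) : Finite (FP k n) := by
  have h0 : (n : 𝓞 k) ≠ 0 := by exact_mod_cast hn
  have h := FinitePlace.hasFiniteMulSupport_int h0
  refine @Finite.of_injective _ _ h.to_subtype (fun v : FP k n => ⟨FinitePlace.mk v.1, ?_⟩) ?_
  · rw [Function.mem_mulSupport]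
    have := (FinitePlace.norm_lt_one_iff_mem k v.1 (n : 𝓞 k)).2 v.2
    exact this.ne
  · intro v v' h
    have h1 : FinitePlace.mk v.1 = FinitePlace.mk v'.1 := congrArg Subtype.val h
    exact Subtype.ext (FinitePlace.mk_eq_iff.1 h1)

/-- the places in `S` -/
abbrev Pl (n : ℕ) := InfinitePlace k ⊕ FP k n

/-- normalised absolute values -/
noncomputable def pf (n : ℕ) : Pl k n → k →*₀ ℝ
  | .inl w =>
    { toFun := fun x => w x ^ w.mult
      map_zero' := by rw [map_zero, zero_pow w.mult_ne_zero]
      map_one' := by rw [map_one, one_pow]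
      map_mul' := fun x y => by rw [map_mul, mul_pow] }
  | .inr v =>
    { toFun := fun x => FinitePlace.mk v.1 x
      map_zero' := map_zero _
      map_one' := map_one _
      map_mul' := fun x y => map_mul _ _ _ }

theorem pf_inl (n : ℕ) (w : InfinitePlace k) (x : k) : pf k n (.inl w) x = w x ^ w.mult := rfl
theorem pf_inr (n : ℕ) (v : FP k n) (x : k) : pf k n (.inr v) x = FinitePlace.mk v.1 x := rfl

theorem pf_nonneg (n : ℕ) (v : Pl k n) (x : k) : 0 ≤ pf k n v x := by
  rcases v with w | v
  · rw [pf_inl]; positivity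
  · rw [pf_inr]; exact apply_nonneg _ _

/-- integers -/
def OO : Subring k := (integralClosure ℤ k).toSubring

theorem mem_OO {x : k} : x ∈ OO k ↔ IsIntegral ℤ x := Iff.rfl

/-- `n`-integers -/
def SA (n : ℕ) : Subring k where
  carrier := {x | ∃ j : ℕ, IsIntegral ℤ ((n : k) ^ j * x)}
  mul_mem' := by
    rintro a b ⟨i, hi⟩ ⟨j, hj⟩
    refine ⟨i + j, ?_⟩
    have := hi.mul hj
    have e : (n : k) ^ (i + j) * (a * b) = (n : k) ^ i * a * ((n : k) ^ j * b) := by ring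
    rw [e]; exact this
  one_mem' := ⟨0, by simpa using isIntegral_one⟩
  add_mem' := by
    rintro a b ⟨i, hi⟩ ⟨j, hj⟩
    refine ⟨i + j, ?_⟩
    have hn : IsIntegral ℤ (n : k) := by
      have := isIntegral_algebraMap (R := ℤ) (A := k) (x := (n : ℤ))
      simpa using this
    have := ((hn.pow j).mul hi).add ((hn.pow i).mul hj)
    have e : (n : k) ^ (i + j) * (a + b) = (n : k) ^ j * ((n : k) ^ i * a) + (n : k) ^ i * ((n : k) ^ j * b) := by ring
    rw [e]; exact this
  zero_mem' := ⟨0, by simpa using isIntegral_zero⟩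
  neg_mem' := by
    rintro a ⟨i, hi⟩
    exact ⟨i, by simpa using hi.neg⟩

theorem mem_SA {n : ℕ} {x : k} : x ∈ SA k n ↔ ∃ j : ℕ, IsIntegral ℤ ((n : k) ^ j * x) := Iff.rfl

theorem int_nat (n : ℕ) : IsIntegral ℤ (n : k) := by
  have := isIntegral_algebraMap (R := ℤ) (A := k) (x := (n : ℤ))
  simpa using this

theorem OO_le (n : ℕ) : OO k ≤ SA k n := fun x hx => ⟨0, by rw [pow_zero, one_mul]; exact hx⟩

theorem inv_mem_SA {n : ℕ} (hn : n ≠ 0) : (n : k)⁻¹ ∈ SA k n := by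
  have h0 : (n : k) ≠ 0 := by exact_mod_cast hn
  exact ⟨1, by rw [pow_one, mul_inv_cancel₀ h0]; exact isIntegral_one⟩

theorem nat_lt_one {n : ℕ} (v : FP k n) : FinitePlace.mk v.1 (n : k) < 1 := by
  have := (FinitePlace.norm_lt_one_iff_mem k v.1 (n : 𝓞 k)).2 v.2
  rw [FinitePlace.mk_apply]; simpa using this

theorem SA_fin {n : ℕ} {a : k} (ha : a ∈ SA k n) (v : HeightOneSpectrum (𝓞 k))
    (hv : (n : 𝓞 k) ∉ v.asIdeal) : FinitePlace.mk v a ≤ 1 := by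
  obtain ⟨j, hj⟩ := ha
  have h1 := fin_le_one k v hj
  have h2 : FinitePlace.mk v (n : k) = 1 := by
    have := (FinitePlace.norm_eq_one_iff_notMem k v (n : 𝓞 k)).2 hv
    rw [FinitePlace.mk_apply]; simpa using this
  rwa [map_mul, map_pow, h2, one_pow, one_mul] at h1

noncomputable instance (n : ℕ) [NeZero n] : Fintype (FP k n) :=
  @Fintype.ofFinite _ (FP_finite k (NeZero.ne n))

theorem prod_ge (n : ℕ) [NeZero n] (a : k) (ha : a ∈ SA k n) (h0 : a ≠ 0) :
    1 ≤ ∏ v, pf k n v a := by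
  classical
  rw [Fintype.prod_sum_type]
  simp only [pf_inl, pf_inr]
  have hp := prod_abs_eq_one h0
  have hsupp := FinitePlace.hasFiniteMulSupport h0
  set T : Finset (FinitePlace k) := Finset.univ.image (fun v : FP k n => FinitePlace.mk v.1)
  have hT : ∏ w ∈ T, w a = ∏ v : FP k n, FinitePlace.mk v.1 a := by
    rw [Finset.prod_image]
    intro v _ v' _ h
    exact Subtype.ext (FinitePlace.mk_eq_iff.1 h)
  have hfin : ∏ᶠ w : FinitePlace k, w a ≤ ∏ w ∈ T, w a := by
    rw [finprod_eq_prod_of_mulSupport_subset (s := hsupp.toFinset ∪ T)]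
    · rw [← Finset.sdiff_union_of_subset (Finset.subset_union_right : T ⊆ hsupp.toFinset ∪ T),
        Finset.prod_union Finset.sdiff_disjoint]
      have h2 : ∏ w ∈ (hsupp.toFinset ∪ T) \ T, w a ≤ 1 := by
        apply Finset.prod_le_one
        · intro w _; exact apply_nonneg _ _
        · intro w hw
          rw [Finset.mem_sdiff] at hw
          rw [← FinitePlace.mk_maximalIdeal w]
          apply SA_fin k ha
          intro h
          apply hw.2
          exact Finset.mem_image.2 ⟨⟨_, h⟩, Finset.mem_univ _, FinitePlace.mk_maximalIdeal w⟩
      have h3 : 0 ≤ ∏ w ∈ T, w a := Finset.prod_nonneg fun w _ => apply_nonneg _ _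
      nlinarith
    · intro w hw
      simp only [Finset.coe_union, Set.mem_union]
      left; exact hsupp.mem_toFinset.2 hw
  rw [hT] at hfin
  rw [← hp]
  apply mul_le_mul_of_nonneg_left hfin
  exact Finset.prod_nonneg fun w _ => by positivity

theorem sum' (n : ℕ) (v : Pl k n) (m : ℕ) (a : Fin m → k) (M : ℝ) (h : ∀ i, pf k n v (a i) ≤ M) :
    pf k n v (∑ i, a i) ≤ (m : ℝ) ^ 2 * M := by
  rcases Nat.eq_zero_or_pos m with rfl | hm
  · simp
  have hM : 0 ≤ M := (pf_nonneg k n v _).trans (h ⟨0, hm⟩)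
  have hm1 : (1 : ℝ) ≤ m := by exact_mod_cast hm
  have hm2 : (1 : ℝ) ≤ (m : ℝ) ^ 2 := one_le_pow₀ hm1
  rcases v with w | v
  · simp only [pf_inl] at h ⊢
    have hs : w (∑ i, a i) ≤ ∑ i, w (a i) := by
      have := w.1.sum_le (Finset.univ) a
      exact this
    rcases w.isReal_or_isComplex with hw | hw
    · have e : w.mult = 1 := by simp [InfinitePlace.mult, hw]
      rw [e] at h ⊢
      simp only [pow_one] at h ⊢
      have h3 : ∑ i, w (a i) ≤ ∑ i : Fin m, M := Finset.sum_le_sum fun i _ => h i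
      rw [Finset.sum_const, Finset.card_univ, Fintype.card_fin, nsmul_eq_mul] at h3
      have h5 : (m : ℝ) ≤ (m : ℝ) ^ 2 := by nlinarith
      have h6 := mul_le_mul_of_nonneg_right h5 hM
      linarith
    · have e : w.mult = 2 := by simp [InfinitePlace.mult, InfinitePlace.not_isReal_iff_isComplex.2 hw]
      rw [e] at h ⊢
      have h3 : ∑ i, w (a i) ≤ ∑ i : Fin m, √M :=
        Finset.sum_le_sum fun i _ => Real.le_sqrt_of_sq_le (h i)
      rw [Finset.sum_const, Finset.card_univ, Fintype.card_fin, nsmul_eq_mul] at h3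
      have h4 := hs.trans h3
      calc w (∑ i, a i) ^ 2 ≤ (m * √M) ^ 2 := pow_le_pow_left₀ (apply_nonneg _ _) h4 2
        _ = (m : ℝ) ^ 2 * M := by rw [mul_pow, Real.sq_sqrt hM]
  · simp only [pf_inr] at h ⊢
    have : ∀ s : Finset (Fin m), FinitePlace.mk v.1 (∑ i ∈ s, a i) ≤ M := by
      classical
      intro s
      induction s using Finset.induction_on with
      | empty => simpa using hM
      | insert i s hi ih =>
        rw [Finset.sum_insert hi]
        exact (FinitePlace.add_le _ _ _).trans (max_le (h i) ih)
    have := this Finset.univ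
    nlinarith

theorem northcott (n : ℕ) [NeZero n] (R : ℝ) :
    {a | a ∈ SA k n ∧ ∀ v, pf k n v a ≤ R}.Finite := by
  have hj : ∃ j : ℕ, ∀ v : FP k n, (FinitePlace.mk v.1 (n : k)) ^ j * R ≤ 1 := by
    have h1 : ∀ v : FP k n, ∀ᶠ j : ℕ in Filter.atTop, (FinitePlace.mk v.1 (n : k)) ^ j * R < 1 := by
      intro v
      have := (tendsto_pow_atTop_nhds_zero_of_lt_one (apply_nonneg _ _) (nat_lt_one k v)).mul_const R
      rw [zero_mul] at this
      exact this.eventually_lt_const one_pos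
    obtain ⟨j, hj⟩ := (Filter.eventually_all.2 h1).exists
    exact ⟨j, fun v => (hj v).le⟩
  obtain ⟨j, hj⟩ := hj
  have h0 : (n : k) ≠ 0 := by exact_mod_cast NeZero.ne n
  have hF := Embeddings.finite_of_norm_le k ℂ ((n : ℝ) ^ j * max R 1)
  refine (hF.preimage (f := fun a => (n : k) ^ j * a) ?_).subset ?_
  · intro a _ b _ h
    exact mul_left_cancel₀ (pow_ne_zero j h0) h
  · rintro a ⟨ha, hb⟩
    refine ⟨?_, ?_⟩
    · apply integral_of_fin
      intro v
      by_cases hv : (n : 𝓞 k) ∈ v.asIdeal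
      · rw [map_mul, map_pow]
        have h1 := hb (.inr ⟨v, hv⟩)
        rw [pf_inr] at h1
        exact (mul_le_mul_of_nonneg_left h1 (by positivity)).trans (hj ⟨v, hv⟩)
      · rw [map_mul]
        have h1 := SA_fin k ha v hv
        have h2 := fin_le_one k v ((int_nat k n).pow j)
        exact mul_le_one₀ h2 (apply_nonneg _ _) h1
    · intro φ
      rw [map_mul, map_pow, map_natCast, norm_mul, norm_pow, Complex.norm_natCast]
      apply mul_le_mul_of_nonneg_left _ (by positivity)
      have h1 := hb (.inl (InfinitePlace.mk φ))
      rw [pf_inl, InfinitePlace.apply] at h1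
      by_contra! hcon
      have h2 := (le_max_right R 1).trans_lt hcon
      have h3 : ‖φ a‖ ≤ ‖φ a‖ ^ (InfinitePlace.mk φ).mult :=
        le_self_pow₀ h2.le (InfinitePlace.mult_ne_zero)
      have := (le_max_left R 1)
      linarith

theorem den (a : k) : ∃ c ∈ OO k, c ≠ 0 ∧ c * a ∈ OO k := by
  obtain ⟨x, y, hy, rfl⟩ := IsFractionRing.div_surjective (A := 𝓞 k) a
  have hy0 : (algebraMap (𝓞 k) k y) ≠ 0 := by
    simpa using nonZeroDivisors.ne_zero hy
  refine ⟨algebraMap (𝓞 k) k y, RingOfIntegers.isIntegral_coe y, hy0, ?_⟩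
  rw [mul_div_cancel₀ _ hy0]
  exact RingOfIntegers.isIntegral_coe x

end NF
end

section
open Finset NumberField IsDedekindDomain
set_option linter.unusedSectionVars false
namespace NF
universe u
variable (k : Type u) [Field k] [NumberField k]

theorem fin_pow (v : HeightOneSpectrum (𝓞 k)) (x : 𝓞 k) (e : ℕ) (hx : x ∈ v.asIdeal ^ e) :
    FinitePlace.mk v (x : k) ≤ ((Ideal.absNorm v.asIdeal : ℝ) ^ e)⁻¹ := by
  rcases eq_or_ne x 0 with rfl | h0
  · simp
  have h1 := FinitePlace.apply_mul_absNorm_pow_eq_one (FinitePlace.mk v) h0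
  rw [FinitePlace.maximalIdeal_mk] at h1
  have hN : (1 : ℝ) < Ideal.absNorm v.asIdeal := by
    exact_mod_cast HeightOneSpectrum.one_lt_absNorm v
  have hfm : FiniteMultiplicity v.asIdeal (Ideal.span {x}) :=
    FiniteMultiplicity.of_prime_left v.prime (by simpa using h0)
  have h2 : e ≤ multiplicity v.asIdeal (Ideal.span {x}) := by
    rw [← hfm.pow_dvd_iff_le_multiplicity, Ideal.dvd_span_singleton]
    exact hx
  have h3 : (Ideal.absNorm v.asIdeal : ℝ) ^ e ≤
      (Ideal.absNorm v.asIdeal : ℝ) ^ multiplicity v.asIdeal (Ideal.span {x}) :=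
    pow_le_pow_right₀ hN.le h2
  have h4 : 0 < (Ideal.absNorm v.asIdeal : ℝ) ^ e := by positivity
  rw [← one_div, le_div_iff₀ h4, ← h1]
  exact mul_le_mul_of_nonneg_left h3 (apply_nonneg _ _)

theorem exists_exp {b r : ℝ} (hb : 1 < b) (hr : 0 < r) (hr1 : r ≤ 1) :
    ∃ e : ℕ, (b ^ e)⁻¹ ≤ r ∧ b ^ e ≤ b / r := by
  obtain ⟨n, h1, h2⟩ := exists_nat_pow_near (one_le_one_div hr hr1) hb
  refine ⟨n + 1, ?_, ?_⟩
  · rw [inv_le_comm₀ (by positivity) hr, ← one_div]; exact h2.le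
  · rw [pow_succ, div_eq_mul_one_div, mul_comm]
    exact mul_le_mul_of_nonneg_left h1 (by linarith)

/-- real or imaginary part -/
def part (t : ℕ) : ℂ →+ ℝ := if t = 0 then Complex.reAddGroupHom else Complex.imAddGroupHom

theorem arch_bound (w : InfinitePlace k) (y : k) (s : ℝ)
    (h : ∀ t : Fin w.mult, |part t (w.embedding y)| ≤ s / 2) : w y ≤ s := by
  rw [← w.norm_embedding_eq]
  refine (Complex.norm_le_abs_re_add_abs_im _).trans ?_
  have h0 : |(w.embedding y).re| ≤ s / 2 := h ⟨0, w.mult_pos⟩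
  have h1 : |(w.embedding y).im| ≤ s / 2 := by
    rcases w.isReal_or_isComplex with hw | hw
    · have : (w.embedding y).im = 0 := by
        have h2 := InfinitePlace.embedding_of_isReal_apply hw y
        rw [← h2]; exact Complex.ofReal_im _
      rw [this]; rw [abs_zero]; exact (abs_nonneg _).trans h0
    · have e : w.mult = 2 := by
        simp [InfinitePlace.mult, InfinitePlace.not_isReal_iff_isComplex.2 hw]
      exact h ⟨1, by omega⟩
  linarith

theorem prod_nat (n : ℕ) [NeZero n] : ∏ v, pf k n v (n : k) = 1 := by
  have h0 : (n : k) ≠ 0 := by exact_mod_cast NeZero.ne n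
  have h1 := prod_ge k n (n : k) (OO_le k n (int_nat k n)) h0
  have h2 := prod_ge k n (n : k)⁻¹ (inv_mem_SA k (NeZero.ne n)) (inv_ne_zero h0)
  have h3 : (∏ v, pf k n v (n : k)) * ∏ v, pf k n v (n : k)⁻¹ = 1 := by
    rw [← Finset.prod_mul_distrib]
    apply Finset.prod_eq_one
    intro v _
    rw [← map_mul, mul_inv_cancel₀ h0, map_one]
  nlinarith

theorem mink0 (n : ℕ) [NeZero n] (m : ℕ) (hm : 0 < m) (L : Pl k n → Matrix (Fin m) (Fin m) k) :
    ∃ C : ℝ, 0 < C ∧ ∀ W : Pl k n → Fin m → ℝ, (∀ v i, 0 < W v i) → (∀ v i, W (.inr v) i ≤ 1) →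
      C ≤ ∏ v, ∏ i, W v i → ∃ x : Fin m → k, x ≠ 0 ∧ (∀ i, IsIntegral ℤ (x i)) ∧
        ∀ v i, pf k n v ((L v).mulVec x i) ≤ W v i := by
  classical
  have hex : ∃ (q : 𝓞 k) (M : FP k n → Fin m → Fin m → 𝓞 k), q ≠ 0 ∧
      ∀ v i j, ((M v i j : 𝓞 k) : k) = q * L (.inr v) i j := by
    obtain ⟨q, hq⟩ := IsLocalization.exist_integer_multiples_of_finite (nonZeroDivisors (𝓞 k))
      (fun p : FP k n × Fin m × Fin m => L (.inr p.1) p.2.1 p.2.2)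
    choose M hM using hq
    refine ⟨q, fun v i j => M (v, i, j), nonZeroDivisors.coe_ne_zero q, fun v i j => ?_⟩
    have := hM (v, i, j)
    simp only [Algebra.smul_def] at this
    exact this
  obtain ⟨q, M, hq0, hM⟩ := hex
  let b := RingOfIntegers.basis k
  let I := Module.Free.ChooseBasisIndex ℤ (𝓞 k)
  have : Nonempty I := by
    have : 0 < Fintype.card I := by
      rw [← Module.finrank_eq_card_chooseBasisIndex, RingOfIntegers.rank]
      exact Module.finrank_pos
    exact Fintype.card_pos_iff.1 this
  have : Nonempty (Fin m) := ⟨⟨0, hm⟩⟩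
  let J := Fin m × Σ w : InfinitePlace k, Fin w.mult
  have hcard : Fintype.card (Fin m × I) = Fintype.card J := by
    rw [Fintype.card_prod, Fintype.card_prod, Fintype.card_sigma]
    congr 1
    rw [← Module.finrank_eq_card_chooseBasisIndex, RingOfIntegers.rank,
      ← InfinitePlace.sum_mult_eq (K := k)]
    simp
  obtain ⟨C0, hC0, hbox⟩ := pigeon_box.{u} hcard (fun (j : J) (p : Fin m × I) =>
    part j.2.2 (j.2.1.embedding (L (.inl j.2.1) j.1 p.1 * (b p.2 : k))))
  let X : (Fin m × I → ℤ) → Fin m → 𝓞 k := fun z i => ∑ a, z (i, a) • b a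
  have hXadd : ∀ z z' i, X (z + z') i = X z i + X z' i := by
    intro z z' i
    simp only [X, Pi.add_apply, add_smul, Finset.sum_add_distrib]
  have hX0 : ∀ z, (∀ i, X z i = 0) → z = 0 := by
    intro z hz
    funext ⟨i, a⟩
    exact Fintype.linearIndependent_iff.1 b.linearIndependent (fun a => z (i, a)) (hz i) a
  have hqpos : ∀ v : FP k n, 0 < FinitePlace.mk v.1 (q : k) := fun v =>
    FinitePlace.pos_iff.2 (by simpa using hq0)
  have hq1 : ∀ v : FP k n, FinitePlace.mk v.1 (q : k) ≤ 1 := fun v =>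
    fin_le_one k v.1 (RingOfIntegers.isIntegral_coe q)
  have hN : ∀ v : FP k n, (1 : ℝ) < Ideal.absNorm v.1.asIdeal := fun v => by
    exact_mod_cast HeightOneSpectrum.one_lt_absNorm v.1
  let E : ℝ := ∏ v : FP k n, ∏ _i : Fin m, ((Ideal.absNorm v.1.asIdeal : ℝ) / FinitePlace.mk v.1 (q : k))
  have hE : 0 < E := Finset.prod_pos fun v _ => Finset.prod_pos fun i _ =>
    div_pos (by linarith [hN v]) (hqpos v)
  refine ⟨C0 * 2 ^ Fintype.card J * E, by positivity, ?_⟩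
  intro W hW hW1 hC
  have hexp : ∀ (v : FP k n) (i : Fin m), ∃ e : ℕ,
      ((Ideal.absNorm v.1.asIdeal : ℝ) ^ e)⁻¹ ≤ FinitePlace.mk v.1 (q : k) * W (.inr v) i ∧
      (Ideal.absNorm v.1.asIdeal : ℝ) ^ e ≤
        (Ideal.absNorm v.1.asIdeal : ℝ) / (FinitePlace.mk v.1 (q : k) * W (.inr v) i) := by
    intro v i
    exact exists_exp (hN v) (mul_pos (hqpos v) (hW _ _))
      (mul_le_one₀ (hq1 v) (hW _ _).le (hW1 v i))
  choose e he1 he2 using hexp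
  let G := (p : FP k n × Fin m) → (𝓞 k ⧸ p.1.1.asIdeal ^ e p.1 p.2)
  have hfinq : ∀ p : FP k n × Fin m, Finite (𝓞 k ⧸ p.1.1.asIdeal ^ e p.1 p.2) := fun p =>
    Ring.HasFiniteQuotients.finiteQuotient (pow_ne_zero _ p.1.1.ne_bot)
  have hGcard : (Nat.card G : ℝ) = ∏ v : FP k n, ∏ i, (Ideal.absNorm v.1.asIdeal : ℝ) ^ e v i := by
    rw [Nat.card_pi, ← Finset.univ_product_univ, Finset.prod_product]
    push_cast
    refine Finset.prod_congr rfl fun v _ => Finset.prod_congr rfl fun i _ => ?_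
    have : Nat.card (𝓞 k ⧸ v.1.asIdeal ^ e v i) = Ideal.absNorm (v.1.asIdeal ^ e v i) := by
      rw [Ideal.absNorm_apply]; rfl
    rw [this, map_pow]; push_cast; rfl
  let g : (Fin m × I → ℤ) →+ G := AddMonoidHom.mk'
    (fun z p => Ideal.Quotient.mk _ (∑ j, M p.1 p.2 j * X z j)) (by
      intro z z'
      funext p
      change Ideal.Quotient.mk (p.1.1.asIdeal ^ e p.1 p.2) _ =
        Ideal.Quotient.mk (p.1.1.asIdeal ^ e p.1 p.2) _ +
        Ideal.Quotient.mk (p.1.1.asIdeal ^ e p.1 p.2) _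
      rw [← map_add]
      congr 1
      rw [← Finset.sum_add_distrib]
      refine Finset.sum_congr rfl fun j _ => ?_
      rw [hXadd, mul_add])
  let s : J → ℝ := fun j => (W (.inl j.2.1) j.1) ^ ((j.2.1.mult : ℝ)⁻¹) / 2
  have hspos : ∀ j, 0 < s j := fun j => div_pos (Real.rpow_pos_of_pos (hW _ _) _) two_pos
  have hsprod : ∏ j, s j = (∏ w : InfinitePlace k, ∏ i, W (.inl w) i) / 2 ^ Fintype.card J := by
    simp only [s]
    rw [Finset.prod_div_distrib, Finset.prod_const, Finset.card_univ]
    congr 1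
    rw [← Finset.univ_product_univ, Finset.prod_product, Finset.prod_comm]
    rw [← Finset.univ_sigma_univ, Finset.prod_sigma]
    refine Finset.prod_congr rfl fun w _ => ?_
    rw [Finset.prod_comm]
    refine Finset.prod_congr rfl fun i _ => ?_
    simp only [Finset.prod_const, Finset.card_univ, Fintype.card_fin]
    exact Real.rpow_inv_natCast_pow (hW _ _).le w.mult_ne_zero
  have hcond : C0 * Nat.card G ≤ ∏ j, s j := by
    rw [hsprod, le_div_iff₀ (by positivity)]
    set Wf := ∏ v : FP k n, ∏ i, W (.inr v) i with hWf
    have hWfpos : 0 < Wf := Finset.prod_pos fun v _ => Finset.prod_pos fun i _ => hW _ _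
    have h1 : (Nat.card G : ℝ) ≤ E / Wf := by
      rw [hGcard, hWf, ← Finset.prod_div_distrib]
      apply Finset.prod_le_prod
      · intro v _; positivity
      intro v _
      rw [← Finset.prod_div_distrib]
      apply Finset.prod_le_prod
      · intro i _; positivity
      intro i _
      rw [div_div]
      exact he2 v i
    rw [Fintype.prod_sum_type] at hC
    have h2 : C0 * 2 ^ Fintype.card J * E / Wf ≤ ∏ w : InfinitePlace k, ∏ i, W (.inl w) i := by
      rw [div_le_iff₀ hWfpos]; exact hC
    refine le_trans ?_ h2
    calc C0 * Nat.card G * 2 ^ Fintype.card J = C0 * 2 ^ Fintype.card J * Nat.card G := by ring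
      _ ≤ C0 * 2 ^ Fintype.card J * (E / Wf) := mul_le_mul_of_nonneg_left h1 (by positivity)
      _ = _ := by ring
  obtain ⟨z, hz0, hgz, hz⟩ := hbox G g s hspos hcond
  refine ⟨fun i => (X z i : k), ?_, fun i => RingOfIntegers.isIntegral_coe _, ?_⟩
  · intro h
    apply hz0
    apply hX0
    intro i
    have := congrFun h i
    simpa using this
  · intro v i
    rcases v with w | v
    · rw [pf_inl]
      have h1 : w ((L (.inl w)).mulVec (fun i => (X z i : k)) i)
          ≤ (W (.inl w) i) ^ ((w.mult : ℝ)⁻¹) := by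
        apply arch_bound
        intro t
        have h2 := hz (i, ⟨w, t⟩)
        refine le_of_eq_of_le ?_ h2
        congr 1
        rw [← Finset.univ_product_univ, Finset.sum_product]
        simp only [Matrix.mulVec, dotProduct, map_sum]
        refine Finset.sum_congr rfl fun j _ => ?_
        simp only [X, map_sum, Finset.mul_sum]
        refine Finset.sum_congr rfl fun a _ => ?_
        have e1 : L (.inl w) i j * ((z (j, a) • b a : 𝓞 k) : k)
            = z (j, a) • (L (.inl w) i j * (b a : k)) := by
          simp only [zsmul_eq_mul, map_mul, map_intCast]; ring
        rw [e1, map_zsmul, map_zsmul, zsmul_eq_mul, mul_comm]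
      calc _ ≤ ((W (.inl w) i) ^ ((w.mult : ℝ)⁻¹)) ^ w.mult :=
            pow_le_pow_left₀ (apply_nonneg _ _) h1 _
        _ = W (.inl w) i := Real.rpow_inv_natCast_pow (hW _ _).le w.mult_ne_zero
    · rw [pf_inr]
      have h1 : Ideal.Quotient.mk (v.1.asIdeal ^ e v i) (∑ j, M v i j * X z j) = 0 :=
        congrFun hgz (v, i)
      rw [Ideal.Quotient.eq_zero_iff_mem] at h1
      have h2 := fin_pow k v.1 _ _ h1
      have h3 : ((∑ j, M v i j * X z j : 𝓞 k) : k)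
          = q * (L (.inr v)).mulVec (fun i => (X z i : k)) i := by
        simp only [Matrix.mulVec, dotProduct, map_sum, map_mul, Finset.mul_sum]
        refine Finset.sum_congr rfl fun j _ => ?_
        have e2 : algebraMap (𝓞 k) k (M v i j) = algebraMap (𝓞 k) k q * L (.inr v) i j := hM v i j
        rw [e2]; exact mul_assoc _ _ _
      rw [h3, map_mul] at h2
      have h4 := h2.trans (he1 v i)
      exact le_of_mul_le_mul_left h4 (hqpos v)

theorem mink (n : ℕ) [NeZero n] (m : ℕ) (L : Pl k n → Matrix (Fin m) (Fin m) k) (hm : 0 < m) :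
    ∃ C : ℝ, 0 < C ∧ ∀ W : Pl k n → Fin m → ℝ, (∀ v i, 0 < W v i) →
      C ≤ ∏ v, ∏ i, W v i → ∃ x : Fin m → k, x ≠ 0 ∧ (∀ i, x i ∈ SA k n) ∧
        ∀ v i, pf k n v ((L v).mulVec x i) ≤ W v i := by
  obtain ⟨C, hC, h⟩ := mink0 k n m hm L
  refine ⟨C, hC, ?_⟩
  intro W hW hCW
  have h0 : (n : k) ≠ 0 := by exact_mod_cast NeZero.ne n
  have hj : ∃ j : ℕ, ∀ (v : FP k n) (i : Fin m), (FinitePlace.mk v.1 (n : k)) ^ j * W (.inr v) i ≤ 1 := by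
    have h1 : ∀ (v : FP k n) (i : Fin m), ∀ᶠ j : ℕ in Filter.atTop,
        (FinitePlace.mk v.1 (n : k)) ^ j * W (.inr v) i < 1 := by
      intro v i
      have := (tendsto_pow_atTop_nhds_zero_of_lt_one (apply_nonneg _ _)
        (nat_lt_one k v)).mul_const (W (.inr v) i)
      rw [zero_mul] at this
      exact this.eventually_lt_const one_pos
    obtain ⟨j, hj⟩ := (Filter.eventually_all.2 fun v => Filter.eventually_all.2 (h1 v)).exists
    exact ⟨j, fun v i => (hj v i).le⟩
  obtain ⟨j, hj⟩ := hj
  have hfpos : ∀ v, 0 < pf k n v (n : k) := by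
    intro v
    refine lt_of_le_of_ne (pf_nonneg k n v _) ?_
    exact fun h => h0 ((map_eq_zero (pf k n v)).1 h.symm)
  obtain ⟨x, hx0, hxi, hx⟩ := h (fun v i => (pf k n v (n : k)) ^ j * W v i)
    (fun v i => mul_pos (pow_pos (hfpos v) _) (hW v i)) (fun v i => hj v i) (by
      have : ∏ v, ∏ i : Fin m, ((pf k n v (n : k)) ^ j * W v i) = ∏ v, ∏ i, W v i := by
        simp only [Finset.prod_mul_distrib]
        simp only [Finset.prod_const, Finset.prod_pow, prod_nat, one_pow, one_mul]
      rw [this]; exact hCW)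
  refine ⟨fun i => ((n : k)⁻¹) ^ j * x i, ?_, ?_, ?_⟩
  · intro hh
    apply hx0
    funext i
    have := congrFun hh i
    simpa [h0] using this
  · intro i
    exact (SA k n).mul_mem ((SA k n).pow_mem (inv_mem_SA k (NeZero.ne n)) _) (OO_le k n (hxi i))
  · intro v i
    have e1 : (L v).mulVec (fun i => ((n : k)⁻¹) ^ j * x i) i = ((n : k)⁻¹) ^ j * (L v).mulVec x i := by
      simp only [Matrix.mulVec, dotProduct, Finset.mul_sum]
      refine Finset.sum_congr rfl fun l _ => by ring
    rw [e1, map_mul, map_pow, map_inv₀, inv_pow, inv_mul_le_iff₀ (pow_pos (hfpos v) _)]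
    exact hx v i

end NF
end

section
open Finset NumberField IsDedekindDomain
set_option linter.unusedSectionVars false
namespace NF
universe u
variable (k : Type u) [Field k] [NumberField k]

theorem siegel (n : ℕ) : ∃ c : ℕ, 1 ≤ c ∧ ∀ (p q : ℕ) (M : Matrix (Fin p) (Fin q) k) (H : ℝ),
    1 ≤ H → 0 < q → 2 * p ≤ q → (∀ i j, M i j ∈ OO k) → (∀ v i j, pf k n v (M i j) ≤ H) →
    ∃ ξ : Fin q → k, ξ ≠ 0 ∧ (∀ j, ξ j ∈ OO k) ∧ M.mulVec ξ = 0 ∧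
      ∀ v j, pf k n v (ξ j) ≤ ((c : ℝ) * q * H) ^ c := by
  obtain ⟨c₀, hc₀⟩ := siegel_house k
  obtain ⟨c, hc⟩ := exists_nat_ge (max |c₀| 1 ^ 2 + 2)
  set c' := max |c₀| 1 with hc'
  have hc'1 : 1 ≤ c' := le_max_right _ _
  have hc2 : (2 : ℝ) ≤ c := by nlinarith
  have hc2' : 2 ≤ c := by exact_mod_cast hc2
  refine ⟨c, by omega, ?_⟩
  intro p q M H hH hq hpq hMO hMH
  have hq1 : (1 : ℝ) ≤ q := by exact_mod_cast hq
  have hqH : 1 ≤ q * H := by nlinarith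
  have hbase : 1 ≤ (c : ℝ) * q * H := by rw [mul_assoc]; nlinarith
  by_cases hM0 : M = 0
  · refine ⟨fun _ => 1, ?_, fun _ => (OO k).one_mem, ?_, ?_⟩
    · intro h
      exact one_ne_zero (congrFun h ⟨0, hq⟩)
    · rw [hM0, Matrix.zero_mulVec]
    · intro v j
      rw [map_one]
      exact one_le_pow₀ hbase
  have hp : 0 < p := by
    rcases Nat.eq_zero_or_pos p with rfl | h
    · exact absurd (Subsingleton.elim _ _) hM0
    · exact h
  set a : Matrix (Fin p) (Fin q) (𝓞 k) := fun i j => ⟨M i j, hMO i j⟩ with ha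
  have haM : ∀ i j, ((a i j : 𝓞 k) : k) = M i j := fun i j => rfl
  clear_value a
  obtain ⟨ξ, hξ0, hξM, hξ⟩ := hc₀ p q a H (by
    intro h
    apply hM0
    ext i j
    rw [← haM, h]; simp) (by omega) hp (by
    intro i j
    rw [haM, house_eq_sup']
    have : ∀ φ : k →+* ℂ, ‖φ (M i j)‖ ≤ H := by
      intro φ
      have h1 := hMH (.inl (InfinitePlace.mk φ)) i j
      rw [pf_inl, InfinitePlace.apply] at h1
      by_contra! hcon
      have h3 : ‖φ (M i j)‖ ≤ ‖φ (M i j)‖ ^ (InfinitePlace.mk φ).mult :=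
        le_self_pow₀ (by linarith) (InfinitePlace.mult_ne_zero)
      linarith
    obtain ⟨φ, -, hφ⟩ := Finset.exists_mem_eq_sup' Finset.univ_nonempty
      (fun φ : k →+* ℂ => ‖φ (M i j)‖₊)
    rw [hφ]
    exact this φ)
  refine ⟨fun j => (ξ j : k), ?_, fun j => RingOfIntegers.isIntegral_coe _, ?_, ?_⟩
  · intro h
    apply hξ0
    funext j
    have := congrFun h j
    simpa using this
  · funext i
    have := congrArg (algebraMap (𝓞 k) k) (congrFun hξM i)
    simp only [Matrix.mulVec, dotProduct, map_sum, map_mul, Pi.zero_apply, map_zero] at this ⊢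
    rw [← this]
    refine Finset.sum_congr rfl fun j _ => ?_
    rw [← haM]
  · have hb : ∀ j, house (ξ j : k) ≤ c' * (c' * q * H) := by
      intro j
      refine (hξ j).trans ((le_abs_self _).trans ?_)
      rw [abs_mul]
      have hqp : (0 : ℝ) < q - p := by
        have : (p : ℝ) < q := by exact_mod_cast (by omega : p < q)
        linarith
      have h1 : |(c₀ * q * H) ^ ((p : ℝ) / (q - p))| ≤ c' * q * H := by
        refine (Real.abs_rpow_le_abs_rpow _ _).trans ?_
        have h2 : |c₀ * q * H| ≤ c' * q * H := by
          rw [abs_mul, abs_mul, abs_of_nonneg (by linarith : (0 : ℝ) ≤ q),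
            abs_of_nonneg (by linarith : (0 : ℝ) ≤ H), mul_assoc, mul_assoc]
          exact mul_le_mul_of_nonneg_right (le_max_left _ _) (by linarith)
        have h3 : 1 ≤ c' * q * H := by rw [mul_assoc]; nlinarith
        have h4 : (p : ℝ) / (q - p) ≤ 1 := by
          rw [div_le_one hqp]
          have : (2 * p : ℝ) ≤ q := by exact_mod_cast hpq
          linarith
        calc |c₀ * q * H| ^ ((p : ℝ) / (q - p)) ≤ (c' * q * H) ^ ((p : ℝ) / (q - p)) :=
              Real.rpow_le_rpow (abs_nonneg _) h2 (by positivity)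
          _ ≤ (c' * q * H) ^ (1 : ℝ) := Real.rpow_le_rpow_of_exponent_le h3 h4
          _ = _ := Real.rpow_one _
      exact mul_le_mul (le_max_left _ _) h1 (abs_nonneg _) (by linarith)
    intro v j
    rcases v with w | v
    · rw [pf_inl]
      have h1 : w (ξ j : k) ≤ (c : ℝ) * q * H := by
        rw [← w.norm_embedding_eq]
        refine (norm_embedding_le_house _ _).trans ((hb j).trans ?_)
        have : c' * (c' * q * H) = c' ^ 2 * (q * H) := by ring
        rw [this, mul_assoc]
        exact mul_le_mul_of_nonneg_right (by linarith) (by linarith)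
      have h2 : w.mult ≤ 2 := by
        unfold InfinitePlace.mult; split_ifs <;> norm_num
      calc w (ξ j : k) ^ w.mult ≤ ((c : ℝ) * q * H) ^ w.mult :=
            pow_le_pow_left₀ (apply_nonneg _ _) h1 _
        _ ≤ _ := pow_le_pow_right₀ hbase (by omega)
    · rw [pf_inr]
      exact (fin_le_one k v.1 (RingOfIntegers.isIntegral_coe _)).trans (one_le_pow₀ hbase)

theorem class_nat : ∃ N : ℕ, N ≠ 0 ∧ ∀ n : ℕ, N ∣ n → n ≠ 0 → ∀ ξ : k, ∃ a ∈ SA k n, ∃ b ∈ SA k n,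
    b ≠ 0 ∧ ξ = a / b ∧ ∃ x ∈ SA k n, ∃ y ∈ SA k n, x * a + y * b = 1 := by
  classical
  choose rep hrep using (ClassGroup.mk0_surjective (R := 𝓞 k))
  refine ⟨∏ c : ClassGroup (𝓞 k), Ideal.absNorm (rep c : Ideal (𝓞 k)), ?_, ?_⟩
  · rw [Finset.prod_ne_zero_iff]
    intro c _
    exact Ideal.absNorm_ne_zero_of_nonZeroDivisors _
  intro n hn hn0 ξ
  obtain ⟨α, β, hβ, rfl⟩ := IsFractionRing.div_surjective (A := 𝓞 k) ξ
  have hβ0 : β ≠ 0 := nonZeroDivisors.ne_zero hβ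
  set I : Ideal (𝓞 k) := Ideal.span {α, β} with hI
  have hα : α ∈ I := Ideal.subset_span (by simp)
  have hβI : β ∈ I := Ideal.subset_span (by simp)
  have hI0 : I ∈ nonZeroDivisors (Ideal (𝓞 k)) := by
    rw [mem_nonZeroDivisors_iff_ne_zero]
    intro h
    rw [h] at hβI
    exact hβ0 (by simpa using hβI)
  set J : Ideal (𝓞 k) := (rep (ClassGroup.mk0 ⟨I, hI0⟩)⁻¹ : Ideal (𝓞 k)) with hJ
  have hIJ : (I * J).IsPrincipal := by
    have h1 : ClassGroup.mk0 (⟨I, hI0⟩ * rep (ClassGroup.mk0 ⟨I, hI0⟩)⁻¹) = 1 := by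
      rw [map_mul, hrep, mul_inv_cancel]
    exact (ClassGroup.mk0_eq_one_iff _).1 h1
  obtain ⟨γ, hγ⟩ := hIJ
  have hγ' : I * J = Ideal.span {γ} := hγ
  have hnJ : (n : 𝓞 k) ∈ J := by
    have h1 : Ideal.absNorm J ∣ n := (Finset.dvd_prod_of_mem (fun c => Ideal.absNorm (rep c : Ideal (𝓞 k)))
      (Finset.mem_univ (ClassGroup.mk0 ⟨I, hI0⟩)⁻¹)).trans hn
    obtain ⟨t, rfl⟩ := h1
    rw [Nat.cast_mul]
    exact J.mul_mem_right _ (Ideal.absNorm_mem J)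
  clear_value J
  have h1 : α * n ∈ I * J := Ideal.mul_mem_mul hα hnJ
  have h2 : β * n ∈ I * J := Ideal.mul_mem_mul hβI hnJ
  have h3 : γ ∈ I := by
    have h4 : γ ∈ Ideal.span {γ} := Ideal.mem_span_singleton_self γ
    rw [← hγ'] at h4
    exact (Ideal.mul_le_inf h4).1
  rw [hγ', Ideal.mem_span_singleton'] at h1 h2
  obtain ⟨a, ha⟩ := h1
  obtain ⟨b, hb⟩ := h2
  rw [hI, Ideal.mem_span_pair] at h3
  obtain ⟨x, y, hxy⟩ := h3
  have hn0' : (n : 𝓞 k) ≠ 0 := by exact_mod_cast hn0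
  have hb0 : b ≠ 0 := by
    rintro rfl
    rw [zero_mul] at hb
    exact mul_ne_zero hβ0 hn0' hb.symm
  have hγ0 : γ ≠ 0 := by
    rintro rfl
    rw [mul_zero] at hb
    exact mul_ne_zero hβ0 hn0' hb.symm
  have hnk : (n : k) ≠ 0 := by exact_mod_cast hn0
  have hkey : x * a + y * b = n := by
    apply mul_right_cancel₀ hγ0
    linear_combination x * ha + y * hb + n * hxy
  have hmem : ∀ z : 𝓞 k, (z : k) ∈ SA k n := fun z => OO_le k n (RingOfIntegers.isIntegral_coe z)
  have hak : (a : k) * γ = α * n := by exact_mod_cast congrArg (algebraMap (𝓞 k) k) ha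
  have hbk : (b : k) * γ = β * n := by exact_mod_cast congrArg (algebraMap (𝓞 k) k) hb
  have hkk : (x : k) * a + y * b = n := by exact_mod_cast congrArg (algebraMap (𝓞 k) k) hkey
  have hbk0 : (b : k) ≠ 0 := by simpa using hb0
  have hγk0 : (γ : k) ≠ 0 := by simpa using hγ0
  have hβk0 : (β : k) ≠ 0 := by simpa using hβ0
  refine ⟨a, hmem a, b, hmem b, hbk0, ?_, (n : k)⁻¹ * x,
    (SA k n).mul_mem (inv_mem_SA k hn0) (hmem x), (n : k)⁻¹ * y,
    (SA k n).mul_mem (inv_mem_SA k hn0) (hmem y), ?_⟩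
  · rw [div_eq_div_iff hβk0 hbk0]
    apply mul_right_cancel₀ hγk0
    apply mul_right_cancel₀ hnk
    linear_combination (α : k) * n * hbk - (β : k) * n * hak
  · field_simp
    exact hkk

theorem den_nat (a : k) : ∃ d : ℕ, d ≠ 0 ∧ ∀ n, d ∣ n → a ∈ SA k n := by
  have halg : IsAlgebraic ℤ a := (IsFractionRing.isAlgebraic_iff ℤ ℚ k).2 (Algebra.IsAlgebraic.isAlgebraic a)
  obtain ⟨y, hy0, hy⟩ := halg.exists_integral_multiple
  refine ⟨y.natAbs, by simpa using hy0, ?_⟩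
  rintro n ⟨t, rfl⟩
  refine ⟨1, ?_⟩
  have h1 : IsIntegral ℤ ((y.natAbs : k) * a) := by
    rcases Int.natAbs_eq y with h | h
    · have e : (y : k) = (y.natAbs : k) := by
        have := congrArg (Int.cast : ℤ → k) h
        rwa [Int.cast_natCast] at this
      rw [← e]; rw [zsmul_eq_mul] at hy; exact hy
    · have e : (y : k) = -(y.natAbs : k) := by
        have := congrArg (Int.cast : ℤ → k) h
        rwa [Int.cast_neg, Int.cast_natCast] at this
      have := hy.neg
      rw [zsmul_eq_mul, e, neg_mul, neg_neg] at this
      exact this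
  have := h1.mul (int_nat k t)
  have e : ((y.natAbs * t : ℕ) : k) ^ 1 * a = (y.natAbs : k) * a * t := by push_cast; ring
  rw [e]; exact this

/-- the place data -/
noncomputable def data (n : ℕ) [NeZero n] (hcop : ∀ ξ : k, ∃ a ∈ SA k n, ∃ b ∈ SA k n,
    b ≠ 0 ∧ ξ = a / b ∧ ∃ x ∈ SA k n, ∃ y ∈ SA k n, x * a + y * b = 1) : PD k (Pl k n) where
  f := pf k n
  nonneg := pf_nonneg k n
  A := SA k n
  O := OO k
  OA := OO_le k n
  sum' := sum' k n
  prod_ge := prod_ge k n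
  den := den k
  cop := hcop
  mink := fun m L hm _ => mink k n m L hm
  siegel := siegel k n

theorem unit (Γ : Subgroup kˣ) (hΓ : Γ.FG) (m : ℕ) (hm : 1 ≤ m) :
    ∃ Φ : Finset k, ∀ x : Fin m → kˣ, (∀ i, x i ∈ Γ) → ∑ i, (x i : k) = 0 →
      ∃ i i', i ≠ i' ∧ (x i : k) / x i' ∈ Φ := by
  classical
  obtain ⟨T, hT⟩ := hΓ
  obtain ⟨N, hN0, hN⟩ := class_nat k
  choose d hd0 hd using den_nat k
  set n : ℕ := N * ((∏ u ∈ T, d u) * ∏ u ∈ T, d (u⁻¹ : kˣ)) with hn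
  have hn0 : n ≠ 0 := mul_ne_zero hN0 (mul_ne_zero (Finset.prod_ne_zero_iff.2 fun u _ => hd0 _)
    (Finset.prod_ne_zero_iff.2 fun u _ => hd0 _))
  have : NeZero n := ⟨hn0⟩
  have hcop := hN n (Dvd.intro _ rfl) hn0
  have hΓA : ∀ γ ∈ Γ, (γ : k) ∈ SA k n ∧ ((γ⁻¹ : kˣ) : k) ∈ SA k n := by
    intro γ hγ
    rw [← hT] at hγ
    induction hγ using Subgroup.closure_induction with
    | mem u hu =>
      have hu : u ∈ T := hu
      constructor
      · apply hd
        exact (Finset.dvd_prod_of_mem (fun u : kˣ => d u) hu).trans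
          (Dvd.intro (N * ∏ u ∈ T, d (u⁻¹ : kˣ)) (by rw [hn]; ring))
      · apply hd
        exact (Finset.dvd_prod_of_mem (fun u : kˣ => d (u⁻¹ : kˣ)) hu).trans
          (Dvd.intro (N * ∏ u ∈ T, d u) (by rw [hn]; ring))
    | one => simp [(SA k n).one_mem]
    | mul x y _ _ hx hy =>
      refine ⟨?_, ?_⟩
      · push_cast; exact (SA k n).mul_mem hx.1 hy.1
      · rw [mul_inv]; push_cast [Units.val_mul]
        have := (SA k n).mul_mem hx.2 hy.2
        simpa using this
    | inv x _ hx => exact ⟨hx.2, by rw [inv_inv]; exact hx.1⟩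
  exact (data k n hcop).unit (.inl (Classical.arbitrary _)) (northcott k n) Γ
    (fun γ h => (hΓA γ h).1) m hm

end NF
end

section
open Finset
set_option linter.style.haveILetI false
namespace GK

theorem root_unity (κ : Type*) [Field κ] [NumberField κ] (D : ℕ) (hD : Module.finrank ℚ κ ≤ D)
    (ζ : κ) (e : ℕ) (he : 0 < e) (h : ζ ^ e = 1) : ζ ^ ((2 * D).factorial) = 1 := by
  have hfin : IsOfFinOrder ζ := isOfFinOrder_iff_pow_eq_one.2 ⟨e, he, h⟩
  have hn : 0 < orderOf ζ := hfin.orderOf_pos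
  have hp : IsPrimitiveRoot ζ (orderOf ζ) := IsPrimitiveRoot.orderOf ζ
  have h1 : (orderOf ζ).totient ≤ D := by
    refine hp.totient_le_degree_minpoly.trans ?_
    have h2 := minpoly.isIntegrallyClosed_eq_field_fractions' ℚ (hp.isIntegral hn)
    have h3 : (minpoly ℚ ζ).natDegree ≤ Module.finrank ℚ κ := minpoly.natDegree_le ζ
    rw [h2, (minpoly.monic (hp.isIntegral hn)).natDegree_map] at h3
    exact h3.trans hD
  have h4 : orderOf ζ ∣ (2 * D).factorial := by
    rw [Nat.dvd_iff_prime_pow_dvd_dvd]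
    intro p a hp' hpa
    rcases Nat.eq_zero_or_pos a with rfl | ha
    · simp
    · have h5 := Nat.le_of_dvd (Nat.totient_pos.2 hn) (Nat.totient_dvd_of_dvd hpa)
      obtain ⟨b, rfl⟩ := Nat.exists_eq_add_of_lt ha
      rw [zero_add, Nat.totient_prime_pow_succ hp'] at h5
      refine Nat.dvd_factorial (pow_pos hp'.pos _) ?_
      have h6 := hp'.two_le
      rw [zero_add, pow_succ]
      obtain ⟨q, rfl⟩ := Nat.exists_eq_add_of_le h6
      have h7 : 2 + q - 1 = q + 1 := by omega
      rw [h7] at h5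
      nlinarith [Nat.zero_le ((2+q)^b * q)]
  exact orderOf_dvd_iff_pow_eq_one.1 h4

universe u
theorem specialize_ex (R : Type u) [CommRing R] [IsDomain R] [Algebra ℚ R] [Algebra.FiniteType ℚ R] :
    ∃ D : ℕ, ∀ f : R, f ≠ 0 → ∃ (κ : Type u) (_ : Field κ) (_ : NumberField κ) (φ : R →+* κ),
      Module.finrank ℚ κ ≤ D ∧ φ f ≠ 0 := by
  classical
  obtain ⟨s, g, hg, hgf⟩ := exists_finite_inj_algHom_of_fg ℚ R
  letI : Algebra (MvPolynomial (Fin s) ℚ) R := g.toRingHom.toAlgebra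
  have halg : ∀ p, algebraMap (MvPolynomial (Fin s) ℚ) R p = g p := fun _ => rfl
  haveI : IsScalarTower ℚ (MvPolynomial (Fin s) ℚ) R := IsScalarTower.of_algebraMap_eq
    (fun r => by rw [halg]; exact (g.commutes r).symm)
  haveI : Module.Finite (MvPolynomial (Fin s) ℚ) R := hgf
  haveI : Algebra.IsIntegral (MvPolynomial (Fin s) ℚ) R := Algebra.IsIntegral.of_finite _ _
  obtain ⟨S, hS⟩ := (Module.finite_def (R := MvPolynomial (Fin s) ℚ) (M := R)).1 inferInstance
  refine ⟨S.card, fun f hf => ?_⟩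
  have h1 : (Ideal.span {f}).comap (algebraMap (MvPolynomial (Fin s) ℚ) R) ≠ ⊥ :=
    Ideal.comap_ne_bot_of_integral_mem hf (Ideal.mem_span_singleton_self f)
      (Algebra.IsIntegral.isIntegral f)
  obtain ⟨c, hc, hc0⟩ := Submodule.exists_mem_ne_zero_of_ne_bot h1
  have h2 : ∃ t : Fin s → ℚ, MvPolynomial.eval t c ≠ 0 := by
    by_contra hcon
    push Not at hcon
    exact hc0 (MvPolynomial.funext (fun x => by rw [hcon x]; simp))
  obtain ⟨t, ht⟩ := h2
  have hsurj : Function.Surjective (MvPolynomial.eval t) := fun q => ⟨MvPolynomial.C q, by simp⟩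
  have hmax : (RingHom.ker (MvPolynomial.eval t)).IsMaximal :=
    RingHom.ker_isMaximal_of_surjective _ hsurj
  obtain ⟨Q, hQ, hQP⟩ := Ideal.exists_ideal_over_maximal_of_isIntegral (S := R)
    (RingHom.ker (MvPolynomial.eval t)) (by
      intro x hx
      have : x = 0 := hg (by rw [map_zero]; exact hx)
      rw [this]; exact zero_mem _)
  letI : Field (R ⧸ Q) := Ideal.Quotient.field Q
  have hspan : ∀ x : R ⧸ Q, x ∈ Submodule.span ℚ ((S.image (Ideal.Quotient.mk Q) : Finset (R ⧸ Q)) : Set (R ⧸ Q)) := by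
    intro x
    obtain ⟨r, rfl⟩ := Ideal.Quotient.mk_surjective x
    have hr : r ∈ Submodule.span (MvPolynomial (Fin s) ℚ) (S : Set R) := by rw [hS]; trivial
    induction hr using Submodule.span_induction with
    | mem x hx => exact Submodule.subset_span (by
        rw [Finset.coe_image]; exact ⟨x, hx, rfl⟩)
    | zero => rw [map_zero]; exact zero_mem _
    | add x y _ _ hx hy => rw [map_add]; exact add_mem hx hy
    | smul a x _ hx =>
      have : Ideal.Quotient.mk Q (a • x) = (MvPolynomial.eval t a) • Ideal.Quotient.mk Q x := by
        have h3 : a - MvPolynomial.C (MvPolynomial.eval t a) ∈ RingHom.ker (MvPolynomial.eval t) := by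
          simp [RingHom.mem_ker]
        rw [← hQP, Ideal.mem_comap, ← Ideal.Quotient.eq_zero_iff_mem, map_sub, map_sub, sub_eq_zero] at h3
        rw [Algebra.smul_def, map_mul, h3, Algebra.smul_def]
        congr 1
        have : algebraMap (MvPolynomial (Fin s) ℚ) R (MvPolynomial.C (MvPolynomial.eval t a)) = algebraMap ℚ R (MvPolynomial.eval t a) := g.commutes _
        rw [this]
        rfl
      rw [this]
      exact Submodule.smul_mem _ _ hx
  have htop : Submodule.span ℚ ((S.image (Ideal.Quotient.mk Q) : Finset (R ⧸ Q)) : Set (R ⧸ Q)) = ⊤ :=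
    Submodule.eq_top_iff'.2 hspan
  haveI hfd : Module.Finite ℚ (R ⧸ Q) := ⟨⟨_, htop⟩⟩
  haveI hcz : CharZero (R ⧸ Q) := algebraRat.charZero _
  have hrank : Module.finrank ℚ (R ⧸ Q) ≤ S.card := by
    rw [← finrank_top, ← htop]
    exact (finrank_span_finset_le_card _).trans Finset.card_image_le
  refine ⟨R ⧸ Q, inferInstance, ?_, Ideal.Quotient.mk Q, ?_, ?_⟩
  · refine @NumberField.mk _ _ hcz ?_
    convert hfd
    exact Subsingleton.elim (α := Module ℚ (R ⧸ Q)) _ _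
  · refine le_trans (le_of_eq ?_) hrank
    have key : ∀ i1 i2 : Module ℚ (R ⧸ Q), @Module.finrank ℚ (R ⧸ Q) _ _ i1 =
        @Module.finrank ℚ (R ⧸ Q) _ _ i2 := by
      intro i1 i2
      rw [Subsingleton.elim i1 i2]
    exact key _ _
  · intro h0
    rw [Ideal.Quotient.eq_zero_iff_mem] at h0
    apply ht
    have h5 : c ∈ Q.comap (algebraMap (MvPolynomial (Fin s) ℚ) R) := by
      have := hc
      rw [Ideal.mem_comap] at this ⊢
      exact (Ideal.span_singleton_le_iff_mem _).2 h0 this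
    rw [hQP] at h5
    exact h5

end GK
end

section
open Finset
namespace GK

theorem lattice {Ω ι H : Type*} [Fintype ι] [AddCommGroup H] (U : Ultrafilter Ω)
    (F : (ι → ℤ) →+ H) (d : Ω → ι → ℤ) (hd : ∀ c, ∀ᶠ ω in (U : Filter Ω), F (d ω) ≠ c) :
    ∃ δ : ι → ℤ, (∀ e : ℕ, 0 < e → e • F δ ≠ 0) ∧
      ∀ (L : AddSubgroup (ι → ℤ)) (a : ι → ℤ), (∀ᶠ ω in (U : Filter Ω), d ω - a ∈ L) →
        ∃ e : ℕ, 0 < e ∧ e • δ ∈ L := by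
  classical
  set S : Set ℕ := {r | ∃ (L : Submodule ℤ (ι → ℤ)) (a : ι → ℤ),
    (∀ᶠ ω in (U : Filter Ω), d ω - a ∈ L) ∧ Module.finrank ℤ L = r} with hS
  have hne : ∃ r, r ∈ S := ⟨_, ⊤, 0, by simp, rfl⟩
  obtain ⟨L0, a0, hL0, hr0⟩ := Nat.find_spec hne
  have hmin : ∀ r ∈ S, Module.finrank ℤ L0 ≤ r := fun r hr => by
    rw [hr0]; exact Nat.find_min' hne hr
  clear hr0
  have key : ∀ (L : AddSubgroup (ι → ℤ)) (a : ι → ℤ), (∀ᶠ ω in (U : Filter Ω), d ω - a ∈ L) →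
      ∀ δ ∈ L0, ∃ e : ℕ, 0 < e ∧ e • δ ∈ L := by
    intro L a hL δ hδ
    obtain ⟨ω₀, h1, h2⟩ := (hL0.and hL).exists
    set L' : Submodule ℤ (ι → ℤ) := AddSubgroup.toIntSubmodule L with hL'
    have hmemL' : ∀ x, x ∈ L' ↔ x ∈ L := fun x => Iff.rfl
    have h3 : ∀ᶠ ω in (U : Filter Ω), d ω - d ω₀ ∈ L0 ⊓ L' := by
      filter_upwards [hL0, hL] with ω h4 h5
      refine ⟨?_, ?_⟩
      · have := sub_mem h4 h1
        rwa [sub_sub_sub_cancel_right] at this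
      · have := sub_mem h5 h2
        rwa [sub_sub_sub_cancel_right] at this
    have h6 := hmin _ ⟨L0 ⊓ L', d ω₀, h3, rfl⟩
    set N : Submodule ℤ L0 := Submodule.comap L0.subtype (L0 ⊓ L') with hN
    have h7 : Module.finrank ℤ N = Module.finrank ℤ (L0 ⊓ L' : Submodule ℤ (ι → ℤ)) :=
      LinearEquiv.finrank_eq (Submodule.comapSubtypeEquivOfLe inf_le_left)
    have h8 := Submodule.finrank_quotient_add_finrank N
    have h9 : Module.finrank ℤ (L0 ⧸ N) = 0 := by omega
    rw [Module.finrank_eq_zero_iff] at h9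
    obtain ⟨z, hz, hz'⟩ := h9 (Submodule.Quotient.mk ⟨δ, hδ⟩)
    rw [← Submodule.Quotient.mk_smul, Submodule.Quotient.mk_eq_zero] at hz'
    have h10 : z • δ ∈ L := hz'.2
    refine ⟨z.natAbs, Int.natAbs_pos.2 hz, ?_⟩
    rw [← natCast_zsmul, Int.natCast_natAbs]
    rcases abs_choice z with h | h <;> rw [h]
    · exact h10
    · rw [neg_smul]; exact neg_mem h10
  by_contra hcon
  have htor : ∀ δ ∈ L0, ∃ e : ℕ, 0 < e ∧ e • F δ = 0 := by
    intro δ hδ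
    by_contra h
    push Not at h
    exact hcon ⟨δ, h, fun L a hL => key L a hL δ hδ⟩
  set W := L0.map F.toIntLinearMap with hW
  have hfg : Module.Finite ℤ W := inferInstance
  have hfin : Finite W := by
    apply Module.finite_of_fg_torsion
    rintro ⟨w, δ, hδ, rfl⟩
    obtain ⟨e, he, h⟩ := htor δ hδ
    refine ⟨⟨(e : ℤ), ?_⟩, ?_⟩
    · rw [mem_nonZeroDivisors_iff_ne_zero]; exact_mod_cast he.ne'
    · apply Subtype.ext
      change (e : ℤ) • F δ = 0
      rw [natCast_zsmul]; exact h
  have h1 : ∀ᶠ ω in (U : Filter Ω), ∃ w : W, F (d ω) = F a0 + w := by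
    filter_upwards [hL0] with ω h
    exact ⟨⟨_, Submodule.mem_map_of_mem h⟩, by
      change F (d ω) = F a0 + F (d ω - a0)
      rw [map_sub]; abel⟩
  obtain ⟨w, hw⟩ := ev_ex U _ h1
  obtain ⟨ω, h2, h3⟩ := (hw.and (hd (F a0 + w))).exists
  exact h3 h2

end GK
end

section
open Finset
set_option linter.style.haveILetI false
namespace GK
universe u

theorem unit_R (R : Type u) [CommRing R] [IsDomain R] [Algebra ℚ R] [Algebra.FiniteType ℚ R]
    {ι : Type*} [Fintype ι] (F : (ι → ℤ) →+ Additive Rˣ) (m : ℕ) (hm : 1 ≤ m) :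
    ∃ Φ : Finset Rˣ, ∀ n : Fin m → ι → ℤ, ∑ i, ((F (n i)).toMul : R) = 0 →
      ∃ i i', i ≠ i' ∧ (F (n i - n i')).toMul ∈ Φ := by
  classical
  by_contra hcon
  push Not at hcon
  obtain ⟨D, hD⟩ := specialize_ex R
  obtain ⟨U, hU⟩ := uf_exists
    (Ω := {n : Fin m → ι → ℤ // ∑ i, ((F (n i)).toMul : R) = 0})
    (P := {p : Fin m × Fin m // p.1 ≠ p.2})
    (fun p ω => F (ω.1 p.1.1 - ω.1 p.1.2)) (by
      intro Φ
      obtain ⟨n, hn, h⟩ := hcon (Φ.image Additive.toMul)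
      refine ⟨⟨n, hn⟩, fun p hp => h p.1.1 p.1.2 p.2 (Finset.mem_image_of_mem _ hp)⟩)
  have hδ := fun p => lattice U F (fun ω => ω.1 p.1.1 - ω.1 p.1.2) (hU p)
  choose δ hδ1 hδ2 using hδ
  set M := (2 * D).factorial with hM
  have hMpos : 0 < M := Nat.factorial_pos _
  have hf : ∏ p, (((F (δ p)).toMul : R) ^ M - 1) ≠ 0 := by
    rw [Finset.prod_ne_zero_iff]
    intro p _ h0
    rw [sub_eq_zero] at h0
    refine hδ1 p M hMpos ?_
    have : (F (δ p)).toMul ^ M = 1 := Units.ext (by push_cast; exact h0)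
    exact this
  obtain ⟨κ, i1, i2, φ, hrank, hφ⟩ := hD _ hf
  let ψ : (ι → ℤ) →+ Additive κˣ := (MonoidHom.toAdditive (Units.map (φ : R →* κ))).comp F
  have hψ : ∀ z, ((ψ z).toMul : κ) = φ ((F z).toMul : R) := fun z => rfl
  haveI : AddGroup.FG (ι → ℤ) := Module.Finite.iff_addGroup_fg.1 inferInstance
  let ψ' : Multiplicative (ι → ℤ) →* κˣ := AddMonoidHom.toMultiplicativeLeft ψ
  have hfg : ψ'.range.FG := by
    rw [← Group.fg_iff_subgroup_fg]
    infer_instance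
  obtain ⟨Φ, hΦ⟩ := NF.unit κ ψ'.range hfg m hm
  have h1 : ∀ ω : {n : Fin m → ι → ℤ // ∑ i, ((F (n i)).toMul : R) = 0},
      ∃ q : {p : Fin m × Fin m // p.1 ≠ p.2} × Φ,
        ((ψ (ω.1 q.1.1.1 - ω.1 q.1.1.2)).toMul : κ) = q.2 := by
    intro ω
    obtain ⟨i, i', hi, hh⟩ := hΦ (fun i => (ψ (ω.1 i)).toMul)
      (fun i => ⟨Multiplicative.ofAdd (ω.1 i), rfl⟩) (by
        have := congrArg φ ω.2
        rw [map_sum, map_zero] at this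
        exact this)
    refine ⟨⟨⟨(i, i'), hi⟩, ⟨_, hh⟩⟩, ?_⟩
    change ((ψ (ω.1 i - ω.1 i')).toMul : κ) = _
    rw [map_sub, toMul_sub, Units.val_div_eq_div_val]
  obtain ⟨⟨p, c⟩, hpc⟩ := ev_ex U _ (Filter.Eventually.of_forall h1)
  obtain ⟨ω₀, hω₀⟩ := hpc.exists
  obtain ⟨e, he, hmem⟩ := hδ2 p ψ.ker (ω₀.1 p.1.1 - ω₀.1 p.1.2) (by
    filter_upwards [hpc] with ω hω
    rw [AddMonoidHom.mem_ker, map_sub, sub_eq_zero]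
    apply Additive.toMul.injective
    exact Units.ext (hω.trans hω₀.symm))
  rw [AddMonoidHom.mem_ker, map_nsmul] at hmem
  have h2 : (φ ((F (δ p)).toMul : R)) ^ e = 1 := by
    have := congrArg (fun x : Additive κˣ => (x.toMul : κ)) hmem
    simp only [toMul_nsmul, Units.val_pow_eq_pow_val, hψ, toMul_zero, Units.val_one] at this
    exact this
  have h3 := root_unity κ D hrank _ e he h2
  apply hφ
  rw [map_prod]
  apply Finset.prod_eq_zero (Finset.mem_univ p)
  rw [map_sub, map_pow, map_one, h3, sub_self]

theorem unit_K (K : Type u) [Field K] [CharZero K] (Γ : Subgroup Kˣ) (hΓ : Γ.FG) (m : ℕ)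
    (hm : 1 ≤ m) : ∃ Φ : Finset K, ∀ x : Fin m → Kˣ, (∀ i, x i ∈ Γ) → ∑ i, (x i : K) = 0 →
      ∃ i i', i ≠ i' ∧ (x i : K) / x i' ∈ Φ := by
  classical
  obtain ⟨T, rfl⟩ := hΓ
  set V : Finset K := T.image (fun t : Kˣ => (t : K)) ∪ T.image (fun t => ((t⁻¹ : Kˣ) : K)) with hV
  set R : Subalgebra ℚ K := Algebra.adjoin ℚ (V : Set K) with hR
  haveI : Algebra.FiniteType ℚ R := (Subalgebra.fg_iff_finiteType R).1 ⟨V, rfl⟩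
  have hT : ∀ t ∈ T, (t : K) ∈ R ∧ ((t⁻¹ : Kˣ) : K) ∈ R := by
    intro t ht
    constructor
    · exact Algebra.subset_adjoin (by
        rw [Finset.mem_coe, hV, Finset.mem_union]; exact Or.inl (Finset.mem_image_of_mem (fun t : Kˣ => (t : K)) ht))
    · exact Algebra.subset_adjoin (by
        rw [Finset.mem_coe, hV, Finset.mem_union]
        exact Or.inr (Finset.mem_image_of_mem (fun t : Kˣ => ((t⁻¹ : Kˣ) : K)) ht))
  let u : T → Rˣ := fun t => ⟨⟨_, (hT t.1 t.2).1⟩, ⟨_, (hT t.1 t.2).2⟩,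
    Subtype.ext (by simp), Subtype.ext (by simp)⟩
  let F : (T → ℤ) →+ Additive Rˣ :=
    { toFun := fun z => Additive.ofMul (∏ t, u t ^ z t)
      map_zero' := by simp
      map_add' := fun a b => by
        rw [← ofMul_mul, ← Finset.prod_mul_distrib]
        simp [zpow_add] }
  let j : Rˣ →* Kˣ := Units.map (R.val : R →* K)
  have hju : ∀ t, j (u t) = t.1 := fun t => Units.ext rfl
  have hjv : ∀ x, ((j x : Kˣ) : K) = ((x : R) : K) := fun x => rfl
  have hF : ∀ z, (F z).toMul = ∏ t, u t ^ z t := fun z => rfl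
  have hsur : ∀ x ∈ Subgroup.closure (T : Set Kˣ), ∃ z, j (F z).toMul = x := by
    intro x hx
    induction hx using Subgroup.closure_induction with
    | mem x hx =>
      refine ⟨Pi.single ⟨x, hx⟩ 1, ?_⟩
      rw [hF, Finset.prod_eq_single ⟨x, hx⟩]
      · simp [hju]
      · intro b _ hb; rw [Pi.single_eq_of_ne hb, zpow_zero]
      · intro h; exact absurd (Finset.mem_univ _) h
    | one => exact ⟨0, by rw [map_zero]; simp⟩
    | mul x y _ _ hx hy =>
      obtain ⟨z, rfl⟩ := hx
      obtain ⟨w, rfl⟩ := hy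
      exact ⟨z + w, by rw [map_add, toMul_add, map_mul]⟩
    | inv x _ hx =>
      obtain ⟨z, rfl⟩ := hx
      exact ⟨-z, by rw [map_neg, toMul_neg, map_inv]⟩
  obtain ⟨Φ, hΦ⟩ := unit_R R F m hm
  refine ⟨Φ.image (fun x => ((j x : Kˣ) : K)), fun x hx hsum => ?_⟩
  choose n hn using fun i => hsur (x i) (hx i)
  obtain ⟨i, i', hi, hmem⟩ := hΦ n (by
    apply Subtype.ext
    rw [AddSubmonoidClass.coe_finset_sum]
    refine Eq.trans ?_ hsum
    refine Finset.sum_congr rfl fun i _ => ?_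
    rw [← hn i, hjv])
  refine ⟨i, i', hi, Finset.mem_image.2 ⟨_, hmem, ?_⟩⟩
  rw [map_sub, toMul_sub, map_div, hn, hn, Units.val_div_eq_div_val]

end GK
end

section
open Finset
set_option linter.style.haveILetI false
namespace GK
universe u

theorem unit_finset (K : Type u) [Field K] [CharZero K] (Γ : Subgroup Kˣ) (hΓ : Γ.FG)
    {ι : Type*} (I : Finset ι) (hI : I.Nonempty) : ∃ Φ : Finset K, ∀ x : ι → Kˣ,
      (∀ i ∈ I, x i ∈ Γ) → ∑ i ∈ I, (x i : K) = 0 →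
      ∃ i ∈ I, ∃ i' ∈ I, i ≠ i' ∧ (x i : K) / x i' ∈ Φ := by
  obtain ⟨Φ, hΦ⟩ := unit_K K Γ hΓ I.card hI.card_pos
  refine ⟨Φ, fun x hx hsum => ?_⟩
  obtain ⟨a, b, hab, h⟩ := hΦ (fun a => x (I.equivFin.symm a)) (fun a => hx _ (I.equivFin.symm a).2)
    (by
      rw [← hsum, ← Finset.sum_coe_sort I]
      exact Equiv.sum_comp I.equivFin.symm (fun i : I => (x i : K)))
  refine ⟨_, (I.equivFin.symm a).2, _, (I.equivFin.symm b).2, ?_, h⟩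
  intro heq
  exact hab (I.equivFin.symm.injective (Subtype.ext heq))

/-- finite unions of cosets of subgroups of `Γ` -/
inductive FUC {A : Type u} [CommGroup A] (Γ : Subgroup A) : Set A → Prop
  | empty : FUC Γ ∅
  | coset (γ : A) (B : Subgroup A) (hγ : γ ∈ Γ) (hB : B ≤ Γ) : FUC Γ {g | ∃ b ∈ B, g = γ * b}
  | union (S T : Set A) (hS : FUC Γ S) (hT : FUC Γ T) : FUC Γ (S ∪ T)

variable {A : Type u} [CommGroup A] {Γ : Subgroup A}

theorem FUC.list {S : Set A} (h : FUC Γ S) : ∃ l : List (A × Subgroup A),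
    (∀ p ∈ l, p.1 ∈ Γ ∧ p.2 ≤ Γ) ∧ S = {g | ∃ p ∈ l, ∃ b ∈ p.2, g = p.1 * b} := by
  induction h with
  | empty => exact ⟨[], by simp, by simp⟩
  | coset γ B hγ hB => exact ⟨[(γ, B)], by simp [hγ, hB], by simp⟩
  | union S T _ _ ihS ihT =>
    obtain ⟨l, hl, rfl⟩ := ihS
    obtain ⟨l', hl', rfl⟩ := ihT
    refine ⟨l ++ l', fun p hp => ?_, ?_⟩
    · rcases List.mem_append.1 hp with h | h
      · exact hl p h
      · exact hl' p h
    · ext g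
      constructor
      · rintro (⟨p, hp, h⟩ | ⟨p, hp, h⟩)
        · exact ⟨p, List.mem_append.2 (Or.inl hp), h⟩
        · exact ⟨p, List.mem_append.2 (Or.inr hp), h⟩
      · rintro ⟨p, hp, h⟩
        rcases List.mem_append.1 hp with h' | h'
        · exact Or.inl ⟨p, h', h⟩
        · exact Or.inr ⟨p, h', h⟩

theorem FUC.final {S : Set A} (h : FUC Γ S) :
    ∃ (n : ℕ) (γ : Fin n → A) (B : Fin n → Subgroup A), (∀ i, γ i ∈ Γ ∧ B i ≤ Γ) ∧
      S = ⋃ i, {g | ∃ b ∈ B i, g = γ i * b} := by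
  obtain ⟨l, hl, rfl⟩ := h.list
  refine ⟨l.length, fun i => (l.get i).1, fun i => (l.get i).2,
    fun i => hl _ (List.get_mem l i), ?_⟩
  ext g
  rw [Set.mem_iUnion]
  constructor
  · rintro ⟨p, hp, h⟩
    obtain ⟨i, rfl⟩ := List.mem_iff_get.1 hp
    exact ⟨i, h⟩
  · rintro ⟨i, h⟩
    exact ⟨_, List.get_mem l i, h⟩

theorem FUC.of_coset_like (S : Set A) (B : Subgroup A) (hSΓ : S ⊆ Γ) (hB : B ≤ Γ)
    (h1 : ∀ x ∈ S, ∀ y, y ∈ S ↔ x⁻¹ * y ∈ B) : FUC Γ S := by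
  rcases S.eq_empty_or_nonempty with rfl | ⟨x, hx⟩
  · exact FUC.empty
  · have : S = {g | ∃ b ∈ B, g = x * b} := by
      ext g
      rw [h1 x hx g]
      constructor
      · intro h; exact ⟨_, h, by group⟩
      · rintro ⟨b, hb, rfl⟩; rwa [inv_mul_cancel_left]
    rw [this]
    exact FUC.coset x B (hSΓ hx) hB

theorem FUC.inter {S T : Set A} (hS : FUC Γ S) (hT : FUC Γ T) : FUC Γ (S ∩ T) := by
  induction hS with
  | empty => rw [Set.empty_inter]; exact FUC.empty
  | union S S' _ _ ih ih' => rw [Set.union_inter_distrib_right]; exact FUC.union _ _ ih ih'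
  | coset γ B hγ hB =>
    induction hT with
    | empty => rw [Set.inter_empty]; exact FUC.empty
    | union S S' _ _ ih ih' => rw [Set.inter_union_distrib_left]; exact FUC.union _ _ ih ih'
    | coset γ' B' hγ' hB' =>
      refine FUC.of_coset_like _ (B ⊓ B') ?_ (inf_le_left.trans hB) ?_
      · rintro x ⟨⟨b, hb, rfl⟩, _⟩
        exact mul_mem hγ (hB hb)
      · have aux : ∀ (δ : A) (C : Subgroup A) (x : A), x ∈ {g | ∃ b ∈ C, g = δ * b} →
            ∀ y, y ∈ {g | ∃ b ∈ C, g = δ * b} ↔ x⁻¹ * y ∈ C := by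
          rintro δ C x ⟨b, hb, rfl⟩ y
          constructor
          · rintro ⟨b', hb', rfl⟩
            have : (δ * b)⁻¹ * (δ * b') = b⁻¹ * b' := by group
            rw [this]
            exact mul_mem (inv_mem hb) hb'
          · intro h
            exact ⟨b * ((δ * b)⁻¹ * y), mul_mem hb h, by group⟩
        rintro x ⟨hx, hx'⟩ y
        rw [Subgroup.mem_inf, ← aux γ B x hx y, ← aux γ' B' x hx' y]
        rfl

theorem FUC.full : FUC Γ (Γ : Set A) := by
  have := FUC.coset (Γ := Γ) 1 Γ (one_mem _) le_rfl
  convert this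
  ext g; simp

theorem FUC.biUnion {α : Type*} (I : Finset α) (S : α → Set A) (h : ∀ i ∈ I, FUC Γ (S i)) :
    FUC Γ (⋃ i ∈ I, S i) := by
  classical
  induction I using Finset.induction_on with
  | empty => simpa using FUC.empty
  | insert a I ha ih =>
    rw [Finset.set_biUnion_insert]
    exact FUC.union _ _ (h a (Finset.mem_insert_self _ _))
      (ih fun i hi => h i (Finset.mem_insert_of_mem hi))

theorem FUC.exp_sum {K : Type u} [Field K] [CharZero K] (hΓ : Γ.FG) {ι : Type*} (χ : ι → A →* Kˣ) :
    ∀ (n : ℕ) (I : Finset ι) (c : ι → K), I.card = n →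
      FUC Γ {g | g ∈ Γ ∧ ∑ i ∈ I, c i * χ i g = 0} := by
  classical
  intro n
  induction n with
  | zero =>
    intro I c hI
    rw [Finset.card_eq_zero] at hI
    subst hI
    simpa using FUC.full
  | succ n ih =>
    intro I c hI
    by_cases hz : ∃ i ∈ I, c i = 0
    · obtain ⟨i, hi, hci⟩ := hz
      have := ih (I.erase i) c (by rw [Finset.card_erase_of_mem hi]; omega)
      convert this using 5
      rw [← Finset.add_sum_erase _ _ hi, hci, zero_mul, zero_add]
    · push Not at hz
      have hne : I.Nonempty := Finset.card_pos.1 (by omega)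
      set cu : ι → Kˣ := fun i => if h : c i = 0 then 1 else Units.mk0 (c i) h with hcu
      have hcu' : ∀ i ∈ I, (cu i : K) = c i := by
        intro i hi
        simp only [hcu, hz i hi, dite_false, Units.val_mk0]
      obtain ⟨T, hT⟩ := hΓ
      set V : Finset Kˣ := I.image cu ∪ I.biUnion (fun i => T.image (χ i)) with hV
      have hχ : ∀ i ∈ I, ∀ g ∈ Γ, χ i g ∈ Subgroup.closure (V : Set Kˣ) := by
        intro i hi g hg
        rw [← hT] at hg
        induction hg using Subgroup.closure_induction with
        | mem x hx => exact Subgroup.subset_closure (by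
            rw [Finset.mem_coe, hV, Finset.mem_union, Finset.mem_biUnion]
            exact Or.inr ⟨i, hi, Finset.mem_image_of_mem _ hx⟩)
        | one => rw [map_one]; exact one_mem _
        | mul x y _ _ hx hy => rw [map_mul]; exact mul_mem hx hy
        | inv x _ hx => rw [map_inv]; exact inv_mem hx
      have hcV : ∀ i ∈ I, cu i ∈ Subgroup.closure (V : Set Kˣ) := fun i hi =>
        Subgroup.subset_closure (by
          rw [Finset.mem_coe, hV, Finset.mem_union]
          exact Or.inl (Finset.mem_image_of_mem _ hi))
      obtain ⟨Φ, hΦ⟩ := unit_finset K (Subgroup.closure (V : Set Kˣ)) ⟨V, rfl⟩ I hne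
      have hcover : {g | g ∈ Γ ∧ ∑ i ∈ I, c i * χ i g = 0} =
          ⋃ q ∈ (I ×ˢ I ×ˢ Φ).filter (fun q => q.1 ≠ q.2.1),
            ({g | g ∈ Γ ∧ c q.1 * χ q.1 g = q.2.2 * (c q.2.1 * χ q.2.1 g)} ∩
              {g | g ∈ Γ ∧ ∑ i ∈ I.erase q.1,
                (if i = q.2.1 then (1 + q.2.2) * c i else c i) * χ i g = 0}) := by
        have hsumeq : ∀ i i' φ g, i ∈ I → i' ∈ I → i ≠ i' →
            c i * χ i g = φ * (c i' * χ i' g) →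
            ∑ l ∈ I.erase i, (if l = i' then (1 + φ) * c l else c l) * χ l g =
              ∑ l ∈ I, c l * (χ l g : K) := by
          intro i i' φ g hi hi' hii h
          have hi'' : i' ∈ I.erase i := Finset.mem_erase.2 ⟨hii.symm, hi'⟩
          rw [← Finset.add_sum_erase I _ hi, ← Finset.add_sum_erase (I.erase i) _ hi'',
            ← Finset.add_sum_erase (I.erase i) _ hi'', if_pos rfl, h, ← add_assoc]
          congr 1
          · ring
          · refine Finset.sum_congr rfl fun l hl => ?_
            rw [if_neg (Finset.ne_of_mem_erase hl)]
        ext g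
        simp only [Set.mem_iUnion]
        constructor
        · rintro ⟨hg, hs⟩
          obtain ⟨i, hi, i', hi', hii, hmem⟩ := hΦ (fun i => cu i * χ i g)
            (fun i hi => mul_mem (hcV i hi) (hχ i hi g hg)) (by
              rw [← hs]
              refine Finset.sum_congr rfl fun i hi => ?_
              rw [Units.val_mul, hcu' i hi])
          have hrel : c i * χ i g = (((cu i * χ i g : Kˣ) : K) / ((cu i' * χ i' g : Kˣ) : K)) *
              (c i' * χ i' g) := by
            rw [← hcu' i hi, ← hcu' i' hi', ← Units.val_mul, ← Units.val_mul,
              div_mul_cancel₀ _ (Units.ne_zero _)]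
          refine ⟨(i, i', _), Finset.mem_filter.2 ⟨Finset.mem_product.2 ⟨hi,
            Finset.mem_product.2 ⟨hi', hmem⟩⟩, hii⟩, ⟨hg, hrel⟩, hg, ?_⟩
          exact (hsumeq i i' _ g hi hi' hii hrel).trans hs
        · rintro ⟨⟨i, i', φ⟩, hq, ⟨hg, hrel⟩, _, hs⟩
          rw [Finset.mem_filter, Finset.mem_product, Finset.mem_product] at hq
          obtain ⟨⟨hi, hi', _⟩, hii⟩ := hq
          exact ⟨hg, (hsumeq i i' φ g hi hi' hii hrel).symm.trans hs⟩
      rw [hcover]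
      refine FUC.biUnion _ _ ?_
      rintro ⟨i, i', φ⟩ hq
      rw [Finset.mem_filter, Finset.mem_product, Finset.mem_product] at hq
      obtain ⟨⟨hi, hi', _⟩, hii⟩ := hq
      dsimp only at hi hi' hii
      refine FUC.inter ?_ (ih _ _ (by rw [Finset.card_erase_of_mem hi]; omega))
      have hci := hz i hi
      refine FUC.of_coset_like _ (Γ ⊓ (χ i / χ i').ker) (fun g hg => hg.1) inf_le_left ?_
      rintro x ⟨hx, hx'⟩ y
      dsimp only at hx'
      have hy0 : ((χ i' x : Kˣ) : K) ≠ 0 := Units.ne_zero _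
      have hx0 : ((χ i x : Kˣ) : K) ≠ 0 := Units.ne_zero _
      have hxy : x⁻¹ * y ∈ Γ ↔ y ∈ Γ := Subgroup.mul_mem_cancel_left Γ (inv_mem hx)
      rw [Subgroup.mem_inf, hxy]
      refine and_congr_right fun hy => ?_
      rw [MonoidHom.mem_ker, MonoidHom.div_apply, div_eq_one, map_mul, map_mul, map_inv, map_inv,
        inv_mul_eq_iff_eq_mul, Units.ext_iff]
      dsimp only
      have e1 : ((χ i x * ((χ i' x)⁻¹ * χ i' y) : Kˣ) : K) = χ i x * ((χ i' x : K)⁻¹ * χ i' y) := by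
        push_cast; rfl
      rw [e1]
      have e2 : φ * (c i' * χ i' y) = c i * (χ i x * ((χ i' x : K)⁻¹ * χ i' y)) := by
        rw [← mul_assoc (c i), hx']
        field_simp
      rw [e2]
      exact mul_right_inj' hci

end GK
end

/-- Laurent's theorem (Mordell–Lang for tori in characteristic 0): over an algebraically
closed field `K` of characteristic `0`, the intersection of a subvariety `X` of `(Kˣ)^N`
with a finitely generated subgroup `Γ` of `(Kˣ)^N` is a finite union of cosets of
subgroups of `Γ`. -/
theorem laurent_mordell_lang_torus_char_zero
    (K : Type*) [Field K] [IsAlgClosed K] [CharZero K]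
    (N : ℕ) (hN : 1 ≤ N) (X : Set (Fin N → Kˣ)) (hX : IsTorusSubvariety K X)
    (Γ : Subgroup (Fin N → Kˣ)) (hΓ : Γ.FG) :
    ∃ (n : ℕ) (γ : Fin n → (Fin N → Kˣ)) (B : Fin n → Subgroup (Fin N → Kˣ)),
      (∀ i, γ i ∈ Γ ∧ B i ≤ Γ) ∧
        X ∩ ↑Γ = ⋃ i, {g | ∃ b ∈ B i, g = γ i * b} := by
  classical
  obtain ⟨𝒮, rfl⟩ := hX
  obtain ⟨T, hT⟩ := IsNoetherian.noetherian (Ideal.span 𝒮)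
  have hzero : ∀ (S : Set (MvPolynomial (Fin N) K)) (x : Fin N → Kˣ),
      (∀ f ∈ S, MvPolynomial.eval (fun i => (x i : K)) f = 0) ↔
        ∀ f ∈ Ideal.span S, MvPolynomial.eval (fun i => (x i : K)) f = 0 := by
    intro S x
    constructor
    · intro h f hf
      have : Ideal.span S ≤ RingHom.ker (MvPolynomial.eval (fun i => (x i : K))) :=
        Ideal.span_le.2 h
      exact this hf
    · intro h f hf
      exact h f (Ideal.subset_span hf)
  apply GK.FUC.final
  let χ : (Fin N →₀ ℕ) → (Fin N → Kˣ) →* Kˣ := fun d =>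
    ∏ i, (Pi.evalMonoidHom (fun _ : Fin N => Kˣ) i) ^ (d i)
  have hχ : ∀ d x, ((χ d x : Kˣ) : K) = ∏ i, (x i : K) ^ (d i) := by
    intro d x
    simp only [χ, MonoidHom.finsetProd_apply, MonoidHom.pow_apply, Pi.evalMonoidHom_apply,
      Units.coe_prod, Units.val_pow_eq_pow_val]
  have hT' : ∀ T' : Finset (MvPolynomial (Fin N) K), GK.FUC Γ
      {x | x ∈ Γ ∧ ∀ f ∈ T', MvPolynomial.eval (fun i => (x i : K)) f = 0} := by
    intro T'
    induction T' using Finset.induction_on with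
    | empty => simpa using GK.FUC.full
    | insert f T' hf ih =>
      have h1 := GK.FUC.exp_sum (Γ := Γ) hΓ χ _ f.support (fun d => f.coeff d) rfl
      have h2 := GK.FUC.inter h1 ih
      convert h2 using 1
      ext x
      have h3 : MvPolynomial.eval (fun i => (x i : K)) f =
          ∑ d ∈ f.support, f.coeff d * (χ d x : K) := by
        rw [MvPolynomial.eval_eq']
        exact Finset.sum_congr rfl fun d _ => by rw [hχ]
      constructor
      · rintro ⟨hx, h⟩
        exact ⟨⟨hx, h3.symm.trans (h f (Finset.mem_insert_self _ _))⟩, hx,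
          fun g hg => h g (Finset.mem_insert_of_mem hg)⟩
      · rintro ⟨⟨hx, h⟩, _, h'⟩
        refine ⟨hx, fun g hg => ?_⟩
        rcases Finset.mem_insert.1 hg with rfl | hg
        · exact h3.trans h
        · exact h' g hg
  convert hT' T using 1
  ext x
  constructor
  · rintro ⟨h, hx⟩
    refine ⟨hx, ?_⟩
    have h' := (hzero 𝒮 x).1 h
    rw [← hT] at h'
    exact (hzero (T : Set _) x).2 h'
  · rintro ⟨hx, h⟩
    refine ⟨?_, hx⟩
    have h' := (hzero (T : Set _) x).1 h
    change ∀ f ∈ Submodule.span _ _, _ at h'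
    rw [hT] at h'
    exact (hzero 𝒮 x).2 h'
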